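/- Let n ≥ 2, 1 ≤ k < n/2, and let Λ_m be the n-linear form associated to a bounded function m on Γ, smooth away from a k-dimensional non-degenerate subspace Γ′ ⊆ Γ, satisfying |∂_ξ^a m(ξ)| ≤ B·dist(ξ,Γ′)^{−|a|} for all derivatives along Γ up to a sufficiently large finite order. Then Λ_m is of restricted type α (with constant depending only on n, k, α, Γ′ and B) for every bad tuple α such that 1/2 < αᵢ < 1 for all good indices i and k − n + 3/2 < αⱼ < k − n + 2 for the bad index j. -/

import Mathlib

open MeasureTheory Real Complex
open scoped FourierTransform ENNReal NNReal Classical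
noncomputable section

def GammaSet (n : ℕ) : Set (Fin n → ℝ) := {ξ | ∑ i, ξ i = 0}

def gammaParam (n : ℕ) (η : Fin (n - 1) → ℝ) : Fin n → ℝ := fun i =>
  if h : (i : ℕ) < n - 1 then η ⟨i, h⟩ else -(∑ j, η j)

def Lam (n : ℕ) (m : (Fin n → ℝ) → ℂ) (f : Fin n → ℝ → ℂ) : ℂ :=
  ∫ η : Fin (n - 1) → ℝ, m (gammaParam n η) * ∏ i, 𝓕 (f i) (gammaParam n η i)

def Tm (n : ℕ) (m : (Fin n → ℝ) → ℂ) (f : Fin (n - 1) → ℝ → ℂ) (x : ℝ) : ℂ :=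
  ∫ η : Fin (n - 1) → ℝ, m (gammaParam n η) * (∏ i, 𝓕 (f i) (η i)) *
    Complex.exp (2 * Real.pi * Complex.I * x * (∑ i, η i))

def NonDegenerate (n k : ℕ) (Γ' : Submodule ℝ (Fin n → ℝ)) : Prop :=
  ∀ ι : Fin k → Fin n, StrictMono ι →
    Function.Bijective (fun (ξ : Γ') (s : Fin k) => (ξ : Fin n → ℝ) (ι s))

def SymbolEst (n : ℕ) (Γ' : Submodule ℝ (Fin n → ℝ)) (M : ℕ) (B : ℝ)
    (m : (Fin n → ℝ) → ℂ) : Prop :=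
  (∀ ξ ∈ GammaSet n, ‖m ξ‖ ≤ B) ∧
  ContDiffOn ℝ (M : ℕ∞) m ((Γ' : Set (Fin n → ℝ))ᶜ) ∧
  ∀ a : ℕ, a ≤ M → ∀ ξ ∈ ((Γ' : Set (Fin n → ℝ))ᶜ), ∀ v : Fin a → (Fin n → ℝ),
    (∀ s, v s ∈ GammaSet n) → (∀ s, ‖v s‖ ≤ 1) →
    ‖iteratedFDerivWithin ℝ a m ((Γ' : Set (Fin n → ℝ))ᶜ) ξ v‖ ≤
      B / Metric.infDist ξ (Γ' : Set (Fin n → ℝ)) ^ a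

def Admissible (n : ℕ) (a : Fin n → ℝ) : Prop :=
  (∀ i, a i < 1) ∧ ∑ i, a i = 1 ∧ ∀ i j, a i < 0 → a j < 0 → i = j

def RestrictedType (n : ℕ) (Λ : (Fin n → ℝ → ℂ) → ℂ) (a : Fin n → ℝ) (C : ℝ) : Prop :=
  ∀ E : Fin n → Set ℝ, (∀ i, MeasurableSet (E i)) → (∀ i, volume (E i) < ⊤) →
    ∃ E' : Fin n → Set ℝ, (∀ i, MeasurableSet (E' i)) ∧ (∀ i, E' i ⊆ E i) ∧
      (∀ i, 0 ≤ a i → E' i = E i) ∧ (∀ i, volume (E i) ≤ 2 * volume (E' i)) ∧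
      ∀ F : Fin n → ℝ → ℂ, (∀ i, Measurable (F i)) →
        (∀ i x, ‖F i x‖ ≤ 1) → (∀ i x, x ∉ E' i → F i x = 0) →
        ‖Λ F‖ ≤ C * ∏ i, (volume (E i)).toReal ^ a i

set_option linter.unusedVariables false
set_option linter.deprecated false
set_option linter.unusedSectionVars false

/-! ### Basic notions -/

def tw (s : ℤ) : ℝ := (2 : ℝ) ^ s

lemma tw_pos (s : ℤ) : 0 < tw s := by unfold tw; positivity
lemma tw_ne (s : ℤ) : tw s ≠ 0 := (tw_pos s).ne'
lemma tw_add (s t : ℤ) : tw (s + t) = tw s * tw t := by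
  unfold tw; rw [zpow_add₀ (by norm_num)]
lemma tw_neg (s : ℤ) : tw (-s) = (tw s)⁻¹ := by unfold tw; rw [zpow_neg]
lemma tw_sub (s t : ℤ) : tw (s - t) = tw s / tw t := by
  unfold tw; rw [zpow_sub₀ (by norm_num)]
lemma tw_le {s t : ℤ} (h : s ≤ t) : tw s ≤ tw t := by
  unfold tw; exact zpow_le_zpow_right₀ (by norm_num) h
lemma tw_lt {s t : ℤ} (h : s < t) : tw s < tw t := by
  unfold tw; exact zpow_lt_zpow_right₀ (by norm_num) h
lemma tw_le_iff {s t : ℤ} : tw s ≤ tw t ↔ s ≤ t := by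
  unfold tw; exact zpow_le_zpow_iff_right₀ (by norm_num)
lemma tw_lt_two {s t : ℤ} (h : s < t) : 2 * tw s ≤ tw t := by
  have : tw (s + 1) ≤ tw t := tw_le (by omega)
  rw [tw_add] at this
  have h1 : tw 1 = 2 := by simp [tw]
  rw [h1] at this; linarith
lemma tw_zero : tw 0 = 1 := by simp [tw]
lemma tw_natCast (k : ℕ) : tw (k : ℤ) = 2 ^ k := by simp [tw]

def rho (u : ℝ) : ℝ := (1 + |u|)⁻¹

lemma rho_pos (u : ℝ) : 0 < rho u := by unfold rho; positivity
lemma rho_nonneg (u : ℝ) : 0 ≤ rho u := (rho_pos u).le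
lemma rho_le_one (u : ℝ) : rho u ≤ 1 := by
  unfold rho; apply inv_le_one_of_one_le₀; linarith [abs_nonneg u]
lemma rho_continuous : Continuous rho := by
  unfold rho
  exact (continuous_const.add continuous_abs).inv₀ (fun u => (by positivity : (0:ℝ) < 1 + |u|).ne')
lemma rho_neg (u : ℝ) : rho (-u) = rho u := by simp [rho]
lemma rho_mul_le {u v w : ℝ} (h : |w| ≤ |u| + |v|) : rho u * rho v ≤ rho w := by
  unfold rho
  rw [← mul_inv]
  apply inv_anti₀ (by positivity)
  nlinarith [abs_nonneg u, abs_nonneg v, mul_nonneg (abs_nonneg u) (abs_nonneg v)]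
lemma rho_anti {u v : ℝ} (h : |u| ≤ |v|) : rho v ≤ rho u := by
  unfold rho; apply inv_anti₀ (by positivity); linarith
lemma rho_le_mul {u v : ℝ} {c : ℝ} (hc : 0 < c) (h : 1 + |u| ≤ c * (1 + |v|)) :
    rho v ≤ c * rho u := by
  unfold rho
  rw [← div_eq_mul_inv, le_div_iff₀ (by positivity), inv_mul_le_iff₀ (by positivity)]
  linarith
lemma rho_pow_le {u : ℝ} {a b : ℕ} (h : a ≤ b) : rho u ^ b ≤ rho u ^ a :=
  pow_le_pow_of_le_one (rho_nonneg u) (rho_le_one u) h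

lemma rho_sq_le (u : ℝ) : rho u ^ 2 ≤ (1 + u ^ 2)⁻¹ := by
  unfold rho
  rw [inv_pow]
  apply inv_anti₀ (by positivity)
  nlinarith [abs_nonneg u, sq_abs u]

lemma rho_sq_integrable : Integrable (fun u => rho u ^ 2) := by
  refine integrable_inv_one_add_sq.mono' (rho_continuous.pow 2).aestronglyMeasurable ?_
  refine Filter.Eventually.of_forall fun u => ?_
  rw [Real.norm_of_nonneg (by have := rho_nonneg u; positivity)]
  exact rho_sq_le u

lemma rho_sq_integral : ∫ u, rho u ^ 2 ≤ 4 := by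
  calc ∫ u, rho u ^ 2 ≤ ∫ u : ℝ, (1 + u ^ 2)⁻¹ :=
        integral_mono rho_sq_integrable integrable_inv_one_add_sq rho_sq_le
    _ = π := integral_univ_inv_one_add_sq
    _ ≤ 4 := pi_le_four

lemma rho_sq_aff_integrable {r : ℝ} (hr : 0 < r) (b : ℝ) :
    Integrable (fun t => rho (r * t - b) ^ 2) := by
  have h1 : Integrable (fun t : ℝ => rho (t - b) ^ 2) := rho_sq_integrable.comp_sub_right b
  exact (integrable_comp_mul_left_iff (fun t : ℝ => rho (t - b) ^ 2) hr.ne').2 h1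

lemma rho_sq_aff_integral {r : ℝ} (hr : 0 < r) (b : ℝ) :
    ∫ t, rho (r * t - b) ^ 2 ≤ 4 / r := by
  have := Measure.integral_comp_mul_left (fun t : ℝ => rho (t - b) ^ 2) r
  rw [this, integral_sub_right_eq_self (fun t : ℝ => rho t ^ 2) b, abs_of_pos (inv_pos.2 hr),
    smul_eq_mul, div_eq_inv_mul]
  exact mul_le_mul_of_nonneg_left rho_sq_integral (inv_pos.2 hr).le

lemma rho_pow_aff_integrable {r : ℝ} (hr : 0 < r) (b : ℝ) {k : ℕ} (hk : 2 ≤ k) :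
    Integrable (fun t => rho (r * t - b) ^ k) := by
  refine (rho_sq_aff_integrable hr b).mono'
    ((rho_continuous.comp (by fun_prop)).pow k).aestronglyMeasurable ?_
  refine Filter.Eventually.of_forall fun u => ?_
  rw [Real.norm_of_nonneg (by have := rho_nonneg (r * u - b); positivity)]
  exact rho_pow_le hk

lemma rho_pow_aff_integral {r : ℝ} (hr : 0 < r) (b : ℝ) {k : ℕ} (hk : 2 ≤ k) :
    ∫ t, rho (r * t - b) ^ k ≤ 4 / r :=
  (integral_mono (rho_pow_aff_integrable hr b hk) (rho_sq_aff_integrable hr b)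
    (fun u => rho_pow_le hk)).trans (rho_sq_aff_integral hr b)

/-- finite overlap summation -/
lemma sum_setIntegral_le {ι : Type*} (S : Finset ι) (A : ι → Set ℝ) (K : ℝ)
    (hA : ∀ i ∈ S, MeasurableSet (A i)) (f : ℝ → ℝ) (hf : Integrable f) (hf0 : ∀ t, 0 ≤ f t)
    (hK : ∀ t, ((S.filter (fun i => t ∈ A i)).card : ℝ) ≤ K) :
    ∑ i ∈ S, ∫ t in A i, f t ≤ K * ∫ t, f t := by
  calc ∑ i ∈ S, ∫ t in A i, f t = ∑ i ∈ S, ∫ t, (A i).indicator f t := by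
        refine Finset.sum_congr rfl fun i hi => ?_
        rw [integral_indicator (hA i hi)]
    _ = ∫ t, ∑ i ∈ S, (A i).indicator f t := by
        rw [integral_finsetSum]
        intro i hi; exact hf.indicator (hA i hi)
    _ ≤ ∫ t, K * f t := by
        apply integral_mono
        · exact integrable_finsetSum _ fun i hi => hf.indicator (hA i hi)
        · exact hf.const_mul K
        · intro t
          simp only
          have : ∑ i ∈ S, (A i).indicator f t = ((S.filter (fun i => t ∈ A i)).card : ℝ) * f t := by
            rw [← nsmul_eq_mul, ← Finset.sum_const, Finset.sum_filter]
            rfl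
          rw [this]
          exact mul_le_mul_of_nonneg_right (hK t) (hf0 t)
    _ = K * ∫ t, f t := integral_const_mul _ _

/-- dyadic intervals -/
def dI (s q : ℤ) : Set ℝ := {t | ⌊tw s * t⌋ = q}

lemma mem_dI {s q : ℤ} {t : ℝ} : t ∈ dI s q ↔ (q : ℝ) ≤ tw s * t ∧ tw s * t < q + 1 := by
  unfold dI; simp only [Set.mem_setOf_eq]; exact Int.floor_eq_iff

lemma dI_eq_Ico (s q : ℤ) : dI s q = Set.Ico ((q : ℝ) / tw s) ((q + 1) / tw s) := by
  ext t
  rw [mem_dI, Set.mem_Ico, div_le_iff₀ (tw_pos s), lt_div_iff₀ (tw_pos s), mul_comm t]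

lemma dI_measurable (s q : ℤ) : MeasurableSet (dI s q) := by
  rw [dI_eq_Ico]; exact measurableSet_Ico

lemma dI_volume (s q : ℤ) : volume (dI s q) = ENNReal.ofReal (tw (-s)) := by
  rw [dI_eq_Ico, Real.volume_Ico, ← sub_div, tw_neg]; congr 1; simp

lemma dI_volume_real (s q : ℤ) : volume.real (dI s q) = tw (-s) := by
  rw [measureReal_def, dI_volume, ENNReal.toReal_ofReal (tw_pos _).le]

lemma dI_left (s q : ℤ) : (q : ℝ) / tw s ∈ dI s q := by
  rw [mem_dI, mul_div_cancel₀ _ (tw_ne s)]; constructor <;> linarith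

/-- nestedness -/
lemma dI_nested {s s' q q' : ℤ} (h : s ≤ s') (hne : ¬ Disjoint (dI s' q') (dI s q)) :
    dI s' q' ⊆ dI s q := by
  rw [Set.not_disjoint_iff] at hne
  obtain ⟨t, ht', ht⟩ := hne
  obtain ⟨d, rfl⟩ := Int.le.dest h
  have key : ∀ u : ℝ, ⌊tw s * u⌋ = ⌊tw (s + d) * u⌋ / (2 ^ d : ℕ) := by
    intro u
    rw [← Int.floor_div_natCast]
    congr 1
    rw [tw_add, tw_natCast]
    push_cast
    field_simp
  intro u hu
  simp only [dI, Set.mem_setOf_eq] at *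
  rw [key, hu, ← ht', ← key, ht]

lemma dI_subset_scale {s s' q q' : ℤ} (h : dI s' q' ⊆ dI s q) : s ≤ s' := by
  have h1 : volume.real (dI s' q') ≤ volume.real (dI s q) := by
    exact measureReal_mono h (by rw [dI_volume]; exact ENNReal.ofReal_ne_top)
  rw [dI_volume_real, dI_volume_real, tw_le_iff] at h1
  omega

/-- coordinates: inner variable bounds outer variable -/
lemma dI_tau_le {s s' q q' : ℤ} (h : dI s' q' ⊆ dI s q) (t : ℝ) :
    |tw s * t - q| ≤ |tw s' * t - q'| + 1 := by
  have hs := dI_subset_scale h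
  have h1 := h (dI_left s' q')
  rw [mem_dI] at h1
  have h2 : tw s * t - q = (tw s / tw s') * (tw s' * t - q') + (tw s * (q' / tw s') - q) := by
    have := tw_ne s'
    field_simp; ring
  have h3 : tw s / tw s' ≤ 1 := by rw [div_le_one (tw_pos _)]; exact tw_le hs
  have h4 : 0 ≤ tw s / tw s' := (div_pos (tw_pos _) (tw_pos _)).le
  rw [h2]
  refine (abs_add_le _ _).trans ?_
  rw [abs_mul, abs_of_nonneg h4]
  have h5 : |tw s * (q' / tw s') - q| ≤ 1 := by
    rw [abs_le]; constructor <;> linarith [h1.1, h1.2]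
  have := mul_le_mul_of_nonneg_right h3 (abs_nonneg (tw s' * t - q'))
  linarith

lemma sum_rho_sq_int (x : ℝ) (A : Finset ℤ) : ∑ q ∈ A, rho (x - q) ^ 2 ≤ 16 := by
  have h1 : ∀ q ∈ A, rho (x - q) ^ 2 ≤ 4 * ∫ t in dI 0 q, rho (1 * t - x) ^ 2 := by
    intro q _
    have : ∫ t in dI 0 q, (rho (x - q) / 2) ^ 2 ≤ ∫ t in dI 0 q, rho (1 * t - x) ^ 2 := by
      apply setIntegral_mono_on
      · rw [integrableOn_const_iff]; right; rw [dI_volume]; exact ENNReal.ofReal_lt_top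
      · exact (rho_sq_aff_integrable one_pos x).integrableOn
      · exact dI_measurable _ _
      · intro t ht
        rw [mem_dI, tw_zero] at ht
        have h0 : rho (x - q) ≤ 2 * rho (1 * t - x) := by
          apply rho_le_mul two_pos
          have : |1 * t - x| ≤ |x - q| + 1 := by
            rw [abs_le]
            have := neg_abs_le (x - q); have := le_abs_self (x - q)
            constructor <;> linarith [ht.1, ht.2]
          linarith [abs_nonneg (x - q)]
        have := rho_nonneg (x - q)
        gcongr; linarith
    rw [setIntegral_const, dI_volume_real] at this
    simp [tw_zero] at this
    simp
    nlinarith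
  calc _ ≤ ∑ q ∈ A, 4 * ∫ t in dI 0 q, rho (1 * t - x) ^ 2 := Finset.sum_le_sum h1
    _ = 4 * ∑ q ∈ A, ∫ t in dI 0 q, rho (1 * t - x) ^ 2 := by rw [Finset.mul_sum]
    _ ≤ 4 * (1 * ∫ t, rho (1 * t - x) ^ 2) := by
        gcongr
        apply sum_setIntegral_le
        · intro q _; exact dI_measurable _ _
        · exact rho_sq_aff_integrable one_pos x
        · intro t; positivity
        · intro t
          norm_cast
          rw [Finset.card_le_one]
          intro a ha b hb
          simp only [Finset.mem_filter, dI, Set.mem_setOf_eq] at ha hb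
          rw [← ha.2, ← hb.2]
    _ ≤ 16 := by
        have := rho_sq_aff_integral one_pos x
        linarith

/-- integer points in window -/
lemma card_int_window (x : ℝ) (K : ℝ) (hK : 0 ≤ K) (A : Finset ℤ) (h : ∀ l ∈ A, |(l : ℝ) - x| ≤ K) :
    (A.card : ℝ) ≤ 2 * K + 1 := by
  have hsub : A ⊆ Finset.Icc ⌈x - K⌉ ⌊x + K⌋ := by
    intro l hl
    have := abs_le.1 (h l hl)
    rw [Finset.mem_Icc, Int.ceil_le, Int.le_floor]
    constructor <;> linarith
  have h1 : (A.card : ℝ) ≤ ((Finset.Icc ⌈x - K⌉ ⌊x + K⌋).card : ℝ) := by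
    exact_mod_cast Finset.card_le_card hsub
  rw [Int.card_Icc] at h1
  refine h1.trans ?_
  have h2 : (((⌊x + K⌋ + 1 - ⌈x - K⌉).toNat : ℤ) : ℝ) ≤ 2 * K + 1 := by
    rw [Int.toNat_eq_max]
    push_cast
    apply max_le
    · have := Int.floor_le (x + K); have := Int.le_ceil (x - K); linarith
    · linarith
  exact_mod_cast h2

/-! ### Tiles, packets and the Gram estimate -/

structure Tile where
  s : ℤ
  q : ℤ
  l : ℤ

structure TTop where
  s : ℤ
  q : ℤ
  x : ℝ

def Tile.I (p : Tile) : Set ℝ := dI p.s p.q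
def TTop.I (T : TTop) : Set ℝ := dI T.s T.q

def ee (x : ℝ) : ℂ := (Real.fourierChar x : ℂ)

lemma ee_norm (x : ℝ) : ‖ee x‖ = 1 := by unfold ee; exact Circle.norm_coe _
lemma ee_continuous : Continuous ee := by
  unfold ee; exact (continuous_subtype_val : Continuous (fun z : Circle => (z : ℂ))).comp Real.continuous_fourierChar
lemma ee_add (x y : ℝ) : ee (x + y) = ee x * ee y := by
  unfold ee; rw [AddChar.map_add_eq_mul]; rfl
lemma ee_eq (x : ℝ) : ee x = Complex.exp (2 * π * x * Complex.I) := by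
  unfold ee; rw [Real.fourierChar_apply]; push_cast; ring_nf
lemma ee_conj (x : ℝ) : (starRingEnd ℂ) (ee x) = ee (-x) := by
  rw [ee_eq, ee_eq, ← Complex.exp_conj]; congr 1; simp [map_ofNat]

def pk (h : ℝ → ℂ) (p : Tile) (t : ℝ) : ℂ := ee (tw p.s * p.l * t) * h (tw p.s * t - p.q)

def wt (s0 q0 : ℤ) (t : ℝ) : ℝ := 1 + (tw s0 * t - q0) ^ 2

lemma wt_pos (s0 q0 : ℤ) (t : ℝ) : 0 < wt s0 q0 t := by unfold wt; positivity
lemma wt_continuous (s0 q0 : ℤ) : Continuous (wt s0 q0) := by unfold wt; fun_prop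

structure Good (N0 : ℝ) (h : ℝ → ℂ) : Prop where
  cont : Continuous h
  bd : ∀ u, ‖h u‖ ≤ rho u ^ 8
  lip : ∀ u w, |u - w| ≤ 1 → ‖h u - h w‖ ≤ |u - w| * rho u ^ 8
  orth : ∀ (p p' : Tile) (s0 q0 : ℤ),
    N0 * (tw p.s + tw p'.s) < |tw p.s * p.l - tw p'.s * p'.l| →
    ∫ t, (wt s0 q0 t : ℂ) * (pk h p t * (starRingEnd ℂ) (pk h p' t)) = 0

variable {N0 : ℝ} {h : ℝ → ℂ}

lemma pk_continuous (hh : Good N0 h) (p : Tile) : Continuous (pk h p) := by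
  unfold pk
  exact (ee_continuous.comp (by fun_prop)).mul (hh.cont.comp (by fun_prop))

lemma pk_norm (h : ℝ → ℂ) (p : Tile) (t : ℝ) : ‖pk h p t‖ = ‖h (tw p.s * t - p.q)‖ := by
  unfold pk; rw [norm_mul, ee_norm, one_mul]

lemma pk_le (hh : Good N0 h) (p : Tile) (t : ℝ) : ‖pk h p t‖ ≤ rho (tw p.s * t - p.q) ^ 8 := by
  rw [pk_norm]; exact hh.bd _

lemma wt_le {s0 q0 : ℤ} {p p' : Tile} (hp : p.I ⊆ dI s0 q0) (hp' : p'.I ⊆ dI s0 q0) (t : ℝ) :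
    wt s0 q0 t * (rho (tw p.s * t - p.q) * rho (tw p'.s * t - p'.q)) ≤ 2 := by
  have h1 := dI_tau_le hp t
  have h2 := dI_tau_le hp' t
  unfold wt rho
  rw [← mul_inv, ← div_eq_mul_inv, div_le_iff₀ (by positivity)]
  set a := |tw p.s * t - p.q|
  set b := |tw p'.s * t - p'.q|
  rw [← sq_abs (tw s0 * t - q0)]
  have ha : 0 ≤ a := abs_nonneg _
  have hb : 0 ≤ b := abs_nonneg _
  nlinarith [abs_nonneg (tw s0 * t - q0), mul_nonneg ha hb,
    mul_le_mul h1 h2 (abs_nonneg (tw s0 * t - q0)) (by linarith : 0 ≤ a + 1)]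

def gram (h : ℝ → ℂ) (s0 q0 : ℤ) (p p' : Tile) : ℂ :=
  ∫ t, (wt s0 q0 t : ℂ) * (pk h p t * (starRingEnd ℂ) (pk h p' t))

lemma gram_integrand_le (hh : Good N0 h) {s0 q0 : ℤ} {p p' : Tile} (hp : p.I ⊆ dI s0 q0)
    (hp' : p'.I ⊆ dI s0 q0) (hs : p.s ≤ p'.s) (t : ℝ) :
    ‖(wt s0 q0 t : ℂ) * (pk h p t * (starRingEnd ℂ) (pk h p' t))‖ ≤
      2 * rho (tw p.s * (p'.q / tw p'.s) - p.q) ^ 4 * rho (tw p'.s * t - p'.q) ^ 2 := by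
  rw [norm_mul, norm_mul, RCLike.norm_conj, Complex.norm_real, Real.norm_of_nonneg (wt_pos _ _ _).le]
  set u := tw p.s * t - p.q
  set u' := tw p'.s * t - p'.q
  have h1 := wt_le hp hp' t
  have h2 : rho u * rho u' ≤ rho (tw p.s * (p'.q / tw p'.s) - p.q) := by
    apply rho_mul_le
    have e : tw p.s * (p'.q / tw p'.s) - p.q = u - (tw p.s / tw p'.s) * u' := by
      have := tw_ne p'.s
      simp only [u, u']; field_simp; ring
    rw [e]
    refine (abs_sub _ _).trans ?_
    rw [abs_mul, abs_of_pos (div_pos (tw_pos _) (tw_pos _))]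
    have h3 : tw p.s / tw p'.s ≤ 1 := by rw [div_le_one (tw_pos _)]; exact tw_le hs
    have := mul_le_mul_of_nonneg_right h3 (abs_nonneg u')
    linarith
  have hu := rho_nonneg u
  have hu' := rho_nonneg u'
  have hu1 := rho_le_one u
  calc wt s0 q0 t * (‖pk h p t‖ * ‖pk h p' t‖)
      ≤ wt s0 q0 t * (rho u ^ 8 * rho u' ^ 8) := by
        have := (wt_pos s0 q0 t).le
        gcongr
        · exact pk_le hh p t
        · exact pk_le hh p' t
    _ = (wt s0 q0 t * (rho u * rho u')) * (rho u * rho u') ^ 4 * (rho u' ^ 2) * (rho u ^ 3 * rho u' ) := by ring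
    _ ≤ 2 * rho (tw p.s * (p'.q / tw p'.s) - p.q) ^ 4 * rho u' ^ 2 * 1 := by
        have h5 : rho u ^ 3 * rho u' ≤ 1 :=
          mul_le_one₀ (pow_le_one₀ hu hu1) hu' (rho_le_one u')
        gcongr
    _ = _ := by ring

lemma gram_integrable (hh : Good N0 h) {s0 q0 : ℤ} {p p' : Tile} (hp : p.I ⊆ dI s0 q0)
    (hp' : p'.I ⊆ dI s0 q0) :
    Integrable (fun t => (wt s0 q0 t : ℂ) * (pk h p t * (starRingEnd ℂ) (pk h p' t))) := by
  have hm : ∀ p p' : Tile, AEStronglyMeasurable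
    (fun t => (wt s0 q0 t : ℂ) * (pk h p t * (starRingEnd ℂ) (pk h p' t))) volume := by
    intro p p'
    apply Continuous.aestronglyMeasurable
    have := pk_continuous hh p
    have := pk_continuous hh p'
    have := wt_continuous s0 q0
    have hc : Continuous (starRingEnd ℂ) := Complex.continuous_conj
    fun_prop
  rcases le_total p.s p'.s with hs | hs
  · exact (((rho_sq_aff_integrable (tw_pos p'.s) p'.q).const_mul _)).mono' (hm p p')
      (Filter.Eventually.of_forall (gram_integrand_le hh hp hp' hs))
  · refine (((rho_sq_aff_integrable (tw_pos p.s) p.q).const_mul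
      (2 * rho (tw p'.s * (p.q / tw p.s) - p'.q) ^ 4))).mono' (hm p p')
      (Filter.Eventually.of_forall fun t => ?_)
    have := gram_integrand_le hh hp' hp hs t
    rw [norm_mul, norm_mul, RCLike.norm_conj] at this ⊢
    rw [mul_comm ‖pk h p t‖]; exact this

lemma gram_le (hh : Good N0 h) {s0 q0 : ℤ} {p p' : Tile} (hp : p.I ⊆ dI s0 q0)
    (hp' : p'.I ⊆ dI s0 q0) (hs : p.s ≤ p'.s) :
    ‖gram h s0 q0 p p'‖ ≤ 8 * tw (-p'.s) * rho (tw p.s * (p'.q / tw p'.s) - p.q) ^ 4 := by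
  unfold gram
  refine (norm_integral_le_of_norm_le ((rho_sq_aff_integrable (tw_pos p'.s) p'.q).const_mul _)
    (Filter.Eventually.of_forall (gram_integrand_le hh hp hp' hs))).trans ?_
  rw [integral_const_mul]
  have := rho_sq_aff_integral (tw_pos p'.s) p'.q
  have h2 := rho_nonneg (tw p.s * (p'.q / tw p'.s) - p.q)
  calc _ ≤ 2 * rho (tw p.s * (p'.q / tw p'.s) - p.q) ^ 4 * (4 / tw p'.s) := by gcongr
    _ = _ := by rw [tw_neg]; ring

lemma gram_symm (h : ℝ → ℂ) (s0 q0 : ℤ) (p p' : Tile) :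
    ‖gram h s0 q0 p p'‖ = ‖gram h s0 q0 p' p‖ := by
  have : gram h s0 q0 p p' = (starRingEnd ℂ) (gram h s0 q0 p' p) := by
    unfold gram
    rw [← integral_conj]
    congr 1; ext t
    simp [mul_comm]
  rw [this, RCLike.norm_conj]

lemma tile_sum_le (S : Finset Tile) (s : ℤ) (hs : ∀ p ∈ S, p.s = s) (x K : ℝ) (hK : 0 ≤ K)
    (hl : ∀ p ∈ S, |(p.l : ℝ) - x| ≤ K) (f : ℤ → ℝ) (hf : ∀ q, 0 ≤ f q) :
    ∑ p ∈ S, f p.q ≤ (2 * K + 1) * ∑ q ∈ S.image Tile.q, f q := by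
  rw [← Finset.sum_fiberwise_of_maps_to (t := S.image Tile.q) (g := Tile.q)
    (fun p hp => Finset.mem_image_of_mem _ hp), Finset.mul_sum]
  refine Finset.sum_le_sum fun q _ => ?_
  have : ∑ p ∈ S with p.q = q, f p.q = ((S.filter (fun p => p.q = q)).card : ℝ) * f q := by
    rw [← nsmul_eq_mul, ← Finset.sum_const]
    refine Finset.sum_congr rfl fun p hp => ?_
    rw [(Finset.mem_filter.1 hp).2]
  rw [this]
  refine mul_le_mul_of_nonneg_right ?_ (hf q)
  have hc : (S.filter (fun p => p.q = q)).card
      = ((S.filter (fun p => p.q = q)).image Tile.l).card := by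
    rw [Finset.card_image_of_injOn]
    intro a ha b hb hab
    simp only [Finset.coe_filter, Set.mem_setOf_eq] at ha hb
    cases a; cases b
    simp only [Tile.mk.injEq]
    refine ⟨?_, ?_, hab⟩
    · exact (hs _ ha.1).trans (hs _ hb.1).symm
    · exact ha.2.trans hb.2.symm
  rw [hc]
  apply card_int_window x K hK
  intro l hl'
  obtain ⟨p, hp, rfl⟩ := Finset.mem_image.1 hl'
  exact hl p (Finset.mem_filter.1 hp).1

lemma tile_sum_rho (S : Finset Tile) (s : ℤ) (hs : ∀ p ∈ S, p.s = s) (x K : ℝ) (hK : 0 ≤ K)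
    (hl : ∀ p ∈ S, |(p.l : ℝ) - x| ≤ K) (y : ℝ) :
    ∑ p ∈ S, rho (y - p.q) ^ 2 ≤ (2 * K + 1) * 16 := by
  refine (tile_sum_le S s hs x K hK hl (fun q => rho (y - q) ^ 2) (fun q => by positivity)).trans ?_
  gcongr
  exact sum_rho_sq_int y _

def HH (h : ℝ → ℂ) (c : Tile → ℂ) (U : Finset Tile) (t : ℝ) : ℂ := ∑ p ∈ U, c p * pk h p t

lemma HH_sq_eq (hh : Good N0 h) (c : Tile → ℂ) (U : Finset Tile) (s0 q0 : ℤ) (t : ℝ) :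
    ((wt s0 q0 t * ‖HH h c U t‖ ^ 2 : ℝ) : ℂ) = ∑ p ∈ U, ∑ p' ∈ U,
      (c p * (starRingEnd ℂ) (c p')) * ((wt s0 q0 t : ℂ) * (pk h p t * (starRingEnd ℂ) (pk h p' t))) := by
  push_cast
  rw [← Complex.mul_conj', HH, map_sum, Finset.sum_mul_sum, Finset.mul_sum]
  refine Finset.sum_congr rfl fun p _ => ?_
  rw [Finset.mul_sum]
  refine Finset.sum_congr rfl fun p' _ => ?_
  rw [map_mul]; ring

lemma HH_sq_integrable (hh : Good N0 h) (c : Tile → ℂ) (U : Finset Tile) (s0 q0 : ℤ)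
    (hU : ∀ p ∈ U, p.I ⊆ dI s0 q0) : Integrable (fun t => wt s0 q0 t * ‖HH h c U t‖ ^ 2) := by
  have : Integrable (fun t => ((wt s0 q0 t * ‖HH h c U t‖ ^ 2 : ℝ) : ℂ)) := by
    simp_rw [HH_sq_eq hh]
    refine integrable_finsetSum _ fun p hp => integrable_finsetSum _ fun p' hp' => ?_
    exact (gram_integrable hh (hU p hp) (hU p' hp')).const_mul _
  have h2 := this.re
  simp only [RCLike.re_to_complex, Complex.ofReal_re] at h2
  exact h2

lemma HH_gram (hh : Good N0 h) (c : Tile → ℂ) (U : Finset Tile) (s0 q0 : ℤ)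
    (hU : ∀ p ∈ U, p.I ⊆ dI s0 q0) :
    ∫ t, wt s0 q0 t * ‖HH h c U t‖ ^ 2 ≤
      ∑ p ∈ U, ∑ p' ∈ U, ‖c p‖ * ‖c p'‖ * ‖gram h s0 q0 p p'‖ := by
  have h1 : ((∫ t, wt s0 q0 t * ‖HH h c U t‖ ^ 2 : ℝ) : ℂ) =
      ∑ p ∈ U, ∑ p' ∈ U, (c p * (starRingEnd ℂ) (c p')) * gram h s0 q0 p p' := by
    rw [← integral_complex_ofReal]
    simp_rw [HH_sq_eq hh]
    rw [integral_finsetSum]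
    · refine Finset.sum_congr rfl fun p hp => ?_
      rw [integral_finsetSum]
      · refine Finset.sum_congr rfl fun p' hp' => ?_
        rw [integral_const_mul]; rfl
      · intro p' hp'; exact (gram_integrable hh (hU p hp) (hU p' hp')).const_mul _
    · intro p hp; refine integrable_finsetSum _ fun p' hp' => ?_
      exact (gram_integrable hh (hU p hp) (hU p' hp')).const_mul _
  have h2 : (∫ t, wt s0 q0 t * ‖HH h c U t‖ ^ 2) ≤
      ‖((∫ t, wt s0 q0 t * ‖HH h c U t‖ ^ 2 : ℝ) : ℂ)‖ := by
    rw [Complex.norm_real]; exact le_abs_self _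
  refine h2.trans ?_
  rw [h1]
  refine (norm_sum_le _ _).trans (Finset.sum_le_sum fun p _ => ?_)
  refine (norm_sum_le _ _).trans (Finset.sum_le_sum fun p' _ => ?_)
  rw [norm_mul, norm_mul, RCLike.norm_conj]

/-- the relation: the tile `p'` is finer and frequency-close to `p` -/
def CrossRel (N0 : ℝ) (p p' : Tile) : Prop :=
  p.s < p'.s ∧ |tw p.s * p.l - tw p'.s * p'.l| ≤ N0 * (tw p.s + tw p'.s)

lemma HH_gram_split (hN : 0 ≤ N0) (hh : Good N0 h) (c : Tile → ℂ) (U : Finset Tile) (s0 q0 : ℤ)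
    (hU : ∀ p ∈ U, p.I ⊆ dI s0 q0) :
    ∫ t, wt s0 q0 t * ‖HH h c U t‖ ^ 2 ≤
      128 * (4 * N0 + 1) * ∑ p ∈ U, tw (-p.s) * ‖c p‖ ^ 2 +
      16 * ∑ p ∈ U, ∑ p' ∈ U with CrossRel N0 p p',
        ‖c p‖ * ‖c p'‖ * (tw (-p'.s) * rho (tw p.s * (p'.q / tw p'.s) - p.q) ^ 4) := by
  refine (HH_gram hh c U s0 q0 hU).trans ?_
  set g := fun p p' => ‖c p‖ * ‖c p'‖ * ‖gram h s0 q0 p p'‖ with hg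
  have hgs : ∀ p p', g p p' = g p' p := by
    intro p p'; simp only [hg]; rw [gram_symm]; ring
  have hz : ∀ p p', N0 * (tw p.s + tw p'.s) < |tw p.s * p.l - tw p'.s * p'.l| → g p p' = 0 := by
    intro p p' hlt
    simp only [hg, gram, hh.orth p p' s0 q0 hlt]; simp
  have hsplit : ∑ p ∈ U, ∑ p' ∈ U, g p p' =
      ∑ p ∈ U, ∑ p' ∈ U, (if p.s = p'.s then g p p' else 0) +
      2 * ∑ p ∈ U, ∑ p' ∈ U, (if p.s < p'.s then g p p' else 0) := by
    have e1 : ∑ p ∈ U, ∑ p' ∈ U, (if p.s < p'.s then g p p' else 0)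
        = ∑ p ∈ U, ∑ p' ∈ U, (if p'.s < p.s then g p p' else 0) := by
      rw [Finset.sum_comm]
      refine Finset.sum_congr rfl fun p _ => Finset.sum_congr rfl fun p' _ => ?_
      rw [hgs]
    rw [two_mul]; nth_rewrite 2 [e1]
    rw [← Finset.sum_add_distrib, ← Finset.sum_add_distrib]
    refine Finset.sum_congr rfl fun p _ => ?_
    rw [← Finset.sum_add_distrib, ← Finset.sum_add_distrib]
    refine Finset.sum_congr rfl fun p' _ => ?_
    rcases lt_trichotomy p.s p'.s with hl | hl | hl
    · simp [hl, hl.ne, hl.not_gt]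
    · simp [hl]
    · simp [hl, hl.ne', hl.not_gt]
  rw [hsplit]
  have hsame : ∑ p ∈ U, ∑ p' ∈ U, (if p.s = p'.s then g p p' else 0) ≤
      128 * (4 * N0 + 1) * ∑ p ∈ U, tw (-p.s) * ‖c p‖ ^ 2 := by
    set K := fun p p' : Tile => if p.s = p'.s ∧ |(p'.l : ℝ) - p.l| ≤ 2 * N0 then
      8 * tw (-p.s) * rho (p.q - p'.q) ^ 2 else 0 with hK
    have hKs : ∀ p p', K p p' = K p' p := by
      intro p p'
      simp only [hK]
      by_cases hs : p.s = p'.s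
      · rw [hs, abs_sub_comm, ← rho_neg, neg_sub]
      · simp [hs, Ne.symm hs]
    have b1 : ∀ p ∈ U, ∀ p' ∈ U, (if p.s = p'.s then g p p' else 0) ≤
        (‖c p‖ ^ 2 / 2) * K p p' + (‖c p'‖ ^ 2 / 2) * K p' p := by
      intro p hp p' hp'
      rw [hKs p' p]
      have hK0 : 0 ≤ K p p' := by
        simp only [hK]; split_ifs
        · have := tw_pos (-p.s); positivity
        · rfl
      by_cases hs : p.s = p'.s
      · rw [if_pos hs]
        by_cases hl : |(p'.l : ℝ) - p.l| ≤ 2 * N0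
        · have hG : ‖gram h s0 q0 p p'‖ ≤ K p p' := by
            have := gram_le hh (hU p hp) (hU p' hp') hs.le
            simp only [hK]; rw [if_pos ⟨hs, hl⟩]
            refine this.trans ?_
            rw [← hs, mul_div_cancel₀ _ (tw_ne p.s)]
            rw [← rho_neg (p.q - p'.q), neg_sub]
            have := tw_pos (-p.s)
            gcongr 8 * _ * ?_
            exact rho_pow_le (by norm_num)
          simp only [hg]
          calc _ ≤ ‖c p‖ * ‖c p'‖ * K p p' := by gcongr
            _ ≤ _ := by nlinarith [sq_nonneg (‖c p‖ - ‖c p'‖)]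
        · rw [hz]
          · positivity
          · push Not at hl
            rw [← hs, ← mul_sub, abs_mul, abs_of_pos (tw_pos _), abs_sub_comm]
            nlinarith [tw_pos p.s]
      · rw [if_neg hs]; positivity
    calc _ ≤ ∑ p ∈ U, ∑ p' ∈ U, ((‖c p‖ ^ 2 / 2) * K p p' + (‖c p'‖ ^ 2 / 2) * K p' p) :=
          Finset.sum_le_sum fun p hp => Finset.sum_le_sum fun p' hp' => b1 p hp p' hp'
      _ = 2 * ∑ p ∈ U, ∑ p' ∈ U, (‖c p‖ ^ 2 / 2) * K p p' := by
          simp_rw [Finset.sum_add_distrib]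
          rw [two_mul]; congr 1
          rw [Finset.sum_comm]
      _ = ∑ p ∈ U, ‖c p‖ ^ 2 * ∑ p' ∈ U, K p p' := by
          rw [Finset.mul_sum]
          refine Finset.sum_congr rfl fun p _ => ?_
          rw [← Finset.mul_sum]; ring
      _ ≤ ∑ p ∈ U, ‖c p‖ ^ 2 * (8 * tw (-p.s) * ((2 * (2 * N0) + 1) * 16)) := by
          refine Finset.sum_le_sum fun p _ => ?_
          gcongr
          simp only [hK]
          rw [← Finset.sum_filter, ← Finset.mul_sum]
          have := tw_pos (-p.s)
          gcongr
          apply tile_sum_rho _ p.s _ p.l (2 * N0) (by linarith)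
          · intro p' hp'; exact (Finset.mem_filter.1 hp').2.2
          · intro p' hp'; exact (Finset.mem_filter.1 hp').2.1.symm
      _ = _ := by rw [Finset.mul_sum]; refine Finset.sum_congr rfl fun p _ => ?_; ring
  have hcross : ∑ p ∈ U, ∑ p' ∈ U, (if p.s < p'.s then g p p' else 0) ≤
      8 * ∑ p ∈ U, ∑ p' ∈ U with CrossRel N0 p p',
        ‖c p‖ * ‖c p'‖ * (tw (-p'.s) * rho (tw p.s * (p'.q / tw p'.s) - p.q) ^ 4) := by
    rw [Finset.mul_sum]
    refine Finset.sum_le_sum fun p hp => ?_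
    rw [Finset.mul_sum, Finset.sum_filter]
    refine Finset.sum_le_sum fun p' hp' => ?_
    have ht := tw_pos (-p'.s)
    by_cases hs : p.s < p'.s
    · rw [if_pos hs]
      by_cases hc : CrossRel N0 p p'
      · rw [if_pos hc]
        have := gram_le hh (hU p hp) (hU p' hp') hs.le
        simp only [hg]
        calc _ ≤ ‖c p‖ * ‖c p'‖ * (8 * tw (-p'.s) * rho (tw p.s * (p'.q / tw p'.s) - p.q) ^ 4) := by
              gcongr
          _ = _ := by ring
      · rw [if_neg hc, hz]
        by_contra hcon
        exact hc ⟨hs, not_lt.1 hcon⟩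
    · rw [if_neg hs]
      split_ifs
      · positivity
      · rfl
  linarith

variable {N0 : ℝ} {h : ℝ → ℂ}

/-! ### Bessel type inequality -/

lemma geom_up (A : Finset ℤ) : ∀ M : ℝ, 0 ≤ M → (∀ s ∈ A, tw s ≤ M) → ∑ s ∈ A, tw s ≤ 2 * M := by
  induction A using Finset.induction_on_max with
  | empty => intro M hM _; simpa using hM
  | insert a A ha ih =>
    intro M hM hA
    rw [Finset.sum_insert (fun hmem => lt_irrefl _ (ha a hmem))]
    have h1 := ih (tw a / 2) (by have := tw_pos a; positivity) (fun s hs => by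
      have := tw_lt_two (ha s hs); linarith)
    have h2 := hA a (Finset.mem_insert_self _ _)
    linarith

lemma geom_down (A : Finset ℤ) (M : ℝ) (hM : 0 ≤ M) (hA : ∀ s ∈ A, tw (-s) ≤ M) :
    ∑ s ∈ A, tw (-s) ≤ 2 * M := by
  have := geom_up (A.image Neg.neg) M hM (by
    intro s hs
    obtain ⟨u, hu, rfl⟩ := Finset.mem_image.1 hs
    exact hA u hu)
  rwa [Finset.sum_image (fun a _ b _ hab => neg_injective hab)] at this

structure FOK (F : ℝ → ℂ) : Prop where
  meas : Measurable F
  bd : ∀ x, ‖F x‖ ≤ 1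
  int : Integrable F

def cf (h F : ℝ → ℂ) (p : Tile) : ℂ := tw p.s * ∫ t, F t * (starRingEnd ℂ) (pk h p t)

lemma pk_le_one (hh : Good N0 h) (p : Tile) (t : ℝ) : ‖pk h p t‖ ≤ 1 :=
  (pk_le hh p t).trans (pow_le_one₀ (rho_nonneg _) (rho_le_one _))

lemma HH_continuous (hh : Good N0 h) (c : Tile → ℂ) (U : Finset Tile) : Continuous (HH h c U) := by
  unfold HH
  exact continuous_finsetSum _ fun p _ => continuous_const.mul (pk_continuous hh p)

lemma HH_bdd (hh : Good N0 h) (c : Tile → ℂ) (U : Finset Tile) (t : ℝ) :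
    ‖HH h c U t‖ ≤ ∑ p ∈ U, ‖c p‖ := by
  unfold HH
  refine (norm_sum_le _ _).trans (Finset.sum_le_sum fun p _ => ?_)
  rw [norm_mul]
  exact mul_le_of_le_one_right (norm_nonneg _) (pk_le_one hh p t)

lemma F_pk_integrable (hh : Good N0 h) {F : ℝ → ℂ} (hF : FOK F) (p : Tile) :
    Integrable (fun t => F t * (starRingEnd ℂ) (pk h p t)) := by
  refine hF.int.mono ?_ (Filter.Eventually.of_forall fun t => ?_)
  · exact hF.int.aestronglyMeasurable.mul
      ((Complex.continuous_conj.comp (pk_continuous hh p)).aestronglyMeasurable)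
  · rw [norm_mul, RCLike.norm_conj]
    exact mul_le_of_le_one_right (norm_nonneg _) (pk_le_one hh p t)

lemma FH_integrable (hh : Good N0 h) {F : ℝ → ℂ} (hF : FOK F) (c : Tile → ℂ) (U : Finset Tile) :
    Integrable (fun t => ‖F t‖ * ‖HH h c U t‖) := by
  refine (hF.int.norm.mul_const (∑ p ∈ U, ‖c p‖)).mono' ?_ (Filter.Eventually.of_forall fun t => ?_)
  · exact hF.int.norm.aestronglyMeasurable.mul
      ((HH_continuous hh c U).norm.aestronglyMeasurable)
  · rw [Real.norm_of_nonneg (by positivity)]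
    have := HH_bdd hh c U t
    gcongr

lemma sum_sq_le_FH (hh : Good N0 h) {F : ℝ → ℂ} (hF : FOK F) (U : Finset Tile) :
    ∑ p ∈ U, tw (-p.s) * ‖cf h F p‖ ^ 2 ≤ ∫ t, ‖F t‖ * ‖HH h (cf h F) U t‖ := by
  have h1 : ((∑ p ∈ U, tw (-p.s) * ‖cf h F p‖ ^ 2 : ℝ) : ℂ) =
      ∫ t, F t * (starRingEnd ℂ) (HH h (cf h F) U t) := by
    have e : ∀ t, F t * (starRingEnd ℂ) (HH h (cf h F) U t) =
        ∑ p ∈ U, (starRingEnd ℂ) (cf h F p) * (F t * (starRingEnd ℂ) (pk h p t)) := by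
      intro t
      unfold HH
      rw [map_sum, Finset.mul_sum]
      refine Finset.sum_congr rfl fun p _ => ?_
      rw [map_mul]; ring
    simp_rw [e]
    rw [integral_finsetSum]
    · push_cast
      refine Finset.sum_congr rfl fun p _ => ?_
      rw [integral_const_mul, ← Complex.mul_conj']
      have : ∫ t, F t * (starRingEnd ℂ) (pk h p t) = (tw (-p.s) : ℂ) * cf h F p := by
        unfold cf
        rw [← mul_assoc, ← Complex.ofReal_mul, tw_neg, inv_mul_cancel₀ (tw_ne _)]; simp
      rw [this]; ring
    · intro p _; exact (F_pk_integrable hh hF p).const_mul _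
  have h2 : (∑ p ∈ U, tw (-p.s) * ‖cf h F p‖ ^ 2 : ℝ) ≤
     ‖((∑ p ∈ U, tw (-p.s) * ‖cf h F p‖ ^ 2 : ℝ) : ℂ)‖ := by
    rw [Complex.norm_real]; exact le_abs_self _
  refine h2.trans ?_
  rw [h1]
  refine (norm_integral_le_integral_norm _).trans_eq ?_
  simp_rw [norm_mul, RCLike.norm_conj]

lemma F_wt_integrable {F : ℝ → ℂ} (hF : FOK F) (s0 q0 : ℤ) :
    Integrable (fun t => ‖F t‖ ^ 2 / wt s0 q0 t) := by
  refine hF.int.norm.mono' ?_ (Filter.Eventually.of_forall fun t => ?_)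
  · exact ((hF.meas.norm.pow_const 2).div (wt_continuous s0 q0).measurable).aestronglyMeasurable
  · have := wt_pos s0 q0 t
    rw [Real.norm_of_nonneg (by positivity)]
    rw [div_le_iff₀ this]
    have h1 := hF.bd t
    have : 1 ≤ wt s0 q0 t := by unfold wt; nlinarith [sq_nonneg (tw s0 * t - q0)]
    nlinarith [norm_nonneg (F t)]

lemma sum_sq_le (hh : Good N0 h) {F : ℝ → ℂ} (hF : FOK F) (U : Finset Tile) (s0 q0 : ℤ)
    (hU : ∀ p ∈ U, p.I ⊆ dI s0 q0) (M : ℝ) (hM : 0 < M) :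
    ∑ p ∈ U, tw (-p.s) * ‖cf h F p‖ ^ 2 ≤ M / 2 * (∫ t, ‖F t‖ ^ 2 / wt s0 q0 t) +
      1 / (2 * M) * ∫ t, wt s0 q0 t * ‖HH h (cf h F) U t‖ ^ 2 := by
  refine (sum_sq_le_FH hh hF U).trans ?_
  rw [← integral_const_mul, ← integral_const_mul, ← integral_add
    ((F_wt_integrable hF s0 q0).const_mul _) ((HH_sq_integrable hh _ U s0 q0 hU).const_mul _)]
  apply integral_mono (FH_integrable hh hF _ _)
    (((F_wt_integrable hF s0 q0).const_mul _).add ((HH_sq_integrable hh _ U s0 q0 hU).const_mul _))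
  intro t
  simp only [Pi.add_apply]
  have hw := wt_pos s0 q0 t
  set a := ‖F t‖
  set b := ‖HH h (cf h F) U t‖
  set w := wt s0 q0 t
  have : M / 2 * (a ^ 2 / w) + 1 / (2 * M) * (w * b ^ 2) - a * b =
      (M * a - w * b) ^ 2 / (2 * M * w) := by field_simp; ring
  have : 0 ≤ (M * a - w * b) ^ 2 / (2 * M * w) := by positivity
  linarith

/-- edge function -/
def edge (s : ℤ) (T : TTop) (t : ℝ) : ℝ :=
  rho (tw s * t - tw s * (T.q / tw T.s)) ^ 2 + rho (tw s * t - tw s * ((T.q + 1) / tw T.s)) ^ 2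

lemma edge_nonneg (s : ℤ) (T : TTop) (t : ℝ) : 0 ≤ edge s T t := by unfold edge; positivity

lemma edge_integrable (s : ℤ) (T : TTop) : Integrable (edge s T) :=
  (rho_sq_aff_integrable (tw_pos s) _).add (rho_sq_aff_integrable (tw_pos s) _)

lemma edge_integral (s : ℤ) (T : TTop) : ∫ t, edge s T t ≤ 8 * tw (-s) := by
  unfold edge
  rw [integral_add (rho_sq_aff_integrable (tw_pos s) _) (rho_sq_aff_integrable (tw_pos s) _)]
  have h1 := rho_sq_aff_integral (tw_pos s) (tw s * (T.q / tw T.s))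
  have h2 := rho_sq_aff_integral (tw_pos s) (tw s * ((T.q + 1) / tw T.s))
  rw [tw_neg]
  calc _ ≤ 4 / tw s + 4 / tw s := add_le_add h1 h2
    _ = _ := by ring

lemma rho_le_edge {p : Tile} {T : TTop} (hp : p.I ⊆ T.I) {t : ℝ} (ht : t ∉ T.I) :
    rho (tw p.s * t - p.q) ^ 4 ≤ rho (tw p.s * t - p.q) ^ 2 * edge p.s T t := by
  have h0 := hp (dI_left p.s p.q)
  unfold TTop.I at h0 ht
  rw [dI_eq_Ico] at h0 ht
  have hr := tw_pos p.s
  have hq : (p.q : ℝ) = tw p.s * (p.q / tw p.s) := by field_simp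
  have key : rho (tw p.s * t - p.q) ^ 2 ≤ edge p.s T t := by
    unfold edge
    rw [Set.mem_Ico, not_and_or, not_le, not_lt] at ht
    rcases ht with ht | ht
    · have : rho (tw p.s * t - p.q) ≤ rho (tw p.s * t - tw p.s * (T.q / tw T.s)) := by
        apply rho_anti
        rw [hq, ← mul_sub, ← mul_sub, abs_mul, abs_mul]
        refine mul_le_mul_of_nonneg_left ?_ (abs_nonneg _)
        rw [abs_of_neg (by linarith), abs_of_neg (by linarith [h0.1])]
        linarith [h0.1]
      have := pow_le_pow_left₀ (rho_nonneg _) this 2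
      have := sq_nonneg (rho (tw p.s * t - tw p.s * ((T.q + 1) / tw T.s)))
      linarith
    · have : rho (tw p.s * t - p.q) ≤ rho (tw p.s * t - tw p.s * ((T.q + 1) / tw T.s)) := by
        apply rho_anti
        rw [hq, ← mul_sub, ← mul_sub, abs_mul, abs_mul]
        refine mul_le_mul_of_nonneg_left ?_ (abs_nonneg _)
        rw [abs_of_nonneg (by linarith), abs_of_nonneg (by linarith [h0.2])]
        linarith [h0.2]
      have := pow_le_pow_left₀ (rho_nonneg _) this 2
      have := sq_nonneg (rho (tw p.s * t - tw p.s * (T.q / tw T.s)))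
      linarith
  calc rho (tw p.s * t - p.q) ^ 4 = rho (tw p.s * t - p.q) ^ 2 * rho (tw p.s * t - p.q) ^ 2 := by ring
    _ ≤ _ := by gcongr

lemma gfun_integrable (p : Tile) (T : TTop) :
    Integrable (fun t => rho (tw p.s * t - p.q) ^ 2 * edge p.s T t) := by
  refine (edge_integrable p.s T).mono' ?_ (Filter.Eventually.of_forall fun t => ?_)
  · exact (((rho_continuous.comp (by fun_prop)).pow 2).aestronglyMeasurable).mul
      (edge_integrable p.s T).aestronglyMeasurable
  · have := edge_nonneg p.s T t
    rw [Real.norm_of_nonneg (by positivity)]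
    exact mul_le_of_le_one_left this (pow_le_one₀ (rho_nonneg _) (rho_le_one _))

/-- sum over a tree of tail integrals -/
lemma tree_tail (S : Finset Tile) (T : TTop) (K : ℝ) (hK : 0 ≤ K)
    (hS : ∀ p ∈ S, p.I ⊆ T.I) (hl : ∀ p ∈ S, |(p.l : ℝ) - T.x / tw p.s| ≤ K) :
    ∑ p ∈ S, ∫ t, rho (tw p.s * t - p.q) ^ 2 * edge p.s T t ≤ 256 * (2 * K + 1) * tw (-T.s) := by
  have h1 : ∀ s ∈ S.image Tile.s, ∑ p ∈ S with p.s = s,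
      ∫ t, rho (tw p.s * t - p.q) ^ 2 * edge p.s T t ≤ (2 * K + 1) * 128 * tw (-s) := by
    intro s _
    have hsum : ∑ p ∈ S with p.s = s, ∫ t, rho (tw p.s * t - p.q) ^ 2 * edge p.s T t =
        ∫ t, (∑ p ∈ S with p.s = s, rho (tw s * t - p.q) ^ 2) * edge s T t := by
      rw [← integral_finsetSum]
      · congr 1; ext t
        rw [Finset.sum_mul]
        refine Finset.sum_congr rfl fun p hp => ?_
        rw [(Finset.mem_filter.1 hp).2]
      · intro p _; exact gfun_integrable p T
    rw [hsum]
    calc _ ≤ ∫ t, (2 * K + 1) * 16 * edge s T t := by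
          apply integral_mono_of_nonneg
          · refine Filter.Eventually.of_forall fun t => ?_
            have := edge_nonneg s T t
            simp only [Pi.zero_apply]
            positivity
          · exact (edge_integrable s T).const_mul _
          · refine Filter.Eventually.of_forall fun t => ?_
            have := edge_nonneg s T t
            simp only
            gcongr
            apply tile_sum_rho _ s _ (T.x / tw s) K hK
            · intro p hp
              have := Finset.mem_filter.1 hp
              rw [← this.2]; exact hl p this.1
            · intro p hp; exact (Finset.mem_filter.1 hp).2
      _ = (2 * K + 1) * 16 * ∫ t, edge s T t := integral_const_mul _ _
      _ ≤ (2 * K + 1) * 16 * (8 * tw (-s)) := by gcongr; exact edge_integral s T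
      _ = _ := by ring
  rw [← Finset.sum_fiberwise_of_maps_to (t := S.image Tile.s) (g := Tile.s)
    (fun p hp => Finset.mem_image_of_mem _ hp)]
  refine (Finset.sum_le_sum h1).trans ?_
  rw [← Finset.mul_sum]
  have := geom_down (S.image Tile.s) (tw (-T.s)) (tw_pos _).le (by
    intro s hs
    obtain ⟨p, hp, rfl⟩ := Finset.mem_image.1 hs
    exact tw_le (neg_le_neg (dI_subset_scale (hS p hp))))
  calc _ ≤ (2 * K + 1) * 128 * (2 * tw (-T.s)) := by gcongr
    _ = _ := by ring

def besselC (N0 K : ℝ) : ℝ :=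
  128 * (4 * N0 + 1) + 16 * (4 * (16 * ((4 * N0 + 1) * (256 * (2 * K + 1)))))

theorem bessel (hN : 0 < N0) {K : ℝ} (hK : 0 ≤ K) (hh : Good N0 h) {F : ℝ → ℂ} (hF : FOK F)
    (U : Finset Tile) (tp : Tile → TTop) (s0 q0 : ℤ)
    (hU : ∀ p ∈ U, p.I ⊆ (tp p).I) (hl : ∀ p ∈ U, |(p.l : ℝ) - (tp p).x / tw p.s| ≤ K)
    (hJ : ∀ p ∈ U, (tp p).I ⊆ dI s0 q0)
    (strong : ∀ p ∈ U, ∀ p' ∈ U, p.s < p'.s →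
      |tw p.s * p.l - tw p'.s * p'.l| ≤ 6 * N0 * tw p'.s → Disjoint p'.I (tp p).I)
    (σ : ℝ) (hσ : 0 < σ) (hcσ : ∀ p ∈ U, ‖cf h F p‖ ≤ σ)
    (big : ∀ T ∈ U.image tp, σ ^ 2 / 4 * tw (-T.s) ≤
      ∑ p ∈ U with tp p = T, tw (-p.s) * ‖cf h F p‖ ^ 2) :
    ∑ T ∈ U.image tp, tw (-T.s) ≤
      4 * besselC N0 K / σ ^ 2 * ∫ t, ‖F t‖ ^ 2 / wt s0 q0 t := by
  have hUJ : ∀ p ∈ U, p.I ⊆ dI s0 q0 := fun p hp => (hU p hp).trans (hJ p hp)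
  set S := ∑ p ∈ U, tw (-p.s) * ‖cf h F p‖ ^ 2 with hS
  set V := ∑ T ∈ U.image tp, tw (-T.s) with hV
  have hVS : σ ^ 2 / 4 * V ≤ S := by
    rw [hV, Finset.mul_sum, hS, ← Finset.sum_fiberwise_of_maps_to (t := U.image tp) (g := tp)
      (fun p hp => Finset.mem_image_of_mem _ hp)]
    exact Finset.sum_le_sum big
  -- cross terms
  have hcross : ∑ p ∈ U, ∑ p' ∈ U with CrossRel N0 p p',
        ‖cf h F p‖ * ‖cf h F p'‖ * (tw (-p'.s) * rho (tw p.s * (p'.q / tw p'.s) - p.q) ^ 4) ≤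
        σ ^ 2 * (16 * ((4 * N0 + 1) * (256 * (2 * K + 1) * V))) := by
    have c1 : ∀ p ∈ U, ∑ p' ∈ U with CrossRel N0 p p',
        ‖cf h F p‖ * ‖cf h F p'‖ * (tw (-p'.s) * rho (tw p.s * (p'.q / tw p'.s) - p.q) ^ 4) ≤
        σ ^ 2 * (16 * ((4 * N0 + 1) * ∫ t, rho (tw p.s * t - p.q) ^ 2 * edge p.s (tp p) t)) := by
      intro p hp
      have hbound : ∀ p' ∈ U.filter (fun p' => CrossRel N0 p p'),
          |tw p.s * p.l - tw p'.s * p'.l| ≤ 2 * N0 * tw p'.s := by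
        intro p' hp'
        have hc := (Finset.mem_filter.1 hp').2
        have := tw_le hc.1.le
        refine hc.2.trans ?_
        nlinarith
      have c2 : ∀ p' ∈ U.filter (fun p' => CrossRel N0 p p'),
          ‖cf h F p‖ * ‖cf h F p'‖ * (tw (-p'.s) * rho (tw p.s * (p'.q / tw p'.s) - p.q) ^ 4) ≤
          σ ^ 2 * (16 * ∫ t in p'.I, rho (tw p.s * t - p.q) ^ 2 * edge p.s (tp p) t) := by
        intro p' hp'
        have hc := (Finset.mem_filter.1 hp').2
        have hp'U := (Finset.mem_filter.1 hp').1
        have hd : Disjoint p'.I (tp p).I := by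
          apply strong p hp p' hp'U hc.1
          refine (hbound p' hp').trans ?_
          have := tw_pos p'.s
          nlinarith
        have hintg : tw (-p'.s) * rho (tw p.s * (p'.q / tw p'.s) - p.q) ^ 4 ≤
            16 * ∫ t in p'.I, rho (tw p.s * t - p.q) ^ 2 * edge p.s (tp p) t := by
          have : ∫ t in p'.I, rho (tw p.s * (p'.q / tw p'.s) - p.q) ^ 4 ≤
              ∫ t in p'.I, 16 * (rho (tw p.s * t - p.q) ^ 2 * edge p.s (tp p) t) := by
            apply setIntegral_mono_on
            · rw [integrableOn_const_iff]; right; rw [Tile.I, dI_volume]; exact ENNReal.ofReal_lt_top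
            · exact ((gfun_integrable p (tp p)).const_mul _).integrableOn
            · exact dI_measurable _ _
            · intro t ht
              have ht' : t ∉ (tp p).I := Set.disjoint_left.1 hd ht
              have h4 := rho_le_edge (hU p hp) ht'
              have h5 : rho (tw p.s * (p'.q / tw p'.s) - p.q) ≤ 2 * rho (tw p.s * t - p.q) := by
                apply rho_le_mul two_pos
                rw [Tile.I, mem_dI] at ht
                have hr : tw p.s / tw p'.s ≤ 1 := by
                  rw [div_le_one (tw_pos _)]; exact tw_le hc.1.le
                have hr0 : 0 < tw p.s / tw p'.s := div_pos (tw_pos _) (tw_pos _)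
                have e : tw p.s * t - p.q = (tw p.s * (p'.q / tw p'.s) - p.q)
                    + (tw p.s / tw p'.s) * (tw p'.s * t - p'.q) := by
                  have := tw_ne p'.s
                  field_simp; ring
                have h6 : |(tw p.s / tw p'.s) * (tw p'.s * t - p'.q)| ≤ 1 := by
                  rw [abs_mul, abs_of_pos hr0]
                  apply mul_le_one₀ hr (abs_nonneg _)
                  rw [abs_le]; constructor <;> linarith [ht.1, ht.2]
                have h7 := abs_add_le (tw p.s * (p'.q / tw p'.s) - p.q)
                  ((tw p.s / tw p'.s) * (tw p'.s * t - p'.q))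
                rw [← e] at h7
                linarith [abs_nonneg (tw p.s * (p'.q / tw p'.s) - p.q)]
              calc _ ≤ (2 * rho (tw p.s * t - p.q)) ^ 4 :=
                    pow_le_pow_left₀ (rho_nonneg _) h5 4
                _ = 16 * rho (tw p.s * t - p.q) ^ 4 := by ring
                _ ≤ _ := by linarith
          rw [setIntegral_const, Tile.I, dI_volume_real, integral_const_mul, smul_eq_mul] at this
          exact this
        have hσ1 := hcσ p hp
        have hσ2 := hcσ p' hp'U
        have hpos : 0 ≤ tw (-p'.s) * rho (tw p.s * (p'.q / tw p'.s) - p.q) ^ 4 := by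
          have := tw_pos (-p'.s); positivity
        calc _ ≤ (σ * σ) * (tw (-p'.s) * rho (tw p.s * (p'.q / tw p'.s) - p.q) ^ 4) := by gcongr
          _ ≤ (σ * σ) * (16 * ∫ t in p'.I, rho (tw p.s * t - p.q) ^ 2 * edge p.s (tp p) t) := by
              gcongr
          _ = _ := by ring
      refine (Finset.sum_le_sum c2).trans ?_
      rw [← Finset.mul_sum, ← Finset.mul_sum]
      gcongr
      apply sum_setIntegral_le
      · intro i _; exact dI_measurable _ _
      · exact gfun_integrable p (tp p)
      · intro t; have := edge_nonneg p.s (tp p) t; positivity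
      · intro t
        set W := (U.filter (fun p' => CrossRel N0 p p')).filter (fun i => t ∈ i.I) with hW
        rcases W.eq_empty_or_nonempty with he | ⟨w, hw⟩
        · rw [he]; simp; positivity
        have hsc : ∀ p' ∈ W, ∀ p'' ∈ W, ¬ p'.s < p''.s := by
          intro p' h1 p'' h2 hlt
          have m1 := Finset.mem_filter.1 h1
          have m2 := Finset.mem_filter.1 h2
          have u1 := (Finset.mem_filter.1 m1.1).1
          have u2 := (Finset.mem_filter.1 m2.1).1
          have := strong p' u1 p'' u2 hlt (by
            have b1 := hbound p' m1.1
            have b2 := hbound p'' m2.1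
            have e : tw p'.s * p'.l - tw p''.s * p''.l = (tw p.s * p.l - tw p''.s * p''.l)
              - (tw p.s * p.l - tw p'.s * p'.l) := by ring
            rw [e]
            refine (abs_sub _ _).trans ?_
            have := tw_le hlt.le
            nlinarith [tw_pos p''.s])
          exact Set.disjoint_left.1 this m2.2 (hU p' u1 m1.2)
        have hs : ∀ p' ∈ W, p'.s = w.s := fun p' hp' =>
          le_antisymm (not_lt.1 (hsc w hw p' hp')) (not_lt.1 (hsc p' hp' w hw))
        have := tile_sum_le W w.s hs (tw p.s * p.l / tw w.s) (2 * N0) (by positivity) (by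
          intro p' hp'
          have b1 := hbound p' (Finset.mem_filter.1 hp').1
          rw [hs p' hp'] at b1
          rw [abs_sub_comm, div_sub' (tw_ne _), abs_div, abs_of_pos (tw_pos w.s),
            div_le_iff₀ (tw_pos _)]
          exact b1) (fun _ => 1) (fun _ => zero_le_one)
        simp only [Finset.sum_const, nsmul_eq_mul, mul_one] at this
        have hc1 : (W.image Tile.q).card ≤ 1 := by
          rw [Finset.card_le_one]
          intro a ha b hb
          obtain ⟨x, hx, rfl⟩ := Finset.mem_image.1 ha
          obtain ⟨y, hy, rfl⟩ := Finset.mem_image.1 hb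
          have m1 := (Finset.mem_filter.1 hx).2
          have m2 := (Finset.mem_filter.1 hy).2
          have e1 : ⌊tw x.s * t⌋ = x.q := m1
          have e2 : ⌊tw y.s * t⌋ = y.q := m2
          rw [← e1, ← e2, hs x hx, hs y hy]
        have hc2 : ((W.image Tile.q).card : ℝ) ≤ 1 := by exact_mod_cast hc1
        nlinarith
    refine (Finset.sum_le_sum c1).trans ?_
    rw [← Finset.mul_sum, ← Finset.mul_sum, ← Finset.mul_sum]
    gcongr
    rw [hV, Finset.mul_sum, ← Finset.sum_fiberwise_of_maps_to (t := U.image tp) (g := tp)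
      (fun p hp => Finset.mem_image_of_mem _ hp)]
    refine Finset.sum_le_sum fun T _ => ?_
    have := tree_tail (U.filter (fun p => tp p = T)) T K hK
      (by intro p hp; have := Finset.mem_filter.1 hp; rw [← this.2]; exact hU p this.1)
      (by intro p hp; have := Finset.mem_filter.1 hp; rw [← this.2]; exact hl p this.1)
    refine le_trans (le_of_eq ?_) this
    refine Finset.sum_congr rfl fun p hp => ?_
    rw [(Finset.mem_filter.1 hp).2]
  have hC : 0 < besselC N0 K := by unfold besselC; positivity
  have hHH : ∫ t, wt s0 q0 t * ‖HH h (cf h F) U t‖ ^ 2 ≤ besselC N0 K * S := by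
    refine (HH_gram_split hN.le hh (cf h F) U s0 q0 hUJ).trans ?_
    have e : besselC N0 K * S = 128 * (4 * N0 + 1) * S +
      16 * (4 * S * (16 * ((4 * N0 + 1) * (256 * (2 * K + 1))))) := by unfold besselC; ring
    rw [e]
    have hV4 : σ ^ 2 * V ≤ 4 * S := by linarith
    gcongr
    refine hcross.trans ?_
    calc σ ^ 2 * (16 * ((4 * N0 + 1) * (256 * (2 * K + 1) * V)))
        = (σ ^ 2 * V) * (16 * ((4 * N0 + 1) * (256 * (2 * K + 1)))) := by ring
      _ ≤ _ := by gcongr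
  have hmain := sum_sq_le hh hF U s0 q0 hUJ (besselC N0 K) hC
  set Y := ∫ t, ‖F t‖ ^ 2 / wt s0 q0 t
  have hSY : S ≤ besselC N0 K * Y := by
    have h1 : 1 / (2 * besselC N0 K) * ∫ t, wt s0 q0 t * ‖HH h (cf h F) U t‖ ^ 2 ≤ S / 2 := by
      calc _ ≤ 1 / (2 * besselC N0 K) * (besselC N0 K * S) := by gcongr
        _ = S / 2 := by field_simp
    linarith
  rw [div_mul_eq_mul_div, le_div_iff₀ (by positivity)]
  nlinarith

/-! ### Tree selection -/

def lacT (η C4 ε : ℝ) (p : Tile) (T : TTop) : Prop :=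
  p.I ⊆ T.I ∧ η ≤ ε * (p.l - T.x / tw p.s) ∧ ε * (p.l - T.x / tw p.s) ≤ C4

def nearT (C4 : ℝ) (p : Tile) (T : TTop) : Prop :=
  p.I ⊆ T.I ∧ |(p.l : ℝ) - T.x / tw p.s| ≤ C4

def SparseT (N0 C4 : ℝ) (S : Finset Tile) : Prop :=
  ∀ p ∈ S, ∀ p' ∈ S, p.s < p'.s → C4 * tw p.s ≤ N0 * tw p'.s

def lacSum (η C4 ε : ℝ) (w : Tile → ℝ) (S : Finset Tile) (T : TTop) : ℝ :=
  ∑ p ∈ S with lacT η C4 ε p T, w p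

lemma lac_near {η C4 ε : ℝ} (hη : 0 ≤ η) (hε : ε = 1 ∨ ε = -1) {p : Tile} {T : TTop}
    (hl : lacT η C4 ε p T) : nearT C4 p T := by
  refine ⟨hl.1, ?_⟩
  have h1 := hl.2.1
  have h2 := hl.2.2
  rw [abs_le]
  rcases hε with rfl | rfl <;> constructor <;> linarith

lemma lacSum_mono {η C4 ε : ℝ} {w : Tile → ℝ} (hw : ∀ p, 0 ≤ w p) {S S' : Finset Tile}
    (hS : S ⊆ S') (T : TTop) : lacSum η C4 ε w S T ≤ lacSum η C4 ε w S' T := by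
  unfold lacSum
  exact Finset.sum_le_sum_of_subset_of_nonneg (Finset.filter_subset_filter _ hS) (fun p _ _ => hw p)

/-- a large top with maximal frequency -/
lemma exists_max_top {η C4 ε : ℝ} {w : Tile → ℝ} (hw : ∀ p, 0 ≤ w p)
    (hε : ε = 1 ∨ ε = -1) (θ : ℝ) (hθ : 0 < θ) (S : Finset Tile)
    (hex : ∃ T, θ * tw (-T.s) < lacSum η C4 ε w S T) :
    ∃ T0, θ * tw (-T0.s) < lacSum η C4 ε w S T0 ∧
      ∀ T, θ * tw (-T.s) < lacSum η C4 ε w S T → ε * T.x ≤ ε * T0.x := by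
  have hεε : ε * ε = 1 := by rcases hε with rfl | rfl <;> norm_num
  set f : Tile → ℝ := fun p => ε * (tw p.s * p.l) - η * tw p.s with hf
  -- every large top can be moved to a canonical one
  have hcan : ∀ T, θ * tw (-T.s) < lacSum η C4 ε w S T → ∃ T', θ * tw (-T'.s) < lacSum η C4 ε w S T' ∧
      ε * T.x ≤ ε * T'.x ∧ ε * T'.x ∈ S.image f := by
    intro T hT
    have hne : (S.filter (fun p => lacT η C4 ε p T)).Nonempty := by
      rw [Finset.nonempty_iff_ne_empty]
      intro he
      unfold lacSum at hT
      rw [he] at hT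
      have := tw_pos (-T.s)
      simp at hT
      nlinarith
    obtain ⟨p0, hp0, hmin⟩ := Finset.exists_min_image _ f hne
    refine ⟨⟨T.s, T.q, ε * f p0⟩, ?_, ?_, ?_⟩
    · refine hT.trans_le ?_
      unfold lacSum
      apply Finset.sum_le_sum_of_subset_of_nonneg
      · intro p hp
        have hp' := Finset.mem_filter.1 hp
        refine Finset.mem_filter.2 ⟨hp'.1, hp'.2.1, ?_, ?_⟩
        · have h1 := hmin p hp
          have hr := tw_pos p.s
          have e : ε * (p.l - ε * f p0 / tw p.s) = (ε * (tw p.s * p.l) - (ε * ε) * f p0) / tw p.s := by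
            field_simp
          simp only
          rw [e, hεε, le_div_iff₀ hr]
          simp only [hf] at h1 ⊢
          linarith
        · have h1 := (Finset.mem_filter.1 hp0).2.2.1
          have hr := tw_pos p.s
          have hr0 := tw_pos p0.s
          have h3 : ε * T.x ≤ f p0 := by
            have e : ε * (p0.l - T.x / tw p0.s) = (ε * (tw p0.s * p0.l) - ε * T.x) / tw p0.s := by
              field_simp
            rw [e, le_div_iff₀ hr0] at h1
            simp only [hf]; linarith
          refine le_trans ?_ hp'.2.2.2
          have e : ε * (p.l - ε * f p0 / tw p.s) = (ε * (tw p.s * p.l) - (ε * ε) * f p0) / tw p.s := by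
            field_simp
          have e' : ε * (p.l - T.x / tw p.s) = (ε * (tw p.s * p.l) - ε * T.x) / tw p.s := by
            field_simp
          simp only
          rw [e, e', hεε]
          exact div_le_div_of_nonneg_right (by linarith) hr.le
      · intro p _ _; exact hw p
    · have h1 := (Finset.mem_filter.1 hp0).2.2.1
      have hr0 := tw_pos p0.s
      have e : ε * (p0.l - T.x / tw p0.s) = (ε * (tw p0.s * p0.l) - ε * T.x) / tw p0.s := by
        field_simp
      rw [e, le_div_iff₀ hr0] at h1
      simp only
      rw [← mul_assoc, hεε]
      simp only [hf]; linarith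
    · simp only
      rw [← mul_assoc, hεε, one_mul]
      exact Finset.mem_image_of_mem _ (Finset.mem_filter.1 hp0).1
  set X := (S.image f).filter (fun y => ∃ T, θ * tw (-T.s) < lacSum η C4 ε w S T ∧ ε * T.x = y)
  have hX : X.Nonempty := by
    obtain ⟨T, hT⟩ := hex
    obtain ⟨T', h1, h2, h3⟩ := hcan T hT
    exact ⟨_, Finset.mem_filter.2 ⟨h3, T', h1, rfl⟩⟩
  obtain ⟨y, hy, hmax⟩ := Finset.exists_max_image X id hX
  obtain ⟨T0, hT0, rfl⟩ := (Finset.mem_filter.1 hy).2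
  refine ⟨T0, hT0, fun T hT => ?_⟩
  obtain ⟨T', h1, h2, h3⟩ := hcan T hT
  exact h2.trans (hmax _ (Finset.mem_filter.2 ⟨h3, T', h1, rfl⟩))

lemma selection {N0 C4 ε : ℝ} (hN : 0 < N0) (hC4 : 8 * N0 ≤ C4) {w : Tile → ℝ} (hw : ∀ p, 0 ≤ w p)
    (hε : ε = 1 ∨ ε = -1) (θ : ℝ) (hθ : 0 < θ) (S : Finset Tile) : SparseT N0 C4 S →
    ∃ (U : Finset Tile) (tp : Tile → TTop) (S' : Finset Tile), U ⊆ S ∧ S' ⊆ S ∧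
      (∀ p ∈ U, lacT (8 * N0) C4 ε p (tp p)) ∧
      (∀ T ∈ U.image tp, θ * tw (-T.s) ≤ ∑ p ∈ U with tp p = T, w p) ∧
      (∀ p ∈ U, ∀ p' ∈ U, p.s < p'.s →
        |tw p.s * p.l - tw p'.s * p'.l| ≤ 6 * N0 * tw p'.s → Disjoint p'.I (tp p).I) ∧
      (∀ p ∈ S, p ∉ S' → ∃ T ∈ U.image tp, nearT C4 p T) ∧
      (∀ T, lacSum (8 * N0) C4 ε w S' T ≤ θ * tw (-T.s)) ∧
      (∀ p ∈ U, θ * tw (-(tp p).s) < lacSum (8 * N0) C4 ε w S (tp p)) := by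
  induction S using Finset.strongInduction with
  | H S ih =>
  intro hsp
  by_cases hex : ∃ T, θ * tw (-T.s) < lacSum (8 * N0) C4 ε w S T
  swap
  · push Not at hex
    refine ⟨∅, fun _ => ⟨0, 0, 0⟩, S, by simp, by simp, by simp, by simp, by simp, ?_, hex, by simp⟩
    intro p hp hp'; exact absurd hp hp'
  obtain ⟨T0, hT0, hmax⟩ := exists_max_top hw hε θ hθ S hex
  set S1 := S.filter (fun p => ¬ nearT C4 p T0) with hS1
  set U0 := S.filter (fun p => lacT (8 * N0) C4 ε p T0) with hU0
  have hη : 0 ≤ 8 * N0 := by positivity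
  have hU0ne : U0.Nonempty := by
    rw [Finset.nonempty_iff_ne_empty]
    intro he
    unfold lacSum at hT0
    rw [← hU0, he] at hT0
    have := tw_pos (-T0.s)
    simp at hT0
    nlinarith
  have hss : S1 ⊂ S := by
    refine Finset.filter_ssubset.2 ?_
    obtain ⟨p, hp⟩ := hU0ne
    refine ⟨p, (Finset.mem_filter.1 hp).1, ?_⟩
    exact not_not.2 (lac_near hη hε (Finset.mem_filter.1 hp).2)
  obtain ⟨U1, tp1, S', hU1S, hS'S, a1, a2, a3, a4, a5, a6⟩ := ih S1 hss
    (fun p hp p' hp' => hsp p (hss.1 hp) p' (hss.1 hp'))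
  have hdis : ∀ p ∈ U1, p ∉ U0 := by
    intro p hp hp0
    exact (Finset.mem_filter.1 (hU1S hp)).2 (lac_near hη hε (Finset.mem_filter.1 hp0).2)
  set tp : Tile → TTop := fun p => if p ∈ U0 then T0 else tp1 p with htp
  have tp0 : ∀ p ∈ U0, tp p = T0 := fun p hp => by simp [htp, hp]
  have tp1' : ∀ p ∈ U1, tp p = tp1 p := fun p hp => by simp [htp, hdis p hp]
  have himg : ∀ T, T ∈ (U0 ∪ U1).image tp → T = T0 ∨ T ∈ U1.image tp1 := by
    intro T hT
    obtain ⟨p, hp, rfl⟩ := Finset.mem_image.1 hT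
    rcases Finset.mem_union.1 hp with hp | hp
    · left; exact tp0 p hp
    · right; rw [tp1' p hp]; exact Finset.mem_image_of_mem _ hp
  have himg1 : ∀ T ∈ U1.image tp1, T ∈ (U0 ∪ U1).image tp := by
    intro T hT
    obtain ⟨p, hp, rfl⟩ := Finset.mem_image.1 hT
    exact Finset.mem_image.2 ⟨p, Finset.mem_union_right _ hp, tp1' p hp⟩
  refine ⟨U0 ∪ U1, tp, S', ?_, hS'S.trans hss.1, ?_, ?_, ?_, ?_, a5, ?_⟩
  · exact Finset.union_subset (Finset.filter_subset _ _) (hU1S.trans hss.1)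
  · intro p hp
    rcases Finset.mem_union.1 hp with hp | hp
    · rw [tp0 p hp]; exact (Finset.mem_filter.1 hp).2
    · rw [tp1' p hp]; exact a1 p hp
  · intro T hT
    rcases himg T hT with rfl | hT
    · refine hT0.le.trans ?_
      unfold lacSum
      apply Finset.sum_le_sum_of_subset_of_nonneg
      · intro p hp
        exact Finset.mem_filter.2 ⟨Finset.mem_union_left _ hp, tp0 p hp⟩
      · intro p _ _; exact hw p
    · refine (a2 T hT).trans ?_
      apply Finset.sum_le_sum_of_subset_of_nonneg
      · intro p hp
        have := Finset.mem_filter.1 hp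
        exact Finset.mem_filter.2 ⟨Finset.mem_union_right _ this.1, (tp1' p this.1).trans this.2⟩
      · intro p _ _; exact hw p
  · intro p hp p' hp' hs hclose
    have hεε : ε * ε = 1 := by rcases hε with rfl | rfl <;> norm_num
    have hpS : p ∈ S := by
      rcases Finset.mem_union.1 hp with hp | hp
      · exact (Finset.mem_filter.1 hp).1
      · exact hss.1 (hU1S hp)
    have hpS' : p' ∈ S := by
      rcases Finset.mem_union.1 hp' with hp | hp
      · exact (Finset.mem_filter.1 hp).1
      · exact hss.1 (hU1S hp)
    have hlac : lacT (8 * N0) C4 ε p (tp p) := by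
      rcases Finset.mem_union.1 hp with hp | hp
      · rw [tp0 p hp]; exact (Finset.mem_filter.1 hp).2
      · rw [tp1' p hp]; exact a1 p hp
    have hlac' : lacT (8 * N0) C4 ε p' (tp p') := by
      rcases Finset.mem_union.1 hp' with hp | hp
      · rw [tp0 p' hp]; exact (Finset.mem_filter.1 hp).2
      · rw [tp1' p' hp]; exact a1 p' hp
    have hr := tw_pos p.s
    have hr' := tw_pos p'.s
    have hsparse := hsp p hpS p' hpS' hs
    -- numeric consequences
    have n1 : ε * (tw p.s * p.l) - ε * (tp p).x ≤ C4 * tw p.s := by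
      have := hlac.2.2
      have e : ε * (p.l - (tp p).x / tw p.s) = (ε * (tw p.s * p.l) - ε * (tp p).x) / tw p.s := by
        field_simp
      rwa [e, div_le_iff₀ hr] at this
    have n2 : 8 * N0 * tw p'.s ≤ ε * (tw p'.s * p'.l) - ε * (tp p').x := by
      have := hlac'.2.1
      have e : ε * (p'.l - (tp p').x / tw p'.s) = (ε * (tw p'.s * p'.l) - ε * (tp p').x) / tw p'.s := by
        field_simp
      rwa [e, le_div_iff₀ hr'] at this
    have n3 : ε * (tw p'.s * p'.l) - ε * (tw p.s * p.l) ≤ 6 * N0 * tw p'.s := by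
      have := abs_le.1 hclose
      rcases hε with rfl | rfl <;> linarith [this.1, this.2]
    have n4 : ε * (tp p').x < ε * (tp p).x := by
      have : 0 < N0 * tw p'.s := by positivity
      linarith
    rcases Finset.mem_union.1 hp with hp | hp
    · rcases Finset.mem_union.1 hp' with hp' | hp'
      · rw [tp0 p hp, tp0 p' hp'] at n4; exact absurd n4 (lt_irrefl _)
      · rw [tp0 p hp]
        by_contra hnd
        have hsub : p'.I ⊆ T0.I := by
          apply dI_nested _ hnd
          have : T0.s ≤ p.s := dI_subset_scale (Finset.mem_filter.1 hp).2.1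
          omega
        refine (Finset.mem_filter.1 (hU1S hp')).2 ⟨hsub, ?_⟩
        have hnp := (lac_near hη hε (Finset.mem_filter.1 hp).2).2
        have m1 : |tw p.s * p.l - T0.x| ≤ C4 * tw p.s := by
          have e : (p.l : ℝ) - T0.x / tw p.s = (tw p.s * p.l - T0.x) / tw p.s := by field_simp
          rwa [e, abs_div, abs_of_pos hr, div_le_iff₀ hr] at hnp
        have e : (p'.l : ℝ) - T0.x / tw p'.s = (tw p'.s * p'.l - T0.x) / tw p'.s := by field_simp
        rw [e, abs_div, abs_of_pos hr', div_le_iff₀ hr']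
        have e2 : tw p'.s * p'.l - T0.x = (tw p.s * p.l - T0.x) - (tw p.s * p.l - tw p'.s * p'.l) := by
          ring
        rw [e2]
        refine (abs_sub _ _).trans ?_
        have := mul_le_mul_of_nonneg_right hC4 hr'.le
        have : 0 < N0 * tw p'.s := by positivity
        linarith
    · rcases Finset.mem_union.1 hp' with hp' | hp'
      · exfalso
        rw [tp0 p' hp', tp1' p hp] at n4
        have := hmax (tp1 p) ((a6 p hp).trans_le (lacSum_mono hw hss.1 _))
        linarith
      · rw [tp1' p hp]
        exact a3 p hp p' hp' hs hclose
  · intro p hp hp'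
    by_cases hn : nearT C4 p T0
    · obtain ⟨p0, hp0⟩ := hU0ne
      refine ⟨T0, Finset.mem_image.2 ⟨p0, Finset.mem_union_left _ hp0, tp0 p0 hp0⟩, hn⟩
    · obtain ⟨T, hT, hTn⟩ := a4 p (Finset.mem_filter.2 ⟨hp, hn⟩) hp'
      exact ⟨T, himg1 T hT, hTn⟩
  · intro p hp
    rcases Finset.mem_union.1 hp with hp | hp
    · rw [tp0 p hp]; exact hT0
    · rw [tp1' p hp]; exact (a6 p hp).trans_le (lacSum_mono hw hss.1 _)

def SizeLE (N0 C4 : ℝ) (A : Tile → ℝ) (S : Finset Tile) (σ : ℝ) : Prop :=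
  ∀ (T : TTop) (ε : ℝ), (ε = 1 ∨ ε = -1) →
    lacSum (8 * N0) C4 ε (fun p => tw (-p.s) * A p ^ 2) S T ≤ σ ^ 2 * tw (-T.s)

lemma SizeLE.single {N0 C4 : ℝ} {A : Tile → ℝ} {S : Finset Tile} {σ : ℝ} (hσ : 0 ≤ σ)
    (hC4 : 8 * N0 ≤ C4) (hS : SizeLE N0 C4 A S σ) {p : Tile} (hp : p ∈ S) : A p ≤ σ := by
  have := hS ⟨p.s, p.q, tw p.s * (p.l - 8 * N0)⟩ 1 (Or.inl rfl)
  unfold lacSum at this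
  have h2 : tw (-p.s) * A p ^ 2 ≤ ∑ p' ∈ S with lacT (8 * N0) C4 1 p'
      ⟨p.s, p.q, tw p.s * (p.l - 8 * N0)⟩, tw (-p'.s) * A p' ^ 2 := by
    apply Finset.single_le_sum (f := fun p' : Tile => tw (-p'.s) * A p' ^ 2)
    · intro i _; have := tw_pos (-i.s); positivity
    · refine Finset.mem_filter.2 ⟨hp, subset_rfl, ?_, ?_⟩
      · simp only; rw [mul_div_cancel_left₀ _ (tw_ne _)]; linarith
      · simp only; rw [mul_div_cancel_left₀ _ (tw_ne _)]; linarith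
  have h3 := h2.trans this
  simp only at h3
  have ht := tw_pos (-p.s)
  have h4 : A p ^ 2 ≤ σ ^ 2 := by
    rw [mul_comm] at h3; exact le_of_mul_le_mul_right h3 ht
  exact le_of_sq_le_sq h4 hσ

lemma SizeLE.mono {N0 C4 : ℝ} {A : Tile → ℝ} {S S' : Finset Tile} {σ : ℝ}
    (hS : SizeLE N0 C4 A S σ) (hss : S' ⊆ S) : SizeLE N0 C4 A S' σ := by
  intro T ε hε
  exact (lacSum_mono (fun p => by have := tw_pos (-p.s); positivity) hss T).trans (hS T ε hε)

section levels
variable {N0 C4 : ℝ} {h : ℝ → ℂ} {F : ℝ → ℂ}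

/-- one sign of the selection together with the packing estimate -/
lemma select_sign (hN : 0 < N0) (hC4 : 8 * N0 ≤ C4) (hh : Good N0 h) (hF : FOK F)
    {ε : ℝ} (hε : ε = 1 ∨ ε = -1) (S : Finset Tile) (hsp : SparseT N0 C4 S) (σ : ℝ) (hσ : 0 < σ)
    (hS : SizeLE N0 C4 (fun p => ‖cf h F p‖) S σ) :
    ∃ (S' : Finset Tile) (FF : Finset TTop), S' ⊆ S ∧
      (∀ T, lacSum (8 * N0) C4 ε (fun p => tw (-p.s) * ‖cf h F p‖ ^ 2) S' T ≤ σ ^ 2 / 4 * tw (-T.s)) ∧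
      (∀ p ∈ S, p ∉ S' → ∃ T ∈ FF, nearT C4 p T) ∧
      (∀ T ∈ FF, ∃ p ∈ S, p.I ⊆ T.I) ∧
      (∀ s0 q0, ∑ T ∈ FF with T.I ⊆ dI s0 q0, tw (-T.s) ≤
        4 * besselC N0 C4 / σ ^ 2 * ∫ t, ‖F t‖ ^ 2 / wt s0 q0 t) := by
  obtain ⟨U, tp, S', hUS, hS'S, a1, a2, a3, a4, a5, a6⟩ := selection (ε := ε) hN hC4
    (w := fun p => tw (-p.s) * ‖cf h F p‖ ^ 2) (fun p => by have := tw_pos (-p.s); positivity)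
    hε (σ ^ 2 / 4) (by positivity) S hsp
  refine ⟨S', U.image tp, hS'S, a5, a4, ?_, ?_⟩
  · intro T hT
    obtain ⟨p, hp, rfl⟩ := Finset.mem_image.1 hT
    exact ⟨p, hUS hp, (a1 p hp).1⟩
  · intro s0 q0
    set U' := U.filter (fun p => (tp p).I ⊆ dI s0 q0) with hU'
    have himg : (U.image tp).filter (fun T => T.I ⊆ dI s0 q0) = U'.image tp := by
      rw [Finset.filter_image]
    rw [himg]
    have hsub : U' ⊆ U := Finset.filter_subset _ _
    apply bessel hN (by linarith) hh hF U' tp s0 q0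
    · intro p hp; exact (a1 p (hsub hp)).1
    · intro p hp; exact (lac_near (by positivity) hε (a1 p (hsub hp))).2
    · intro p hp; exact (Finset.mem_filter.1 hp).2
    · intro p hp p' hp'; exact a3 p (hsub hp) p' (hsub hp')
    · exact hσ
    · intro p hp; exact hS.single hσ.le hC4 (hUS (hsub hp))
    · intro T hT
      obtain ⟨p, hp, rfl⟩ := Finset.mem_image.1 hT
      refine (a2 (tp p) (Finset.mem_image_of_mem _ (hsub hp))).trans (le_of_eq ?_)
      refine Finset.sum_congr ?_ (fun _ _ => rfl)
      ext p'
      simp only [hU', Finset.mem_filter]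
      constructor
      · rintro ⟨h1, h2⟩
        refine ⟨⟨h1, ?_⟩, h2⟩
        rw [h2]; exact (Finset.mem_filter.1 hp).2
      · rintro ⟨⟨h1, _⟩, h2⟩; exact ⟨h1, h2⟩

lemma select_step (hN : 0 < N0) (hC4 : 8 * N0 ≤ C4) (hh : Good N0 h) (hF : FOK F)
    (S : Finset Tile) (hsp : SparseT N0 C4 S) (σ : ℝ) (hσ : 0 < σ)
    (hS : SizeLE N0 C4 (fun p => ‖cf h F p‖) S σ) :
    ∃ (S' : Finset Tile) (FF : Finset TTop), S' ⊆ S ∧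
      SizeLE N0 C4 (fun p => ‖cf h F p‖) S' (σ / 2) ∧
      (∀ p ∈ S, p ∉ S' → ∃ T ∈ FF, nearT C4 p T) ∧
      (∀ T ∈ FF, ∃ p ∈ S, p.I ⊆ T.I) ∧
      (∀ s0 q0, ∑ T ∈ FF with T.I ⊆ dI s0 q0, tw (-T.s) ≤
        8 * besselC N0 C4 / σ ^ 2 * ∫ t, ‖F t‖ ^ 2 / wt s0 q0 t) := by
  obtain ⟨S1, F1, b1, b2, b3, b4, b5⟩ := select_sign hN hC4 hh hF (ε := 1) (Or.inl rfl) S hsp σ hσ hS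
  obtain ⟨S2, F2, c1, c2, c3, c4, c5⟩ := select_sign hN hC4 hh hF (ε := -1) (Or.inr rfl) S1
    (fun p hp p' hp' => hsp p (b1 hp) p' (b1 hp')) σ hσ (hS.mono b1)
  refine ⟨S2, F1 ∪ F2, c1.trans b1, ?_, ?_, ?_, ?_⟩
  · intro T ε hε
    have e : (σ / 2) ^ 2 = σ ^ 2 / 4 := by ring
    rw [e]
    rcases hε with rfl | rfl
    · exact (lacSum_mono (fun p => by have := tw_pos (-p.s); positivity) c1 T).trans (b2 T)
    · exact c2 T
  · intro p hp hp2
    by_cases hp1 : p ∈ S1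
    · obtain ⟨T, hT, hn⟩ := c3 p hp1 hp2
      exact ⟨T, Finset.mem_union_right _ hT, hn⟩
    · obtain ⟨T, hT, hn⟩ := b3 p hp hp1
      exact ⟨T, Finset.mem_union_left _ hT, hn⟩
  · intro T hT
    rcases Finset.mem_union.1 hT with hT | hT
    · exact b4 T hT
    · obtain ⟨p, hp, hp'⟩ := c4 T hT
      exact ⟨p, b1 hp, hp'⟩
  · intro s0 q0
    have h1 : ∑ T ∈ F1 ∪ F2 with T.I ⊆ dI s0 q0, tw (-T.s) ≤
        ∑ T ∈ F1 with T.I ⊆ dI s0 q0, tw (-T.s) + ∑ T ∈ F2 with T.I ⊆ dI s0 q0, tw (-T.s) := by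
      rw [Finset.filter_union, ← Finset.sum_union_inter]
      have : 0 ≤ ∑ T ∈ (F1.filter (fun T => T.I ⊆ dI s0 q0)) ∩ (F2.filter (fun T => T.I ⊆ dI s0 q0)),
        tw (-T.s) := Finset.sum_nonneg fun T _ => (tw_pos _).le
      linarith
    have h2 := b5 s0 q0
    have h3 := c5 s0 q0
    refine h1.trans ((add_le_add h2 h3).trans (le_of_eq ?_))
    ring

lemma levels (hN : 0 < N0) (hC4 : 8 * N0 ≤ C4) (hh : Good N0 h) (hF : FOK F)
    (S : Finset Tile) (hsp : SparseT N0 C4 S) (σ : ℝ) (hσ : 0 < σ)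
    (hS : SizeLE N0 C4 (fun p => ‖cf h F p‖) S σ) :
    ∃ (Sm : ℕ → Finset Tile) (FF : ℕ → Finset TTop), Sm 0 = S ∧ (∀ m, Sm m ⊆ S) ∧
      (∀ m, SizeLE N0 C4 (fun p => ‖cf h F p‖) (Sm m) (σ / 2 ^ m)) ∧
      (∀ m, ∀ p ∈ Sm m, p ∉ Sm (m + 1) → ∃ T ∈ FF m, nearT C4 p T) ∧
      (∀ m, ∀ T ∈ FF m, ∃ p ∈ S, p.I ⊆ T.I) ∧
      (∀ m s0 q0, ∑ T ∈ FF m with T.I ⊆ dI s0 q0, tw (-T.s) ≤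
        8 * besselC N0 C4 * 4 ^ m / σ ^ 2 * ∫ t, ‖F t‖ ^ 2 / wt s0 q0 t) := by
  have step : ∀ m : ℕ, ∀ X : {X : Finset Tile // X ⊆ S ∧
      SizeLE N0 C4 (fun p => ‖cf h F p‖) X (σ / 2 ^ m)},
      ∃ (Y : {X : Finset Tile // X ⊆ S ∧
      SizeLE N0 C4 (fun p => ‖cf h F p‖) X (σ / 2 ^ (m + 1))}) (FF : Finset TTop),
      (∀ p ∈ X.1, p ∉ Y.1 → ∃ T ∈ FF, nearT C4 p T) ∧
      (∀ T ∈ FF, ∃ p ∈ S, p.I ⊆ T.I) ∧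
      (∀ s0 q0, ∑ T ∈ FF with T.I ⊆ dI s0 q0, tw (-T.s) ≤
        8 * besselC N0 C4 * 4 ^ m / σ ^ 2 * ∫ t, ‖F t‖ ^ 2 / wt s0 q0 t) := by
    rintro m ⟨X, hX, hXs⟩
    obtain ⟨Y, FF, d1, d2, d3, d4, d5⟩ := select_step hN hC4 hh hF X
      (fun p hp p' hp' => hsp p (hX hp) p' (hX hp')) (σ / 2 ^ m) (by positivity) hXs
    refine ⟨⟨Y, d1.trans hX, ?_⟩, FF, d3, ?_, ?_⟩
    · have : σ / 2 ^ (m + 1) = σ / 2 ^ m / 2 := by rw [pow_succ]; field_simp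
      rw [this]; exact d2
    · intro T hT; obtain ⟨p, hp, h'⟩ := d4 T hT; exact ⟨p, hX hp, h'⟩
    · intro s0 q0
      refine (d5 s0 q0).trans (le_of_eq ?_)
      congr 1
      have e4 : (4 : ℝ) ^ m = 2 ^ m * 2 ^ m := by rw [← mul_pow]; norm_num
      rw [e4]; field_simp
  choose nxt ff hff using step
  let seq : (m : ℕ) → {X : Finset Tile // X ⊆ S ∧
      SizeLE N0 C4 (fun p => ‖cf h F p‖) X (σ / 2 ^ m)} :=
    fun m => Nat.rec ⟨S, subset_rfl, by simpa using hS⟩ (fun m X => nxt m X) m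
  refine ⟨fun m => (seq m).1, fun m => ff m (seq m), rfl, fun m => (seq m).2.1,
    fun m => (seq m).2.2, fun m => (hff m (seq m)).1, fun m => (hff m (seq m)).2.1,
    fun m => (hff m (seq m)).2.2⟩

end levels

/-! ### Density and the size estimate -/

def Dens (F : ℝ → ℂ) (Ω : Set ℝ) (D : ℝ) : Prop :=
  ∀ x, x ∉ Ω → ∀ R : ℝ, 0 < R → ∫ t in Metric.closedBall x R, ‖F t‖ ≤ D * R

lemma rho_sq_dyadic (v : ℝ) (N : ℕ) : rho v ^ 2 ≤
    ∑ k ∈ Finset.range N, 4 * (1 / 4 : ℝ) ^ k * (if |v| ≤ 2 ^ k then 1 else 0) + 4 * (1 / 4 : ℝ) ^ N := by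
  induction N with
  | zero =>
    have h1 := rho_le_one v
    have h0 := rho_nonneg v
    simp
    nlinarith
  | succ N ih =>
    rw [Finset.sum_range_succ]
    by_cases hv : |v| ≤ 2 ^ N
    · rw [if_pos hv]
      have : (0:ℝ) ≤ 4 * (1 / 4 : ℝ) ^ (N + 1) := by positivity
      linarith
    · rw [if_neg hv]
      push Not at hv
      have h1 : rho v ^ 2 ≤ 4 * (1 / 4 : ℝ) ^ (N + 1) := by
        have e : 4 * (1 / 4 : ℝ) ^ (N + 1) = ((2 ^ N : ℝ)⁻¹) ^ 2 := by
          rw [pow_succ, inv_pow, ← pow_mul, mul_comm N 2, pow_mul]; norm_num; rw [one_div, inv_pow]; ring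
        rw [e]
        apply pow_le_pow_left₀ (rho_nonneg _)
        unfold rho
        apply inv_anti₀ (by positivity)
        linarith
      have : (0:ℝ) ≤ ∑ k ∈ Finset.range N, 4 * (1 / 4 : ℝ) ^ k * (if |v| ≤ 2 ^ k then 1 else 0) := by
        apply Finset.sum_nonneg; intro k _; split_ifs <;> positivity
      linarith

lemma F_rho_integrable {F : ℝ → ℂ} (hF : FOK F) (r b : ℝ) (k : ℕ) :
    Integrable (fun t => ‖F t‖ * rho (r * t - b) ^ k) := by
  refine hF.int.norm.mono' ?_ (Filter.Eventually.of_forall fun t => ?_)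
  · exact hF.int.norm.aestronglyMeasurable.mul
      ((rho_continuous.comp (by fun_prop)).pow k).aestronglyMeasurable
  · have := rho_nonneg (r * t - b)
    rw [Real.norm_of_nonneg (by positivity)]
    exact mul_le_of_le_one_right (norm_nonneg _) (pow_le_one₀ this (rho_le_one _))

lemma dens_rho {F : ℝ → ℂ} (hF : FOK F) {Ω : Set ℝ} {D : ℝ} (hD : Dens F Ω D) {x : ℝ} (hx : x ∉ Ω)
    {r : ℝ} (hr : 0 < r) : ∫ t, ‖F t‖ * rho (r * t - r * x) ^ 2 ≤ 8 * D / r := by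
  have hD0 : 0 ≤ D := by
    have := hD x hx 1 one_pos
    have h2 : 0 ≤ ∫ t in Metric.closedBall x 1, ‖F t‖ := integral_nonneg fun t => norm_nonneg _
    linarith
  have key : ∀ N : ℕ, ∫ t, ‖F t‖ * rho (r * t - r * x) ^ 2 ≤
      8 * D / r + (4 * ∫ t, ‖F t‖) * (1 / 4 : ℝ) ^ N := by
    intro N
    have hset : ∀ k : ℕ, ∀ t, ‖F t‖ * (if |r * t - r * x| ≤ 2 ^ k then (1 : ℝ) else 0) =
        (Metric.closedBall x (2 ^ k / r)).indicator (fun t => ‖F t‖) t := by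
      intro k t
      rw [Set.indicator_apply]
      have : |r * t - r * x| ≤ 2 ^ k ↔ t ∈ Metric.closedBall x (2 ^ k / r) := by
        rw [Metric.mem_closedBall, Real.dist_eq, le_div_iff₀ hr, ← mul_sub, abs_mul, abs_of_pos hr,
          mul_comm]
      simp only [this]
      split_ifs <;> simp
    calc ∫ t, ‖F t‖ * rho (r * t - r * x) ^ 2
        ≤ ∫ t, (∑ k ∈ Finset.range N, 4 * (1 / 4 : ℝ) ^ k *
            (Metric.closedBall x (2 ^ k / r)).indicator (fun t => ‖F t‖) t
            + 4 * (1 / 4 : ℝ) ^ N * ‖F t‖) := by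
          apply integral_mono (F_rho_integrable hF _ _ _)
          · apply Integrable.add
            · refine integrable_finsetSum _ fun k _ => ?_
              exact (hF.int.norm.indicator Metric.isClosed_closedBall.measurableSet).const_mul _
            · exact hF.int.norm.const_mul _
          · intro t
            have h1 := mul_le_mul_of_nonneg_left (rho_sq_dyadic (r * t - r * x) N) (norm_nonneg (F t))
            refine h1.trans (le_of_eq ?_)
            rw [mul_add, Finset.mul_sum]
            congr 1
            · refine Finset.sum_congr rfl fun k _ => ?_
              rw [← hset]; ring
            · ring
      _ = ∑ k ∈ Finset.range N, 4 * (1 / 4 : ℝ) ^ k *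
            (∫ t in Metric.closedBall x (2 ^ k / r), ‖F t‖) + 4 * (1 / 4 : ℝ) ^ N * ∫ t, ‖F t‖ := by
          rw [integral_add, integral_finsetSum, integral_const_mul]
          · congr 1
            refine Finset.sum_congr rfl fun k _ => ?_
            rw [integral_const_mul, integral_indicator Metric.isClosed_closedBall.measurableSet]
          · intro k _
            exact (hF.int.norm.indicator Metric.isClosed_closedBall.measurableSet).const_mul _
          · refine integrable_finsetSum _ fun k _ => ?_
            exact (hF.int.norm.indicator Metric.isClosed_closedBall.measurableSet).const_mul _
          · exact hF.int.norm.const_mul _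
      _ ≤ ∑ k ∈ Finset.range N, 4 * (1 / 4 : ℝ) ^ k * (D * (2 ^ k / r)) +
            4 * (1 / 4 : ℝ) ^ N * ∫ t, ‖F t‖ := by
          gcongr with k _
          exact hD x hx _ (by positivity)
      _ = 4 * D / r * (∑ k ∈ Finset.range N, (1 / 2 : ℝ) ^ k) + (4 * ∫ t, ‖F t‖) * (1 / 4 : ℝ) ^ N := by
          rw [Finset.mul_sum]
          congr 1
          · refine Finset.sum_congr rfl fun k _ => ?_
            have : (1 / 4 : ℝ) ^ k * 2 ^ k = (1 / 2) ^ k := by rw [← mul_pow]; norm_num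
            rw [← this]; field_simp
          · ring
      _ ≤ 4 * D / r * 2 + (4 * ∫ t, ‖F t‖) * (1 / 4 : ℝ) ^ N := by
          gcongr
          exact sum_geometric_two_le N
      _ = _ := by ring
  have hlim : Filter.Tendsto (fun N : ℕ => 8 * D / r + (4 * ∫ t, ‖F t‖) * (1 / 4 : ℝ) ^ N)
      Filter.atTop (nhds (8 * D / r + (4 * ∫ t, ‖F t‖) * 0)) := by
    apply Filter.Tendsto.const_add
    apply Filter.Tendsto.const_mul
    exact tendsto_pow_atTop_nhds_zero_of_lt_one (by norm_num) (by norm_num)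
  rw [mul_zero, add_zero] at hlim
  exact ge_of_tendsto' hlim key

lemma dens_rho' {F : ℝ → ℂ} (hF : FOK F) {Ω : Set ℝ} {D : ℝ} (hD : Dens F Ω D) {x : ℝ} (hx : x ∉ Ω)
    {r : ℝ} (hr : 0 < r) {b c : ℝ} (hc : 0 ≤ c) (hxb : |r * x - b| ≤ c) :
    ∫ t, ‖F t‖ * rho (r * t - b) ^ 2 ≤ (1 + c) ^ 2 * (8 * D / r) := by
  have h1 : ∀ t, rho (r * t - b) ≤ (1 + c) * rho (r * t - r * x) := by
    intro t
    apply rho_le_mul (by positivity)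
    have : |r * t - r * x| ≤ |r * t - b| + c := by
      have e : r * t - r * x = (r * t - b) - (r * x - b) := by ring
      rw [e]; refine (abs_sub _ _).trans ?_; linarith
    nlinarith [abs_nonneg (r * t - b)]
  calc _ ≤ ∫ t, (1 + c) ^ 2 * (‖F t‖ * rho (r * t - r * x) ^ 2) := by
        apply integral_mono (F_rho_integrable hF _ _ _) ((F_rho_integrable hF _ _ _).const_mul _)
        intro t
        have := pow_le_pow_left₀ (rho_nonneg _) (h1 t) 2
        have := mul_le_mul_of_nonneg_left this (norm_nonneg (F t))
        refine this.trans (le_of_eq ?_); ring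
    _ = (1 + c) ^ 2 * ∫ t, ‖F t‖ * rho (r * t - r * x) ^ 2 := integral_const_mul _ _
    _ ≤ _ := by gcongr; exact dens_rho hF hD hx hr

def NearO (Ω : Set ℝ) (p : Tile) : Prop := ∃ x, x ∉ Ω ∧ |tw p.s * x - p.q| ≤ 2

lemma Dens.nonneg {F : ℝ → ℂ} {Ω : Set ℝ} {D : ℝ} (hD : Dens F Ω D) {x : ℝ} (hx : x ∉ Ω) : 0 ≤ D := by
  have := hD x hx 1 one_pos
  have h2 : 0 ≤ ∫ t in Metric.closedBall x 1, ‖F t‖ := integral_nonneg fun t => norm_nonneg _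
  linarith

lemma cf_le_int {N0 : ℝ} {h : ℝ → ℂ} (hh : Good N0 h) {F : ℝ → ℂ} (hF : FOK F) (p : Tile) :
    ‖cf h F p‖ ≤ tw p.s * ∫ t, ‖F t‖ * rho (tw p.s * t - p.q) ^ 2 := by
  unfold cf
  rw [norm_mul, Complex.norm_real, Real.norm_of_nonneg (tw_pos _).le]
  refine mul_le_mul_of_nonneg_left ?_ (tw_pos _).le
  refine norm_integral_le_of_norm_le (F_rho_integrable hF _ _ _) (Filter.Eventually.of_forall fun t => ?_)
  rw [norm_mul, RCLike.norm_conj]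
  gcongr
  exact (pk_le hh p t).trans (rho_pow_le (by norm_num))

lemma cf_le_dens {N0 : ℝ} {h : ℝ → ℂ} (hh : Good N0 h) {F : ℝ → ℂ} (hF : FOK F) {Ω : Set ℝ} {D : ℝ}
    (hD : Dens F Ω D) {p : Tile} (hp : NearO Ω p) : ‖cf h F p‖ ≤ 72 * D := by
  obtain ⟨x, hx, hxp⟩ := hp
  have h1 := dens_rho' hF hD hx (tw_pos p.s) (by norm_num : (0:ℝ) ≤ 2) hxp
  refine (cf_le_int hh hF p).trans ?_
  calc _ ≤ tw p.s * ((1 + 2) ^ 2 * (8 * D / tw p.s)) := by gcongr; exact (tw_pos _).le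
    _ = 72 * D := by have := tw_ne p.s; field_simp; ring

lemma wt_inv_le (s0 q0 : ℤ) (t : ℝ) : 1 / wt s0 q0 t ≤ 2 * rho (tw s0 * t - q0) ^ 2 := by
  unfold wt rho
  rw [inv_pow, ← div_eq_mul_inv, div_le_div_iff₀ (by positivity) (by positivity), ← sq_abs (tw s0 * t - q0)]
  nlinarith [sq_nonneg (|tw s0 * t - q0| - 1)]

lemma near_sup {Ω : Set ℝ} {p : Tile} (hp : NearO Ω p) {s0 q0 : ℤ} (hsub : p.I ⊆ dI s0 q0) :
    ∃ x, x ∉ Ω ∧ |tw s0 * x - q0| ≤ 3 := by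
  obtain ⟨x, hx, hxp⟩ := hp
  exact ⟨x, hx, by have := dI_tau_le hsub x; linarith⟩

lemma wt_dens {F : ℝ → ℂ} (hF : FOK F) {Ω : Set ℝ} {D : ℝ} (hD : Dens F Ω D) {p : Tile}
    (hp : NearO Ω p) {s0 q0 : ℤ} (hsub : p.I ⊆ dI s0 q0) :
    ∫ t, ‖F t‖ ^ 2 / wt s0 q0 t ≤ 256 * D * tw (-s0) := by
  obtain ⟨x, hx, hx3⟩ := near_sup hp hsub
  have h1 := dens_rho' hF hD hx (tw_pos s0) (by norm_num : (0:ℝ) ≤ 3) hx3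
  calc _ ≤ ∫ t, 2 * (‖F t‖ * rho (tw s0 * t - q0) ^ 2) := by
        apply integral_mono (F_wt_integrable hF _ _) ((F_rho_integrable hF _ _ _).const_mul _)
        intro t
        have h2 := wt_inv_le s0 q0 t
        have h3 := hF.bd t
        have h4 : ‖F t‖ ^ 2 ≤ ‖F t‖ := by nlinarith [norm_nonneg (F t)]
        simp only
        rw [div_eq_mul_one_div]
        have hw := wt_pos s0 q0 t
        calc _ ≤ ‖F t‖ * (2 * rho (tw s0 * t - q0) ^ 2) := by gcongr
          _ = _ := by ring
    _ = 2 * ∫ t, ‖F t‖ * rho (tw s0 * t - q0) ^ 2 := integral_const_mul _ _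
    _ ≤ 2 * ((1 + 3) ^ 2 * (8 * D / tw s0)) := by gcongr
    _ = _ := by rw [tw_neg]; ring

lemma ee_sub_le (a b : ℝ) : ‖ee a - ee b‖ ≤ 7 * |a - b| := by
  have e : ee a - ee b = ee b * (Complex.exp (Complex.I * ((2 * π * (a - b) : ℝ) : ℂ)) - 1) := by
    rw [mul_sub, mul_one]
    congr 1
    rw [ee_eq, ee_eq, ← Complex.exp_add]
    congr 1; push_cast; ring
  rw [e, norm_mul, ee_norm, one_mul]
  refine (Real.norm_exp_I_mul_ofReal_sub_one_le).trans ?_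
  rw [Real.norm_eq_abs, abs_mul, abs_of_pos (by positivity)]
  have := Real.pi_lt_d2
  nlinarith [abs_nonneg (a - b)]

section size
variable {N0 C4 : ℝ} {h : ℝ → ℂ} {F : ℝ → ℂ} {Ω : Set ℝ} {D : ℝ}

/-- smoothness of packets at scale `ℓ` -/
lemma pk_diff (hh : Good N0 h) (hC4 : 0 ≤ C4) {p : Tile} {ξ : ℝ} (hl : |(p.l : ℝ) - ξ / tw p.s| ≤ C4)
    {x y ℓ : ℝ} (hℓ : 0 < ℓ) (hxy : |x - y| ≤ ℓ)
    (hfar : 1 < tw p.s * ℓ → 3 * (tw p.s * ℓ) ≤ |tw p.s * x - p.q|) :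
    ‖pk h p x - ee (ξ * (x - y)) * pk h p y‖ ≤
      (7 * C4 + 258) * (min (tw p.s * ℓ) (1 / (tw p.s * ℓ)) * rho (tw p.s * x - p.q) ^ 4) := by
  have hr := tw_pos p.s
  set r := tw p.s
  set u := r * x - p.q
  set w := r * y - p.q
  have hrl : 0 < r * ℓ := by positivity
  have huw : |u - w| ≤ r * ℓ := by
    have : u - w = r * (x - y) := by simp only [u, w]; ring
    rw [this, abs_mul, abs_of_pos hr]; gcongr
  have hρ := rho_nonneg u
  have hρ1 := rho_le_one u
  have hρ8 : rho u ^ 8 ≤ rho u ^ 4 := rho_pow_le (by norm_num)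
  by_cases hc : r * ℓ ≤ 1
  · have hmin : min (r * ℓ) (1 / (r * ℓ)) = r * ℓ := by
      apply min_eq_left; rw [le_div_iff₀ hrl]; nlinarith
    rw [hmin]
    have e : pk h p x - ee (ξ * (x - y)) * pk h p y =
        (ee (r * p.l * x) - ee (ξ * (x - y) + r * p.l * y)) * h u +
        ee (ξ * (x - y) + r * p.l * y) * (h u - h w) := by
      unfold pk; rw [ee_add]; ring
    rw [e]
    refine (norm_add_le _ _).trans ?_
    rw [norm_mul, norm_mul, ee_norm, one_mul]
    have h1 := ee_sub_le (r * p.l * x) (ξ * (x - y) + r * p.l * y)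
    have e2 : r * p.l * x - (ξ * (x - y) + r * p.l * y) = (r * (p.l - ξ / r)) * (x - y) := by
      field_simp; ring
    rw [e2, abs_mul, abs_mul, abs_of_pos hr] at h1
    have h2 := hh.bd u
    have h3 := hh.lip u w (huw.trans hc)
    have h4 : r * |(p.l : ℝ) - ξ / r| * |x - y| ≤ r * C4 * ℓ := by gcongr
    calc _ ≤ (7 * (r * C4 * ℓ)) * rho u ^ 4 + (r * ℓ) * rho u ^ 4 := by
          gcongr
          · exact h1.trans (by linarith)
          · exact h2.trans hρ8
          · refine h3.trans ?_; gcongr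
      _ = (7 * C4 + 1) * (r * ℓ * rho u ^ 4) := by ring
      _ ≤ _ := by
          have : 0 ≤ r * ℓ * rho u ^ 4 := by positivity
          nlinarith
  · push Not at hc
    have hf := hfar hc
    have hmin : min (r * ℓ) (1 / (r * ℓ)) = 1 / (r * ℓ) := by
      apply min_eq_right; rw [div_le_iff₀ hrl]; nlinarith
    rw [hmin]
    have hw2 : rho w ≤ 2 * rho u := by
      apply rho_le_mul two_pos
      have : |u| ≤ |w| + r * ℓ := by
        have e : u = w + (u - w) := by ring
        have := abs_add_le w (u - w)
        rw [← e] at this; linarith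
      linarith [abs_nonneg w]
    have hu1 : rho u ≤ 1 / (r * ℓ) := by
      unfold rho
      rw [one_div]
      apply inv_anti₀ hrl
      linarith
    refine (norm_sub_le _ _).trans ?_
    rw [norm_mul, ee_norm, one_mul]
    have h1 := pk_le hh p x
    have h2 := (pk_le hh p y).trans (pow_le_pow_left₀ (rho_nonneg _) hw2 8)
    have h3 : rho u ^ 8 ≤ rho u * rho u ^ 4 := by
      have : rho u ^ 8 = rho u * rho u ^ 4 * rho u ^ 3 := by ring
      rw [this]
      exact mul_le_of_le_one_right (by positivity) (pow_le_one₀ hρ hρ1)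
    calc _ ≤ rho u ^ 8 + (2 * rho u) ^ 8 := add_le_add h1 h2
      _ = 257 * rho u ^ 8 := by ring
      _ ≤ 257 * (rho u * rho u ^ 4) := by gcongr
      _ ≤ 257 * (1 / (r * ℓ) * rho u ^ 4) := by gcongr
      _ ≤ _ := by
          have : 0 ≤ 1 / (r * ℓ) * rho u ^ 4 := by positivity
          nlinarith

lemma sum_min_le (A : Finset ℤ) {ℓ : ℝ} (hℓ : 0 < ℓ) :
    ∑ s ∈ A, min (tw s * ℓ) (1 / (tw s * ℓ)) ≤ 4 := by
  rw [← Finset.sum_filter_add_sum_filter_not A (fun s => tw s ≤ 1 / ℓ)]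
  have h1 : ∑ s ∈ A with tw s ≤ 1 / ℓ, min (tw s * ℓ) (1 / (tw s * ℓ)) ≤ 2 := by
    calc _ ≤ ∑ s ∈ A with tw s ≤ 1 / ℓ, tw s * ℓ := Finset.sum_le_sum fun s _ => min_le_left _ _
      _ = (∑ s ∈ A with tw s ≤ 1 / ℓ, tw s) * ℓ := by rw [Finset.sum_mul]
      _ ≤ (2 * (1 / ℓ)) * ℓ := by
          gcongr
          apply geom_up _ _ (by positivity)
          intro s hs; exact (Finset.mem_filter.1 hs).2
      _ = 2 := by field_simp
  have h2 : ∑ s ∈ A with ¬ tw s ≤ 1 / ℓ, min (tw s * ℓ) (1 / (tw s * ℓ)) ≤ 2 := by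
    calc _ ≤ ∑ s ∈ A with ¬ tw s ≤ 1 / ℓ, tw (-s) * (1 / ℓ) := by
          refine Finset.sum_le_sum fun s _ => (min_le_right _ _).trans (le_of_eq ?_)
          rw [tw_neg]; have := tw_ne s; field_simp
      _ = (∑ s ∈ A with ¬ tw s ≤ 1 / ℓ, tw (-s)) * (1 / ℓ) := by rw [Finset.sum_mul]
      _ ≤ (2 * ℓ) * (1 / ℓ) := by
          gcongr
          apply geom_down _ _ hℓ.le
          intro s hs
          have := (Finset.mem_filter.1 hs).2
          push Not at this
          rw [tw_neg, inv_le_comm₀ (tw_pos _) hℓ, ← one_div]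
          exact this.le
      _ = 2 := by field_simp
  linarith

def Cb (C4 : ℝ) : ℝ := 72 * (7 * C4 + 258) * (256 * (2 * C4 + 1))

lemma HH_smooth (hh : Good N0 h) (hF : FOK F) (hC4 : 0 ≤ C4) (hD : Dens F Ω D) (hD0 : 0 ≤ D)
    (U : Finset Tile) (T : TTop) (hU : ∀ p ∈ U, nearT C4 p T) (hnear : ∀ p ∈ U, NearO Ω p)
    {x y ℓ : ℝ} (hℓ : 0 < ℓ) (hxy : |x - y| ≤ ℓ)
    (hfar : ∀ p ∈ U, 1 < tw p.s * ℓ → 3 * (tw p.s * ℓ) ≤ |tw p.s * x - p.q|) :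
    ‖HH h (cf h F) U x‖ ≤ ‖HH h (cf h F) U y‖ + Cb C4 * D * rho (tw T.s * x - T.q) ^ 2 := by
  have e : HH h (cf h F) U x = ee (T.x * (x - y)) * HH h (cf h F) U y +
      ∑ p ∈ U, cf h F p * (pk h p x - ee (T.x * (x - y)) * pk h p y) := by
    unfold HH
    rw [Finset.mul_sum, ← Finset.sum_add_distrib]
    refine Finset.sum_congr rfl fun p _ => ?_
    ring
  rw [e]
  refine (norm_add_le _ _).trans ?_
  rw [norm_mul, ee_norm, one_mul]
  gcongr
  refine (norm_sum_le _ _).trans ?_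
  set v := rho (tw T.s * x - T.q) ^ 2
  have hv : 0 ≤ v := by positivity
  calc _ ≤ ∑ p ∈ U, (72 * D * (7 * C4 + 258) * 4 * v) *
        (min (tw p.s * ℓ) (1 / (tw p.s * ℓ)) * rho (tw p.s * x - p.q) ^ 2) := by
        refine Finset.sum_le_sum fun p hp => ?_
        rw [norm_mul]
        have h1 := cf_le_dens hh hF hD (hnear p hp)
        have h2 := pk_diff hh hC4 (hU p hp).2 hℓ hxy (hfar p hp)
        have h3 : rho (tw p.s * x - p.q) ≤ 2 * rho (tw T.s * x - T.q) := by
          apply rho_le_mul two_pos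
          have := dI_tau_le (hU p hp).1 x
          linarith [abs_nonneg (tw p.s * x - p.q)]
        have h4 : rho (tw p.s * x - p.q) ^ 4 ≤ 4 * v * rho (tw p.s * x - p.q) ^ 2 := by
          have := pow_le_pow_left₀ (rho_nonneg _) h3 2
          calc rho (tw p.s * x - p.q) ^ 4 = rho (tw p.s * x - p.q) ^ 2 * rho (tw p.s * x - p.q) ^ 2 := by ring
            _ ≤ (2 * rho (tw T.s * x - T.q)) ^ 2 * rho (tw p.s * x - p.q) ^ 2 := by gcongr
            _ = _ := by simp only [v]; ring
        have hm : 0 ≤ min (tw p.s * ℓ) (1 / (tw p.s * ℓ)) := by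
          have := tw_pos p.s; positivity
        calc _ ≤ (72 * D) * ((7 * C4 + 258) * (min (tw p.s * ℓ) (1 / (tw p.s * ℓ)) *
              (4 * v * rho (tw p.s * x - p.q) ^ 2))) := by
              refine mul_le_mul h1 (h2.trans ?_) (norm_nonneg _) (by positivity)
              gcongr
          _ = _ := by ring
    _ = (72 * D * (7 * C4 + 258) * 4 * v) * ∑ p ∈ U,
        (min (tw p.s * ℓ) (1 / (tw p.s * ℓ)) * rho (tw p.s * x - p.q) ^ 2) := by rw [Finset.mul_sum]
    _ ≤ (72 * D * (7 * C4 + 258) * 4 * v) * (4 * ((2 * C4 + 1) * 16)) := by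
        gcongr
        rw [← Finset.sum_fiberwise_of_maps_to (t := U.image Tile.s) (g := Tile.s)
          (fun p hp => Finset.mem_image_of_mem _ hp)]
        calc _ ≤ ∑ s ∈ U.image Tile.s, min (tw s * ℓ) (1 / (tw s * ℓ)) * ((2 * C4 + 1) * 16) := by
              refine Finset.sum_le_sum fun s _ => ?_
              have hm : 0 ≤ min (tw s * ℓ) (1 / (tw s * ℓ)) := by
                have := tw_pos s; positivity
              calc _ = min (tw s * ℓ) (1 / (tw s * ℓ)) * ∑ p ∈ U with p.s = s, rho (tw s * x - p.q) ^ 2 := by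
                    rw [Finset.mul_sum]
                    refine Finset.sum_congr rfl fun p hp => ?_
                    rw [(Finset.mem_filter.1 hp).2]
                _ ≤ _ := by
                    gcongr
                    apply tile_sum_rho _ s _ (T.x / tw s) C4 hC4
                    · intro p hp
                      have := Finset.mem_filter.1 hp
                      rw [← this.2]; exact (hU p this.1).2
                    · intro p hp; exact (Finset.mem_filter.1 hp).2
          _ = (∑ s ∈ U.image Tile.s, min (tw s * ℓ) (1 / (tw s * ℓ))) * ((2 * C4 + 1) * 16) := by
              rw [Finset.sum_mul]
          _ ≤ _ := by gcongr; exact sum_min_le _ hℓ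
    _ = _ := by unfold Cb; ring

end size

/-! ### Size estimate for lacunary trees -/

lemma averaging {F : ℝ → ℂ} (hF : FOK F) {Ω : Set ℝ} {D : ℝ} (hD : Dens F Ω D)
    {ℓ G v : ℝ → ℝ} (hℓ : ∀ x, 0 < ℓ x) (hℓc : Continuous ℓ) (hℓL : ∀ x y, |ℓ x - ℓ y| ≤ |x - y| / 5)
    (hx0 : ∀ y, ∃ x0, x0 ∉ Ω ∧ |y - x0| ≤ 6 * ℓ y)
    (hG : ∀ x, 0 ≤ G x) (hGc : Continuous G) (hGi : Integrable G)
    (hFG : Integrable (fun x => ‖F x‖ * G x)) (hv : ∀ x, 0 ≤ v x)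
    (hFv : Integrable (fun x => ‖F x‖ * v x))
    (hGv : ∀ x y, |x - y| ≤ ℓ x → G x ≤ G y + v x) :
    ∫ x, ‖F x‖ * G x ≤ 8 * D * (∫ x, G x) + ∫ x, ‖F x‖ * v x := by
  have hD0 : 0 ≤ D := by obtain ⟨x, hx, _⟩ := hx0 0; exact hD.nonneg hx
  set g : ℝ → ℝ → ℝ≥0∞ := fun x y =>
    ({p : ℝ × ℝ | |p.1 - p.2| ≤ ℓ p.1}.indicator
      (fun p => ENNReal.ofReal (‖F p.1‖ * (2 * ℓ p.1)⁻¹ * G p.2)) (x, y)) with hg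
  have hset : MeasurableSet {p : ℝ × ℝ | |p.1 - p.2| ≤ ℓ p.1} :=
    measurableSet_le (by fun_prop) (by fun_prop)
  have hgm : Measurable (Function.uncurry g) := by
    have : Function.uncurry g = {p : ℝ × ℝ | |p.1 - p.2| ≤ ℓ p.1}.indicator
      (fun p => ENNReal.ofReal (‖F p.1‖ * (2 * ℓ p.1)⁻¹ * G p.2)) := by ext ⟨x, y⟩; rfl
    rw [this]
    refine Measurable.indicator ?_ hset
    have := hF.meas
    have h3 := hℓc.measurable
    have h4 := hGc.measurable
    fun_prop
  have h1 : ∀ x, ENNReal.ofReal (‖F x‖ * G x) ≤ (∫⁻ y, g x y) + ENNReal.ofReal (‖F x‖ * v x) := by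
    intro x
    have h2 : ENNReal.ofReal (‖F x‖ * (G x - v x)) ≤ ∫⁻ y, g x y := by
      calc ENNReal.ofReal (‖F x‖ * (G x - v x))
          = ∫⁻ y in Metric.closedBall x (ℓ x), ENNReal.ofReal (‖F x‖ * (2 * ℓ x)⁻¹ * (G x - v x)) := by
            rw [setLIntegral_const, Real.volume_closedBall,
              ← ENNReal.ofReal_mul' (by linarith [hℓ x])]
            congr 1
            have := (hℓ x).ne'
            field_simp
        _ ≤ ∫⁻ y in Metric.closedBall x (ℓ x), g x y := by
            refine setLIntegral_mono' Metric.isClosed_closedBall.measurableSet fun y hy => ?_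
            rw [Metric.mem_closedBall, Real.dist_eq, abs_sub_comm] at hy
            simp only [hg]
            rw [Set.indicator_of_mem (by exact hy)]
            apply ENNReal.ofReal_le_ofReal
            have := hGv x y hy
            have := hℓ x
            gcongr
            linarith
        _ ≤ _ := setLIntegral_le_lintegral _ _
    calc _ = ENNReal.ofReal (‖F x‖ * (G x - v x) + ‖F x‖ * v x) := by congr 1; ring
      _ ≤ _ := ENNReal.ofReal_add_le
      _ ≤ _ := by gcongr
  have h2 : ∀ y, ∫⁻ x, g x y ≤ ENNReal.ofReal (8 * D * G y) := by
    intro y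
    obtain ⟨x0, hx0, hxy⟩ := hx0 y
    have hy := hℓ y
    calc _ ≤ ∫⁻ x, (Metric.closedBall x0 (8 * ℓ y)).indicator
          (fun x => ENNReal.ofReal (‖F x‖ * (ℓ y)⁻¹ * G y)) x := by
          refine lintegral_mono fun x => ?_
          simp only [hg]
          by_cases hxy' : |x - y| ≤ ℓ x
          · rw [Set.indicator_of_mem (by exact hxy')]
            have hL := abs_le.1 (hℓL x y)
            have hx := hℓ x
            rw [Set.indicator_of_mem]
            · apply ENNReal.ofReal_le_ofReal
              have := hG y
              gcongr
              linarith
            · rw [Metric.mem_closedBall, Real.dist_eq]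
              have e : x - x0 = (x - y) + (y - x0) := by ring
              rw [e]; refine (abs_add_le _ _).trans ?_; linarith
          · rw [Set.indicator_of_notMem (by exact hxy')]; exact zero_le
      _ = ∫⁻ x in Metric.closedBall x0 (8 * ℓ y), ENNReal.ofReal (‖F x‖ * (ℓ y)⁻¹ * G y) :=
          lintegral_indicator Metric.isClosed_closedBall.measurableSet _
      _ = ENNReal.ofReal (∫ x in Metric.closedBall x0 (8 * ℓ y), ‖F x‖ * (ℓ y)⁻¹ * G y) := by
          rw [ofReal_integral_eq_lintegral_ofReal]
          · exact ((hF.int.norm.mul_const _).mul_const _).integrableOn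
          · exact Filter.Eventually.of_forall fun x => by have := hG y; positivity
      _ ≤ _ := by
          apply ENNReal.ofReal_le_ofReal
          rw [integral_mul_const, integral_mul_const]
          have := hD x0 hx0 (8 * ℓ y) (by positivity)
          have := hG y
          calc _ ≤ (D * (8 * ℓ y)) * (ℓ y)⁻¹ * G y := by gcongr
            _ = _ := by field_simp
  have h3 : ENNReal.ofReal (∫ x, ‖F x‖ * G x) ≤
      ENNReal.ofReal (8 * D * (∫ x, G x) + ∫ x, ‖F x‖ * v x) := by
    rw [ENNReal.ofReal_add (mul_nonneg (by positivity) (integral_nonneg hG))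
      (integral_nonneg fun x => mul_nonneg (norm_nonneg _) (hv x)), ← integral_const_mul,
      ofReal_integral_eq_lintegral_ofReal hFG
        (Filter.Eventually.of_forall fun x => mul_nonneg (norm_nonneg _) (hG x)),
      ofReal_integral_eq_lintegral_ofReal hFv
        (Filter.Eventually.of_forall fun x => mul_nonneg (norm_nonneg _) (hv x)),
      ofReal_integral_eq_lintegral_ofReal (hGi.const_mul _)
        (Filter.Eventually.of_forall fun x => mul_nonneg (by positivity) (hG x))]
    calc _ ≤ ∫⁻ x, ((∫⁻ y, g x y) + ENNReal.ofReal (‖F x‖ * v x)) := lintegral_mono h1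
      _ = (∫⁻ x, ∫⁻ y, g x y) + ∫⁻ x, ENNReal.ofReal (‖F x‖ * v x) :=
          lintegral_add_left hgm.lintegral_prod_right' _
      _ = (∫⁻ y, ∫⁻ x, g x y) + ∫⁻ x, ENNReal.ofReal (‖F x‖ * v x) := by
          rw [lintegral_lintegral_swap hgm.aemeasurable]
      _ ≤ _ := by gcongr with y; exact h2 y
  exact (ENNReal.ofReal_le_ofReal_iff (add_nonneg (mul_nonneg (by positivity) (integral_nonneg hG))
      (integral_nonneg fun x => mul_nonneg (norm_nonneg _) (hv x)))).1 h3

lemma wt_inv_integrable (s0 q0 : ℤ) : Integrable (fun t => 1 / wt s0 q0 t) := by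
  refine ((rho_sq_aff_integrable (tw_pos s0) q0).const_mul 2).mono' ?_
    (Filter.Eventually.of_forall fun t => ?_)
  · apply Continuous.aestronglyMeasurable
    exact continuous_const.div (by unfold wt; fun_prop) fun t => (wt_pos s0 q0 t).ne'
  · have := wt_pos s0 q0 t
    rw [Real.norm_of_nonneg (by positivity)]; exact wt_inv_le _ _ _

lemma wt_inv_integral (s0 q0 : ℤ) : ∫ t, 1 / wt s0 q0 t ≤ 8 * tw (-s0) := by
  calc _ ≤ ∫ t, 2 * rho (tw s0 * t - q0) ^ 2 :=
        integral_mono (wt_inv_integrable _ _) ((rho_sq_aff_integrable (tw_pos s0) q0).const_mul 2)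
          (fun t => wt_inv_le _ _ _)
    _ = 2 * ∫ t, rho (tw s0 * t - q0) ^ 2 := integral_const_mul _ _
    _ ≤ 2 * (4 / tw s0) := by gcongr; exact rho_sq_aff_integral (tw_pos s0) q0
    _ = _ := by rw [tw_neg]; ring

def sizeC (N0 C4 : ℝ) : ℝ := 512 * (128 * (4 * N0 + 1)) + 256 * Cb C4

section size2
variable {N0 C4 : ℝ} {h : ℝ → ℂ} {F : ℝ → ℂ} {Ω : Set ℝ} {D : ℝ}

lemma lac_no_cross (hN : 0 < N0) {ε : ℝ} (hε : ε = 1 ∨ ε = -1) {p p' : Tile} {T : TTop}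
    (h1 : lacT (8 * N0) C4 ε p T) (h2 : lacT (8 * N0) C4 ε p' T)
    (hs : C4 * tw p.s ≤ N0 * tw p'.s) : ¬ CrossRel N0 p p' := by
  rintro ⟨hlt, hab⟩
  have hr := tw_pos p.s
  have hr' := tw_pos p'.s
  have h12 := tw_lt_two hlt
  have e1 : tw p.s * (ε * (p.l - T.x / tw p.s)) = ε * (tw p.s * p.l - T.x) := by field_simp
  have e2 : tw p'.s * (ε * (p'.l - T.x / tw p'.s)) = ε * (tw p'.s * p'.l - T.x) := by field_simp
  have a1 := mul_le_mul_of_nonneg_left h1.2.2 hr.le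
  have a2 := mul_le_mul_of_nonneg_left h2.2.1 hr'.le
  rw [e1] at a1
  rw [e2] at a2
  have hab' := abs_le.1 hab
  have : N0 * tw p'.s > 0 := by positivity
  have : N0 * (2 * tw p.s) ≤ N0 * tw p'.s := by gcongr
  rcases hε with rfl | rfl <;> nlinarith

theorem size_bound (hN : 0 < N0) (hC4 : 8 * N0 ≤ C4) (hh : Good N0 h) (hF : FOK F) (hD : Dens F Ω D)
    {ε : ℝ} (hε : ε = 1 ∨ ε = -1) (U : Finset Tile) (T : TTop)
    (hU : ∀ p ∈ U, lacT (8 * N0) C4 ε p T) (hnear : ∀ p ∈ U, NearO Ω p) (hsp : SparseT N0 C4 U) :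
    ∑ p ∈ U, tw (-p.s) * ‖cf h F p‖ ^ 2 ≤ sizeC N0 C4 * D ^ 2 * tw (-T.s) := by
  have hC40 : 0 ≤ C4 := by linarith
  have hCb : 0 ≤ Cb C4 := by unfold Cb; positivity
  rcases U.eq_empty_or_nonempty with rfl | hne
  · simp
    have := tw_pos (-T.s)
    unfold sizeC; positivity
  obtain ⟨p1, hp1, hp1m⟩ := Finset.exists_max_image U Tile.s hne
  obtain ⟨x1, hx1, hx1T⟩ := near_sup (hnear p1 hp1) (hU p1 hp1).1
  have hD0 := hD.nonneg hx1
  set C0 : ℝ := 128 * (4 * N0 + 1) with hC0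
  have hC0p : 0 < C0 := by positivity
  set S := ∑ p ∈ U, tw (-p.s) * ‖cf h F p‖ ^ 2 with hS
  set H := HH h (cf h F) U with hH
  have hsub : ∀ p ∈ U, p.I ⊆ dI T.s T.q := fun p hp => (hU p hp).1
  have hgram : ∫ t, wt T.s T.q t * ‖H t‖ ^ 2 ≤ C0 * S := by
    refine (HH_gram_split hN.le hh (cf h F) U T.s T.q hsub).trans ?_
    have : ∑ p ∈ U, ∑ p' ∈ U with CrossRel N0 p p',
        ‖cf h F p‖ * ‖cf h F p'‖ * (tw (-p'.s) * rho (tw p.s * (p'.q / tw p'.s) - p.q) ^ 4) = 0 := by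
      refine Finset.sum_eq_zero fun p hp => ?_
      rw [Finset.filter_false_of_mem, Finset.sum_empty]
      intro p' hp' hc
      exact lac_no_cross hN hε (hU p hp) (hU p' hp') (hsp p hp p' hp' hc.1) hc
    rw [this]; simp [C0, S]
  set ℓ : ℝ → ℝ := fun x => max (tw (-p1.s)) (Metric.infDist x Ωᶜ / 5) with hℓ
  have hℓ0 : ∀ x, 0 < ℓ x := fun x => lt_max_of_lt_left (tw_pos _)
  have hℓc : Continuous ℓ := continuous_const.max ((Metric.continuous_infDist_pt _).div_const _)
  have hΩ : (Ωᶜ).Nonempty := ⟨x1, hx1⟩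
  have hℓL : ∀ x y, |ℓ x - ℓ y| ≤ |x - y| / 5 := by
    intro x y
    simp only [hℓ]
    rw [max_comm (tw _), max_comm (tw _)]
    refine (abs_max_sub_max_le_abs _ _ _).trans ?_
    have a1 := Metric.infDist_le_infDist_add_dist (s := Ωᶜ) (x := x) (y := y)
    have a2 := Metric.infDist_le_infDist_add_dist (s := Ωᶜ) (x := y) (y := x)
    rw [Real.dist_eq] at a1 a2
    rw [abs_sub_comm y x] at a2
    rw [abs_le]; constructor <;> linarith
  have hx0 : ∀ y, ∃ x0, x0 ∉ Ω ∧ |y - x0| ≤ 6 * ℓ y := by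
    intro y
    have : Metric.infDist y Ωᶜ < 6 * ℓ y := by
      have := hℓ0 y
      have : Metric.infDist y Ωᶜ / 5 ≤ ℓ y := le_max_right _ _
      linarith
    obtain ⟨x0, hx0, hlt⟩ := (Metric.infDist_lt_iff hΩ).1 this
    exact ⟨x0, hx0, by rw [← Real.dist_eq]; exact hlt.le⟩
  have hfar : ∀ x, ∀ p ∈ U, 1 < tw p.s * ℓ x → 3 * (tw p.s * ℓ x) ≤ |tw p.s * x - p.q| := by
    intro x p hp hlt
    obtain ⟨z, hz, hzp⟩ := hnear p hp
    have hr := tw_pos p.s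
    have h5 : ℓ x ≤ |x - z| / 5 := by
      simp only [hℓ] at hlt ⊢
      apply max_le
      · by_contra hcon
        push Not at hcon
        have hd : Metric.infDist x Ωᶜ ≤ |x - z| := by
          rw [← Real.dist_eq]; exact Metric.infDist_le_dist_of_mem hz
        rw [max_eq_left (by linarith)] at hlt
        have : tw p.s * tw (-p1.s) ≤ 1 := by
          rw [← tw_add, ← tw_zero]; apply tw_le; have := hp1m p hp; omega
        linarith
      · rw [← Real.dist_eq]
        have := Metric.infDist_le_dist_of_mem (s := Ωᶜ) (x := x) hz
        linarith
    have h6 : tw p.s * |x - z| ≤ |tw p.s * x - p.q| + 2 := by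
      rw [← abs_of_pos hr, ← abs_mul, abs_of_pos hr]
      have e : tw p.s * (x - z) = (tw p.s * x - p.q) - (tw p.s * z - p.q) := by ring
      rw [e]; refine (abs_sub _ _).trans ?_; linarith
    have : tw p.s * ℓ x ≤ tw p.s * (|x - z| / 5) := by gcongr
    linarith
  have hHi2 : Integrable (fun t => wt T.s T.q t * ‖H t‖ ^ 2) := HH_sq_integrable hh _ U _ _ hsub
  have hwi := wt_inv_integrable T.s T.q
  have hHc : Continuous (fun t => ‖H t‖) := (HH_continuous hh _ U).norm
  have hHi : Integrable (fun t => ‖H t‖) := by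
    refine (hHi2.add hwi).mono' hHc.aestronglyMeasurable (Filter.Eventually.of_forall fun t => ?_)
    have hw := wt_pos T.s T.q t
    simp only [norm_norm, Pi.add_apply]
    have : wt T.s T.q t * ‖H t‖ ^ 2 + 1 / wt T.s T.q t - ‖H t‖ =
        ((wt T.s T.q t * ‖H t‖ - 1) ^ 2 + wt T.s T.q t * ‖H t‖) / wt T.s T.q t := by field_simp; ring
    have h2 : 0 ≤ ((wt T.s T.q t * ‖H t‖ - 1) ^ 2 + wt T.s T.q t * ‖H t‖) / wt T.s T.q t := by positivity
    linarith
  have hav := averaging hF hD (ℓ := ℓ) (G := fun t => ‖H t‖)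
    (v := fun x => Cb C4 * D * rho (tw T.s * x - T.q) ^ 2) hℓ0 hℓc hℓL hx0 (fun _ => norm_nonneg _) hHc hHi
    (FH_integrable hh hF _ U) (fun x => by have := rho_nonneg (tw T.s * x - T.q); positivity)
    (by
      refine ((F_rho_integrable hF (tw T.s) T.q 2).const_mul (Cb C4 * D)).congr
        (Filter.Eventually.of_forall fun t => ?_)
      simp only; ring)
    (fun x y hxy => HH_smooth hh hF hC40 hD hD0 U T (fun p hp => lac_near (by positivity) hε (hU p hp))
      hnear (hℓ0 x) hxy (hfar x))
  have hv1 : ∫ x, ‖F x‖ * (Cb C4 * D * rho (tw T.s * x - T.q) ^ 2) ≤ 128 * Cb C4 * D ^ 2 * tw (-T.s) := by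
    have e : ∀ x, ‖F x‖ * (Cb C4 * D * rho (tw T.s * x - T.q) ^ 2) =
      (Cb C4 * D) * (‖F x‖ * rho (tw T.s * x - T.q) ^ 2) := fun x => by ring
    simp_rw [e]
    rw [integral_const_mul]
    have := dens_rho' hF hD hx1 (tw_pos T.s) (by norm_num : (0:ℝ) ≤ 3) hx1T
    calc _ ≤ (Cb C4 * D) * ((1 + 3) ^ 2 * (8 * D / tw T.s)) := by gcongr
      _ = _ := by rw [tw_neg]; ring
  have hv2 : 8 * D * ∫ x, ‖H x‖ ≤ S / 2 + 256 * C0 * D ^ 2 * tw (-T.s) := by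
    rw [← integral_const_mul]
    calc _ ≤ ∫ t, ((2 * C0)⁻¹ * (wt T.s T.q t * ‖H t‖ ^ 2) + 32 * C0 * D ^ 2 * (1 / wt T.s T.q t)) := by
          apply integral_mono (hHi.const_mul _) ((hHi2.const_mul _).add (hwi.const_mul _))
          intro t
          have hw := wt_pos T.s T.q t
          simp only [Pi.add_apply]
          have e : (2 * C0)⁻¹ * (wt T.s T.q t * ‖H t‖ ^ 2) + 32 * C0 * D ^ 2 * (1 / wt T.s T.q t)
            - 8 * D * ‖H t‖ = (wt T.s T.q t * ‖H t‖ - 8 * C0 * D) ^ 2 / (2 * C0 * wt T.s T.q t) := by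
            field_simp; ring
          have h2 : 0 ≤ (wt T.s T.q t * ‖H t‖ - 8 * C0 * D) ^ 2 / (2 * C0 * wt T.s T.q t) := by positivity
          linarith
      _ = (2 * C0)⁻¹ * (∫ t, wt T.s T.q t * ‖H t‖ ^ 2) + 32 * C0 * D ^ 2 * ∫ t, 1 / wt T.s T.q t := by
          rw [integral_add (hHi2.const_mul _) (hwi.const_mul _), integral_const_mul, integral_const_mul]
      _ ≤ (2 * C0)⁻¹ * (C0 * S) + 32 * C0 * D ^ 2 * (8 * tw (-T.s)) := by
          gcongr; exact wt_inv_integral _ _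
      _ = _ := by field_simp; ring
  have hfin := sum_sq_le_FH hh hF U
  have : S ≤ (S / 2 + 256 * C0 * D ^ 2 * tw (-T.s)) + 128 * Cb C4 * D ^ 2 * tw (-T.s) :=
    hfin.trans (hav.trans (add_le_add hv2 hv1))
  unfold sizeC
  rw [← hC0]
  linarith

lemma size_near (hN : 0 < N0) (hC4 : 8 * N0 ≤ C4) (hh : Good N0 h) (hF : FOK F) (hD : Dens F Ω D)
    (S : Finset Tile) (hnear : ∀ p ∈ S, NearO Ω p) (hsp : SparseT N0 C4 S) :
    SizeLE N0 C4 (fun p => ‖cf h F p‖) S (Real.sqrt (sizeC N0 C4) * D) := by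
  intro T ε hε
  unfold lacSum
  have hC40 : 0 ≤ C4 := by linarith
  have : 0 ≤ sizeC N0 C4 := by unfold sizeC Cb; positivity
  rw [mul_pow, Real.sq_sqrt this]
  apply size_bound hN hC4 hh hF hD hε _ T
  · intro p hp; exact (Finset.mem_filter.1 hp).2
  · intro p hp; exact hnear p (Finset.mem_filter.1 hp).1
  · intro p hp p' hp'
    exact hsp p (Finset.mem_filter.1 hp).1 p' (Finset.mem_filter.1 hp').1

end size2

/-! ### Counting functions of tops -/

lemma pow_count {α : Type*} (A : Finset α) (s : α → ℤ) (k : ℕ) :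
    (A.card : ℝ) ^ (k + 1) ≤ (k + 1) * ∑ a ∈ A, ((A.filter fun b => s a ≤ s b).card : ℝ) ^ k := by
  induction A using Finset.induction_on_min_value s with
  | empty => simp
  | insert a A ha hmin ih =>
    rw [Finset.sum_insert ha]
    have e : ((insert a A).filter fun b => s a ≤ s b) = insert a A := by
      apply Finset.filter_true_of_mem
      intro b hb
      rcases Finset.mem_insert.1 hb with rfl | hb
      · exact le_rfl
      · exact hmin b hb
    rw [e, Finset.card_insert_of_notMem ha]
    have h1 : ∑ x ∈ A, ((A.filter fun b => s x ≤ s b).card : ℝ) ^ k ≤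
        ∑ x ∈ A, (((insert a A).filter fun b => s x ≤ s b).card : ℝ) ^ k := by
      refine Finset.sum_le_sum fun x _ => ?_
      gcongr
      exact Finset.subset_insert _ _
    have h2 : ((A.card + 1 : ℕ) : ℝ) ^ (k + 1) ≤ (A.card : ℝ) ^ (k + 1) + (k + 1) * ((A.card + 1 : ℕ) : ℝ) ^ k := by
      push_cast
      set x : ℝ := (A.card : ℝ)
      have hx : 0 ≤ x := Nat.cast_nonneg _
      clear_value x
      clear ih h1 e
      induction k with
      | zero => simp
      | succ k ih =>
        have h3 : x ^ (k + 1) ≤ (x + 1) ^ (k + 1) := by gcongr; linarith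
        have := mul_le_mul_of_nonneg_right ih (by linarith : 0 ≤ x + 1)
        push_cast
        have e1 : (x + 1) ^ (k + 1 + 1) = (x + 1) ^ (k + 1) * (x + 1) := pow_succ _ _
        have e2 : (x ^ (k + 1) + (k + 1) * (x + 1) ^ k) * (x + 1) =
          x ^ (k + 1 + 1) + x ^ (k + 1) + (k + 1) * (x + 1) ^ (k + 1) := by ring
        rw [e1]
        rw [e2] at this
        linarith
    have : (0:ℝ) ≤ k + 1 := by positivity
    nlinarith

def Nc (FF : Finset TTop) (t : ℝ) : ℝ := ∑ T ∈ FF, T.I.indicator (fun _ => (1:ℝ)) t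

lemma Nc_nonneg (FF : Finset TTop) (t : ℝ) : 0 ≤ Nc FF t :=
  Finset.sum_nonneg fun T _ => Set.indicator_nonneg (fun _ _ => zero_le_one) _

lemma Nc_card (FF : Finset TTop) (t : ℝ) : Nc FF t = ((FF.filter fun T => t ∈ T.I).card : ℝ) := by
  unfold Nc
  rw [Finset.card_filter]
  push_cast
  refine Finset.sum_congr rfl fun T _ => ?_
  by_cases h : t ∈ T.I <;> simp [h]

lemma Nc_le (FF : Finset TTop) (t : ℝ) : Nc FF t ≤ FF.card := by
  rw [Nc_card]; exact_mod_cast Finset.card_filter_le _ _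

lemma TI_meas (T : TTop) : MeasurableSet T.I := dI_measurable _ _

lemma TI_int (T : TTop) : Integrable (T.I.indicator (fun _ => (1:ℝ))) := by
  rw [integrable_indicator_iff (TI_meas T)]
  apply integrableOn_const
  · unfold TTop.I; rw [dI_volume]; exact ENNReal.ofReal_ne_top
  · simp

lemma TI_integral (T : TTop) : ∫ t, T.I.indicator (fun _ => (1:ℝ)) t = tw (-T.s) := by
  rw [integral_indicator (TI_meas T)]
  simp [TTop.I, dI_volume_real]

lemma Nc_int (FF : Finset TTop) : Integrable (Nc FF) := integrable_finsetSum _ fun T _ => TI_int T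

lemma Nc_meas (FF : Finset TTop) : Measurable (Nc FF) :=
  Finset.measurable_fun_sum _ fun T _ => measurable_const.indicator (TI_meas T)

lemma Nc_integral (FF : Finset TTop) : ∫ t, Nc FF t = ∑ T ∈ FF, tw (-T.s) := by
  unfold Nc
  rw [integral_finsetSum _ fun T _ => TI_int T]
  simp_rw [TI_integral]

lemma Nc_pow_int (FF : Finset TTop) (k : ℕ) : Integrable (fun t => Nc FF t ^ (k + 1)) := by
  refine ((Nc_int FF).const_mul ((FF.card : ℝ) ^ k)).mono' ((Nc_meas FF).pow_const _).aestronglyMeasurable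
    (Filter.Eventually.of_forall fun t => ?_)
  have h0 := Nc_nonneg FF t
  have h1 := Nc_le FF t
  rw [Real.norm_of_nonneg (by positivity), pow_succ]
  gcongr

def PackL (FF : Finset TTop) (x : ℝ) : Prop :=
  ∀ T ∈ FF, ∑ T' ∈ FF with T'.I ⊆ T.I, tw (-T'.s) ≤ x * tw (-T.s)

lemma Nc_step (FF : Finset TTop) (k : ℕ) (t : ℝ) :
    Nc FF t ^ (k + 2) ≤ (k + 2) * ∑ T ∈ FF, Nc (FF.filter fun T' => T'.I ⊆ T.I) t ^ (k + 1) := by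
  rw [Nc_card]
  have := pow_count (FF.filter fun T => t ∈ T.I) TTop.s (k + 1)
  push_cast at this
  refine this.trans ?_
  have e : ((k:ℝ) + 1 + 1) = k + 2 := by ring
  rw [e]
  gcongr
  refine (Finset.sum_le_sum fun T hT => ?_).trans (Finset.sum_le_sum_of_subset_of_nonneg
    (Finset.filter_subset _ _) (fun T _ _ => pow_nonneg (Nc_nonneg _ _) _))
  rw [Nc_card]
  have hT := (Finset.mem_filter.1 hT)
  gcongr
  intro T' hT'
  simp only [Finset.mem_filter] at hT' ⊢
  refine ⟨⟨hT'.1.1, ?_⟩, hT'.1.2⟩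
  exact dI_nested hT'.2 (Set.not_disjoint_iff.2 ⟨t, by tauto, by tauto⟩)

lemma Nc_pow_integral {x : ℝ} (hx : 0 ≤ x) (k : ℕ) : ∀ FF : Finset TTop, PackL FF x →
    ∫ t, Nc FF t ^ (k + 1) ≤ (k + 1).factorial * x ^ k * ∑ T ∈ FF, tw (-T.s) := by
  induction k with
  | zero => intro FF _; simp [Nc_integral]
  | succ k ih =>
    intro FF hP
    calc _ ≤ ∫ t, ((k:ℝ) + 2) * ∑ T ∈ FF, Nc (FF.filter fun T' => T'.I ⊆ T.I) t ^ (k + 1) :=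
          integral_mono (Nc_pow_int _ _)
            ((integrable_finsetSum _ fun T _ => Nc_pow_int _ _).const_mul _) (Nc_step FF k)
      _ = ((k:ℝ) + 2) * ∑ T ∈ FF, ∫ t, Nc (FF.filter fun T' => T'.I ⊆ T.I) t ^ (k + 1) := by
          rw [integral_const_mul, integral_finsetSum _ fun T _ => Nc_pow_int _ _]
      _ ≤ ((k:ℝ) + 2) * ∑ T ∈ FF, ((k + 1).factorial * x ^ k * (x * tw (-T.s))) := by
          gcongr with T hT
          refine (ih _ ?_).trans ?_
          · intro T1 hT1
            have h1 := Finset.mem_filter.1 hT1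
            refine (Finset.sum_le_sum_of_subset_of_nonneg ?_ fun T _ _ => (tw_pos _).le).trans (hP T1 h1.1)
            intro T2 hT2
            simp only [Finset.mem_filter] at hT2 ⊢
            tauto
          · gcongr; exact hP T hT
      _ = _ := by
          rw [Finset.mul_sum, Finset.mul_sum]
          refine Finset.sum_congr rfl fun T _ => ?_
          rw [Nat.factorial_succ (k + 1)]
          push_cast; ring

lemma prod_le_sum_pow {ι : Type*} (A : Finset ι) (hA : A.Nonempty) (y : ι → ℝ) (hy : ∀ i, 0 ≤ y i) :
    ∏ i ∈ A, y i ≤ ∑ i ∈ A, y i ^ A.card := by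
  obtain ⟨i, hi, hm⟩ := Finset.exists_max_image A y hA
  calc _ ≤ ∏ _j ∈ A, y i := Finset.prod_le_prod (fun j _ => hy j) hm
    _ = y i ^ A.card := by simp
    _ ≤ _ := Finset.single_le_sum (f := fun i => y i ^ A.card) (fun j _ => pow_nonneg (hy j) _) hi

lemma prod_Nc_int {ι : Type*} (A : Finset ι) (hA : A.Nonempty) (FF : ι → Finset TTop) :
    Integrable (fun t => ∏ i ∈ A, Nc (FF i) t) := by
  obtain ⟨i, hi⟩ := hA
  refine ((Nc_int (FF i)).const_mul (∏ j ∈ A.erase i, ((FF j).card : ℝ))).mono'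
    (Finset.measurable_fun_prod _ fun j _ => Nc_meas _).aestronglyMeasurable
    (Filter.Eventually.of_forall fun t => ?_)
  rw [Real.norm_of_nonneg (Finset.prod_nonneg fun j _ => Nc_nonneg _ _), ← Finset.prod_erase_mul _ _ hi]
  have := Nc_nonneg (FF i) t
  gcongr with j hj
  · exact fun j hj => Nc_nonneg _ _
  · exact Nc_le _ _

theorem prod_Nc_integral {ι : Type*} (A : Finset ι) (hA : A.Nonempty) (FF : ι → Finset TTop)
    (x : ι → ℝ) (V : ℝ) (hx : ∀ i, 0 < x i) (hP : ∀ i ∈ A, PackL (FF i) (x i))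
    (hV : ∀ i ∈ A, ∑ T ∈ FF i, tw (-T.s) ≤ x i * V) :
    ∫ t, ∏ i ∈ A, Nc (FF i) t ≤ A.card * A.card.factorial * V * ∏ i ∈ A, x i := by
  obtain ⟨k, hk⟩ : ∃ k, A.card = k + 1 := ⟨A.card - 1, by have := hA.card_pos; omega⟩
  have hp : 0 < ∏ i ∈ A, x i := Finset.prod_pos fun i _ => hx i
  calc _ ≤ ∫ t, (∏ i ∈ A, x i) * ∑ i ∈ A, (x i ^ (k + 1))⁻¹ * Nc (FF i) t ^ (k + 1) := by
        apply integral_mono (prod_Nc_int A hA FF)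
        · exact (integrable_finsetSum _ fun i _ => (Nc_pow_int _ _).const_mul _).const_mul _
        · intro t
          have := prod_le_sum_pow A hA (fun i => Nc (FF i) t / x i)
            (fun i => div_nonneg (Nc_nonneg _ _) (hx i).le)
          rw [Finset.prod_div_distrib, div_le_iff₀ hp, hk] at this
          refine this.trans (le_of_eq ?_)
          rw [mul_comm]
          congr 1
          refine Finset.sum_congr rfl fun i _ => ?_
          rw [div_pow]; ring
    _ = (∏ i ∈ A, x i) * ∑ i ∈ A, (x i ^ (k + 1))⁻¹ * ∫ t, Nc (FF i) t ^ (k + 1) := by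
        rw [integral_const_mul, integral_finsetSum _ fun i _ => (Nc_pow_int _ _).const_mul _]
        simp_rw [integral_const_mul]
    _ ≤ (∏ i ∈ A, x i) * ∑ i ∈ A, ((k + 1).factorial * V) := by
        refine mul_le_mul_of_nonneg_left (Finset.sum_le_sum fun i hi => ?_) hp.le
        have h1 := Nc_pow_integral (hx i).le k (FF i) (hP i hi)
        have hxi := hx i
        calc _ ≤ (x i ^ (k + 1))⁻¹ * ((k + 1).factorial * x i ^ k * (x i * V)) := by
              gcongr
              refine h1.trans ?_
              gcongr
              exact hV i hi
          _ = _ := by rw [pow_succ]; field_simp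
    _ = _ := by rw [hk]; simp [hk]; ring

/-! ### Multitiles -/

@[ext] structure MT (n : ℕ) where
  s : ℤ
  q : ℤ
  ζ : Fin n → ℤ

def MT.pr {n : ℕ} (P : MT n) (i : Fin n) : Tile := ⟨P.s, P.q, P.ζ i⟩

structure ND (n k : ℕ) (Γ' : Submodule ℝ (Fin n → ℝ)) (C3 : ℝ) : Prop where
  ex : ∀ A : Finset (Fin n), A.card = k → ∀ c : Fin n → ℝ, ∃ γ ∈ Γ', ∀ i ∈ A, γ i = c i
  bd : ∀ A : Finset (Fin n), A.card = k → ∀ γ ∈ Γ', ∀ b : ℝ, (∀ i ∈ A, |γ i| ≤ b) → ∀ i, |γ i| ≤ C3 * b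
  sum : ∀ γ ∈ Γ', ∑ i, γ i = 0

structure Whit {n : ℕ} (Γ' : Submodule ℝ (Fin n → ℝ)) (Lw C2 : ℝ) (P : MT n) : Prop where
  sum : ∑ i, (P.ζ i : ℝ) = 0
  far : ∀ γ ∈ Γ', ∃ i, Lw ≤ |(P.ζ i : ℝ) - γ i / tw P.s|
  near : ∃ γ ∈ Γ', ∀ i, |(P.ζ i : ℝ) - γ i / tw P.s| ≤ C2

section multi
variable {n k : ℕ} {Γ' : Submodule ℝ (Fin n → ℝ)} {C3 Lw C2 η C4 : ℝ}

lemma whit_near (hND : ND n k Γ' C3) {P : MT n} (hW : Whit Γ' Lw C2 P) {A : Finset (Fin n)}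
    (hA : A.card = k) {c : Fin n → ℝ} (hc : c ∈ Γ') {b : ℝ}
    (hb : ∀ i ∈ A, |(P.ζ i : ℝ) - c i / tw P.s| ≤ b) (u : Fin n) :
    |(P.ζ u : ℝ) - c u / tw P.s| ≤ C3 * (b + C2) + C2 := by
  obtain ⟨γ, hγ, h2⟩ := hW.near
  have hr := tw_pos P.s
  have h3 := hND.bd A hA ((tw P.s)⁻¹ • (γ - c)) (Γ'.smul_mem _ (Γ'.sub_mem hγ hc)) (b + C2) (by
    intro i hi
    have e : ((tw P.s)⁻¹ • (γ - c)) i = ((P.ζ i : ℝ) - c i / tw P.s) - ((P.ζ i : ℝ) - γ i / tw P.s) := by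
      simp; field_simp
    rw [e]
    refine (abs_sub _ _).trans ?_
    exact add_le_add (hb i hi) (h2 i)) u
  have e : (P.ζ u : ℝ) - c u / tw P.s =
      ((tw P.s)⁻¹ • (γ - c)) u + ((P.ζ u : ℝ) - γ u / tw P.s) := by
    simp; field_simp; ring
  rw [e]
  refine (abs_add_le _ _).trans ?_
  exact add_le_add h3 (h2 u)

def RS (η C4 : ℝ) (P : MT n) (c : Fin n → ℝ) (u : Fin n) : Prop :=
  η ≤ |(P.ζ u : ℝ) - c u / tw P.s| ∧ |(P.ζ u : ℝ) - c u / tw P.s| ≤ C4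

lemma RS_alt (hND : ND n k Γ' C3) {P : MT n} (hη : 0 < η) (hn : 1 ≤ n) (hL : n * η ≤ Lw)
    (hC4 : C3 * (η + C2) + C2 ≤ C4) (hW : Whit Γ' Lw C2 P) {A : Finset (Fin n)}
    (hA : A.card = k) {c : Fin n → ℝ} (hc : c ∈ Γ')
    (hb : ∀ i ∈ A, |(P.ζ i : ℝ) - c i / tw P.s| ≤ C4) :
    (∃ u ∈ A, RS η C4 P c u) ∨ ∃ u v, u ≠ v ∧ RS η C4 P c u ∧ RS η C4 P c v := by
  by_cases h : ∃ u ∈ A, η ≤ |(P.ζ u : ℝ) - c u / tw P.s|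
  · obtain ⟨u, hu, h1⟩ := h
    exact Or.inl ⟨u, hu, h1, hb u hu⟩
  · right
    push Not at h
    have hall : ∀ u, |(P.ζ u : ℝ) - c u / tw P.s| ≤ C4 := fun u =>
      (whit_near hND hW hA hc (fun i hi => (h i hi).le) u).trans hC4
    obtain ⟨u, hu⟩ := hW.far c hc
    have hnη : η ≤ n * η := by
      have : (1:ℝ) ≤ n := by exact_mod_cast hn
      nlinarith
    by_cases h2 : ∃ v, u ≠ v ∧ η ≤ |(P.ζ v : ℝ) - c v / tw P.s|
    · obtain ⟨v, huv, hv⟩ := h2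
      exact ⟨u, v, huv, ⟨by linarith, hall u⟩, ⟨hv, hall v⟩⟩
    · exfalso
      push Not at h2
      have hsum : ∑ i, ((P.ζ i : ℝ) - c i / tw P.s) = 0 := by
        rw [Finset.sum_sub_distrib, hW.sum, ← Finset.sum_div, hND.sum c hc]; simp
      rw [← Finset.add_sum_erase _ _ (Finset.mem_univ u)] at hsum
      have h3 : |(P.ζ u : ℝ) - c u / tw P.s| ≤ ∑ v ∈ Finset.univ.erase u, η := by
        have e : (P.ζ u : ℝ) - c u / tw P.s = -∑ v ∈ Finset.univ.erase u, ((P.ζ v : ℝ) - c v / tw P.s) := by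
          linarith
        rw [e, abs_neg]
        refine (Finset.abs_sum_le_sum_abs _ _).trans (Finset.sum_le_sum fun v hv => ?_)
        exact (h2 v (Finset.ne_of_mem_erase hv).symm).le
      rw [Finset.sum_const, Finset.card_erase_of_mem (Finset.mem_univ u), Finset.card_univ,
        Fintype.card_fin, nsmul_eq_mul, Nat.cast_sub hn] at h3
      push_cast at h3
      nlinarith

lemma RS_two {A A' : Finset (Fin n)} (hd : Disjoint A A') {R R' : Fin n → Prop}
    (h : (∃ u ∈ A, R u) ∨ ∃ u v, u ≠ v ∧ R u ∧ R v)
    (h' : (∃ u ∈ A', R' u) ∨ ∃ u v, u ≠ v ∧ R' u ∧ R' v) : ∃ u v, u ≠ v ∧ R u ∧ R' v := by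
  rcases h with ⟨u, hu, hRu⟩ | ⟨u, v, huv, hu, hv⟩
  · rcases h' with ⟨u', hu', hRu'⟩ | ⟨u', v', huv', hu', hv'⟩
    · exact ⟨u, u', fun e => Finset.disjoint_left.1 hd hu (e ▸ hu'), hRu, hRu'⟩
    · by_cases e : u = u'
      · exact ⟨u, v', fun e2 => huv' (e.symm.trans e2), hRu, hv'⟩
      · exact ⟨u, u', e, hRu, hu'⟩
  · obtain ⟨w, hw⟩ : ∃ w, R' w := by
      rcases h' with ⟨u', _, h⟩ | ⟨u', _, _, h, _⟩ <;> exact ⟨u', h⟩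
    by_cases e : u = w
    · exact ⟨v, w, fun e2 => huv (e.trans e2.symm), hv, hw⟩
    · exact ⟨u, w, e, hu, hw⟩

/-- the number of multitiles with given scale, position and approximate frequencies -/
lemma mt_count (C5 : ℝ) (hC5 : 0 ≤ C5) (X : Finset (MT n)) (s q : ℤ) (c : Fin n → ℝ)
    (hX : ∀ P ∈ X, P.s = s ∧ P.q = q ∧ ∀ i, |(P.ζ i : ℝ) - c i| ≤ C5) :
    (X.card : ℝ) ≤ (2 * C5 + 1) ^ n := by
  have h1 : X.card ≤ (Fintype.piFinset fun i => X.image fun P => P.ζ i).card := by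
    apply Finset.card_le_card_of_injOn (fun P => P.ζ)
    · intro P hP
      simp only [Finset.mem_coe, Fintype.mem_piFinset]
      intro i; exact Finset.mem_image_of_mem _ hP
    · intro P hP P' hP' he
      ext1
      · rw [(hX P hP).1, (hX P' hP').1]
      · rw [(hX P hP).2.1, (hX P' hP').2.1]
      · exact he
  rw [Fintype.card_piFinset] at h1
  calc (X.card : ℝ) ≤ ∏ i, ((X.image fun P => P.ζ i).card : ℝ) := by exact_mod_cast h1
    _ ≤ ∏ _i : Fin n, (2 * C5 + 1) := by
        refine Finset.prod_le_prod (fun i _ => Nat.cast_nonneg _) fun i _ => ?_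
        apply card_int_window (c i) C5 hC5
        intro l hl
        obtain ⟨P, hP, rfl⟩ := Finset.mem_image.1 hl
        exact (hX P hP).2.2 i
    _ = _ := by simp

end multi

section cls
variable {n k : ℕ} {Γ' : Submodule ℝ (Fin n → ℝ)} {C3 Lw C2 N0 C4 : ℝ}

def multC (C5 : ℝ) (n : ℕ) : ℝ := (2 * C5 + 1) ^ n

lemma sum_fiber_le {α β : Type*} [DecidableEq β] (X : Finset α) (f : α → β) (w : β → ℝ) (hw : ∀ b, 0 ≤ w b) (K : ℝ)
    (hK : ∀ b ∈ X.image f, ((X.filter fun a => f a = b).card : ℝ) ≤ K) :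
    ∑ a ∈ X, w (f a) ≤ K * ∑ b ∈ X.image f, w b := by
  rw [← Finset.sum_fiberwise_of_maps_to (t := X.image f) (g := f)
    (fun a ha => Finset.mem_image_of_mem _ ha), Finset.mul_sum]
  refine Finset.sum_le_sum fun b hb => ?_
  calc _ = ∑ a ∈ X with f a = b, w b := Finset.sum_congr rfl fun a ha => by rw [(Finset.mem_filter.1 ha).2]
    _ = ((X.filter fun a => f a = b).card : ℝ) * w b := by rw [Finset.sum_const, nsmul_eq_mul]
    _ ≤ _ := mul_le_mul_of_nonneg_right (hK b hb) (hw b)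

/-- one group of multitiles -/
lemma group_bound {C5 : ℝ} (hC5 : 0 ≤ C5) (X : Finset (MT n)) (u : Fin n) (Am : Tile → ℝ)
    (S : Finset Tile) (σ : ℝ) (hS : SizeLE N0 C4 Am S σ) (hXS : ∀ P ∈ X, P.pr u ∈ S)
    (c : Fin n → ℝ) (s0 q0 : ℤ) (hXI : ∀ P ∈ X, dI P.s P.q ⊆ dI s0 q0)
    (hXR : ∀ P ∈ X, RS (8 * N0) C4 P c u)
    (hX5 : ∀ P ∈ X, ∀ i, |(P.ζ i : ℝ) - c i / tw P.s| ≤ C5) :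
    ∑ P ∈ X, tw (-P.s) * Am (P.pr u) ^ 2 ≤ multC C5 n * (2 * σ ^ 2 * tw (-s0)) := by
  have hw : ∀ p : Tile, 0 ≤ tw (-p.s) * Am p ^ 2 := fun p => by have := tw_pos (-p.s); positivity
  have hM : 0 ≤ multC C5 n := by unfold multC; positivity
  have h1 := sum_fiber_le X (fun P => P.pr u) (fun p => tw (-p.s) * Am p ^ 2) hw (multC C5 n) (by
    intro p hp
    obtain ⟨P0, hP0, rfl⟩ := Finset.mem_image.1 hp
    apply mt_count C5 hC5 _ P0.s P0.q (fun i => c i / tw P0.s)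
    intro P hP
    obtain ⟨hP1, hP2⟩ := Finset.mem_filter.1 hP
    have e1 : P.s = P0.s := congrArg Tile.s hP2
    have e2 : P.q = P0.q := congrArg Tile.q hP2
    refine ⟨e1, e2, fun i => ?_⟩
    rw [← e1]; exact hX5 P hP1 i)
  refine h1.trans (mul_le_mul_of_nonneg_left ?_ hM)
  set T : TTop := ⟨s0, q0, c u⟩
  have h2 := hS T 1 (Or.inl rfl)
  have h3 := hS T (-1) (Or.inr rfl)
  unfold lacSum at h2 h3
  have h4 : ∑ p ∈ X.image (fun P => P.pr u), tw (-p.s) * Am p ^ 2 ≤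
      ∑ p ∈ S with lacT (8 * N0) C4 1 p T, tw (-p.s) * Am p ^ 2 +
      ∑ p ∈ S with lacT (8 * N0) C4 (-1) p T, tw (-p.s) * Am p ^ 2 := by
    refine (Finset.sum_le_sum_of_subset_of_nonneg (t := (S.filter fun p => lacT (8 * N0) C4 1 p T) ∪
      (S.filter fun p => lacT (8 * N0) C4 (-1) p T)) ?_ fun p _ _ => hw p).trans ?_
    · intro p hp
      obtain ⟨P, hP, rfl⟩ := Finset.mem_image.1 hp
      have hR := hXR P hP
      have hI : (P.pr u).I ⊆ T.I := hXI P hP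
      rw [Finset.mem_union, Finset.mem_filter, Finset.mem_filter]
      rcases le_total 0 ((P.ζ u : ℝ) - c u / tw P.s) with h0 | h0
      · left
        rw [RS, abs_of_nonneg h0] at hR
        refine ⟨hXS P hP, hI, ?_, ?_⟩ <;> rw [one_mul]
        · exact hR.1
        · exact hR.2
      · right
        rw [RS, abs_of_nonpos h0] at hR
        refine ⟨hXS P hP, hI, ?_, ?_⟩ <;> rw [neg_one_mul]
        · exact hR.1
        · exact hR.2
    · rw [← Finset.sum_union_inter]
      have : 0 ≤ ∑ p ∈ (S.filter fun p => lacT (8 * N0) C4 1 p T) ∩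
        (S.filter fun p => lacT (8 * N0) C4 (-1) p T), tw (-p.s) * Am p ^ 2 :=
        Finset.sum_nonneg fun p _ => hw p
      linarith
  refine h4.trans ?_
  have : T.s = s0 := rfl
  rw [this] at h2 h3
  linarith

/-- the data attached to a class of multitiles -/
structure Cls (n : ℕ) (N0 C4 : ℝ) (X : Finset (MT n)) (Am : Fin n → Tile → ℝ) (σ : Fin n → ℝ)
    (FF : Fin n → Finset TTop) : Prop where
  am0 : ∀ i p, 0 ≤ Am i p
  sg0 : ∀ i, 0 ≤ σ i
  size : ∀ i, ∃ S : Finset Tile, (∀ P ∈ X, P.pr i ∈ S) ∧ SizeLE N0 C4 (Am i) S (σ i)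
  top : ∀ i, ∀ P ∈ X, ∃ T ∈ FF i, nearT C4 (P.pr i) T

variable {X : Finset (MT n)} {Am : Fin n → Tile → ℝ} {σ : Fin n → ℝ} {FF : Fin n → Finset TTop}

lemma Cls.mono (h : Cls n N0 C4 X Am σ FF) {X' : Finset (MT n)} (hX : X' ⊆ X) : Cls n N0 C4 X' Am σ FF :=
  ⟨h.am0, h.sg0, fun i => by
    obtain ⟨S, h1, h2⟩ := h.size i
    exact ⟨S, fun P hP => h1 P (hX hP), h2⟩, fun i P hP => h.top i P (hX hP)⟩

lemma indicator_prod_integral (A : Finset (Fin n)) (hA : A.Nonempty) (τ : Fin n → TTop) (t0 : ℝ)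
    (ht : ∀ i ∈ A, t0 ∈ (τ i).I) : ∃ i0 ∈ A, (∀ i ∈ A, (τ i0).I ⊆ (τ i).I) ∧
      ∀ t, ∏ i ∈ A, (τ i).I.indicator (fun _ => (1:ℝ)) t = (τ i0).I.indicator (fun _ => (1:ℝ)) t := by
  obtain ⟨i0, hi0, hm⟩ := Finset.exists_max_image A (fun i => (τ i).s) hA
  have hsub : ∀ i ∈ A, (τ i0).I ⊆ (τ i).I := fun i hi =>
    dI_nested (hm i hi) (Set.not_disjoint_iff.2 ⟨t0, ht i0 hi0, ht i hi⟩)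
  refine ⟨i0, hi0, hsub, fun t => ?_⟩
  by_cases h : t ∈ (τ i0).I
  · rw [Set.indicator_of_mem h]
    apply Finset.prod_eq_one
    intro i hi
    rw [Set.indicator_of_mem (hsub i hi h)]
  · rw [Set.indicator_of_notMem h]
    apply Finset.prod_eq_zero hi0
    rw [Set.indicator_of_notMem h]

instance : Inhabited TTop := ⟨⟨0, 0, 0⟩⟩

/-- the bound for one frequency index -/
lemma cls_square (hk : 1 ≤ k) (hND : ND n k Γ' C3) (hC3 : 0 ≤ C3) (hC2 : 0 ≤ C2) (hC40 : 0 ≤ C4)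
    (hW : ∀ P ∈ X, Whit Γ' Lw C2 P) (hX : Cls n N0 C4 X Am σ FF) {A : Finset (Fin n)} (hA : A.card = k)
    (tp : Fin n → MT n → TTop) (htp : ∀ i, ∀ P ∈ X, tp i P ∈ FF i ∧ nearT C4 (P.pr i) (tp i P))
    (cc : (Fin n → TTop) → Fin n → ℝ) (hcc : ∀ τ, cc τ ∈ Γ' ∧ ∀ i ∈ A, cc τ i = (τ i).x) (u : Fin n) :
    ∑ P ∈ X with RS (8 * N0) C4 P (cc fun i => if i ∈ A then tp i P else default) u,
        tw (-P.s) * Am u (P.pr u) ^ 2 ≤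
      multC (C3 * (C4 + C2) + C2) n * (2 * σ u ^ 2) * ∫ t, ∏ i ∈ A, Nc (FF i) t := by
  have hAne : A.Nonempty := by rw [← Finset.card_pos]; omega
  set C5 := C3 * (C4 + C2) + C2 with hC5
  have hC50 : 0 ≤ C5 := by positivity
  have hM : 0 ≤ multC C5 n := by unfold multC; positivity
  set τ : MT n → Fin n → TTop := fun P i => if i ∈ A then tp i P else default with hτ
  set Y := X.filter fun P => RS (8 * N0) C4 P (cc (τ P)) u with hY
  obtain ⟨S, hXS, hS⟩ := hX.size u
  have hYX : ∀ P ∈ Y, P ∈ X := fun P hP => (Finset.mem_filter.1 hP).1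
  rw [← Finset.sum_fiberwise_of_maps_to (t := Y.image τ) (g := τ)
    (fun a ha => Finset.mem_image_of_mem _ ha)]
  have h1 : ∀ τ0 ∈ Y.image τ, ∑ P ∈ Y with τ P = τ0, tw (-P.s) * Am u (P.pr u) ^ 2 ≤
      multC C5 n * (2 * σ u ^ 2) * ∫ t, ∏ i ∈ A, (τ0 i).I.indicator (fun _ => (1:ℝ)) t := by
    intro τ0 hτ0
    obtain ⟨P0, hP0, rfl⟩ := Finset.mem_image.1 hτ0
    have hsubI : ∀ P ∈ Y, ∀ i ∈ A, (P.pr i).I ⊆ (τ P i).I := by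
      intro P hP i hi
      simp only [hτ, if_pos hi]
      exact (htp i P (hYX P hP)).2.1
    obtain ⟨i0, hi0, hi0s, hi0e⟩ := indicator_prod_integral A hAne (τ P0) ((P0.q : ℝ) / tw P0.s)
      (fun i hi => hsubI P0 hP0 i hi (dI_left _ _))
    simp_rw [hi0e]
    rw [TI_integral]
    have := group_bound (C4 := C4) (N0 := N0) hC50 (Y.filter fun P => τ P = τ P0) u (Am u) S (σ u) hS
      (fun P hP => hXS P (hYX P (Finset.mem_filter.1 hP).1)) (cc (τ P0)) (τ P0 i0).s (τ P0 i0).q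
      (by
        intro P hP
        obtain ⟨h1, h2⟩ := Finset.mem_filter.1 hP
        have := hsubI P h1 i0 hi0
        rw [h2] at this; exact this)
      (by
        intro P hP
        obtain ⟨h1, h2⟩ := Finset.mem_filter.1 hP
        rw [← h2]; exact (Finset.mem_filter.1 h1).2)
      (by
        intro P hP i
        obtain ⟨h1, h2⟩ := Finset.mem_filter.1 hP
        rw [← h2]
        apply whit_near hND (hW P (hYX P h1)) hA (hcc _).1
        intro i hi
        rw [(hcc _).2 i hi]
        simp only [hτ, if_pos hi]
        exact (htp i P (hYX P h1)).2.2)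
    refine this.trans (le_of_eq ?_)
    ring
  refine (Finset.sum_le_sum h1).trans ?_
  rw [← Finset.mul_sum]
  gcongr
  rw [← integral_finsetSum]
  swap
  · intro τ0 _
    have := prod_Nc_int A hAne (fun i => {τ0 i})
    simpa [Nc] using this
  apply integral_mono
  · refine integrable_finsetSum _ fun τ0 _ => ?_
    have := prod_Nc_int A hAne (fun i => {τ0 i})
    simpa [Nc] using this
  · exact prod_Nc_int A hAne FF
  intro t
  simp only
  have e : ∏ i ∈ A, Nc (FF i) t = ∏ i : Fin n, ∑ T ∈ (if i ∈ A then FF i else {default}),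
      (if i ∈ A then T.I.indicator (fun _ => (1:ℝ)) t else 1) := by
    rw [← Finset.prod_subset (Finset.subset_univ A)]
    · refine Finset.prod_congr rfl fun i hi => ?_
      simp only [if_pos hi, Nc]
    · intro i _ hi
      simp only [if_neg hi, Finset.sum_singleton]
  rw [e, Finset.prod_univ_sum]
  have e2 : ∀ τ0 : Fin n → TTop, ∏ i ∈ A, (τ0 i).I.indicator (fun _ => (1:ℝ)) t =
      ∏ i, (if i ∈ A then (τ0 i).I.indicator (fun _ => (1:ℝ)) t else 1) := by
    intro τ0
    rw [← Finset.prod_subset (Finset.subset_univ A)]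
    · refine Finset.prod_congr rfl fun i hi => ?_
      simp only [if_pos hi]
    · intro i _ hi
      simp only [if_neg hi]
  simp_rw [e2]
  apply Finset.sum_le_sum_of_subset_of_nonneg
  · intro τ0 hτ0
    obtain ⟨P0, hP0, rfl⟩ := Finset.mem_image.1 hτ0
    rw [Fintype.mem_piFinset]
    intro i
    by_cases hi : i ∈ A
    · simp only [hτ, if_pos hi]; exact (htp i P0 (hYX P0 hP0)).1
    · simp only [hτ, if_neg hi]; exact Finset.mem_singleton_self _
  · intro τ0 _ _
    refine Finset.prod_nonneg fun i _ => ?_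
    split_ifs
    · exact Set.indicator_nonneg (fun _ _ => zero_le_one) _
    · exact zero_le_one

def clsC (n k : ℕ) (C5 : ℝ) : ℝ := n ^ 2 * (multC C5 n * 2 * (k * k.factorial))

theorem cls_bound (hk : 1 ≤ k) (hn : 1 ≤ n) (hND : ND n k Γ' C3) (hC3 : 0 ≤ C3) (hC2 : 0 ≤ C2)
    (hN : 0 < N0) (hL : n * (8 * N0) ≤ Lw) (hC4 : C3 * (8 * N0 + C2) + C2 ≤ C4) (hC48 : 8 * N0 ≤ C4)
    (hW : ∀ P ∈ X, Whit Γ' Lw C2 P) (hX : Cls n N0 C4 X Am σ FF)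
    {A A' : Finset (Fin n)} (hA : A.card = k) (hA' : A'.card = k) (hd : Disjoint A A')
    (x : Fin n → ℝ) (V : ℝ) (hx : ∀ i, 0 < x i) (hV0 : 0 ≤ V) (hP : ∀ i, PackL (FF i) (x i))
    (hV : ∀ i, ∑ T ∈ FF i, tw (-T.s) ≤ x i * V) :
    ∑ P ∈ X, tw (-P.s) * ∏ i, Am i (P.pr i) ≤
      clsC n k (C3 * (C4 + C2) + C2) * V * (∏ i, σ i) * ∏ i ∈ A ∪ A', Real.sqrt (x i) := by
  set C5 := C3 * (C4 + C2) + C2 with hC5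
  have hC40 : 0 ≤ C4 := by linarith
  have hC50 : 0 ≤ C5 := by positivity
  have hM : 0 ≤ multC C5 n := by unfold multC; positivity
  have hAne : A.Nonempty := by rw [← Finset.card_pos]; omega
  have hAne' : A'.Nonempty := by rw [← Finset.card_pos]; omega
  have hst : ∀ i, ∀ P, ∃ T, P ∈ X → T ∈ FF i ∧ nearT C4 (P.pr i) T := by
    intro i P
    by_cases hP : P ∈ X
    · obtain ⟨T, h1, h2⟩ := hX.top i P hP
      exact ⟨T, fun _ => ⟨h1, h2⟩⟩
    · exact ⟨default, fun h => absurd h hP⟩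
  choose tp htp using hst
  have hc1 : ∀ τ : Fin n → TTop, ∃ c, c ∈ Γ' ∧ ∀ i ∈ A, c i = (τ i).x := fun τ => by
    obtain ⟨γ, h1, h2⟩ := hND.ex A hA fun i => (τ i).x
    exact ⟨γ, h1, h2⟩
  have hc2 : ∀ τ : Fin n → TTop, ∃ c, c ∈ Γ' ∧ ∀ i ∈ A', c i = (τ i).x := fun τ => by
    obtain ⟨γ, h1, h2⟩ := hND.ex A' hA' fun i => (τ i).x
    exact ⟨γ, h1, h2⟩
  choose cc hcc using hc1
  choose cc' hcc' using hc2
  set R : MT n → Fin n → Prop := fun P u => RS (8 * N0) C4 P (cc fun i => if i ∈ A then tp i P else default) u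
    with hR
  set R' : MT n → Fin n → Prop := fun P u => RS (8 * N0) C4 P (cc' fun i => if i ∈ A' then tp i P else default) u
    with hR'
  have hall : ∀ P ∈ X, ∃ u v, u ≠ v ∧ R P u ∧ R' P v := by
    intro P hP
    apply RS_two hd
    · apply RS_alt hND (by positivity) hn hL hC4 (hW P hP) hA (hcc _).1
      intro i hi
      rw [(hcc _).2 i hi]
      simp only [if_pos hi]
      exact (htp i P hP).2.2
    · apply RS_alt hND (by positivity) hn hL hC4 (hW P hP) hA' (hcc' _).1
      intro i hi
      rw [(hcc' _).2 i hi]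
      simp only [if_pos hi]
      exact (htp i P hP).2.2
  set J := ∫ t, ∏ i ∈ A, Nc (FF i) t
  set J' := ∫ t, ∏ i ∈ A', Nc (FF i) t
  have hJ0 : 0 ≤ J := integral_nonneg fun t => Finset.prod_nonneg fun i _ => Nc_nonneg _ _
  have hJ0' : 0 ≤ J' := integral_nonneg fun t => Finset.prod_nonneg fun i _ => Nc_nonneg _ _
  have hs1 := cls_square hk hND hC3 hC2 hC40 hW hX hA tp htp cc hcc
  have hs2 := cls_square hk hND hC3 hC2 hC40 hW hX hA' tp htp cc' hcc'
  have hamσ : ∀ i, ∀ P ∈ X, Am i (P.pr i) ≤ σ i := by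
    intro i P hP
    obtain ⟨S, h1, h2⟩ := hX.size i
    exact h2.single (hX.sg0 i) hC48 (h1 P hP)
  have hpair : ∀ u v, u ≠ v → ∑ P ∈ X with R P u ∧ R' P v, tw (-P.s) * ∏ i, Am i (P.pr i) ≤
      (∏ i, σ i) * (multC C5 n * 2 * (Real.sqrt J * Real.sqrt J')) := by
    intro u v huv
    set p := ∏ i ∈ (Finset.univ.erase u).erase v, σ i with hp
    have hvmem : v ∈ Finset.univ.erase u := Finset.mem_erase.2 ⟨huv.symm, Finset.mem_univ _⟩
    have hp0 : 0 ≤ p := Finset.prod_nonneg fun i _ => hX.sg0 i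
    have hpe : ∏ i, σ i = σ u * (σ v * p) := by
      rw [← Finset.mul_prod_erase _ _ (Finset.mem_univ u), ← Finset.mul_prod_erase _ _ hvmem]
    calc _ ≤ ∑ P ∈ X with R P u ∧ R' P v, p * ((Real.sqrt (tw (-P.s)) * Am u (P.pr u)) *
          (Real.sqrt (tw (-P.s)) * Am v (P.pr v))) := by
          refine Finset.sum_le_sum fun P hP => ?_
          have hPX := (Finset.mem_filter.1 hP).1
          rw [← Finset.mul_prod_erase _ _ (Finset.mem_univ u), ← Finset.mul_prod_erase _ _ hvmem]
          have h2 : ∏ i ∈ (Finset.univ.erase u).erase v, Am i (P.pr i) ≤ p :=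
            Finset.prod_le_prod (fun i _ => hX.am0 i _) (fun i _ => hamσ i P hPX)
          have h3 : Real.sqrt (tw (-P.s)) * Real.sqrt (tw (-P.s)) = tw (-P.s) :=
            Real.mul_self_sqrt (tw_pos _).le
          have h4 := hX.am0 u (P.pr u)
          have h5 := hX.am0 v (P.pr v)
          have h6 := tw_pos (-P.s)
          calc _ = tw (-P.s) * Am u (P.pr u) * Am v (P.pr v) *
                ∏ i ∈ (Finset.univ.erase u).erase v, Am i (P.pr i) := by ring
            _ ≤ tw (-P.s) * Am u (P.pr u) * Am v (P.pr v) * p := by gcongr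
            _ = _ := by linear_combination (-(Am u (P.pr u) * Am v (P.pr v) * p)) * h3
      _ = p * ∑ P ∈ X with R P u ∧ R' P v, ((Real.sqrt (tw (-P.s)) * Am u (P.pr u)) *
          (Real.sqrt (tw (-P.s)) * Am v (P.pr v))) := by rw [Finset.mul_sum]
      _ ≤ p * (Real.sqrt (∑ P ∈ X with R P u ∧ R' P v, (Real.sqrt (tw (-P.s)) * Am u (P.pr u)) ^ 2) *
          Real.sqrt (∑ P ∈ X with R P u ∧ R' P v, (Real.sqrt (tw (-P.s)) * Am v (P.pr v)) ^ 2)) := by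
          gcongr
          exact Real.sum_mul_le_sqrt_mul_sqrt _ _ _
      _ ≤ p * (Real.sqrt (multC C5 n * (2 * σ u ^ 2) * J) * Real.sqrt (multC C5 n * (2 * σ v ^ 2) * J')) := by
          have hsq : ∀ (P : MT n) (b : ℝ), (Real.sqrt (tw (-P.s)) * b) ^ 2 = tw (-P.s) * b ^ 2 := by
            intro P b; rw [mul_pow, Real.sq_sqrt (tw_pos _).le]
          simp_rw [hsq]
          have hpos : ∀ (P : MT n) (b : ℝ), 0 ≤ tw (-P.s) * b ^ 2 := fun P b => by
            have := tw_pos (-P.s); positivity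
          gcongr
          · refine (Finset.sum_le_sum_of_subset_of_nonneg ?_ fun P _ _ => hpos P _).trans (hs1 u)
            intro P hP
            simp only [Finset.mem_filter] at hP ⊢
            exact ⟨hP.1, hP.2.1⟩
          · refine (Finset.sum_le_sum_of_subset_of_nonneg ?_ fun P _ _ => hpos P _).trans (hs2 v)
            intro P hP
            simp only [Finset.mem_filter] at hP ⊢
            exact ⟨hP.1, hP.2.2⟩
      _ = _ := by
          have hu := hX.sg0 u
          have hv := hX.sg0 v
          have e1 : ∀ a b : ℝ, 0 ≤ a → 0 ≤ b → Real.sqrt (multC C5 n * (2 * a ^ 2) * b) =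
              a * (Real.sqrt (multC C5 n * 2) * Real.sqrt b) := by
            intro a b ha hb
            have : multC C5 n * (2 * a ^ 2) * b = a ^ 2 * ((multC C5 n * 2) * b) := by ring
            rw [this, Real.sqrt_mul (by positivity), Real.sqrt_sq ha, Real.sqrt_mul (by positivity)]
          rw [e1 _ _ hu hJ0, e1 _ _ hv hJ0', hpe]
          have e3 : Real.sqrt (multC C5 n * 2) * Real.sqrt (multC C5 n * 2) = multC C5 n * 2 :=
            Real.mul_self_sqrt (by positivity)
          linear_combination (p * σ u * σ v * Real.sqrt J * Real.sqrt J') * e3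
  have hpi : 0 ≤ ∏ i, σ i := Finset.prod_nonneg fun i _ => hX.sg0 i
  have hfin : ∑ P ∈ X, tw (-P.s) * ∏ i, Am i (P.pr i) ≤
      ∑ uv : Fin n × Fin n, if uv.1 ≠ uv.2 then
        ∑ P ∈ X with R P uv.1 ∧ R' P uv.2, tw (-P.s) * ∏ i, Am i (P.pr i) else 0 := by
    have hterm : ∀ P : MT n, 0 ≤ tw (-P.s) * ∏ i, Am i (P.pr i) := fun P =>
      mul_nonneg (tw_pos _).le (Finset.prod_nonneg fun i _ => hX.am0 i _)
    have e : ∀ uv : Fin n × Fin n, (if uv.1 ≠ uv.2 then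
        ∑ P ∈ X with R P uv.1 ∧ R' P uv.2, tw (-P.s) * ∏ i, Am i (P.pr i) else 0) =
        ∑ P ∈ X, if (uv.1 ≠ uv.2 ∧ R P uv.1 ∧ R' P uv.2) then tw (-P.s) * ∏ i, Am i (P.pr i) else 0 := by
      intro uv
      by_cases h : uv.1 ≠ uv.2
      · rw [if_pos h, Finset.sum_filter]
        refine Finset.sum_congr rfl fun P _ => ?_
        simp only [h, true_and, ne_eq, not_false_eq_true]
      · rw [if_neg h]
        symm
        apply Finset.sum_eq_zero
        intro P _
        rw [if_neg (fun hh => h hh.1)]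
    simp_rw [e]
    rw [Finset.sum_comm]
    refine Finset.sum_le_sum fun P hP => ?_
    obtain ⟨u, v, huv, h1, h2⟩ := hall P hP
    have := Finset.single_le_sum (f := fun uv : Fin n × Fin n =>
      if (uv.1 ≠ uv.2 ∧ R P uv.1 ∧ R' P uv.2) then tw (-P.s) * ∏ i, Am i (P.pr i) else 0)
      (fun uv _ => by split_ifs; exacts [hterm P, le_rfl]) (Finset.mem_univ (u, v))
    simp only [if_pos (show u ≠ v ∧ R P u ∧ R' P v from ⟨huv, h1, h2⟩)] at this
    exact this
  have hJb := prod_Nc_integral A hAne FF x V hx (fun i _ => hP i) (fun i _ => hV i)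
  have hJb' := prod_Nc_integral A' hAne' FF x V hx (fun i _ => hP i) (fun i _ => hV i)
  rw [hA] at hJb
  rw [hA'] at hJb'
  have hsJ : Real.sqrt J * Real.sqrt J' ≤ k * k.factorial * V * ∏ i ∈ A ∪ A', Real.sqrt (x i) := by
    rw [Finset.prod_union hd]
    have e : ∀ B : Finset (Fin n), Real.sqrt (∏ i ∈ B, x i) = ∏ i ∈ B, Real.sqrt (x i) := fun B =>
      Real.sqrt_prod B (fun i _ => (hx i).le)
    have h1 := Real.sqrt_le_sqrt hJb
    have h2 := Real.sqrt_le_sqrt hJb'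
    rw [Real.sqrt_mul (by positivity), e] at h1 h2
    calc _ ≤ (Real.sqrt (k * k.factorial * V) * ∏ i ∈ A, Real.sqrt (x i)) *
          (Real.sqrt (k * k.factorial * V) * ∏ i ∈ A', Real.sqrt (x i)) := by gcongr
      _ = (Real.sqrt (k * k.factorial * V) * Real.sqrt (k * k.factorial * V)) *
          ((∏ i ∈ A, Real.sqrt (x i)) * ∏ i ∈ A', Real.sqrt (x i)) := by ring
      _ = _ := by rw [Real.mul_self_sqrt (by positivity)]
  refine hfin.trans ?_
  calc _ ≤ ∑ uv : Fin n × Fin n, (∏ i, σ i) * (multC C5 n * 2 * (Real.sqrt J * Real.sqrt J')) := by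
        refine Finset.sum_le_sum fun uv _ => ?_
        split_ifs with h
        · exact hpair _ _ h
        · positivity
    _ = n ^ 2 * ((∏ i, σ i) * (multC C5 n * 2 * (Real.sqrt J * Real.sqrt J'))) := by
        rw [Finset.sum_const, Finset.card_univ, Fintype.card_prod, Fintype.card_fin, nsmul_eq_mul]
        push_cast; ring
    _ ≤ n ^ 2 * ((∏ i, σ i) * (multC C5 n * 2 * (k * k.factorial * V * ∏ i ∈ A ∪ A', Real.sqrt (x i)))) := by
        gcongr
    _ = _ := by unfold clsC; ring

end cls

/-! ## P10: near tiles, summation over levels -/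

lemma hyper {ι : Type*} [Fintype ι] (z β : ι → ℝ) (K : ℕ) (hβ0 : ∀ i, 0 ≤ β i) (hβ1 : ∀ i, β i ≤ 1)
    (hs : ∑ i, β i = K) : ∃ B : Finset ι, B.card = K ∧ ∑ i ∈ B, z i ≤ ∑ i, β i * z i := by
  have hK : K ≤ (Finset.univ : Finset ι).card := by
    have : (K : ℝ) ≤ ((Finset.univ : Finset ι).card : ℝ) := by
      rw [← hs]
      calc ∑ i, β i ≤ ∑ i : ι, (1 : ℝ) := Finset.sum_le_sum (fun i _ => hβ1 i)
        _ = _ := by simp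
    exact_mod_cast this
  have hne : (Finset.powersetCard K (Finset.univ : Finset ι)).Nonempty := Finset.powersetCard_nonempty.2 hK
  obtain ⟨B, hB, hmin⟩ := Finset.exists_min_image _ (fun B => ∑ i ∈ B, z i) hne
  have hBc : B.card = K := (Finset.mem_powersetCard.1 hB).2
  refine ⟨B, hBc, ?_⟩
  rcases B.eq_empty_or_nonempty with h0 | hBn
  · subst h0
    have hK0 : K = 0 := by simpa using hBc.symm
    have : ∀ i, β i = 0 := by
      subst hK0
      have := (Finset.sum_eq_zero_iff_of_nonneg (fun i _ => hβ0 i)).1 (by simpa using hs)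
      exact fun i => this i (Finset.mem_univ i)
    simp [this]
  · obtain ⟨b, hb, hbm⟩ := Finset.exists_max_image B z hBn
    have hout : ∀ i, i ∉ B → z b ≤ z i := by
      intro i hi
      have hm := hmin (insert i (B.erase b)) (by
        rw [Finset.mem_powersetCard]
        refine ⟨Finset.subset_univ _, ?_⟩
        rw [Finset.card_insert_of_notMem (by simp [hi]), Finset.card_erase_of_mem hb, hBc]
        have : 0 < K := by rw [← hBc]; exact Finset.card_pos.2 hBn
        omega)
      rw [Finset.sum_insert (by simp [hi]), ← Finset.add_sum_erase B z hb] at hm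
      linarith
    have key : ∑ i, β i * z i - ∑ i ∈ B, z i = ∑ i, (β i - if i ∈ B then 1 else 0) * (z i - z b) := by
      have e1 : ∑ i ∈ B, z i = ∑ i, (if i ∈ B then z i else 0) := by
        rw [Finset.sum_ite_mem, Finset.univ_inter]
      have e2 : (K : ℝ) = ∑ i, (if i ∈ B then (1 : ℝ) else 0) := by
        rw [Finset.sum_ite_mem, Finset.univ_inter]; simp [hBc]
      have e3 : ∑ i, (β i - if i ∈ B then 1 else 0) * z b = 0 := by
        rw [← Finset.sum_mul, Finset.sum_sub_distrib, hs, ← e2]; ring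
      have : ∑ i, (β i - if i ∈ B then 1 else 0) * (z i - z b) =
        ∑ i, (β i * z i - if i ∈ B then z i else 0) - ∑ i, (β i - if i ∈ B then 1 else 0) * z b := by
        rw [← Finset.sum_sub_distrib]
        refine Finset.sum_congr rfl (fun i _ => ?_)
        split_ifs <;> ring
      rw [this, e3, Finset.sum_sub_distrib, e1, sub_zero]
    have : 0 ≤ ∑ i, (β i - if i ∈ B then 1 else 0) * (z i - z b) := by
      refine Finset.sum_nonneg (fun i _ => ?_)
      split_ifs with h
      · nlinarith [hβ1 i, hbm i h]
      · exact mul_nonneg (by simpa using hβ0 i) (by linarith [hout i h])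
    linarith

lemma hyper_prod {ι : Type*} [Fintype ι] (x β : ι → ℝ) (K : ℕ) (hx : ∀ i, 0 < x i) (hβ0 : ∀ i, 0 ≤ β i)
    (hβ1 : ∀ i, β i ≤ 1) (hs : ∑ i, β i = K) :
    ∃ B : Finset ι, B.card = K ∧ ∏ i ∈ B, Real.sqrt (x i) ≤ ∏ i, (x i) ^ (β i / 2) := by
  obtain ⟨B, hB, h⟩ := hyper (fun i => Real.log (x i) / 2) β K hβ0 hβ1 hs
  refine ⟨B, hB, ?_⟩
  have e1 : ∏ i ∈ B, Real.sqrt (x i) = Real.exp (∑ i ∈ B, Real.log (x i) / 2) := by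
    rw [Real.exp_sum]
    refine Finset.prod_congr rfl (fun i _ => ?_)
    rw [Real.sqrt_eq_rpow, Real.rpow_def_of_pos (hx i)]; congr 1; ring
  have e2 : ∏ i, (x i) ^ (β i / 2) = Real.exp (∑ i, β i * (Real.log (x i) / 2)) := by
    rw [Real.exp_sum]
    refine Finset.prod_congr rfl (fun i _ => ?_)
    rw [Real.rpow_def_of_pos (hx i)]; congr 1; ring
  rw [e1, e2]
  exact Real.exp_le_exp.2 h

lemma geom_multi {n : ℕ} (r : Fin n → ℝ) (hr0 : ∀ i, 0 ≤ r i) (hr1 : ∀ i, r i < 1)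
    (S : Finset (Fin n → ℕ)) : ∑ v ∈ S, ∏ i, r i ^ v i ≤ ∏ i, (1 - r i)⁻¹ := by
  have hsub : S ⊆ Fintype.piFinset (fun _ : Fin n => Finset.range (S.sup (fun v => ∑ i, v i) + 1)) := by
    intro v hv
    rw [Fintype.mem_piFinset]
    intro i
    rw [Finset.mem_range]
    have h1 : v i ≤ ∑ i, v i := Finset.single_le_sum (f := v) (fun _ _ => Nat.zero_le _) (Finset.mem_univ i)
    have h2 : ∑ i, v i ≤ S.sup (fun v => ∑ i, v i) := Finset.le_sup (f := fun v : Fin n → ℕ => ∑ i, v i) hv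
    omega
  refine (Finset.sum_le_sum_of_subset_of_nonneg hsub
    (fun v _ _ => Finset.prod_nonneg (fun i _ => pow_nonneg (hr0 i) _))).trans ?_
  rw [← Finset.prod_univ_sum (t := fun _ : Fin n => Finset.range (S.sup (fun v => ∑ i, v i) + 1))
    (f := fun i m => r i ^ m)]
  refine Finset.prod_le_prod (fun i _ => Finset.sum_nonneg (fun m _ => pow_nonneg (hr0 i) _)) (fun i _ => ?_)
  rw [← tsum_geometric_of_lt_one (hr0 i) (hr1 i)]
  exact (summable_geometric_of_lt_one (hr0 i) (hr1 i)).sum_le_tsum _ (fun m _ => pow_nonneg (hr0 i) _)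

lemma big_interval (FF : Finset TTop) : ∃ L : ℤ, ∀ T ∈ FF, T.I ⊆ dI L 0 ∨ T.I ⊆ dI L (-1) := by
  set N : ℕ := ∑ T ∈ FF, (T.s.natAbs + ⌈|(T.q : ℝ) / tw T.s|⌉₊) with hN
  refine ⟨-(N : ℤ), fun T hT => ?_⟩
  have h1 : T.s.natAbs + ⌈|(T.q : ℝ) / tw T.s|⌉₊ ≤ N :=
    Finset.single_le_sum (f := fun T : TTop => T.s.natAbs + ⌈|(T.q : ℝ) / tw T.s|⌉₊)
      (fun _ _ => Nat.zero_le _) hT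
  have h2 : -(N : ℤ) ≤ T.s := by omega
  have h3 : |(T.q : ℝ) / tw T.s| < tw N := by
    rw [tw_natCast]
    have a : |(T.q : ℝ) / tw T.s| ≤ N := (Nat.le_ceil _).trans (by exact_mod_cast (by omega))
    have b : (N : ℝ) < 2 ^ N := by exact_mod_cast Nat.lt_two_pow_self
    linarith
  have h4 : |tw (-(N : ℤ)) * ((T.q : ℝ) / tw T.s)| < 1 := by
    rw [abs_mul, abs_of_pos (tw_pos _), tw_neg, inv_mul_lt_iff₀ (tw_pos _)]; linarith
  rw [abs_lt] at h4
  have hx := dI_left T.s T.q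
  rcases le_or_gt 0 (tw (-(N : ℤ)) * ((T.q : ℝ) / tw T.s)) with h | h
  · left
    refine dI_nested h2 (Set.not_disjoint_iff.2 ⟨_, hx, ?_⟩)
    rw [mem_dI]; push_cast; constructor <;> linarith
  · right
    refine dI_nested h2 (Set.not_disjoint_iff.2 ⟨_, hx, ?_⟩)
    rw [mem_dI]; push_cast; constructor <;> linarith

lemma wt_int_le {F : ℝ → ℂ} (hF : FOK F) (s0 q0 : ℤ) :
    ∫ t, ‖F t‖ ^ 2 / wt s0 q0 t ≤ ∫ t, ‖F t‖ ^ 2 := by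
  have hi : Integrable (fun t => ‖F t‖ ^ 2) := by
    refine hF.int.norm.mono' (hF.meas.norm.pow_const 2).aestronglyMeasurable
      (Filter.Eventually.of_forall (fun t => ?_))
    rw [Real.norm_of_nonneg (by positivity)]
    have := hF.bd t
    nlinarith [norm_nonneg (F t)]
  refine integral_mono_of_nonneg (Filter.Eventually.of_forall (fun t => by
    have := wt_pos s0 q0 t; positivity)) hi (Filter.Eventually.of_forall (fun t => ?_))
  refine div_le_self (by positivity) ?_
  unfold wt; nlinarith [sq_nonneg (tw s0 * t - q0)]

lemma besselC_pos {N0 K : ℝ} (hN : 0 < N0) (hK : 0 ≤ K) : 0 < besselC N0 K := by unfold besselC; positivity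
lemma sizeC_pos {N0 K : ℝ} (hN : 0 < N0) (hK : 0 ≤ K) : 0 < sizeC N0 K := by unfold sizeC Cb; positivity

/-- packing constant -/
def packC (N0 C4 : ℝ) : ℝ := 2048 * besselC N0 C4 / sizeC N0 C4

/-- one coordinate level structure -/
lemma levels_near {N0 C4 : ℝ} {h F : ℝ → ℂ} {Ω : Set ℝ} {D V : ℝ} (hN : 0 < N0) (hC4 : 8 * N0 ≤ C4)
    (hh : Good N0 h) (hF : FOK F) (hD : Dens F Ω D) (hD0 : 0 < D) (hV : 0 ≤ V) (hFV : ∫ t, ‖F t‖ ^ 2 ≤ D * V)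
    (S : Finset Tile) (hnear : ∀ p ∈ S, NearO Ω p) (hsp : SparseT N0 C4 S) :
    ∃ (Sm : ℕ → Finset Tile) (FF : ℕ → Finset TTop), 
      (∀ m, SizeLE N0 C4 (fun p => ‖cf h F p‖) (Sm m) (Real.sqrt (sizeC N0 C4) * D / 2 ^ m)) ∧
      (∀ p ∈ S, cf h F p ≠ 0 → ∃ m, p ∈ Sm m ∧ ∃ T ∈ FF m, nearT C4 p T) ∧
      (∀ m, PackL (FF m) (packC N0 C4 * 4 ^ m / D)) ∧
      (∀ m, ∑ T ∈ FF m, tw (-T.s) ≤ (packC N0 C4 * 4 ^ m / D) * V) := by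
  have hC40 : 0 ≤ C4 := by linarith
  have hs := sizeC_pos hN hC40
  have hb := besselC_pos hN hC40
  have hσ : 0 < Real.sqrt (sizeC N0 C4) * D := by positivity
  obtain ⟨Sm, FF, h0, hsub, hsz, htop, hcon, hpack⟩ := levels hN hC4 hh hF S hsp _ hσ
    (size_near hN hC4 hh hF hD S hnear hsp)
  have hsq : (Real.sqrt (sizeC N0 C4) * D) ^ 2 = sizeC N0 C4 * D ^ 2 := by
    rw [mul_pow, Real.sq_sqrt hs.le]
  refine ⟨Sm, FF, hsz, ?_, ?_, ?_⟩
  · intro p hp hcf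
    have hex : ∃ m, p ∉ Sm m := by
      by_contra hcon'
      push Not at hcon'
      have h1 : ∀ m, ‖cf h F p‖ ≤ Real.sqrt (sizeC N0 C4) * D / 2 ^ m := fun m =>
        SizeLE.single (by positivity) hC4 (hsz m) (hcon' m)
      have h2 : Filter.Tendsto (fun m : ℕ => Real.sqrt (sizeC N0 C4) * D / 2 ^ m) Filter.atTop (nhds 0) :=
        tendsto_const_nhds.div_atTop (tendsto_pow_atTop_atTop_of_one_lt one_lt_two)
      have h3 := ge_of_tendsto' h2 h1
      exact hcf (norm_le_zero_iff.1 h3)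
    have hf := Nat.find_spec hex
    have hpos : Nat.find hex ≠ 0 := by
      intro h; rw [h, h0] at hf; exact hf hp
    obtain ⟨m, hm⟩ := Nat.exists_eq_succ_of_ne_zero hpos
    have hmem : p ∈ Sm m := by
      have := Nat.find_min hex (m := m) (by omega)
      push Not at this
      exact this
    rw [hm] at hf
    exact ⟨m, hmem, htop m p hmem hf⟩
  · intro m T hT
    obtain ⟨p, hpS, hpT⟩ := hcon m T hT
    have h1 := hpack m T.s T.q
    have h2 := wt_dens hF hD (hnear p hpS) (s0 := T.s) (q0 := T.q) hpT
    refine h1.trans ?_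
    rw [hsq]
    calc _ ≤ 8 * besselC N0 C4 * 4 ^ m / (sizeC N0 C4 * D ^ 2) * (256 * D * tw (-T.s)) := by gcongr
      _ = _ := by unfold packC; field_simp; ring
  · intro m
    obtain ⟨L, hL⟩ := big_interval (FF m)
    have hb1 : ∀ q0 : ℤ, ∑ T ∈ FF m with T.I ⊆ dI L q0, tw (-T.s) ≤
        8 * besselC N0 C4 * 4 ^ m / (sizeC N0 C4 * D ^ 2) * (D * V) := by
      intro q0
      have h1 := hpack m L q0
      rw [hsq] at h1
      refine h1.trans ?_
      gcongr
      exact (wt_int_le hF L q0).trans hFV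
    have h2 : ∑ T ∈ FF m, tw (-T.s) ≤ ∑ T ∈ FF m with T.I ⊆ dI L 0, tw (-T.s) +
        ∑ T ∈ FF m with T.I ⊆ dI L (-1), tw (-T.s) := by
      rw [Finset.sum_filter, Finset.sum_filter, ← Finset.sum_add_distrib]
      refine Finset.sum_le_sum (fun T hT => ?_)
      have := tw_pos (-T.s)
      rcases hL T hT with h | h
      · rw [if_pos h]; split_ifs <;> linarith
      · rw [if_pos h]; split_ifs <;> linarith
    refine h2.trans ((add_le_add (hb1 0) (hb1 (-1))).trans ?_)
    have : packC N0 C4 * 4 ^ m / D * V =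
      256 * (8 * besselC N0 C4 * 4 ^ m / (sizeC N0 C4 * D ^ 2) * (D * V)) := by
      unfold packC; field_simp; ring
    rw [this]
    have : 0 ≤ 8 * besselC N0 C4 * 4 ^ m / (sizeC N0 C4 * D ^ 2) * (D * V) := by positivity
    linarith

def nearC (n k : ℕ) (C2 C3 N0 C4 : ℝ) (β : Fin n → ℝ) : ℝ :=
  clsC n k (C3 * (C4 + C2) + C2) * (∏ i, Real.sqrt (sizeC N0 C4) * packC N0 C4 ^ (β i / 2)) *
    ∏ i, (1 - (2 : ℝ) ^ (-(1 - β i)))⁻¹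

theorem near_total {n k : ℕ} {Γ' : Submodule ℝ (Fin n → ℝ)} {C3 Lw C2 N0 C4 : ℝ} (hk : 1 ≤ k) (hn : 1 ≤ n)
    (hND : ND n k Γ' C3) (hC3 : 0 ≤ C3) (hC2 : 0 ≤ C2) (hN : 0 < N0) (hL : n * (8 * N0) ≤ Lw)
    (hC4 : C3 * (8 * N0 + C2) + C2 ≤ C4) (hC48 : 8 * N0 ≤ C4) (β : Fin n → ℝ) (hβ0 : ∀ i, 0 < β i)
    (hβ1 : ∀ i, β i < 1) (hβs : ∑ i, β i = 2 * k) (h F : Fin n → ℝ → ℂ) (Ω : Set ℝ) (D : Fin n → ℝ) (V : ℝ)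
    (PP : Finset (MT n)) (hh : ∀ i, Good N0 (h i)) (hF : ∀ i, FOK (F i)) (hD0 : ∀ i, 0 < D i)
    (hD : ∀ i, Dens (F i) Ω (D i)) (hV : 0 ≤ V) (hFV : ∀ i, ∫ t, ‖F i t‖ ^ 2 ≤ D i * V)
    (hW : ∀ P ∈ PP, Whit Γ' Lw C2 P) (hnear : ∀ P ∈ PP, ∀ i, NearO Ω (P.pr i))
    (hsp : ∀ P ∈ PP, ∀ P' ∈ PP, P.s < P'.s → C4 * tw P.s ≤ N0 * tw P'.s) :
    ∑ P ∈ PP, tw (-P.s) * ∏ i, ‖cf (h i) (F i) (P.pr i)‖ ≤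
      nearC n k C2 C3 N0 C4 β * V * ∏ i, D i ^ (1 - β i / 2) := by
  have hC40 : 0 ≤ C4 := by linarith
  have hs := sizeC_pos hN hC40
  have hb := besselC_pos hN hC40
  have hpc : 0 < packC N0 C4 := by unfold packC; positivity
  have hcl : 0 ≤ clsC n k (C3 * (C4 + C2) + C2) := by
    unfold clsC multC; positivity
  choose Sm FF hsz hlev hpl hpg using fun i => levels_near hN hC48 (hh i) (hF i) (hD i) (hD0 i) hV (hFV i)
    (PP.image (fun P => P.pr i)) (by
      intro p hp; obtain ⟨P, hP, rfl⟩ := Finset.mem_image.1 hp; exact hnear P hP i) (by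
      intro p hp p' hp' hlt
      obtain ⟨P, hP, rfl⟩ := Finset.mem_image.1 hp
      obtain ⟨P', hP', rfl⟩ := Finset.mem_image.1 hp'
      exact hsp P hP P' hP' hlt)
  set f : MT n → ℝ := fun P => tw (-P.s) * ∏ i, ‖cf (h i) (F i) (P.pr i)‖ with hf
  set X := PP.filter (fun P => f P ≠ 0) with hX
  have hmv : ∀ P : MT n, ∃ v : Fin n → ℕ, P ∈ X → ∀ i, P.pr i ∈ Sm i (v i) ∧
      ∃ T ∈ FF i (v i), nearT C4 (P.pr i) T := by
    intro P
    by_cases hP : P ∈ X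
    · have hP' := Finset.mem_filter.1 hP
      have hne : ∀ i, cf (h i) (F i) (P.pr i) ≠ 0 := by
        intro i hi
        apply hP'.2
        simp only [hf]
        rw [Finset.prod_eq_zero (Finset.mem_univ i) (by rw [hi, norm_zero]), mul_zero]
      choose v hv using fun i => hlev i (P.pr i) (Finset.mem_image_of_mem _ hP'.1) (hne i)
      exact ⟨v, fun _ => hv⟩
    · exact ⟨fun _ => 0, fun h => absurd h hP⟩
  choose mv hmv using hmv
  set Gc : ℝ := clsC n k (C3 * (C4 + C2) + C2) * V * ∏ i, ((Real.sqrt (sizeC N0 C4) * packC N0 C4 ^ (β i / 2)) *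
    D i ^ (1 - β i / 2)) with hGc
  have hclass : ∀ v : Fin n → ℕ, ∑ P ∈ X with mv P = v, f P ≤
      Gc * ∏ i, ((2 : ℝ) ^ (-(1 - β i))) ^ v i := by
    intro v
    obtain ⟨B, hBc, hB⟩ := hyper_prod (fun i => packC N0 C4 * 4 ^ v i / D i) β (2 * k)
      (fun i => by have := hD0 i; positivity) (fun i => (hβ0 i).le) (fun i => (hβ1 i).le) (by push_cast; exact hβs)
    obtain ⟨A, hAB, hA⟩ := Finset.exists_subset_card_eq (s := B) (n := k) (by omega)
    have hA' : (B \ A).card = k := by rw [Finset.card_sdiff_of_subset hAB]; omega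
    have hc := cls_bound (Γ' := Γ') (N0 := N0) (X := X.filter (fun P => mv P = v))
      (Am := fun i p => ‖cf (h i) (F i) p‖)
      (σ := fun i => Real.sqrt (sizeC N0 C4) * D i / 2 ^ v i) (FF := fun i => FF i (v i))
      hk hn hND hC3 hC2 hN hL hC4 hC48
      (fun P hP => hW P (Finset.mem_filter.1 (Finset.mem_filter.1 hP).1).1)
      ⟨fun i p => norm_nonneg _, fun i => by have := hD0 i; positivity,
        fun i => ⟨Sm i (v i), fun P hP => by
          have := Finset.mem_filter.1 hP
          rw [← this.2]; exact (hmv P this.1 i).1, hsz i (v i)⟩,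
        fun i P hP => by
          have := Finset.mem_filter.1 hP
          rw [← this.2]; exact (hmv P this.1 i).2⟩ hA hA' Finset.disjoint_sdiff
      (fun i => packC N0 C4 * 4 ^ v i / D i) V (fun i => by have := hD0 i; positivity) hV
      (fun i => hpl i (v i)) (fun i => hpg i (v i))
    rw [Finset.union_sdiff_of_subset hAB] at hc
    refine hc.trans ?_
    have hD0' := hD0
    calc _ ≤ (clsC n k (C3 * (C4 + C2) + C2) * V * ∏ i, Real.sqrt (sizeC N0 C4) * D i / 2 ^ v i) *
          ∏ i, (packC N0 C4 * 4 ^ v i / D i) ^ (β i / 2) := by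
          refine mul_le_mul_of_nonneg_left hB (mul_nonneg (mul_nonneg hcl hV) (Finset.prod_nonneg (fun i _ => ?_)))
          have := hD0 i; positivity
      _ = Gc * ∏ i, ((2 : ℝ) ^ (-(1 - β i))) ^ v i := by
          rw [hGc, mul_assoc (clsC n k (C3 * (C4 + C2) + C2) * V), mul_assoc (clsC n k (C3 * (C4 + C2) + C2) * V),
            ← Finset.prod_mul_distrib, ← Finset.prod_mul_distrib]
          congr 1
          refine Finset.prod_congr rfl (fun i _ => ?_)
          have hd := hD0 i
          have e4 : ((4 : ℝ) ^ v i) ^ (β i / 2) = (2 : ℝ) ^ (β i * v i) := by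
            rw [← Real.rpow_natCast, ← Real.rpow_mul (by norm_num), show (4 : ℝ) = 2 ^ (2 : ℝ) by norm_num,
              ← Real.rpow_mul (by norm_num)]
            congr 1; ring
          have e5 : ((2 : ℝ) ^ (-(1 - β i))) ^ v i = (2 : ℝ) ^ (β i * v i) / 2 ^ v i := by
            rw [← Real.rpow_natCast, ← Real.rpow_mul (by norm_num), ← Real.rpow_natCast,
              ← Real.rpow_sub (by norm_num)]
            congr 1; ring
          rw [Real.div_rpow (by positivity) hd.le, Real.mul_rpow hpc.le (by positivity), e4, e5,
            Real.rpow_sub hd, Real.rpow_one]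
          ring
  have hGc0 : 0 ≤ Gc := by
    rw [hGc]
    refine mul_nonneg (mul_nonneg hcl hV) (Finset.prod_nonneg (fun i _ => ?_))
    have := hD0 i; positivity
  calc ∑ P ∈ PP, f P = ∑ P ∈ X, f P := by rw [hX, Finset.sum_filter_ne_zero]
    _ = ∑ v ∈ X.image mv, ∑ P ∈ X with mv P = v, f P :=
        (Finset.sum_fiberwise_of_maps_to (fun P hP => Finset.mem_image_of_mem mv hP) f).symm
    _ ≤ ∑ v ∈ X.image mv, Gc * ∏ i, ((2 : ℝ) ^ (-(1 - β i))) ^ v i := Finset.sum_le_sum (fun v _ => hclass v)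
    _ = Gc * ∑ v ∈ X.image mv, ∏ i, ((2 : ℝ) ^ (-(1 - β i))) ^ v i := by rw [Finset.mul_sum]
    _ ≤ Gc * ∏ i, (1 - (2 : ℝ) ^ (-(1 - β i)))⁻¹ := by
        refine mul_le_mul_of_nonneg_left (geom_multi _ (fun i => by positivity) (fun i => ?_) _) hGc0
        exact Real.rpow_lt_one_of_one_lt_of_neg (by norm_num) (by linarith [hβ1 i])
    _ = _ := by
        rw [hGc, nearC, Finset.prod_mul_distrib]; ring

/-! ## P11: deep tiles -/

lemma single_bessel {N0 : ℝ} {h F : ℝ → ℂ} (hN : 0 < N0) (hh : Good N0 h) (hF : FOK F) (U : Finset Tile)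
    (s0 q0 : ℤ) (hU : ∀ p ∈ U, p.s = s0 ∧ p.q = q0) :
    ∑ p ∈ U, ‖cf h F p‖ ^ 2 ≤ 128 * (4 * N0 + 1) * (tw s0 * ∫ t, ‖F t‖ ^ 2 / wt s0 q0 t) := by
  have hUJ : ∀ p ∈ U, p.I ⊆ dI s0 q0 := fun p hp => by
    unfold Tile.I; rw [(hU p hp).1, (hU p hp).2]
  have h1 := HH_gram_split hN.le hh (cf h F) U s0 q0 hUJ
  have h0 : ∑ p ∈ U, ∑ p' ∈ U with CrossRel N0 p p',
      ‖cf h F p‖ * ‖cf h F p'‖ * (tw (-p'.s) * rho (tw p.s * (p'.q / tw p'.s) - p.q) ^ 4) = 0 := by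
    refine Finset.sum_eq_zero (fun p hp => ?_)
    rw [Finset.filter_false_of_mem, Finset.sum_empty]
    intro p' hp' hc
    have := hc.1
    rw [(hU p hp).1, (hU p' hp').1] at this
    exact lt_irrefl _ this
  rw [h0, mul_zero, add_zero] at h1
  have hB : 0 < 128 * (4 * N0 + 1) := by positivity
  have h2 := sum_sq_le hh hF U s0 q0 hUJ _ hB
  set S := ∑ p ∈ U, tw (-p.s) * ‖cf h F p‖ ^ 2 with hS
  set Y := ∫ t, ‖F t‖ ^ 2 / wt s0 q0 t
  set Bc := 128 * (4 * N0 + 1)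
  have h3 : 1 / (2 * Bc) * ∫ t, wt s0 q0 t * ‖HH h (cf h F) U t‖ ^ 2 ≤ S / 2 := by
    calc _ ≤ 1 / (2 * Bc) * (Bc * S) := by gcongr
      _ = S / 2 := by field_simp
  have h4 : S ≤ Bc * Y := by linarith
  have h5 : S = tw (-s0) * ∑ p ∈ U, ‖cf h F p‖ ^ 2 := by
    rw [hS, Finset.mul_sum]
    refine Finset.sum_congr rfl (fun p hp => ?_)
    rw [(hU p hp).1]
  have h6 : ∑ p ∈ U, ‖cf h F p‖ ^ 2 = tw s0 * S := by
    rw [h5, ← mul_assoc, tw_neg, mul_inv_cancel₀ (tw_ne s0), one_mul]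
  rw [h6]
  calc tw s0 * S ≤ tw s0 * (Bc * Y) := mul_le_mul_of_nonneg_left h4 (tw_pos s0).le
    _ = _ := by ring

lemma deep_sup {N0 : ℝ} {h F : ℝ → ℂ} (hh : Good N0 h) (hF : FOK F) {Ω : Set ℝ} {D : ℝ} (hD : Dens F Ω D)
    {x c : ℝ} (hx : x ∉ Ω) (hc : 0 ≤ c) (p : Tile) (hp : |tw p.s * x - p.q| ≤ c) :
    ‖cf h F p‖ ≤ (1 + c) ^ 2 * (8 * D) := by
  have h1 := cf_le_int hh hF p
  have h2 := dens_rho' hF hD hx (tw_pos p.s) hc hp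
  refine h1.trans ((mul_le_mul_of_nonneg_left h2 (tw_pos p.s).le).trans (le_of_eq ?_))
  have := tw_ne p.s
  field_simp

lemma deep_l2 {N0 : ℝ} {h F : ℝ → ℂ} (hN : 0 < N0) (hh : Good N0 h) (hF : FOK F) {Ω : Set ℝ} {D : ℝ}
    (hD : Dens F Ω D) {x c : ℝ} (hx : x ∉ Ω) (hc : 0 ≤ c) (U : Finset Tile)
    (s0 q0 : ℤ) (hU : ∀ p ∈ U, p.s = s0 ∧ p.q = q0) (hp : |tw s0 * x - q0| ≤ c) :
    ∑ p ∈ U, ‖cf h F p‖ ^ 2 ≤ 128 * (4 * N0 + 1) * (2 * ((1 + c) ^ 2 * (8 * D))) := by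
  refine (single_bessel hN hh hF U s0 q0 hU).trans ?_
  have h2 := dens_rho' hF hD hx (tw_pos s0) hc hp
  have h3 : ∫ t, ‖F t‖ ^ 2 / wt s0 q0 t ≤ 2 * ∫ t, ‖F t‖ * rho (tw s0 * t - q0) ^ 2 := by
    rw [← integral_const_mul]
    refine integral_mono (F_wt_integrable hF s0 q0) ((F_rho_integrable hF _ _ 2).const_mul 2) (fun t => ?_)
    simp only
    have a := wt_inv_le s0 q0 t
    have b := hF.bd t
    have c : 0 ≤ 1 / wt s0 q0 t := by have := wt_pos s0 q0 t; positivity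
    calc ‖F t‖ ^ 2 / wt s0 q0 t = ‖F t‖ * (‖F t‖ * (1 / wt s0 q0 t)) := by ring
      _ ≤ ‖F t‖ * (1 * (2 * rho (tw s0 * t - q0) ^ 2)) := by gcongr
      _ = _ := by ring
  have h4 : tw s0 * ∫ t, ‖F t‖ ^ 2 / wt s0 q0 t ≤ 2 * ((1 + c) ^ 2 * (8 * D)) := by
    calc _ ≤ tw s0 * (2 * ((1 + c) ^ 2 * (8 * D / tw s0))) :=
          mul_le_mul_of_nonneg_left (h3.trans (by linarith)) (tw_pos s0).le
      _ = _ := by have := tw_ne s0; field_simp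
  gcongr

/-- the polynomially amplified packet generator -/
def amp (N : ℕ) (h : ℝ → ℂ) (u : ℝ) : ℂ := (((1 + u ^ 2) ^ N : ℝ) : ℂ) * h u

/-- damped function -/
def damp (N : ℕ) (d : ℝ) (s q : ℤ) (F : ℝ → ℂ) (t : ℝ) : ℂ :=
  ((d ^ (2 * N) / (1 + (tw s * t - q) ^ 2) ^ N : ℝ) : ℂ) * F t

lemma cf_damp {N : ℕ} {d : ℝ} (hd : 0 < d) (h F : ℝ → ℂ) (p : Tile) :
    ‖cf h F p‖ = (d ^ (2 * N))⁻¹ * ‖cf (amp N h) (damp N d p.s p.q F) p‖ := by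
  have : cf (amp N h) (damp N d p.s p.q F) p = ((d ^ (2 * N) : ℝ) : ℂ) * cf h F p := by
    unfold cf
    rw [mul_left_comm]
    congr 1
    rw [← integral_const_mul]
    refine integral_congr_ae (Filter.Eventually.of_forall (fun t => ?_))
    simp only
    unfold damp pk amp
    simp only [map_mul, Complex.conj_ofReal]
    have h1 : (((1 + (tw p.s * t - p.q) ^ 2) ^ N : ℝ) : ℂ) ≠ 0 := by
      exact_mod_cast (by positivity : ((1 + (tw p.s * t - p.q) ^ 2) ^ N : ℝ) ≠ 0)
    rw [Complex.ofReal_div]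
    field_simp
  rw [this, norm_mul, Complex.norm_real, Real.norm_of_nonneg (by positivity), ← mul_assoc,
    inv_mul_cancel₀ (by positivity), one_mul]

lemma damp_ok {N : ℕ} {d : ℝ} (hd : 0 < d) {F : ℝ → ℂ} (hF : FOK F) (s q : ℤ)
    (hsup : ∀ t, F t ≠ 0 → d ≤ |tw s * t - q|) : FOK (damp N d s q F) := by
  have hb : ∀ t, ‖damp N d s q F t‖ ≤ ‖F t‖ := by
    intro t
    by_cases h0 : F t = 0
    · simp [damp, h0]
    unfold damp
    rw [norm_mul, Complex.norm_real, Real.norm_of_nonneg (by positivity)]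
    refine mul_le_of_le_one_left (norm_nonneg _) ?_
    rw [div_le_one (by positivity), pow_mul]
    refine pow_le_pow_left₀ (by positivity) ?_ N
    have := hsup t h0
    rw [← sq_abs (tw s * t - q)]
    nlinarith
  have hm : Measurable (damp N d s q F) := by
    unfold damp
    refine Measurable.mul (Complex.measurable_ofReal.comp ?_) hF.meas
    exact Continuous.measurable (Continuous.div (by fun_prop) (by fun_prop) (fun t => by positivity))
  exact ⟨hm, fun t => (hb t).trans (hF.bd t), hF.int.norm.mono' hm.aestronglyMeasurable
    (Filter.Eventually.of_forall hb)⟩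

lemma triv_sup {N0 : ℝ} {h F : ℝ → ℂ} (hh : Good N0 h) (hF : FOK F) (p : Tile) : ‖cf h F p‖ ≤ 4 := by
  refine (cf_le_int hh hF p).trans ?_
  have h1 : ∫ t, ‖F t‖ * rho (tw p.s * t - p.q) ^ 2 ≤ ∫ t, rho (tw p.s * t - p.q) ^ 2 :=
    integral_mono (F_rho_integrable hF _ _ 2) (rho_sq_aff_integrable (tw_pos p.s) _) (fun t =>
      mul_le_of_le_one_left (by have := rho_nonneg (tw p.s * t - p.q); positivity) (hF.bd t))
  have h2 := rho_sq_aff_integral (tw_pos p.s) (p.q : ℝ)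
  calc _ ≤ tw p.s * (4 / tw p.s) := mul_le_mul_of_nonneg_left (h1.trans h2) (tw_pos _).le
    _ = 4 := by have := tw_ne p.s; field_simp

lemma triv_l2 {N0 : ℝ} {h F : ℝ → ℂ} (hN : 0 < N0) (hh : Good N0 h) (hF : FOK F) (U : Finset Tile)
    (s0 q0 : ℤ) (hU : ∀ p ∈ U, p.s = s0 ∧ p.q = q0) :
    ∑ p ∈ U, ‖cf h F p‖ ^ 2 ≤ 128 * (4 * N0 + 1) * 8 := by
  refine (single_bessel hN hh hF U s0 q0 hU).trans ?_
  have h1 : ∫ t, ‖F t‖ ^ 2 / wt s0 q0 t ≤ ∫ t, 1 / wt s0 q0 t := by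
    refine integral_mono (F_wt_integrable hF s0 q0) (wt_inv_integrable s0 q0) (fun t => ?_)
    have := wt_pos s0 q0 t
    have b := hF.bd t
    simp only
    gcongr
    exact pow_le_one₀ (norm_nonneg _) b
  have h2 := wt_inv_integral s0 q0
  have : tw s0 * ∫ t, ‖F t‖ ^ 2 / wt s0 q0 t ≤ 8 := by
    calc _ ≤ tw s0 * (8 * tw (-s0)) := mul_le_mul_of_nonneg_left (h1.trans h2) (tw_pos _).le
      _ = 8 := by rw [tw_neg]; have := tw_ne s0; field_simp
  gcongr

lemma prod_sq_count {n k : ℕ} {Γ' : Submodule ℝ (Fin n → ℝ)} {C3 Lw C2 : ℝ} (hND : ND n k Γ' C3) (hC3 : 0 ≤ C3)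
    (hC2 : 0 ≤ C2) (X : Finset (MT n)) (s q : ℤ) (hX : ∀ P ∈ X, P.s = s ∧ P.q = q)
    (hW : ∀ P ∈ X, Whit Γ' Lw C2 P) (Am : Fin n → Tile → ℝ) {A : Finset (Fin n)} (hA : A.card = k) :
    ∑ P ∈ X, ∏ i ∈ A, Am i (P.pr i) ^ 2 ≤
      multC (C3 * (C2 + C2) + C2) n * ∏ i ∈ A, ∑ p ∈ X.image (fun P => P.pr i), Am i p ^ 2 := by
  have h1 := sum_fiber_le X (fun P => (fun i : A => P.pr i)) (fun b => ∏ i : A, Am i (b i) ^ 2)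
    (fun b => Finset.prod_nonneg (fun i _ => sq_nonneg _)) (multC (C3 * (C2 + C2) + C2) n) (by
      intro b hb
      obtain ⟨P0, hP0, rfl⟩ := Finset.mem_image.1 hb
      obtain ⟨γ, hγ, hγn⟩ := (hW P0 hP0).near
      refine mt_count _ (by positivity) _ s q (fun i => γ i / tw s) ?_
      intro P hP
      obtain ⟨hPX, hPe⟩ := Finset.mem_filter.1 hP
      refine ⟨(hX P hPX).1, (hX P hPX).2, ?_⟩
      have hz : ∀ i ∈ A, P.ζ i = P0.ζ i := by
        intro i hi
        have := congrFun hPe ⟨i, hi⟩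
        simp only [MT.pr, Tile.mk.injEq] at this
        exact this.2.2
      have := whit_near hND (hW P hPX) hA hγ (b := C2) (by
        intro i hi
        rw [hz i hi, (hX P hPX).1, ← (hX P0 hP0).1]; exact hγn i)
      rw [(hX P hPX).1] at this
      exact this)
  have e : ∀ P ∈ X, ∏ i ∈ A, Am i (P.pr i) ^ 2 = ∏ i : A, Am i (P.pr i) ^ 2 := fun P _ =>
    (Finset.prod_coe_sort A (fun i => Am i (P.pr i) ^ 2)).symm
  rw [Finset.sum_congr rfl e]
  refine h1.trans (mul_le_mul_of_nonneg_left ?_ (by unfold multC; positivity))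
  rw [← Finset.prod_coe_sort A (fun i => ∑ p ∈ X.image (fun P => P.pr i), Am i p ^ 2),
    Finset.prod_univ_sum (t := fun i : A => X.image (fun P => P.pr i)) (f := fun i p => Am i p ^ 2)]
  refine Finset.sum_le_sum_of_subset_of_nonneg ?_ (fun b _ _ => Finset.prod_nonneg (fun i _ => sq_nonneg _))
  intro b hb
  obtain ⟨P0, hP0, rfl⟩ := Finset.mem_image.1 hb
  rw [Fintype.mem_piFinset]
  exact fun i => Finset.mem_image_of_mem _ hP0

lemma interval_sum {n k : ℕ} {Γ' : Submodule ℝ (Fin n → ℝ)} {C3 Lw C2 : ℝ} (hND : ND n k Γ' C3) (hC3 : 0 ≤ C3)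
    (hC2 : 0 ≤ C2) (X : Finset (MT n)) (s q : ℤ) (hX : ∀ P ∈ X, P.s = s ∧ P.q = q)
    (hW : ∀ P ∈ X, Whit Γ' Lw C2 P) (Am : Fin n → Tile → ℝ) (hAm : ∀ i p, 0 ≤ Am i p)
    (w y β : Fin n → ℝ) (hw : ∀ i, 0 < w i) (hy : ∀ i, 0 < y i) (hβ0 : ∀ i, 0 ≤ β i) (hβ1 : ∀ i, β i ≤ 1)
    (hβs : ∑ i, β i = 2 * k) (hsup : ∀ i, ∀ P ∈ X, Am i (P.pr i) ≤ w i)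
    (hl2 : ∀ i, ∑ p ∈ X.image (fun P => P.pr i), Am i p ^ 2 ≤ w i ^ 2 * y i) :
    ∑ P ∈ X, ∏ i, Am i (P.pr i) ≤ multC (C3 * (C2 + C2) + C2) n * ∏ i, w i * y i ^ (β i / 2) := by
  obtain ⟨B, hBc, hB⟩ := hyper_prod y β (2 * k) hy hβ0 hβ1 (by push_cast; exact hβs)
  obtain ⟨A, hAB, hA⟩ := Finset.exists_subset_card_eq (s := B) (n := k) (by omega)
  have hA' : (B \ A).card = k := by rw [Finset.card_sdiff_of_subset hAB]; omega
  set Mc := multC (C3 * (C2 + C2) + C2) n with hMc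
  have hMc0 : 0 ≤ Mc := by rw [hMc]; unfold multC; positivity
  have hsq : ∀ A : Finset (Fin n), A.card = k →
      Real.sqrt (∑ P ∈ X, (∏ i ∈ A, Am i (P.pr i)) ^ 2) ≤ Real.sqrt Mc * ∏ i ∈ A, w i * Real.sqrt (y i) := by
    intro A hA
    have h1 : ∑ P ∈ X, (∏ i ∈ A, Am i (P.pr i)) ^ 2 ≤ Mc * ∏ i ∈ A, (w i * Real.sqrt (y i)) ^ 2 := by
      simp_rw [← Finset.prod_pow]
      refine (prod_sq_count hND hC3 hC2 X s q hX hW Am hA).trans (mul_le_mul_of_nonneg_left ?_ hMc0)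
      refine Finset.prod_le_prod (fun i _ => Finset.sum_nonneg (fun p _ => sq_nonneg _)) (fun i _ => ?_)
      rw [mul_pow, Real.sq_sqrt (hy i).le]; exact hl2 i
    refine (Real.sqrt_le_sqrt h1).trans (le_of_eq ?_)
    rw [Real.sqrt_mul hMc0, Finset.prod_pow, Real.sqrt_sq]
    exact Finset.prod_nonneg (fun i _ => mul_nonneg (hw i).le (Real.sqrt_nonneg _))
  have hsplit : ∀ g : Fin n → ℝ, ∏ i, g i = (∏ i ∈ Finset.univ \ B, g i) * ((∏ i ∈ A, g i) * ∏ i ∈ B \ A, g i) := by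
    intro g
    rw [mul_comm (∏ i ∈ A, g i), Finset.prod_sdiff hAB, Finset.prod_sdiff (Finset.subset_univ B)]
  have hpn : ∀ (S : Finset (Fin n)) (P : MT n), 0 ≤ ∏ i ∈ S, Am i (P.pr i) := fun S P =>
    Finset.prod_nonneg (fun i _ => hAm i _)
  calc ∑ P ∈ X, ∏ i, Am i (P.pr i)
      ≤ ∑ P ∈ X, (∏ i ∈ Finset.univ \ B, w i) * ((∏ i ∈ A, Am i (P.pr i)) * ∏ i ∈ B \ A, Am i (P.pr i)) := by
        refine Finset.sum_le_sum (fun P hP => ?_)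
        rw [hsplit]
        refine mul_le_mul_of_nonneg_right (Finset.prod_le_prod (fun i _ => hAm i _) (fun i _ => hsup i P hP))
          (mul_nonneg (hpn _ _) (hpn _ _))
    _ = (∏ i ∈ Finset.univ \ B, w i) * ∑ P ∈ X, (∏ i ∈ A, Am i (P.pr i)) * ∏ i ∈ B \ A, Am i (P.pr i) := by
        rw [Finset.mul_sum]
    _ ≤ (∏ i ∈ Finset.univ \ B, w i) * ((Real.sqrt Mc * ∏ i ∈ A, w i * Real.sqrt (y i)) *
          (Real.sqrt Mc * ∏ i ∈ B \ A, w i * Real.sqrt (y i))) := by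
        refine mul_le_mul_of_nonneg_left ?_ (Finset.prod_nonneg (fun i _ => (hw i).le))
        refine (Real.sum_mul_le_sqrt_mul_sqrt X _ _).trans ?_
        exact mul_le_mul (hsq A hA) (hsq _ hA') (Real.sqrt_nonneg _) (mul_nonneg (Real.sqrt_nonneg _)
          (Finset.prod_nonneg (fun i _ => mul_nonneg (hw i).le (Real.sqrt_nonneg _))))
    _ = Mc * ((∏ i, w i) * ∏ i ∈ B, Real.sqrt (y i)) := by
        rw [hsplit w, ← Finset.prod_sdiff hAB (f := fun i => Real.sqrt (y i)), Finset.prod_mul_distrib,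
          Finset.prod_mul_distrib]
        have := Real.mul_self_sqrt hMc0
        linear_combination (∏ i ∈ Finset.univ \ B, w i) * (∏ i ∈ A, w i) * (∏ i ∈ B \ A, w i) *
          (∏ i ∈ A, Real.sqrt (y i)) * (∏ i ∈ B \ A, Real.sqrt (y i)) * this
    _ ≤ Mc * ((∏ i, w i) * ∏ i, y i ^ (β i / 2)) := by
        refine mul_le_mul_of_nonneg_left (mul_le_mul_of_nonneg_left hB
          (Finset.prod_nonneg (fun i _ => (hw i).le))) hMc0
    _ = _ := by rw [Finset.prod_mul_distrib]

/-- rescaled distance of an interval to the complement of `Ω` -/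
def ddist (Ω : Set ℝ) (s q : ℤ) : ℝ := tw s * Metric.infDist ((q : ℝ) / tw s) Ωᶜ

lemma ddist_aux (s q : ℤ) (x : ℝ) : |tw s * x - q| = tw s * dist ((q : ℝ) / tw s) x := by
  rw [Real.dist_eq, abs_sub_comm]
  conv_rhs => rw [← abs_of_pos (tw_pos s)]
  rw [abs_of_pos (tw_pos s)]
  conv_rhs => enter [1]; rw [← abs_of_pos (tw_pos s)]
  rw [← abs_mul]; congr 1; have := tw_ne s; field_simp

lemma ddist_le {Ω : Set ℝ} {x : ℝ} (hx : x ∉ Ω) (s q : ℤ) : ddist Ω s q ≤ |tw s * x - q| := by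
  have h1 : Metric.infDist ((q : ℝ) / tw s) Ωᶜ ≤ dist ((q : ℝ) / tw s) x := Metric.infDist_le_dist_of_mem hx
  unfold ddist
  calc _ ≤ tw s * dist ((q : ℝ) / tw s) x := mul_le_mul_of_nonneg_left h1 (tw_pos s).le
    _ = |tw s * x - q| := (ddist_aux s q x).symm

lemma ddist_ge {Ω : Set ℝ} (hne : (Ωᶜ).Nonempty) {s q : ℤ} {b : ℝ} (h : ∀ x ∉ Ω, b ≤ |tw s * x - q|) :
    b ≤ ddist Ω s q := by
  unfold ddist
  have : b / tw s ≤ Metric.infDist ((q : ℝ) / tw s) Ωᶜ := by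
    rw [Metric.le_infDist hne]
    intro x hx
    rw [div_le_iff₀ (tw_pos s)]
    refine (h x hx).trans (le_of_eq ?_)
    rw [ddist_aux, mul_comm]
  rw [div_le_iff₀ (tw_pos s)] at this
  linarith

lemma ddist_ex {Ω : Set ℝ} (hne : (Ωᶜ).Nonempty) {s q : ℤ} (h : 0 < ddist Ω s q) :
    ∃ x ∉ Ω, |tw s * x - q| ≤ 2 * ddist Ω s q := by
  have h1 : 0 < Metric.infDist ((q : ℝ) / tw s) Ωᶜ := by
    unfold ddist at h; exact (mul_pos_iff_of_pos_left (tw_pos s)).1 h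
  obtain ⟨x, hx, hlt⟩ := (Metric.infDist_lt_iff hne).1 (show Metric.infDist ((q : ℝ) / tw s) Ωᶜ <
    2 * Metric.infDist ((q : ℝ) / tw s) Ωᶜ by linarith)
  refine ⟨x, hx, ?_⟩
  rw [ddist_aux]; unfold ddist
  have := mul_le_mul_of_nonneg_left hlt.le (tw_pos s).le
  linarith

lemma deep_intervals {Ω : Set ℝ} (hm : MeasurableSet Ω) (hfin : volume Ω < ⊤) (hne : (Ωᶜ).Nonempty)
    (Y : Finset (ℤ × ℤ)) (hY : ∀ a ∈ Y, 2 ≤ ddist Ω a.1 a.2) :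
    ∑ a ∈ Y, tw (-a.1) * (ddist Ω a.1 a.2)⁻¹ ≤ 4 * volume.real Ω := by
  have hsub : ∀ a ∈ Y, dI a.1 a.2 ⊆ Ω := by
    intro a ha t ht
    by_contra hcon
    have := ddist_le hcon a.1 a.2
    rw [mem_dI] at ht
    have h1 : |tw a.1 * t - a.2| ≤ 1 := by rw [abs_le]; constructor <;> linarith
    linarith [hY a ha]
  have hintg : ∀ a ∈ Y, IntegrableOn ((dI a.1 a.2).indicator (fun _ => (ddist Ω a.1 a.2)⁻¹)) Ω := by
    intro a _
    exact (integrableOn_const (hs := hfin.ne)).indicator (dI_measurable _ _)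
  have e : ∑ a ∈ Y, tw (-a.1) * (ddist Ω a.1 a.2)⁻¹ =
      ∫ t in Ω, ∑ a ∈ Y, (dI a.1 a.2).indicator (fun _ => (ddist Ω a.1 a.2)⁻¹) t := by
    rw [integral_finset_sum _ hintg]
    refine Finset.sum_congr rfl (fun a ha => ?_)
    rw [setIntegral_indicator (dI_measurable _ _), Set.inter_eq_self_of_subset_right (hsub a ha), setIntegral_const,
      dI_volume_real, smul_eq_mul]
  rw [e]
  have hpt : ∀ t ∈ Ω, ∑ a ∈ Y, (dI a.1 a.2).indicator (fun _ => (ddist Ω a.1 a.2)⁻¹) t ≤ 4 := by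
    intro t ht
    set δ := Metric.infDist t Ωᶜ with hδ
    have hδ0 : 0 ≤ δ := Metric.infDist_nonneg
    set Yt := Y.filter (fun a => t ∈ dI a.1 a.2) with hYt
    have e1 : ∑ a ∈ Y, (dI a.1 a.2).indicator (fun _ => (ddist Ω a.1 a.2)⁻¹) t = ∑ a ∈ Yt, (ddist Ω a.1 a.2)⁻¹ := by
      rw [hYt, Finset.sum_filter]
      exact Finset.sum_congr rfl (fun a _ => by rw [Set.indicator_apply])
    rw [e1]
    have hrel : ∀ a ∈ Yt, tw (-a.1) ≤ δ ∧ tw a.1 * δ ≤ 2 * ddist Ω a.1 a.2 := by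
      intro a ha
      obtain ⟨haY, hat⟩ := Finset.mem_filter.1 ha
      have h2 := hY a haY
      rw [mem_dI] at hat
      have hd : tw a.1 * dist t ((a.2 : ℝ) / tw a.1) ≤ 1 := by
        rw [Real.dist_eq]
        nth_rw 1 [← abs_of_pos (tw_pos a.1)]
        rw [← abs_mul, mul_sub, mul_div_cancel₀ _ (tw_ne a.1), abs_le]; constructor <;> linarith
      have l1 : δ ≤ Metric.infDist ((a.2 : ℝ) / tw a.1) Ωᶜ + dist t ((a.2 : ℝ) / tw a.1) :=
        Metric.infDist_le_infDist_add_dist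
      have l2 : Metric.infDist ((a.2 : ℝ) / tw a.1) Ωᶜ ≤ δ + dist ((a.2 : ℝ) / tw a.1) t :=
        Metric.infDist_le_infDist_add_dist
      rw [dist_comm] at l2
      have m1 := mul_le_mul_of_nonneg_left l1 (tw_pos a.1).le
      have m2 := mul_le_mul_of_nonneg_left l2 (tw_pos a.1).le
      unfold ddist at h2 ⊢
      refine ⟨?_, by linarith⟩
      rw [tw_neg, inv_le_iff_one_le_mul₀ (tw_pos _)]
      linarith
    by_cases hemp : Yt = ∅
    · rw [hemp]; simp
    obtain ⟨a0, ha0⟩ := Finset.nonempty_iff_ne_empty.2 hemp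
    have hδp : 0 < δ := lt_of_lt_of_le (tw_pos _) (hrel a0 ha0).1
    have hinj : Set.InjOn (fun a : ℤ × ℤ => a.1) Yt := by
      intro a ha b hb hab
      have h1 := (Finset.mem_filter.1 ha).2
      have h2 := (Finset.mem_filter.1 hb).2
      simp only at hab
      unfold dI at h1 h2
      simp only [Set.mem_setOf_eq] at h1 h2
      refine Prod.ext hab ?_
      rw [← h1, ← h2, hab]
    calc ∑ a ∈ Yt, (ddist Ω a.1 a.2)⁻¹ ≤ ∑ a ∈ Yt, (2 / δ) * tw (-a.1) := by
          refine Finset.sum_le_sum (fun a ha => ?_)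
          have h1 := (hrel a ha).2
          have h2 := hY a (Finset.mem_filter.1 ha).1
          have hp := tw_pos a.1
          rw [tw_neg, inv_le_iff_one_le_mul₀ (by linarith), div_mul_eq_mul_div, div_mul_eq_mul_div, le_div_iff₀ hδp]
          rw [one_mul, mul_right_comm, ← div_eq_mul_inv, le_div_iff₀ hp]
          linarith
      _ = (2 / δ) * ∑ s ∈ Yt.image (fun a => a.1), tw (-s) := by
          rw [← Finset.mul_sum, Finset.sum_image hinj]
      _ ≤ (2 / δ) * (2 * δ) := by
          refine mul_le_mul_of_nonneg_left (geom_down _ δ hδ0 ?_) (by positivity)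
          intro s hs
          obtain ⟨a, ha, rfl⟩ := Finset.mem_image.1 hs
          exact (hrel a ha).1
      _ = 4 := by field_simp; norm_num
  calc _ ≤ ∫ t in Ω, (4 : ℝ) := by
        refine setIntegral_mono_on (integrable_finset_sum _ hintg) (integrableOn_const (hs := hfin.ne)) hm hpt
    _ = _ := by rw [setIntegral_const, smul_eq_mul, mul_comm]

def deepc (N0 : ℝ) : ℝ := 72 + 144 * (128 * (4 * N0 + 1))
def deepC (n : ℕ) (C2 C3 N0 : ℝ) : ℝ := 4 * (multC (C3 * (C2 + C2) + C2) n * deepc N0 ^ n)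

theorem deep_total {n k : ℕ} {Γ' : Submodule ℝ (Fin n → ℝ)} {C3 Lw C2 N0 : ℝ}
    (hND : ND n k Γ' C3) (hC3 : 0 ≤ C3) (hC2 : 0 ≤ C2) (hN : 0 < N0) (β : Fin n → ℝ) (hβ0 : ∀ i, 0 < β i)
    (hβ1 : ∀ i, β i < 1) (hβs : ∑ i, β i = 2 * k) (h F : Fin n → ℝ → ℂ) (Ω : Set ℝ) (D : Fin n → ℝ)
    (PP : Finset (MT n)) (hh : ∀ i, Good N0 (h i)) (hF : ∀ i, FOK (F i)) (hD0 : ∀ i, 0 < D i)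
    (hD : ∀ i, Dens (F i) Ω (D i)) (j : Fin n) (hhj : Good N0 (amp (n + 1) (h j))) (hDj : 1 ≤ D j)
    (hFj : ∀ t ∈ Ω, F j t = 0) (hm : MeasurableSet Ω) (hfin : volume Ω < ⊤) (hne : (Ωᶜ).Nonempty)
    (hW : ∀ P ∈ PP, Whit Γ' Lw C2 P) (hdeep : ∀ P ∈ PP, ∀ x ∉ Ω, 2 ≤ |tw P.s * x - P.q|) :
    ∑ P ∈ PP, tw (-P.s) * ∏ i, ‖cf (h i) (F i) (P.pr i)‖ ≤
      deepC n C2 C3 N0 * volume.real Ω * ∏ i, D i ^ (1 - β i / 2) := by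
  set Mc := multC (C3 * (C2 + C2) + C2) n with hMc
  have hMc0 : 0 ≤ Mc := by rw [hMc]; unfold multC; positivity
  set Y := PP.image (fun P => (P.s, P.q)) with hYdef
  have hY : ∀ a ∈ Y, 2 ≤ ddist Ω a.1 a.2 := by
    intro a ha
    obtain ⟨P, hP, rfl⟩ := Finset.mem_image.1 ha
    exact ddist_ge hne (hdeep P hP)
  set c := deepc N0 with hc
  have hc1 : 1 ≤ c := by rw [hc]; unfold deepc; linarith
  have hc72 : 72 ≤ c := by rw [hc]; unfold deepc; linarith
  have hcB : 144 * (128 * (4 * N0 + 1)) ≤ c := by rw [hc]; unfold deepc; linarith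
  have hDp : ∀ i, 0 < D i ^ (1 - β i / 2) := fun i => Real.rpow_pos_of_pos (hD0 i) _
  have hone : ∀ a ∈ Y, ∑ P ∈ PP with (P.s, P.q) = a, ∏ i, ‖cf (h i) (F i) (P.pr i)‖ ≤
      (Mc * c ^ n * ∏ i, D i ^ (1 - β i / 2)) * (ddist Ω a.1 a.2)⁻¹ := by
    intro a ha
    set d := ddist Ω a.1 a.2 with hd
    have hd2 : 2 ≤ d := hY a ha
    have hd0 : 0 < d := by linarith
    obtain ⟨x, hx, hxd⟩ := ddist_ex hne (s := a.1) (q := a.2) hd0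
    set X := PP.filter (fun P => (P.s, P.q) = a) with hX
    have hXs : ∀ P ∈ X, P.s = a.1 ∧ P.q = a.2 := by
      intro P hP
      have := (Finset.mem_filter.1 hP).2
      rw [← this]; exact ⟨rfl, rfl⟩
    have hU : ∀ i, ∀ p ∈ X.image (fun P => P.pr i), p.s = a.1 ∧ p.q = a.2 := by
      intro i p hp
      obtain ⟨P, hP, rfl⟩ := Finset.mem_image.1 hp
      exact hXs P hP
    have hdok : FOK (damp (n + 1) d a.1 a.2 (F j)) := by
      refine damp_ok hd0 (hF j) _ _ (fun t ht => ?_)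
      exact ddist_le (fun hmem => ht (hFj t hmem)) _ _
    set w : Fin n → ℝ := fun i => if i = j then c * (d ^ (2 * (n + 1)))⁻¹ else c * (d ^ 2 * D i) with hw
    set y : Fin n → ℝ := fun i => if i = j then 1 else (d ^ 2 * D i)⁻¹ with hy
    have hbd : (1 + 2 * d) ^ 2 ≤ 9 * d ^ 2 := by nlinarith
    have key := interval_sum (Lw := Lw) hND hC3 hC2 X a.1 a.2 hXs
      (fun P hP => hW P (Finset.mem_filter.1 hP).1)
      (fun i p => ‖cf (h i) (F i) p‖) (fun i p => norm_nonneg _) w y β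
      (fun i => by
        have := hD0 i
        simp only [hw]; split_ifs <;> positivity)
      (fun i => by
        have := hD0 i
        simp only [hy]; split_ifs <;> positivity) (fun i => (hβ0 i).le) (fun i => (hβ1 i).le) hβs
      (by
        intro i P hP
        have hs := hXs P hP
        have := hD0 i
        simp only [hw]
        split_ifs with hij
        · subst hij
          rw [cf_damp hd0 (N := n + 1), mul_comm]
          refine mul_le_mul_of_nonneg_right ((triv_sup hhj ?_ _).trans (by linarith)) (by positivity)
          simp only [MT.pr]; rw [hs.1, hs.2]; exact hdok
        · refine (deep_sup (hh i) (hF i) (hD i) hx (by positivity : (0 : ℝ) ≤ 2 * d) _ ?_).trans ?_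
          · simp only [MT.pr]; rw [hs.1, hs.2]; exact hxd
          · calc (1 + 2 * d) ^ 2 * (8 * D i) ≤ (9 * d ^ 2) * (8 * D i) := by gcongr
              _ = 72 * (d ^ 2 * D i) := by ring
              _ ≤ _ := by gcongr)
      (by
        intro i
        have := hD0 i
        simp only [hw, hy]
        split_ifs with hij
        · subst hij
          have h1 : ∀ p ∈ X.image (fun P => P.pr i), ‖cf (h i) (F i) p‖ ^ 2 =
              ((d ^ (2 * (n + 1)))⁻¹) ^ 2 * ‖cf (amp (n + 1) (h i)) (damp (n + 1) d a.1 a.2 (F i)) p‖ ^ 2 := by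
            intro p hp
            rw [cf_damp hd0 (N := n + 1), mul_pow, (hU i p hp).1, (hU i p hp).2]
          rw [Finset.sum_congr rfl h1, ← Finset.mul_sum]
          have h2 := triv_l2 hN hhj hdok _ a.1 a.2 (hU i)
          calc _ ≤ ((d ^ (2 * (n + 1)))⁻¹) ^ 2 * (128 * (4 * N0 + 1) * 8) := by gcongr
            _ ≤ ((d ^ (2 * (n + 1)))⁻¹) ^ 2 * c ^ 2 := by
              gcongr
              nlinarith
            _ = _ := by ring
        · have h2 := deep_l2 hN (hh i) (hF i) (hD i) hx (by positivity : (0 : ℝ) ≤ 2 * d) _ a.1 a.2 (hU i) hxd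
          refine h2.trans ?_
          calc 128 * (4 * N0 + 1) * (2 * ((1 + 2 * d) ^ 2 * (8 * D i)))
              ≤ 128 * (4 * N0 + 1) * (2 * ((9 * d ^ 2) * (8 * D i))) := by gcongr
            _ = 144 * (128 * (4 * N0 + 1)) * (d ^ 2 * D i) := by ring
            _ ≤ c ^ 2 * (d ^ 2 * D i) := by
              gcongr
              nlinarith
            _ = _ := by field_simp)
    refine key.trans ?_
    set g : Fin n → ℝ := fun i => if i = j then (d ^ (2 * (n + 1)))⁻¹ else d ^ 2 with hg
    have hterm : ∀ i, w i * y i ^ (β i / 2) ≤ c * D i ^ (1 - β i / 2) * g i := by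
      intro i
      have hDi := hD0 i
      simp only [hw, hy, hg]
      split_ifs with hij
      · subst hij
        rw [Real.one_rpow, mul_one]
        have : 1 ≤ D i ^ (1 - β i / 2) := Real.one_le_rpow hDj (by linarith [hβ1 i])
        calc c * (d ^ (2 * (n + 1)))⁻¹ = c * 1 * (d ^ (2 * (n + 1)))⁻¹ := by ring
          _ ≤ _ := by gcongr
      · have e : (d ^ 2 * D i) * ((d ^ 2 * D i)⁻¹) ^ (β i / 2) = (d ^ 2) ^ (1 - β i / 2) * D i ^ (1 - β i / 2) := by
          rw [← Real.mul_rpow (by positivity) hDi.le, Real.inv_rpow (by positivity), Real.rpow_sub (by positivity),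
            Real.rpow_one, ← div_eq_mul_inv]
        have e2 : (d ^ 2) ^ (1 - β i / 2) ≤ d ^ 2 := by
          calc (d ^ 2) ^ (1 - β i / 2) ≤ (d ^ 2) ^ (1 : ℝ) :=
                Real.rpow_le_rpow_of_exponent_le (by nlinarith) (by linarith [hβ0 i])
            _ = d ^ 2 := Real.rpow_one _
        have := hDp i
        calc _ = c * ((d ^ 2) ^ (1 - β i / 2) * D i ^ (1 - β i / 2)) := by rw [mul_assoc, e]
          _ ≤ c * (d ^ 2 * D i ^ (1 - β i / 2)) := by gcongr
          _ = _ := by ring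
    have hgprod : ∏ i, g i ≤ d⁻¹ := by
      rw [← Finset.mul_prod_erase Finset.univ g (Finset.mem_univ j)]
      have e1 : ∏ i ∈ Finset.univ.erase j, g i = (d ^ 2) ^ (n - 1) := by
        rw [Finset.prod_congr rfl (g := fun _ => d ^ 2) (fun i hi => by
          simp only [hg]; rw [if_neg (Finset.ne_of_mem_erase hi)]), Finset.prod_const,
          Finset.card_erase_of_mem (Finset.mem_univ j), Finset.card_univ, Fintype.card_fin]
      have e2 : g j = (d ^ (2 * (n + 1)))⁻¹ := by simp [hg]
      rw [e1, e2, ← pow_mul, inv_mul_le_iff₀ (by positivity), ← div_eq_mul_inv, le_div_iff₀ hd0, ← pow_succ]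
      exact pow_le_pow_right₀ (by linarith) (by omega)
    calc Mc * ∏ i, w i * y i ^ (β i / 2) ≤ Mc * ∏ i, (c * D i ^ (1 - β i / 2) * g i) := by
          refine mul_le_mul_of_nonneg_left (Finset.prod_le_prod (fun i _ => ?_) (fun i _ => hterm i)) hMc0
          have := hD0 i
          refine mul_nonneg ?_ (Real.rpow_nonneg ?_ _)
          · simp only [hw]; split_ifs <;> positivity
          · simp only [hy]; split_ifs <;> positivity
      _ = Mc * (c ^ n * (∏ i, D i ^ (1 - β i / 2)) * ∏ i, g i) := by
          rw [Finset.prod_mul_distrib, Finset.prod_mul_distrib, Finset.prod_const, Finset.card_univ, Fintype.card_fin]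
      _ ≤ Mc * (c ^ n * (∏ i, D i ^ (1 - β i / 2)) * d⁻¹) := by
          have := Finset.prod_pos (s := Finset.univ) (fun i _ => hDp i)
          gcongr
      _ = _ := by ring
  have hpr := Finset.prod_pos (s := Finset.univ) (fun i _ => hDp i)
  calc ∑ P ∈ PP, tw (-P.s) * ∏ i, ‖cf (h i) (F i) (P.pr i)‖
      = ∑ a ∈ Y, ∑ P ∈ PP with (P.s, P.q) = a, tw (-P.s) * ∏ i, ‖cf (h i) (F i) (P.pr i)‖ :=
        (Finset.sum_fiberwise_of_maps_to (fun P hP => Finset.mem_image_of_mem (fun P : MT n => (P.s, P.q)) hP) _).symm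
    _ = ∑ a ∈ Y, tw (-a.1) * ∑ P ∈ PP with (P.s, P.q) = a, ∏ i, ‖cf (h i) (F i) (P.pr i)‖ := by
        refine Finset.sum_congr rfl (fun a _ => ?_)
        rw [Finset.mul_sum]
        refine Finset.sum_congr rfl (fun P hP => ?_)
        rw [← (Finset.mem_filter.1 hP).2]
    _ ≤ ∑ a ∈ Y, tw (-a.1) * ((Mc * c ^ n * ∏ i, D i ^ (1 - β i / 2)) * (ddist Ω a.1 a.2)⁻¹) :=
        Finset.sum_le_sum (fun a ha => mul_le_mul_of_nonneg_left (hone a ha) (tw_pos _).le)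
    _ = (Mc * c ^ n * ∏ i, D i ^ (1 - β i / 2)) * ∑ a ∈ Y, tw (-a.1) * (ddist Ω a.1 a.2)⁻¹ := by
        rw [Finset.mul_sum]; exact Finset.sum_congr rfl (fun a _ => by ring)
    _ ≤ (Mc * c ^ n * ∏ i, D i ^ (1 - β i / 2)) * (4 * volume.real Ω) := by
        refine mul_le_mul_of_nonneg_left (deep_intervals hm hfin hne Y hY) ?_
        positivity
    _ = _ := by unfold deepC; rw [← hc, ← hMc]; ring

/-! ## P12: exceptional set and the model sum estimate -/

def badSet (E : Set ℝ) (lam : ℝ) : Set ℝ :=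
  {x | ∃ R > 0, ENNReal.ofReal (2 * lam * R) < volume (E ∩ Metric.closedBall x R)}

lemma badSet_volume {E : Set ℝ} (hE : MeasurableSet E) (hfin : volume E < ⊤) {lam : ℝ} (hl : 0 < lam) :
    volume (badSet E lam) ≤ ENNReal.ofReal (5 / lam) * volume E := by
  set t : Set (ℝ × ℝ) := {a | 0 < a.2 ∧ ENNReal.ofReal (2 * lam * a.2) < volume (E ∩ Metric.closedBall a.1 a.2)}
    with ht
  obtain ⟨u, hut, hud, huc⟩ := Vitali.exists_disjoint_subfamily_covering_enlargement_closedBall t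
    (fun a => a.1) (fun a => a.2) ((volume E).toReal / (2 * lam)) (by
      intro a ha
      rw [le_div_iff₀ (by positivity)]
      have h1 : ENNReal.ofReal (2 * lam * a.2) ≤ volume E :=
        ha.2.le.trans (measure_mono Set.inter_subset_left)
      have := (ENNReal.ofReal_le_iff_le_toReal hfin.ne).1 h1
      linarith) 5 (by norm_num)
  have hcount : u.Countable := by
    refine hud.countable_of_nonempty_interior (fun a ha => ?_)
    have := (hut ha).1
    exact (Metric.nonempty_ball.2 this).mono Metric.ball_subset_interior_closedBall
  have hsub : badSet E lam ⊆ ⋃ b ∈ u, Metric.closedBall b.1 (5 * b.2) := by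
    rintro x ⟨R, hR, hx⟩
    obtain ⟨b, hb, hs⟩ := huc (x, R) ⟨hR, hx⟩
    exact Set.mem_biUnion hb (hs (Metric.mem_closedBall_self hR.le))
  calc volume (badSet E lam) ≤ volume (⋃ b ∈ u, Metric.closedBall b.1 (5 * b.2)) := measure_mono hsub
    _ ≤ ∑' b : u, volume (Metric.closedBall (b : ℝ × ℝ).1 (5 * (b : ℝ × ℝ).2)) := measure_biUnion_le _ hcount _
    _ ≤ ∑' b : u, ENNReal.ofReal (5 / lam) * volume (E ∩ Metric.closedBall (b : ℝ × ℝ).1 (b : ℝ × ℝ).2) := by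
        refine ENNReal.tsum_le_tsum (fun b => ?_)
        have hb := hut b.2
        rw [Real.volume_closedBall]
        calc ENNReal.ofReal (2 * (5 * (b : ℝ × ℝ).2)) = ENNReal.ofReal (5 / lam) * ENNReal.ofReal (2 * lam * (b : ℝ × ℝ).2) := by
              rw [← ENNReal.ofReal_mul (by positivity)]; congr 1; field_simp
          _ ≤ _ := by gcongr; exact hb.2.le
    _ = ENNReal.ofReal (5 / lam) * ∑' b : u, volume (E ∩ Metric.closedBall (b : ℝ × ℝ).1 (b : ℝ × ℝ).2) :=
        ENNReal.tsum_mul_left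
    _ = ENNReal.ofReal (5 / lam) * volume (⋃ b ∈ u, E ∩ Metric.closedBall b.1 b.2) := by
        rw [measure_biUnion hcount (hud.mono (fun a => Set.inter_subset_right))
          (fun b _ => hE.inter measurableSet_closedBall)]
    _ ≤ _ := by
        gcongr
        exact Set.iUnion₂_subset (fun b _ => Set.inter_subset_left)

lemma norm_int_le {F : ℝ → ℂ} {E : Set ℝ} (hm : Measurable F) (hb : ∀ x, ‖F x‖ ≤ 1) (hs : ∀ x, x ∉ E → F x = 0)
    (hE : MeasurableSet E) (hfin : volume E < ⊤) (G : Set ℝ) (hG : MeasurableSet G) :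
    ∫ t in G, ‖F t‖ ≤ (volume (E ∩ G)).toReal := by
  have h1 : ∫ t in G, ‖F t‖ ≤ ∫ t in G, E.indicator (fun _ => (1 : ℝ)) t := by
    refine integral_mono_of_nonneg (Filter.Eventually.of_forall (fun t => norm_nonneg _)) ?_
      (Filter.Eventually.of_forall (fun t => ?_))
    · exact ((integrable_indicator_iff hE).2 (integrableOn_const (hs := hfin.ne))).integrableOn
    · by_cases ht : t ∈ E
      · simp only [Set.indicator_of_mem ht]; exact hb t
      · simp [hs t ht, ht]
  refine h1.trans (le_of_eq ?_)
  rw [integral_indicator hE, Measure.restrict_restrict hE, setIntegral_const]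
  simp [measureReal_def]

lemma fok_of {F : ℝ → ℂ} {E : Set ℝ} (hm : Measurable F) (hb : ∀ x, ‖F x‖ ≤ 1) (hs : ∀ x, x ∉ E → F x = 0)
    (hE : MeasurableSet E) (hfin : volume E < ⊤) : FOK F := by
  refine ⟨hm, hb, ?_⟩
  refine ((integrable_indicator_iff hE).2 (integrableOn_const (C := (1 : ℝ)) (hs := hfin.ne))).mono'
    hm.aestronglyMeasurable (Filter.Eventually.of_forall (fun t => ?_))
  by_cases ht : t ∈ E
  · simp only [Set.indicator_of_mem ht]; exact hb t
  · simp [hs t ht, ht]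

lemma dens_of_bad {F : ℝ → ℂ} {E Ω : Set ℝ} (hm : Measurable F) (hb : ∀ x, ‖F x‖ ≤ 1) (hs : ∀ x, x ∉ E → F x = 0)
    (hE : MeasurableSet E) (hfin : volume E < ⊤) {lam : ℝ} (hl : 0 < lam) (hΩ : badSet E lam ⊆ Ω) :
    Dens F Ω (2 * lam) := by
  intro x hx R hR
  refine (norm_int_le hm hb hs hE hfin _ measurableSet_closedBall).trans ?_
  have h1 : ¬ ENNReal.ofReal (2 * lam * R) < volume (E ∩ Metric.closedBall x R) := fun h => hx (hΩ ⟨R, hR, h⟩)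
  push Not at h1
  exact ENNReal.toReal_le_of_le_ofReal (by positivity) h1

lemma dens_triv {F : ℝ → ℂ} (hF : FOK F) (Ω : Set ℝ) : Dens F Ω 2 := by
  intro x _ R hR
  calc ∫ t in Metric.closedBall x R, ‖F t‖ ≤ ∫ t in Metric.closedBall x R, (1 : ℝ) := by
        refine setIntegral_mono hF.int.norm.integrableOn (integrableOn_const (hs := ?_)) hF.bd
        rw [Real.volume_closedBall]; exact ENNReal.ofReal_ne_top
    _ = 2 * R := by
        rw [setIntegral_const, measureReal_def, Real.volume_closedBall, ENNReal.toReal_ofReal (by positivity)]; simp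

def Lam0 (n : ℕ) : ℝ := 10 * n

lemma exc_set {n : ℕ} (hn : 1 ≤ n) (E : Fin n → Set ℝ) (hE : ∀ i, MeasurableSet (E i)) (hfin : ∀ i, volume (E i) < ⊤)
    (hpos : ∀ i, 0 < (volume (E i)).toReal) (j : Fin n) :
    ∃ Ω, MeasurableSet Ω ∧ 2 * volume Ω ≤ volume (E j) ∧
      ∀ i, badSet (E i) (Lam0 n * (volume (E i)).toReal / (volume (E j)).toReal) ⊆ Ω := by
  have hn' : (0 : ℝ) < n := by exact_mod_cast hn
  refine ⟨toMeasurable volume (⋃ i, badSet (E i) (Lam0 n * (volume (E i)).toReal / (volume (E j)).toReal)),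
    measurableSet_toMeasurable _ _, ?_, fun i => (Set.subset_iUnion (fun i => badSet (E i) (Lam0 n * (volume (E i)).toReal / (volume (E j)).toReal)) i).trans (subset_toMeasurable _ _)⟩
  rw [measure_toMeasurable]
  have h1 : ∀ i, volume (badSet (E i) (Lam0 n * (volume (E i)).toReal / (volume (E j)).toReal)) ≤
      ENNReal.ofReal ((volume (E j)).toReal / (2 * n)) := by
    intro i
    have := hpos i
    have := hpos j
    have hL : 0 < Lam0 n := by unfold Lam0; positivity
    refine (badSet_volume (hE i) (hfin i) (by positivity)).trans ?_
    rw [← ENNReal.ofReal_toReal (hfin i).ne, ← ENNReal.ofReal_mul (by positivity)]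
    refine ENNReal.ofReal_le_ofReal (le_of_eq ?_)
    rw [ENNReal.toReal_ofReal (hpos i).le]
    unfold Lam0; field_simp; norm_num
  calc 2 * volume (⋃ i, badSet (E i) (Lam0 n * (volume (E i)).toReal / (volume (E j)).toReal))
      ≤ 2 * ∑ i : Fin n, ENNReal.ofReal ((volume (E j)).toReal / (2 * n)) := by
        gcongr
        exact (measure_iUnion_fintype_le volume _).trans (Finset.sum_le_sum (fun i _ => h1 i))
    _ = volume (E j) := by
        rw [Finset.sum_const, Finset.card_univ, Fintype.card_fin, nsmul_eq_mul, ← mul_assoc]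
        have : (2 : ℝ≥0∞) * (n : ℝ≥0∞) = ENNReal.ofReal (2 * n) := by
          rw [ENNReal.ofReal_mul (by norm_num)]; simp
        rw [this, ← ENNReal.ofReal_mul (by positivity), mul_div_cancel₀ _ (by positivity),
          ENNReal.ofReal_toReal (hfin j).ne]

/-- the exponents `β` -/
def bet {n : ℕ} (k : ℕ) (a : Fin n → ℝ) (j : Fin n) (i : Fin n) : ℝ :=
  if i = j then 2 * (k - n + 2 - a j) else 2 - 2 * a i

lemma bet_sum {n k : ℕ} (a : Fin n → ℝ) (j : Fin n) (ha : ∑ i, a i = 1) : ∑ i, bet k a j i = 2 * k := by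
  have hn : 1 ≤ n := by have := j.2; omega
  rw [← Finset.add_sum_erase _ _ (Finset.mem_univ j)] at ha ⊢
  have e1 : ∑ i ∈ Finset.univ.erase j, bet k a j i = ∑ i ∈ Finset.univ.erase j, (2 - 2 * a i) :=
    Finset.sum_congr rfl (fun i hi => by unfold bet; rw [if_neg (Finset.ne_of_mem_erase hi)])
  rw [e1, Finset.sum_sub_distrib, ← Finset.mul_sum, Finset.sum_const, Finset.card_erase_of_mem (Finset.mem_univ j),
    Finset.card_univ, Fintype.card_fin, nsmul_eq_mul, Nat.cast_sub hn]
  unfold bet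
  rw [if_pos rfl]
  push_cast
  linear_combination (-2) * ha

/-- uniform hypotheses on the geometric parameters -/
structure Par (n k : ℕ) (Γ' : Submodule ℝ (Fin n → ℝ)) (C3 Lw C2 N0 : ℝ) : Prop where
  hk : 1 ≤ k
  hn : 1 ≤ n
  hND : ND n k Γ' C3
  hC3 : 0 ≤ C3
  hC2 : 0 ≤ C2
  hN : 0 < N0
  hL : n * (8 * N0) ≤ Lw

theorem sparse_split {n : ℕ} (κ : ℕ) (hκ : 0 < κ) (PP : Finset (MT n)) (f : MT n → ℝ) (R : ℝ)
    (h : ∀ r : ℤ, ∑ P ∈ PP with P.s % (κ : ℤ) = r, f P ≤ R) : ∑ P ∈ PP, f P ≤ κ * R := by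
  have hmap : ∀ P ∈ PP, P.s % (κ : ℤ) ∈ Finset.Ico (0 : ℤ) κ := by
    intro P _
    rw [Finset.mem_Ico]
    exact ⟨Int.emod_nonneg _ (by omega), Int.emod_lt_of_pos _ (by omega)⟩
  rw [← Finset.sum_fiberwise_of_maps_to hmap]
  refine (Finset.sum_le_sum (fun r _ => h r)).trans (le_of_eq ?_)
  rw [Finset.sum_const, Int.card_Ico]; simp

theorem model_bound {n k : ℕ} {Γ' : Submodule ℝ (Fin n → ℝ)} {C3 Lw C2 N0 : ℝ} (hp : Par n k Γ' C3 Lw C2 N0)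
    (a : Fin n → ℝ) (ha : ∑ i, a i = 1) (ha1 : ∀ i, a i < 1) (j : Fin n) (hj : ∀ i, i ≠ j → 1 / 2 < a i)
    (hj1 : (k : ℝ) - n + 3 / 2 < a j) (hj2 : a j < (k : ℝ) - n + 2) :
    ∃ C, 0 ≤ C ∧ ∀ E : Fin n → Set ℝ, (∀ i, MeasurableSet (E i)) → (∀ i, volume (E i) < ⊤) →
      (∀ i, 0 < (volume (E i)).toReal) → ∃ Ω, MeasurableSet Ω ∧ 2 * volume Ω ≤ volume (E j) ∧
      ∀ F h : Fin n → ℝ → ℂ, (∀ i, Measurable (F i)) → (∀ i x, ‖F i x‖ ≤ 1) → (∀ i x, x ∉ E i → F i x = 0) →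
        (∀ x ∈ Ω, F j x = 0) → (∀ i, Good N0 (h i)) → (∀ i, Good N0 (amp (n + 1) (h i))) →
        ∀ PP : Finset (MT n), (∀ P ∈ PP, Whit Γ' Lw C2 P) →
        ∑ P ∈ PP, tw (-P.s) * ∏ i, ‖cf (h i) (F i) (P.pr i)‖ ≤ C * ∏ i, (volume (E i)).toReal ^ a i := by
  obtain ⟨hk, hn, hND, hC3, hC2, hN, hL⟩ := hp
  set C4 : ℝ := (C3 * (8 * N0 + C2) + C2) + 8 * N0 with hC4d
  have hC40 : 0 ≤ C4 := by positivity
  have hC4 : C3 * (8 * N0 + C2) + C2 ≤ C4 := by rw [hC4d]; linarith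
  have hC48 : 8 * N0 ≤ C4 := by
    have : 0 ≤ C3 * (8 * N0 + C2) + C2 := by positivity
    rw [hC4d]; linarith
  set β := bet k a j with hβ
  have hβ0 : ∀ i, 0 < β i := by
    intro i; simp only [hβ, bet]; split_ifs with h
    · linarith
    · linarith [ha1 i]
  have hβ1 : ∀ i, β i < 1 := by
    intro i; simp only [hβ, bet]; split_ifs with h
    · linarith
    · linarith [hj i h]
  have hβs : ∑ i, β i = 2 * k := bet_sum a j ha
  obtain ⟨κ, hκ⟩ : ∃ κ : ℕ, C4 ≤ N0 * 2 ^ κ := by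
    obtain ⟨κ, hκ⟩ := pow_unbounded_of_one_lt (C4 / N0) (one_lt_two)
    rw [div_lt_iff₀ hN] at hκ
    exact ⟨κ, by linarith⟩
  have hn' : (1 : ℝ) ≤ n := by exact_mod_cast hn
  have hLam : 1 ≤ Lam0 n := by unfold Lam0; linarith
  have hnC : 0 ≤ nearC n k C2 C3 N0 C4 β := by
    have hs := sizeC_pos hN hC40
    have hb := besselC_pos hN hC40
    have hpc : 0 < packC N0 C4 := by unfold packC; positivity
    unfold nearC clsC multC
    have : 0 ≤ ∏ i, (1 - (2 : ℝ) ^ (-(1 - β i)))⁻¹ := by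
      refine Finset.prod_nonneg (fun i _ => inv_nonneg.2 ?_)
      have := Real.rpow_lt_one_of_one_lt_of_neg (x := 2) (by norm_num) (show -(1 - β i) < 0 by linarith [hβ1 i])
      linarith
    positivity
  have hdC : 0 ≤ deepC n C2 C3 N0 := by unfold deepC deepc multC; positivity
  set K : ℝ := 2 ^ (1 - β j / 2) * ∏ i ∈ Finset.univ.erase j, (2 * Lam0 n) ^ a i with hK
  have hK0 : 0 ≤ K := by positivity
  refine ⟨(κ + 1 : ℕ) * ((nearC n k C2 C3 N0 C4 β + deepC n C2 C3 N0) * K), by positivity, ?_⟩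
  intro E hE hfin hpos
  obtain ⟨Ω, hΩm, hΩv, hΩb⟩ := exc_set hn E hE hfin hpos j
  refine ⟨Ω, hΩm, hΩv, ?_⟩
  intro F h hFm hFb hFs hFj hh hha PP hW
  have hFok : ∀ i, FOK (F i) := fun i => fok_of (hFm i) (hFb i) (hFs i) (hE i) (hfin i)
  set V := (volume (E j)).toReal with hV
  have hV0 : 0 < V := hpos j
  have hΩ2 : volume Ω ≤ volume (E j) := by
    refine le_trans ?_ hΩv
    rw [two_mul]; exact le_self_add
  have hΩfin : volume Ω < ⊤ := hΩ2.trans_lt (hfin j)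
  have hΩr : volume.real Ω ≤ V := by
    rw [measureReal_def]; exact ENNReal.toReal_mono (hfin j).ne hΩ2
  have hΩne : (Ωᶜ).Nonempty := by
    by_contra hcon
    rw [Set.not_nonempty_iff_eq_empty, Set.compl_empty_iff] at hcon
    rw [hcon] at hΩfin
    simp at hΩfin
  set D : Fin n → ℝ := fun i => if i = j then 2 else 2 * (Lam0 n * (volume (E i)).toReal / V) with hDd
  have hD0 : ∀ i, 0 < D i := by
    intro i
    have := hpos i
    simp only [hDd]; split_ifs <;> positivity
  have hD : ∀ i, Dens (F i) Ω (D i) := by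
    intro i
    have := hpos i
    simp only [hDd]; split_ifs with hij
    · exact dens_triv (hFok i) Ω
    · exact dens_of_bad (hFm i) (hFb i) (hFs i) (hE i) (hfin i) (by positivity) (hΩb i)
  have hFV : ∀ i, ∫ t, ‖F i t‖ ^ 2 ≤ D i * V := by
    intro i
    have h1 : ∫ t, ‖F i t‖ ^ 2 ≤ ∫ t, ‖F i t‖ := by
      refine integral_mono_of_nonneg (Filter.Eventually.of_forall (fun t => by positivity)) (hFok i).int.norm
        (Filter.Eventually.of_forall (fun t => ?_))
      have := hFb i t
      have := norm_nonneg (F i t)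
      simp only; nlinarith
    have h2 : ∫ t, ‖F i t‖ ≤ (volume (E i)).toReal := by
      have := norm_int_le (hFm i) (hFb i) (hFs i) (hE i) (hfin i) Set.univ MeasurableSet.univ
      simpa using this
    have := hpos i
    simp only [hDd]; split_ifs with hij
    · subst hij; linarith
    · have e : 2 * (Lam0 n * (volume (E i)).toReal / V) * V = 2 * (Lam0 n * (volume (E i)).toReal) := by
        field_simp
      rw [e]; nlinarith
  have hprod : V * ∏ i, D i ^ (1 - β i / 2) = K * ∏ i, (volume (E i)).toReal ^ a i := by
    rw [← Finset.mul_prod_erase Finset.univ _ (Finset.mem_univ j),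
      ← Finset.mul_prod_erase Finset.univ (fun i => (volume (E i)).toReal ^ a i) (Finset.mem_univ j), hK]
    have e1 : ∏ i ∈ Finset.univ.erase j, D i ^ (1 - β i / 2) = (∏ i ∈ Finset.univ.erase j, (2 * Lam0 n) ^ a i) *
        (∏ i ∈ Finset.univ.erase j, (volume (E i)).toReal ^ a i) * V ^ (-∑ i ∈ Finset.univ.erase j, a i) := by
      rw [← Finset.sum_neg_distrib, Real.rpow_sum_of_pos hV0, ← Finset.prod_mul_distrib, ← Finset.prod_mul_distrib]
      refine Finset.prod_congr rfl (fun i hi => ?_)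
      have hij := Finset.ne_of_mem_erase hi
      have hpi := hpos i
      have : 1 - β i / 2 = a i := by simp only [hβ, bet, if_neg hij]; ring
      rw [this]
      simp only [hDd, if_neg hij]
      rw [Real.rpow_neg hV0.le, ← div_eq_mul_inv, ← mul_div_assoc, ← mul_assoc, Real.div_rpow (by positivity) hV0.le,
        Real.mul_rpow (by positivity) hpi.le]
    have e2 : D j = 2 := by simp [hDd]
    have e3 : V * V ^ (-∑ i ∈ Finset.univ.erase j, a i) = V ^ a j := by
      have : a j = 1 + -∑ i ∈ Finset.univ.erase j, a i := by
        rw [← Finset.add_sum_erase _ _ (Finset.mem_univ j)] at ha; linarith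
      rw [this, Real.rpow_add hV0, Real.rpow_one]
    rw [e1, e2, ← hV, ← e3]
    ring
  have hpD : 0 ≤ ∏ i, D i ^ (1 - β i / 2) := Finset.prod_nonneg (fun i _ => Real.rpow_nonneg (hD0 i).le _)
  set f : MT n → ℝ := fun P => tw (-P.s) * ∏ i, ‖cf (h i) (F i) (P.pr i)‖ with hf
  refine (sparse_split (κ + 1) (Nat.succ_pos κ) PP f ((nearC n k C2 C3 N0 C4 β + deepC n C2 C3 N0) *
    (V * ∏ i, D i ^ (1 - β i / 2))) ?_).trans (le_of_eq (by rw [hprod]; ring))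
  intro r
  set Q := PP.filter (fun P => P.s % ((κ + 1 : ℕ) : ℤ) = r) with hQ
  have hQP : ∀ P ∈ Q, P ∈ PP := fun P hP => (Finset.mem_filter.1 hP).1
  rw [← Finset.sum_filter_add_sum_filter_not Q (fun P => ∃ x ∉ Ω, |tw P.s * x - P.q| ≤ 2)]
  have near := near_total (Γ' := Γ') hk hn hND hC3 hC2 hN hL hC4 hC48 β hβ0 hβ1 hβs h F Ω D V
    (Q.filter (fun P => ∃ x ∉ Ω, |tw P.s * x - P.q| ≤ 2)) hh hFok hD0 hD hV0.le hFV
    (fun P hP => hW P (hQP P (Finset.mem_filter.1 hP).1))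
    (fun P hP i => (Finset.mem_filter.1 hP).2) (by
      intro P hP P' hP' hlt
      have h1 := (Finset.mem_filter.1 (Finset.mem_filter.1 hP).1).2
      have h2 := (Finset.mem_filter.1 (Finset.mem_filter.1 hP').1).2
      have h3 : P.s + κ ≤ P'.s := by
        have e : (P'.s - P.s) % ((κ + 1 : ℕ) : ℤ) = 0 := by
          rw [Int.sub_emod, h1, h2]; simp
        obtain ⟨c, hc⟩ := Int.dvd_of_emod_eq_zero e
        have hcpos : 0 < c := by
          by_contra hneg
          push Not at hneg
          have : ((κ + 1 : ℕ) : ℤ) * c ≤ 0 := mul_nonpos_of_nonneg_of_nonpos (by positivity) hneg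
          omega
        have : ((κ + 1 : ℕ) : ℤ) * 1 ≤ ((κ + 1 : ℕ) : ℤ) * c := by gcongr; omega
        push_cast at this hc
        linarith
      calc C4 * tw P.s ≤ N0 * 2 ^ κ * tw P.s := by
            have := tw_pos P.s
            gcongr
        _ = N0 * tw (P.s + κ) := by rw [tw_add, tw_natCast]; ring
        _ ≤ N0 * tw P'.s := by gcongr; exact tw_le h3)
  have deep := deep_total (Γ' := Γ') (Lw := Lw) hND hC3 hC2 hN β hβ0 hβ1 hβs h F Ω D
    (Q.filter (fun P => ¬ ∃ x ∉ Ω, |tw P.s * x - P.q| ≤ 2)) hh hFok hD0 hD j (hha j) (by simp [hDd]) hFj hΩm hΩfin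
    hΩne (fun P hP => hW P (hQP P (Finset.mem_filter.1 hP).1)) (by
      intro P hP x hx
      have := (Finset.mem_filter.1 hP).2
      push Not at this
      exact (this x hx).le)
  calc _ ≤ nearC n k C2 C3 N0 C4 β * V * ∏ i, D i ^ (1 - β i / 2) +
        deepC n C2 C3 N0 * volume.real Ω * ∏ i, D i ^ (1 - β i / 2) := add_le_add near deep
    _ ≤ nearC n k C2 C3 N0 C4 β * V * ∏ i, D i ^ (1 - β i / 2) + deepC n C2 C3 N0 * V * ∏ i, D i ^ (1 - β i / 2) := by
        gcongr
    _ = _ := by ring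

/-! ### Linear algebra of the singular subspace -/

lemma nd_of {n k : ℕ} (hk : 1 ≤ k) {Γ' : Submodule ℝ (Fin n → ℝ)} (hΓ : (Γ' : Set (Fin n → ℝ)) ⊆ GammaSet n)
    (h : NonDegenerate n k Γ') : ∃ C3, 0 ≤ C3 ∧ ND n k Γ' C3 := by
  have key : ∀ A : Finset (Fin n), ∃ c : ℝ, 0 ≤ c ∧ (A.card = k →
      (∀ c : Fin n → ℝ, ∃ γ ∈ Γ', ∀ i ∈ A, γ i = c i) ∧
      ∀ γ ∈ Γ', ∀ b : ℝ, (∀ i ∈ A, |γ i| ≤ b) → ∀ i, |γ i| ≤ c * b) := by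
    intro A
    by_cases hA : A.card = k
    swap
    · exact ⟨0, le_rfl, fun h => absurd h hA⟩
    set ι := A.orderEmbOfFin hA with hι
    have hb := h ι ι.strictMono
    let T : Γ' →ₗ[ℝ] (Fin k → ℝ) :=
      { toFun := fun ξ s => (ξ : Fin n → ℝ) (ι s)
        map_add' := fun x y => by ext s; simp
        map_smul' := fun c x => by ext s; simp }
    let e : Γ' ≃ₗ[ℝ] (Fin k → ℝ) := LinearEquiv.ofBijective T hb
    let S : (Fin k → ℝ) →L[ℝ] Γ' := LinearMap.toContinuousLinearMap (e.symm : (Fin k → ℝ) →ₗ[ℝ] Γ')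
    have hιA : ∀ s, ι s ∈ A := fun s => A.orderEmbOfFin_mem hA s
    have hAι : ∀ i ∈ A, ∃ s, ι s = i := by
      intro i hi
      have : i ∈ Set.range ι := by rw [hι, A.range_orderEmbOfFin hA]; exact hi
      exact this
    refine ⟨‖S‖, S.opNorm_nonneg, fun _ => ⟨?_, ?_⟩⟩
    · intro c
      obtain ⟨γ, hγ⟩ := hb.2 (fun s => c (ι s))
      refine ⟨γ, γ.2, fun i hi => ?_⟩
      obtain ⟨s, rfl⟩ := hAι i hi
      exact congrFun hγ s
    · intro γ hγ b hb' i
      have h0 : 0 ≤ b := (abs_nonneg _).trans (hb' _ (hιA ⟨0, hk⟩))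
      have h1 : S (T ⟨γ, hγ⟩) = ⟨γ, hγ⟩ := e.symm_apply_apply ⟨γ, hγ⟩
      have h2 : ‖T ⟨γ, hγ⟩‖ ≤ b := by
        rw [pi_norm_le_iff_of_nonneg h0]
        intro s; exact hb' _ (hιA s)
      calc |γ i| = ‖γ i‖ := rfl
        _ ≤ ‖γ‖ := norm_le_pi_norm γ i
        _ = ‖S (T ⟨γ, hγ⟩)‖ := by rw [h1]; rfl
        _ ≤ ‖S‖ * ‖T ⟨γ, hγ⟩‖ := S.le_opNorm _
        _ ≤ ‖S‖ * b := by gcongr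
  choose c hc0 hc using key
  refine ⟨∑ A, c A, Finset.sum_nonneg fun A _ => hc0 A, fun A hA => (hc A hA).1, fun A hA γ hγ b hb i => ?_, fun γ hγ => hΓ hγ⟩
  have hne : A.Nonempty := by rw [← Finset.card_pos]; omega
  obtain ⟨i0, hi0⟩ := hne
  have h0 : 0 ≤ b := (abs_nonneg _).trans (hb _ hi0)
  refine ((hc A hA).2 γ hγ b hb i).trans ?_
  exact mul_le_mul_of_nonneg_right (Finset.single_le_sum (fun A _ => hc0 A) (Finset.mem_univ A)) h0

abbrev ES (d : ℕ) := EuclideanSpace ℝ (Fin d)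

def gL (n : ℕ) : ES (n - 1) →L[ℝ] (Fin n → ℝ) := LinearMap.toContinuousLinearMap
  { toFun := fun y => gammaParam n (fun i => y i)
    map_add' := fun x y => by
      ext i; simp only [gammaParam, Pi.add_apply]; split_ifs
      · simp
      · simp [Finset.sum_add_distrib]; ring
    map_smul' := fun c x => by
      ext i; simp only [gammaParam, Pi.smul_apply]; split_ifs
      · simp
      · simp [Finset.mul_sum] }

lemma gL_apply (n : ℕ) (y : ES (n - 1)) : gL n y = gammaParam n (fun i => y i) := rfl

lemma gammaParam_sum {n : ℕ} (hn : 1 ≤ n) (η : Fin (n - 1) → ℝ) : ∑ i, gammaParam n η i = 0 := by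
  obtain ⟨d, rfl⟩ : ∃ d, n = d + 1 := ⟨n - 1, by omega⟩
  rw [Fin.sum_univ_castSucc]
  simp only [gammaParam]
  have : ∀ i : Fin d, (if h : ((Fin.castSucc i : Fin (d+1)) : ℕ) < d + 1 - 1 then η ⟨(Fin.castSucc i : Fin (d+1)), h⟩ else -(∑ j, η j)) = η i := by
    intro i; rw [dif_pos]; rfl
  rw [Finset.sum_congr rfl (fun i _ => this i)]
  simp

lemma gL_mem {n : ℕ} (hn : 1 ≤ n) (y : ES (n - 1)) : gL n y ∈ GammaSet n := gammaParam_sum hn _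

lemma gL_coord (n : ℕ) (y : ES (n - 1)) (i : Fin (n - 1)) : gL n y ⟨i, by omega⟩ = y i := by
  rw [gL_apply]; simp [gammaParam]

/-- every element of Gamma is parametrised -/
lemma gL_surj {n : ℕ} (hn : 1 ≤ n) {ξ : Fin n → ℝ} (h : ξ ∈ GammaSet n) : ∃ y, gL n y = ξ := by
  obtain ⟨d, rfl⟩ : ∃ d, n = d + 1 := ⟨n - 1, by omega⟩
  refine ⟨WithLp.toLp 2 (fun i => ξ (Fin.castSucc i)), ?_⟩
  have h' : ∑ i, ξ i = 0 := h
  rw [Fin.sum_univ_castSucc] at h'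
  ext i
  rw [gL_apply]
  refine Fin.lastCases ?_ (fun i => ?_) i
  · simp [gammaParam]; linarith
  · simp only [gammaParam]; rw [dif_pos (by simp)]; rfl

structure Proj {n : ℕ} (Γ' : Submodule ℝ (Fin n → ℝ)) (T : ES (n - 1) →L[ℝ] ES (n - 1)) : Prop where
  idem : ∀ x, T (T x) = T x
  ker : ∀ x, T x = 0 ↔ gL n x ∈ Γ'
  le : ∀ x, ‖T x‖ ≤ ‖x‖

lemma exists_proj {n : ℕ} (Γ' : Submodule ℝ (Fin n → ℝ)) : ∃ T, Proj Γ' T := by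
  let K : Submodule ℝ (ES (n - 1)) := Γ'.comap (gL n : ES (n-1) →ₗ[ℝ] (Fin n → ℝ))
  refine ⟨Kᗮ.starProjection, fun x => ?_, fun x => ?_, fun x => Submodule.norm_starProjection_apply_le _ _⟩
  · exact Submodule.starProjection_eq_self_iff.2 (Submodule.starProjection_apply_mem _ _)
  · rw [Submodule.starProjection_apply_eq_zero_iff, Submodule.orthogonal_orthogonal]
    rfl

lemma es_norm_le (n : ℕ) (y : ES (n - 1)) : ‖y‖ ≤ n * ‖gL n y‖ := by
  rw [EuclideanSpace.norm_eq]
  apply Real.sqrt_le_iff.2 ⟨by positivity, ?_⟩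
  have h : ∀ i : Fin (n - 1), ‖y i‖ ^ 2 ≤ ‖gL n y‖ ^ 2 := by
    intro i
    have := norm_le_pi_norm (gL n y) ⟨i, by omega⟩
    rw [gL_coord] at this
    gcongr
  calc ∑ i, ‖y i‖ ^ 2 ≤ ∑ i : Fin (n - 1), ‖gL n y‖ ^ 2 := Finset.sum_le_sum fun i _ => h i
    _ = ((n - 1 : ℕ) : ℝ) * ‖gL n y‖ ^ 2 := by simp
    _ ≤ (n : ℝ) ^ 2 * ‖gL n y‖ ^ 2 := by
        gcongr
        have h1 : n - 1 ≤ n ^ 2 := by nlinarith [Nat.sub_le n 1, Nat.le_self_pow (two_ne_zero) n]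
        exact_mod_cast h1
    _ = (n * ‖gL n y‖) ^ 2 := by ring

lemma proj_dist {n : ℕ} (hn : 1 ≤ n) {Γ' : Submodule ℝ (Fin n → ℝ)} {T : ES (n - 1) →L[ℝ] ES (n - 1)} (hT : Proj Γ' T)
    (hΓ : (Γ' : Set (Fin n → ℝ)) ⊆ GammaSet n) (x : ES (n - 1)) :
    ∀ γ ∈ Γ', ‖T x‖ ≤ n * ‖gL n x - γ‖ := by
  intro γ hγ
  obtain ⟨y, rfl⟩ := gL_surj hn (hΓ hγ)
  have h1 : T (x - y) = T x := by rw [map_sub, (hT.ker y).2 hγ, sub_zero]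
  rw [← h1, ← map_sub]
  exact (hT.le _).trans (es_norm_le n _)

lemma proj_infDist {n : ℕ} (hn : 1 ≤ n) {Γ' : Submodule ℝ (Fin n → ℝ)} {T : ES (n - 1) →L[ℝ] ES (n - 1)} (hT : Proj Γ' T)
    (hΓ : (Γ' : Set (Fin n → ℝ)) ⊆ GammaSet n) (x : ES (n - 1)) :
    ‖T x‖ / n ≤ Metric.infDist (gL n x) Γ' := by
  have hn' : (0 : ℝ) < n := by exact_mod_cast hn
  rw [Metric.le_infDist ⟨0, Γ'.zero_mem⟩]
  intro γ hγ
  rw [div_le_iff₀' hn', dist_eq_norm]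
  exact proj_dist hn hT hΓ x γ hγ

/-- integer points -/
def zz {d : ℕ} (z : Fin d → ℤ) : ES d := WithLp.toLp 2 (fun i => (z i : ℝ))

def zt (n : ℕ) (z : Fin (n - 1) → ℤ) : Fin n → ℤ := fun i =>
  if h : (i : ℕ) < n - 1 then z ⟨i, h⟩ else -(∑ j, z j)

lemma zt_cast (n : ℕ) (z : Fin (n - 1) → ℤ) (i : Fin n) : (zt n z i : ℝ) = gL n (zz z) i := by
  rw [gL_apply]; simp only [zt, gammaParam, zz]; split_ifs <;> simp

lemma zt_inj (n : ℕ) : Function.Injective (zt n) := by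
  intro z w h
  ext i
  have := congrFun h ⟨i, by omega⟩
  simpa [zt] using this

lemma cube_norm {n : ℕ} (hn : 1 ≤ n) {u : ES (n - 1)} (hu : ∀ i, |u i| ≤ 1) : ‖u‖ ≤ n := by
  rw [EuclideanSpace.norm_eq]
  apply Real.sqrt_le_iff.2 ⟨by positivity, ?_⟩
  calc ∑ i, ‖u i‖ ^ 2 ≤ ∑ i : Fin (n - 1), (1:ℝ) := Finset.sum_le_sum fun i _ => by
        have := hu i; rw [Real.norm_eq_abs]; exact pow_le_one₀ (abs_nonneg _) this
    _ = ((n - 1 : ℕ) : ℝ) := by simp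
    _ ≤ (n : ℝ) ^ 2 := by
        have h1 : n - 1 ≤ n ^ 2 := by nlinarith [Nat.sub_le n 1, Nat.le_self_pow (two_ne_zero) n]
        exact_mod_cast h1

lemma whit_of {n : ℕ} (hn : 1 ≤ n) {Γ' : Submodule ℝ (Fin n → ℝ)} {T : ES (n - 1) →L[ℝ] ES (n - 1)} (hT : Proj Γ' T)
    (hΓ : (Γ' : Set (Fin n → ℝ)) ⊆ GammaSet n) {Lw r R : ℝ} (hL : 0 < Lw) (hr : n * Lw + n ≤ r)
    (s q : ℤ) (z : Fin (n - 1) → ℤ) (u : ES (n - 1)) (hu : ∀ i, |u i| ≤ 1) (h1 : r ≤ ‖T (u + zz z)‖) (h2 : ‖T (u + zz z)‖ ≤ R) :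
    Whit Γ' Lw (‖gL n‖ * (R + n)) ⟨s, q, zt n z⟩ := by
  have hn' : (0 : ℝ) < n := by exact_mod_cast hn
  have hun := (hT.le u).trans (cube_norm hn hu)
  rw [map_add] at h1 h2
  have h3 : r - n ≤ ‖T (zz z)‖ := by have := norm_add_le (T u) (T (zz z)); linarith
  have h4 : ‖T (zz z)‖ ≤ R + n := by
    have := norm_sub_le (T u + T (zz z)) (T u); rw [add_sub_cancel_left] at this; linarith
  refine ⟨?_, ?_, ?_⟩
  · simp only [zt_cast]; exact gL_mem hn _
  · intro γ hγ
    simp only [zt_cast]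
    have h5 := proj_dist hn hT hΓ (zz z) ((tw s)⁻¹ • γ) (Γ'.smul_mem _ hγ)
    have h6 : Lw ≤ ‖gL n (zz z) - (tw s)⁻¹ • γ‖ := by
      have : n * Lw ≤ n * ‖gL n (zz z) - (tw s)⁻¹ • γ‖ := by linarith
      exact le_of_mul_le_mul_left this hn'
    by_contra hcon
    push Not at hcon
    have h7 : ‖gL n (zz z) - (tw s)⁻¹ • γ‖ < Lw := by
      rw [pi_norm_lt_iff hL]
      intro i
      have := hcon i
      rw [Real.norm_eq_abs]
      simpa [div_eq_inv_mul] using this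
    linarith
  · refine ⟨tw s • gL n (zz z - T (zz z)), Γ'.smul_mem _ ((hT.ker _).1 ?_), fun i => ?_⟩
    · rw [map_sub, hT.idem, sub_self]
    · simp only [zt_cast]
      have : gL n (zz z) i - (tw s • gL n (zz z - T (zz z))) i / tw s = gL n (T (zz z)) i := by
        have := tw_ne s
        simp only [map_sub, Pi.smul_apply, Pi.sub_apply, smul_eq_mul]
        field_simp; ring
      rw [this]
      calc |gL n (T (zz z)) i| ≤ ‖gL n (T (zz z))‖ := norm_le_pi_norm (gL n (T (zz z))) i
        _ ≤ ‖gL n‖ * ‖T (zz z)‖ := (gL n).le_opNorm _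
        _ ≤ _ := by gcongr

/-! ### Partition of the frequency space -/

def psi1 (x : ℝ) : ℝ := Real.smoothTransition (x + 1) - Real.smoothTransition x

lemma psi1_supp {x : ℝ} (h : psi1 x ≠ 0) : |x| ≤ 1 := by
  by_contra hc
  push Not at hc
  apply h
  unfold psi1
  rcases lt_abs.1 hc with h1 | h1
  · rw [Real.smoothTransition.one_of_one_le (by linarith), Real.smoothTransition.one_of_one_le h1.le, sub_self]
  · rw [Real.smoothTransition.zero_of_nonpos (by linarith), Real.smoothTransition.zero_of_nonpos (by linarith), sub_self]

lemma psi1_contDiff : ContDiff ℝ (⊤ : ℕ∞) psi1 := by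
  unfold psi1
  exact (Real.smoothTransition.contDiff.comp (contDiff_id.add contDiff_const)).sub Real.smoothTransition.contDiff

lemma psi1_sum (x : ℝ) (Z : ℕ) : ∑ z ∈ Finset.Icc (-(Z : ℤ)) Z, psi1 (x - z) =
    Real.smoothTransition (x + Z + 1) - Real.smoothTransition (x - Z) := by
  induction Z with
  | zero => simp [psi1]
  | succ Z ih =>
    have : Finset.Icc (-((Z + 1 : ℕ) : ℤ)) ((Z + 1 : ℕ) : ℤ) =
        insert (-((Z : ℤ) + 1)) (insert ((Z : ℤ) + 1) (Finset.Icc (-(Z : ℤ)) Z)) := by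
      ext a; simp only [Finset.mem_Icc, Finset.mem_insert]; push_cast; omega
    rw [this, Finset.sum_insert (by simp; omega), Finset.sum_insert (by simp), ih]
    unfold psi1; push_cast; ring_nf

lemma psi1_sum_abs (x : ℝ) (Z : ℕ) : |∑ z ∈ Finset.Icc (-(Z : ℤ)) Z, psi1 (x - z)| ≤ 1 := by
  rw [psi1_sum, abs_le]
  have := Real.smoothTransition.nonneg (x + Z + 1)
  have := Real.smoothTransition.nonneg (x - Z)
  have := Real.smoothTransition.le_one (x + Z + 1)
  have := Real.smoothTransition.le_one (x - Z)
  constructor <;> linarith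

lemma psi1_sum_one {x : ℝ} {Z : ℕ} (h : |x| ≤ Z) : ∑ z ∈ Finset.Icc (-(Z : ℤ)) Z, psi1 (x - z) = 1 := by
  have := abs_le.1 h
  rw [psi1_sum, Real.smoothTransition.one_of_one_le (by linarith), Real.smoothTransition.zero_of_nonpos (by linarith), sub_zero]

def psi {d : ℕ} (u : ES d) : ℝ := ∏ i, psi1 (u i)

lemma psi_supp {d : ℕ} {u : ES d} (h : psi u ≠ 0) (i : Fin d) : |u i| ≤ 1 :=
  psi1_supp fun h0 => h (Finset.prod_eq_zero (Finset.mem_univ i) h0)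

lemma psi_contDiff {d : ℕ} : ContDiff ℝ (⊤ : ℕ∞) (psi : ES d → ℝ) := by
  unfold psi
  apply contDiff_prod
  intro i _
  exact psi1_contDiff.comp (EuclideanSpace.proj (𝕜 := ℝ) i : ES d →L[ℝ] ℝ).contDiff

/-- box of integer points -/
def zbox (d Z : ℕ) : Finset (Fin d → ℤ) := Fintype.piFinset fun _ => Finset.Icc (-(Z : ℤ)) Z

lemma psi_sum {d : ℕ} (x : ES d) (Z : ℕ) : ∑ z ∈ zbox d Z, psi (x - zz z) =
    ∏ i, ∑ z ∈ Finset.Icc (-(Z : ℤ)) Z, psi1 (x i - z) := by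
  rw [Finset.prod_univ_sum]
  rfl

lemma psi_sum_abs {d : ℕ} (x : ES d) (Z : ℕ) : |∑ z ∈ zbox d Z, psi (x - zz z)| ≤ 1 := by
  rw [psi_sum, Finset.abs_prod]
  exact Finset.prod_le_one (fun _ _ => abs_nonneg _) fun i _ => psi1_sum_abs _ _

lemma psi_sum_one {d : ℕ} (x : ES d) {Z : ℕ} (h : ∀ i, |x i| ≤ Z) : ∑ z ∈ zbox d Z, psi (x - zz z) = 1 := by
  rw [psi_sum]
  exact Finset.prod_eq_one fun i _ => psi1_sum_one (h i)

def bmp (d : ℕ) (r : ℝ) : ContDiffBump (0 : ES d) :=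
  if h : 0 < r then ⟨r, 2 * r, h, by linarith⟩ else ⟨1, 2, one_pos, by norm_num⟩

lemma bmp_one {d : ℕ} {r : ℝ} (hr : 0 < r) {x : ES d} (h : ‖x‖ ≤ r) : bmp d r x = 1 := by
  apply ContDiffBump.one_of_mem_closedBall
  simp [bmp, hr, h]

lemma bmp_zero {d : ℕ} {r : ℝ} (hr : 0 < r) {x : ES d} (h : 2 * r ≤ ‖x‖) : bmp d r x = 0 := by
  apply ContDiffBump.zero_of_le_dist
  simp [bmp, hr, h]

def Wf {d : ℕ} (r : ℝ) (x : ES d) : ℝ := bmp d r ((1 / 2 : ℝ) • x) - bmp d r x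

lemma Wf_abs {d : ℕ} (r : ℝ) (x : ES d) : |Wf r x| ≤ 1 := by
  unfold Wf
  have := (bmp d r).nonneg' ((1 / 2 : ℝ) • x)
  have := (bmp d r).nonneg' x
  have := (bmp d r).le_one (x := (1 / 2 : ℝ) • x)
  have := (bmp d r).le_one (x := x)
  rw [abs_le]; constructor <;> linarith

lemma Wf_supp {d : ℕ} {r : ℝ} (hr : 0 < r) {x : ES d} (h : Wf r x ≠ 0) : r ≤ ‖x‖ ∧ ‖x‖ ≤ 4 * r := by
  have h1 : ‖(1 / 2 : ℝ) • x‖ = ‖x‖ / 2 := by rw [norm_smul]; norm_num; ring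
  constructor
  · by_contra hc
    push Not at hc
    apply h
    unfold Wf
    rw [bmp_one hr hc.le, bmp_one hr (by rw [h1]; linarith [norm_nonneg x]), sub_self]
  · by_contra hc
    push Not at hc
    apply h
    unfold Wf
    rw [bmp_zero hr (x := x) (by linarith [norm_nonneg x]), bmp_zero hr (by rw [h1]; linarith [norm_nonneg x]), sub_self]

lemma Wf_contDiff {d : ℕ} (r : ℝ) : ContDiff ℝ (⊤ : ℕ∞) (Wf r : ES d → ℝ) := by
  unfold Wf
  exact ((bmp d r).contDiff.comp (contDiff_id.const_smul (1 / 2 : ℝ))).sub (bmp d r).contDiff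

lemma Wf_sum {d : ℕ} (r : ℝ) (x : ES d) (S : ℕ) : ∑ s ∈ Finset.Ico (-(S : ℤ)) S, Wf r (tw (-s) • x) =
    bmp d r (tw (-S) • x) - bmp d r (tw S • x) := by
  induction S with
  | zero => simp
  | succ S ih =>
    have : Finset.Ico (-((S + 1 : ℕ) : ℤ)) ((S + 1 : ℕ) : ℤ) =
        insert (-((S : ℤ) + 1)) (insert (S : ℤ) (Finset.Ico (-(S : ℤ)) S)) := by
      ext a; simp only [Finset.mem_Ico, Finset.mem_insert]; push_cast; omega
    rw [this, Finset.sum_insert (by simp), Finset.sum_insert (by simp), ih]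
    unfold Wf
    simp only [smul_smul]
    have e1 : (1 / 2 : ℝ) * tw (-(-((S : ℤ) + 1))) = tw S := by rw [neg_neg]; unfold tw; rw [zpow_add₀ two_ne_zero, zpow_one]; ring
    have e2 : (1 / 2 : ℝ) * tw (-(S : ℤ)) = tw (-((S + 1 : ℕ) : ℤ)) := by
      unfold tw; push_cast; rw [neg_add, zpow_add₀ two_ne_zero, zpow_neg_one]; ring
    have e3 : tw (-(-((S : ℤ) + 1))) = tw ((S + 1 : ℕ) : ℤ) := by rw [neg_neg]; push_cast; rfl
    rw [e1, e2, e3]; ring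

def kap {d : ℕ} (T : ES d →L[ℝ] ES d) (r : ℝ) (z : Fin d → ℤ) (u : ES d) : ℝ := psi u * Wf r (T (u + zz z))

def KK {d : ℕ} (T : ES d →L[ℝ] ES d) (r : ℝ) (p : ES d × ES d) : ℝ := psi p.1 * Wf r (T p.1 + p.2)

lemma KK_contDiff {d : ℕ} (T : ES d →L[ℝ] ES d) (r : ℝ) : ContDiff ℝ (⊤ : ℕ∞) (KK T r) := by
  unfold KK
  exact (psi_contDiff.comp contDiff_fst).mul
    ((Wf_contDiff r).comp ((T.contDiff.comp contDiff_fst).add contDiff_snd))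

lemma cube_norm2 {d : ℕ} {u : ES d} (hu : ∀ i, |u i| ≤ 1) : ‖u‖ ≤ d + 1 := by
  have := cube_norm (n := d + 1) (by omega) (u := u) hu
  exact_mod_cast this

lemma KK_supp {d : ℕ} (T : ES d →L[ℝ] ES d) {r : ℝ} (hr : 0 < r) : HasCompactSupport (KK T r) := by
  apply HasCompactSupport.intro (K := Metric.closedBall 0 (d + 1) ×ˢ Metric.closedBall 0 (4 * r + ‖T‖ * (d + 1)))
  · exact (isCompact_closedBall _ _).prod (isCompact_closedBall _ _)
  · rintro ⟨u, v⟩ h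
    by_contra hc
    apply h
    have h1 : psi u ≠ 0 := fun h => hc (by simp [KK, h])
    have h2 : Wf r (T u + v) ≠ 0 := fun h => hc (by simp [KK, h])
    have h3 := cube_norm2 (psi_supp h1)
    have h4 := (Wf_supp hr h2).2
    constructor
    · simpa using h3
    · simp only [mem_closedBall_zero_iff]
      have h5 := norm_sub_le (T u + v) (T u)
      rw [add_sub_cancel_left] at h5
      have h6 : ‖T u‖ ≤ ‖T‖ * (d + 1) := (T.le_opNorm u).trans (by gcongr)
      linarith

lemma kap_bound {d : ℕ} (T : ES d →L[ℝ] ES d) {r : ℝ} (hr : 0 < r) (a : ℕ) :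
    ∃ C, 0 ≤ C ∧ ∀ z u, ‖iteratedFDeriv ℝ a (fun u => (kap T r z u : ℂ)) u‖ ≤ C := by
  have hc : ContDiff ℝ (⊤ : ℕ∞) (fun p => (KK T r p : ℂ)) := Complex.ofRealCLM.contDiff.comp (KK_contDiff T r)
  have hs : HasCompactSupport (fun p => (KK T r p : ℂ)) := (KK_supp T hr).comp_left (g := fun x : ℝ => (x : ℂ)) (by simp)
  have hcont : Continuous (iteratedFDeriv ℝ a (fun p => (KK T r p : ℂ))) :=
    hc.continuous_iteratedFDeriv (by exact_mod_cast le_top)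
  obtain ⟨C, hC⟩ := hcont.bounded_above_of_compact_support (hs.iteratedFDeriv a)
  set I := ContinuousLinearMap.inl ℝ (ES d) (ES d)
  have hC0 : 0 ≤ C := (norm_nonneg _).trans (hC 0)
  refine ⟨C * ‖I‖ ^ a, by positivity, fun z u => ?_⟩
  have e : (fun u => (kap T r z u : ℂ)) = (fun p => (KK T r (p + (0, T (zz z))) : ℂ)) ∘ I := by
    ext u; simp [kap, KK, I]
  have hc2 : ContDiff ℝ (⊤ : ℕ∞) (fun p => (KK T r (p + (0, T (zz z))) : ℂ)) := hc.comp (contDiff_id.add contDiff_const)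
  rw [e, I.iteratedFDeriv_comp_right (n := (⊤ : ℕ∞)) hc2 u (by exact_mod_cast le_top)]
  refine (ContinuousMultilinearMap.norm_compContinuousLinearMap_le _ _).trans ?_
  simp only [Finset.prod_const, Finset.card_univ, Fintype.card_fin]
  gcongr
  rw [iteratedFDeriv_comp_add_right (f := fun p => (KK T r p : ℂ))]
  exact hC _

lemma kap_contDiff {d : ℕ} (T : ES d →L[ℝ] ES d) (r : ℝ) (z : Fin d → ℤ) :
    ContDiff ℝ (⊤ : ℕ∞) (fun u => (kap T r z u : ℂ)) := by
  unfold kap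
  exact Complex.ofRealCLM.contDiff.comp (psi_contDiff.mul
    ((Wf_contDiff r).comp (T.contDiff.comp (contDiff_id.add contDiff_const))))

lemma kap_supp {d : ℕ} {T : ES d →L[ℝ] ES d} {r : ℝ} (hr : 0 < r) {z : Fin d → ℤ} {u : ES d} (h : kap T r z u ≠ 0) :
    (∀ i, |u i| ≤ 1) ∧ r ≤ ‖T (u + zz z)‖ ∧ ‖T (u + zz z)‖ ≤ 4 * r := by
  have h1 : psi u ≠ 0 := fun h' => h (by unfold kap; rw [h']; simp)
  have h2 : Wf r (T (u + zz z)) ≠ 0 := fun h' => h (by unfold kap; rw [h']; simp)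
  exact ⟨psi_supp h1, Wf_supp hr h2⟩

/-! ### Smoothness of the symbol pieces -/

section symb
variable {n : ℕ} {Γ' : Submodule ℝ (Fin n → ℝ)} {T : ES (n - 1) →L[ℝ] ES (n - 1)} {M : ℕ} {B r : ℝ} {m : (Fin n → ℝ) → ℂ}

lemma symb_nonneg (hm : SymbolEst n Γ' M B m) : 0 ≤ B :=
  (norm_nonneg _).trans (hm.1 0 (by simp [GammaSet]))

lemma symb_num {t c r N : ℝ} (ht : 0 < t) (hc : 0 < c) (hr : 0 < r) (hN : 0 < N) (a : ℕ) (P B : ℝ) :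
    (t * c) ^ a * P * (B / (t * (r / (2 * N))) ^ a) = B * (2 * N * c / r) ^ a * P := by
  rw [show (2 * N * c / r) = (t * c) / (t * (r / (2 * N))) by field_simp, div_pow]; ring

lemma symb_pull (hn : 1 ≤ n) (hT : Proj Γ' T) (hΓ : (Γ' : Set (Fin n → ℝ)) ⊆ GammaSet n) (hr : 0 < r)
    (hm : SymbolEst n Γ' M B m) (s : ℤ) :
    ContDiffOn ℝ (M : ℕ∞) (fun y => m (gL n (tw s • y))) {x | r / 2 < ‖T x‖} ∧
    ∀ a ≤ M, ∀ x, r / 2 < ‖T x‖ → ‖iteratedFDeriv ℝ a (fun y => m (gL n (tw s • y))) x‖ ≤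
      B * (2 * n * (‖gL n‖ + 1) / r) ^ a := by
  have hn' : (0 : ℝ) < n := by exact_mod_cast hn
  have hB := symb_nonneg hm
  set G : ES (n - 1) →L[ℝ] (Fin n → ℝ) := tw s • gL n with hG
  have hGx : ∀ y, G y = gL n (tw s • y) := fun y => by simp [hG]
  have e : (fun y => m (gL n (tw s • y))) = m ∘ G := by ext y; simp [hG]
  have hS : IsOpen ((Γ' : Set (Fin n → ℝ))ᶜ) := (Submodule.closed_of_finiteDimensional Γ').isOpen_compl
  have hV : {x | r / 2 < ‖T x‖} ⊆ G ⁻¹' ((Γ' : Set (Fin n → ℝ))ᶜ) := by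
    intro x hx hc
    have h0 : T (tw s • x) = 0 := (hT.ker _).2 (by rw [← hGx]; exact hc)
    rw [map_smul, smul_eq_zero] at h0
    rcases h0 with h0 | h0
    · exact tw_ne s h0
    · simp only [Set.mem_setOf_eq, h0, norm_zero] at hx; linarith
  have hS2 : IsOpen (G ⁻¹' ((Γ' : Set (Fin n → ℝ))ᶜ)) := hS.preimage G.continuous
  rw [e]
  refine ⟨(hm.2.1.comp G.contDiff.contDiffOn (fun x hx => hx)).mono hV, fun a ha x hx => ?_⟩
  rw [← iteratedFDerivWithin_of_isOpen a hS2 (hV hx),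
    G.iteratedFDerivWithin_comp_right hm.2.1 hS.uniqueDiffOn hS2.uniqueDiffOn (hV hx) (by exact_mod_cast ha)]
  apply ContinuousMultilinearMap.opNorm_le_bound (by positivity)
  intro v
  rw [ContinuousMultilinearMap.compContinuousLinearMap_apply]
  set c := ‖gL n‖ + 1 with hc
  have hc0 : 0 < c := by positivity
  set w : Fin a → (Fin n → ℝ) := fun i => (c * ‖v i‖)⁻¹ • gL n (v i) with hw
  have e1 : (fun i => G (v i)) = fun i => (tw s * (c * ‖v i‖)) • w i := by
    ext1 i
    by_cases h0 : v i = 0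
    · simp [hw, h0]
    · have : ‖v i‖ ≠ 0 := by simpa using h0
      simp only [hw, hG, smul_smul]
      rw [mul_assoc, mul_inv_cancel₀ (by positivity), mul_one]; rfl
  have hw1 : ∀ i, w i ∈ GammaSet n := by
    intro i
    have := gL_mem hn ((c * ‖v i‖)⁻¹ • v i)
    rwa [map_smul] at this
  have hw2 : ∀ i, ‖w i‖ ≤ 1 := by
    intro i
    rw [hw, norm_smul, norm_inv, Real.norm_of_nonneg (by positivity)]
    by_cases h0 : v i = 0
    · simp [h0]
    · have : 0 < ‖v i‖ := by simpa using h0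
      rw [inv_mul_le_iff₀ (by positivity), mul_one]
      exact ((gL n).le_opNorm _).trans (by gcongr; linarith)
  rw [e1, ContinuousMultilinearMap.map_smul_univ, norm_smul]
  have hb := hm.2.2 a ha (G x) (hV hx) w hw1 hw2
  have hd : tw s * (r / (2 * n)) ≤ Metric.infDist (G x) Γ' := by
    rw [hGx]
    refine le_trans ?_ (proj_infDist hn hT hΓ _)
    rw [map_smul, norm_smul, Real.norm_of_nonneg (tw_pos s).le, mul_div_assoc]
    have key : r / (2 * n) ≤ ‖T x‖ / n := by
      rw [div_mul_eq_div_div]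
      exact div_le_div_of_nonneg_right (le_of_lt hx) hn'.le
    exact mul_le_mul_of_nonneg_left key (tw_pos s).le
  have hts := tw_pos s
  have hb2 : B / Metric.infDist (G x) Γ' ^ a ≤ B / (tw s * (r / (2 * n))) ^ a := by gcongr
  have e2 : ‖∏ i, tw s * (c * ‖v i‖)‖ = (tw s * c) ^ a * ∏ i, ‖v i‖ := by
    rw [norm_prod]
    have : ∀ i, ‖tw s * (c * ‖v i‖)‖ = (tw s * c) * ‖v i‖ := fun i => by
      rw [Real.norm_of_nonneg (by positivity)]; ring
    simp_rw [this]
    rw [Finset.prod_mul_distrib]; simp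
  rw [e2]
  have hP : 0 ≤ ∏ i, ‖v i‖ := Finset.prod_nonneg fun i _ => norm_nonneg _
  refine (mul_le_mul_of_nonneg_left (hb.trans hb2) (mul_nonneg (by positivity) hP)).trans (le_of_eq ?_)
  exact symb_num hts hc0 hr hn' _ _ _

def gQ (n : ℕ) (T : ES (n - 1) →L[ℝ] ES (n - 1)) (r : ℝ) (m : (Fin n → ℝ) → ℂ) (s : ℤ) (z : Fin (n - 1) → ℤ)
    (u : ES (n - 1)) : ℂ := m (gL n (tw s • (u + zz z))) * (kap T r z u : ℂ)

lemma gQ_bound (hn : 1 ≤ n) (hT : Proj Γ' T) (hΓ : (Γ' : Set (Fin n → ℝ)) ⊆ GammaSet n) (hr : 0 < r) (M : ℕ) (B : ℝ) :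
    ∃ C, 0 ≤ C ∧ ∀ m, SymbolEst n Γ' M B m → ∀ s z, ContDiff ℝ (M : ℕ∞) (gQ n T r m s z) ∧
      ∀ a ≤ M, ∀ u, ‖iteratedFDeriv ℝ a (gQ n T r m s z) u‖ ≤ C := by
  choose CK hCK0 hCK using fun a => kap_bound T hr a
  set CF : ℕ → ℝ := fun a => |B| * (2 * n * (‖gL n‖ + 1) / r) ^ a with hCF
  have hCF0 : ∀ a, 0 ≤ CF a := fun a => by positivity
  set CA : ℕ → ℝ := fun a => ∑ i ∈ Finset.range (a + 1), (a.choose i : ℝ) * CF i * CK (a - i) with hCA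
  have hCA0 : ∀ a, 0 ≤ CA a := fun a => Finset.sum_nonneg fun i _ =>
    mul_nonneg (mul_nonneg (by positivity) (hCF0 _)) (hCK0 _)
  refine ⟨∑ a ∈ Finset.range (M + 1), CA a, Finset.sum_nonneg fun a _ => hCA0 a, fun m hm s z => ?_⟩
  obtain ⟨h1, h2⟩ := symb_pull hn hT hΓ hr hm s
  set f : ES (n - 1) → ℂ := fun y => m (gL n (tw s • y)) with hf
  set V : Set (ES (n - 1)) := {x | r / 2 < ‖T x‖} with hV
  have hVo : IsOpen V := isOpen_lt continuous_const (by fun_prop)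
  set U : Set (ES (n - 1)) := {u | u + zz z ∈ V} with hU
  have hUo : IsOpen U := hVo.preimage (continuous_id.add continuous_const)
  have hfU : ContDiffOn ℝ (M : ℕ∞) (fun u => f (u + zz z)) U :=
    h1.comp (contDiff_id.add contDiff_const).contDiffOn (fun u hu => hu)
  have hk := (kap_contDiff T r z).of_le (m := (M : ℕ∞)) (by exact_mod_cast le_top)
  have hz : ∀ u, u ∉ U → gQ n T r m s z =ᶠ[nhds u] 0 := by
    intro u hu
    have hu' : ‖T (u + zz z)‖ < r := by
      simp only [hU, hV, Set.mem_setOf_eq, not_lt] at hu; linarith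
    have : ∀ᶠ w in nhds u, ‖T (w + zz z)‖ < r :=
      (isOpen_lt (f := fun w : ES (n-1) => ‖T (w + zz z)‖) (by fun_prop) continuous_const).mem_nhds hu'
    filter_upwards [this] with w hw
    have : kap T r z w = 0 := by
      by_contra hc
      exact absurd (kap_supp hr hc).2.1 (not_le.2 hw)
    simp [gQ, this]
  constructor
  · rw [contDiff_iff_contDiffAt]
    intro u
    by_cases hu : u ∈ U
    · exact (hfU.contDiffAt (hUo.mem_nhds hu)).mul hk.contDiffAt
    · exact (contDiffAt_const (c := (0 : ℂ))).congr_of_eventuallyEq (hz u hu)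
  · intro a ha u
    have hCa : CA a ≤ ∑ a ∈ Finset.range (M + 1), CA a :=
      Finset.single_le_sum (fun a _ => hCA0 a) (Finset.mem_range.2 (by omega))
    refine le_trans ?_ hCa
    by_cases hu : u ∈ U
    · rw [← iteratedFDerivWithin_of_isOpen a hUo hu]
      refine (norm_iteratedFDerivWithin_mul_le hfU hk.contDiffOn hUo.uniqueDiffOn hu (n := a) (by exact_mod_cast ha)).trans ?_
      apply Finset.sum_le_sum
      intro i hi
      have hi' : i ≤ a := by simpa [Nat.lt_succ_iff] using hi
      rw [iteratedFDerivWithin_of_isOpen _ hUo hu, iteratedFDerivWithin_of_isOpen _ hUo hu]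
      rw [iteratedFDeriv_comp_add_right (f := f)]
      have h3 := h2 i (by omega) (u + zz z) hu
      have h4 := hCK (a - i) z u
      have h5 : ‖iteratedFDeriv ℝ i f (u + zz z)‖ ≤ CF i := by
        rw [hCF]; simp only; rw [abs_of_nonneg (symb_nonneg hm)]; exact h3
      have := hCF0 i
      gcongr
    · have h0 : iteratedFDeriv ℝ a (gQ n T r m s z) u = 0 := by
        rw [((hz u hu).iteratedFDeriv ℝ a).self_of_nhds]; simp
      rw [h0, norm_zero]; exact hCA0 a

lemma gQ_supp (hr : 0 < r) {s : ℤ} {z : Fin (n - 1) → ℤ} {u : ES (n - 1)} (h : gQ n T r m s z u ≠ 0) :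
    (∀ i, |u i| ≤ 1) ∧ r ≤ ‖T (u + zz z)‖ ∧ ‖T (u + zz z)‖ ≤ 4 * r := by
  apply kap_supp hr (z := z)
  intro h0; apply h; simp [gQ, h0]

/-- Fourier decay and inversion for the symbol pieces. -/
lemma gQ_fourier (hn : 1 ≤ n) (hT : Proj Γ' T) (hΓ : (Γ' : Set (Fin n → ℝ)) ⊆ GammaSet n) (hr : 0 < r) (N : ℕ) (B : ℝ) :
    ∃ C, 0 ≤ C ∧ ∀ m, SymbolEst n Γ' (N + n) B m → ∀ s z,
      Continuous (gQ n T r m s z) ∧ Integrable (gQ n T r m s z) ∧ Integrable (𝓕 (gQ n T r m s z)) ∧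
      (∀ y, ‖𝓕 (gQ n T r m s z) y‖ ≤ C * (1 + ‖y‖) ^ (-((N + n : ℕ) : ℝ))) ∧
      ∀ u, gQ n T r m s z u = ∫ y, 𝓕 (gQ n T r m s z) y * ee (inner ℝ y u) := by
  obtain ⟨C, hC0, hC⟩ := gQ_bound hn hT hΓ hr (N + n) B
  set M := N + n with hM
  set V0 : ℝ := (volume : Measure (ES (n - 1))).real (Metric.closedBall 0 n) with hV0
  set C1 : ℝ := 2 ^ M * (∑ p ∈ Finset.range 1 ×ˢ Finset.range (M + 1), C * V0) with hC1
  set C2 : ℝ := ∑ p ∈ Finset.range 1 ×ˢ Finset.range 1, C * V0 with hC2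
  have hV00 : 0 ≤ V0 := measureReal_nonneg
  refine ⟨2 ^ M * (C1 + C2), by positivity, fun m hm s z => ?_⟩
  obtain ⟨h1, h2⟩ := hC m hm s z
  set g := gQ n T r m s z with hg
  have hsup : ∀ u, u ∉ Metric.closedBall (0 : ES (n - 1)) n → g u = 0 := by
    intro u hu
    by_contra hc
    apply hu
    simpa using cube_norm hn (gQ_supp hr hc).1
  have hcs : HasCompactSupport g := HasCompactSupport.intro (isCompact_closedBall _ _) hsup
  have hgi : Integrable g := h1.continuous.integrable_of_hasCompactSupport hcs
  have hts : tsupport g ⊆ Metric.closedBall (0 : ES (n - 1)) n := by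
    apply closure_minimal _ Metric.isClosed_closedBall
    intro u hu; by_contra hc; exact hu (hsup u hc)
  have hDc : ∀ a ≤ M, Continuous (iteratedFDeriv ℝ a g) := fun a ha =>
    h1.continuous_iteratedFDeriv (by exact_mod_cast ha)
  have hDi : ∀ a ≤ M, Integrable (fun v => ‖iteratedFDeriv ℝ a g v‖) := fun a ha =>
    ((hDc a ha).integrable_of_hasCompactSupport (hcs.iteratedFDeriv a)).norm
  have hDb : ∀ a ≤ M, ∫ v, ‖iteratedFDeriv ℝ a g v‖ ≤ C * V0 := by
    intro a ha
    have : ∀ v, ‖iteratedFDeriv ℝ a g v‖ ≤ (Metric.closedBall (0 : ES (n - 1)) n).indicator (fun _ => C) v := by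
      intro v
      by_cases hv : v ∈ Metric.closedBall (0 : ES (n - 1)) n
      · rw [Set.indicator_of_mem hv]; exact h2 a ha v
      · rw [Set.indicator_of_notMem hv]
        have : iteratedFDeriv ℝ a g v = 0 := by
          by_contra hc
          exact hv (hts (support_iteratedFDeriv_subset a hc))
        rw [this, norm_zero]
    calc ∫ v, ‖iteratedFDeriv ℝ a g v‖ ≤ ∫ v, (Metric.closedBall (0 : ES (n - 1)) n).indicator (fun _ => C) v := by
          apply integral_mono (hDi a ha) _ this
          exact (integrableOn_const (hs := measure_closedBall_lt_top.ne)).integrable_indicator Metric.isClosed_closedBall.measurableSet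
      _ = C * V0 := by
          rw [integral_indicator Metric.isClosed_closedBall.measurableSet, setIntegral_const, smul_eq_mul, mul_comm]
  have hintg : ∀ (k a : ℕ), (k : ℕ∞) ≤ (0 : ℕ) → (a : ℕ∞) ≤ (M : ℕ) → Integrable (fun v ↦ ‖v‖ ^ k * ‖iteratedFDeriv ℝ a g v‖) := by
    intro k a hk ha
    have hk0 : k = 0 := by have : k ≤ 0 := by exact_mod_cast hk
                           omega
    subst hk0
    simpa using hDi a (by exact_mod_cast ha)
  have hF : ∀ a ≤ M, ∀ w, ‖w‖ ^ a * ‖𝓕 g w‖ ≤ 2 ^ a * (∑ p ∈ Finset.range 1 ×ˢ Finset.range (a + 1), C * V0) := by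
    intro a ha w
    have := Real.pow_mul_norm_iteratedFDeriv_fourier_le (K := (0 : ℕ)) (N := (M : ℕ)) h1 hintg (k := 0) (n := a) le_rfl (by exact_mod_cast ha) w
    simp only [norm_iteratedFDeriv_zero, pow_zero, one_mul] at this
    refine this.trans ?_
    rw [show (2 * ((0 : ℕ) : ℝ) + 2) = 2 by norm_num]
    apply mul_le_mul_of_nonneg_left _ (by positivity)
    apply Finset.sum_le_sum
    rintro ⟨p1, p2⟩ hp
    simp only [Finset.mem_product, Finset.mem_range] at hp
    have hp1 : p1 = 0 := by omega
    subst hp1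
    simp only [pow_zero, one_mul]
    exact hDb p2 (by omega)
  have hdec : ∀ y, ‖𝓕 g y‖ ≤ 2 ^ M * (C1 + C2) * (1 + ‖y‖) ^ (-((M : ℕ) : ℝ)) := by
    intro y
    have ha := hF M le_rfl y
    have hb := hF 0 (by omega) y
    simp only [pow_zero, one_mul] at hb
    rw [Real.rpow_neg (by positivity), Real.rpow_natCast, ← div_eq_mul_inv, le_div_iff₀ (by positivity)]
    have h3 : (1 + ‖y‖) ^ M ≤ 2 ^ M * (1 + ‖y‖ ^ M) := by
      rcases le_total ‖y‖ 1 with h | h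
      · calc (1 + ‖y‖) ^ M ≤ 2 ^ M := by gcongr; linarith
          _ ≤ 2 ^ M * (1 + ‖y‖ ^ M) := le_mul_of_one_le_right (by positivity) (by linarith [pow_nonneg (norm_nonneg y) M])
      · calc (1 + ‖y‖) ^ M ≤ (2 * ‖y‖) ^ M := by gcongr; linarith
          _ = 2 ^ M * ‖y‖ ^ M := by rw [mul_pow]
          _ ≤ _ := by gcongr; linarith
    calc ‖𝓕 g y‖ * (1 + ‖y‖) ^ M ≤ ‖𝓕 g y‖ * (2 ^ M * (1 + ‖y‖ ^ M)) := by gcongr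
      _ = 2 ^ M * (‖y‖ ^ M * ‖𝓕 g y‖ + ‖𝓕 g y‖) := by ring
      _ ≤ _ := by gcongr
  have hFc : Continuous (𝓕 g) := VectorFourier.fourierIntegral_continuous Real.continuous_fourierChar
    (continuous_inner) hgi
  have hFi : Integrable (𝓕 g) := by
    have : Integrable (fun y : ES (n - 1) => (1 + ‖y‖) ^ (-((M : ℕ) : ℝ))) := by
      apply integrable_one_add_norm
      simp only [finrank_euclideanSpace, Fintype.card_fin]
      exact_mod_cast (by omega : n - 1 < M)
    exact (this.const_mul _).mono' hFc.aestronglyMeasurable (Filter.Eventually.of_forall hdec)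
  refine ⟨h1.continuous, hgi, hFi, hdec, fun u => ?_⟩
  have hinv := congrFun (h1.continuous.fourierInv_fourier_eq hgi hFi) u
  rw [Real.fourierInv_eq] at hinv
  rw [← hinv]
  apply integral_congr_ae
  filter_upwards with y
  rw [Circle.smul_def, smul_eq_mul, mul_comm]; rfl

end symb

/-! ### Band limited functions -/

lemma ft_eq (f : ℝ → ℂ) (w : ℝ) : 𝓕 f w = ∫ v, ee (-(v * w)) * f v := by
  rw [Real.fourier_real_eq]; rfl

lemma ft_continuous {f : ℝ → ℂ} (hf : Integrable f) : Continuous (𝓕 f) :=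
  VectorFourier.fourierIntegral_continuous (by exact Real.continuous_fourierChar)
    (by simp only [innerₗ_apply_apply]; fun_prop) hf

structure BL (a R : ℝ) (f : ℝ → ℂ) : Prop where
  cont : Continuous f
  dec : ∀ K : ℕ, ∃ C : ℝ, 0 ≤ C ∧ ∀ u, ‖f u‖ ≤ C * rho u ^ K
  van : ∀ w, R < |w - a| → 𝓕 f w = 0

lemma BL.int {a R : ℝ} {f : ℝ → ℂ} (hf : BL a R f) : Integrable f := by
  obtain ⟨C, hC, h⟩ := hf.dec 2
  exact (rho_sq_integrable.const_mul C).mono' hf.cont.aestronglyMeasurable (Filter.Eventually.of_forall h)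

lemma rho_abs_mul (u : ℝ) : |u| * rho u ≤ 1 := by
  unfold rho
  rw [← div_eq_mul_inv, div_le_one (by positivity)]; linarith

lemma dec_mul {f : ℝ → ℂ} (h : ∀ K : ℕ, ∃ C : ℝ, 0 ≤ C ∧ ∀ u, ‖f u‖ ≤ C * rho u ^ K) :
    ∀ K : ℕ, ∃ C : ℝ, 0 ≤ C ∧ ∀ u : ℝ, ‖(u : ℂ) * f u‖ ≤ C * rho u ^ K := by
  intro K
  obtain ⟨C, hC, h⟩ := h (K + 1)
  refine ⟨C, hC, fun u => ?_⟩
  rw [norm_mul, Complex.norm_real, Real.norm_eq_abs]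
  have h1 := mul_le_mul_of_nonneg_left (h u) (abs_nonneg u)
  have h2 := rho_abs_mul u
  have h3 : 0 ≤ C * rho u ^ K := mul_nonneg hC (pow_nonneg (rho_nonneg u) K)
  calc _ ≤ _ := h1
    _ = (C * rho u ^ K) * (|u| * rho u) := by ring
    _ ≤ (C * rho u ^ K) * 1 := mul_le_mul_of_nonneg_left h2 h3
    _ = _ := by ring

lemma BL.mulX {a R : ℝ} {f : ℝ → ℂ} (hf : BL a R f) : BL a R (fun u => (u : ℂ) * f u) where
  cont := by have := hf.cont; fun_prop
  dec := dec_mul hf.dec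
  van := by
    intro w hw
    have hintg : Integrable (fun u : ℝ => (u : ℂ) * f u) := by
      obtain ⟨C, hC, h⟩ := dec_mul hf.dec 2
      have := hf.cont
      exact (rho_sq_integrable.const_mul C).mono' (by fun_prop) (Filter.Eventually.of_forall h)
    have h1 := Real.hasDerivAt_fourier hf.int (by simpa using hintg) w
    have h2 : 𝓕 f =ᶠ[nhds w] fun _ => 0 := by
      have : IsOpen {w : ℝ | R < |w - a|} := isOpen_lt continuous_const (by fun_prop)
      filter_upwards [this.mem_nhds hw] with x hx using hf.van x hx
    have h3 := (h1.congr_of_eventuallyEq h2.symm).unique (hasDerivAt_const w (0 : ℂ))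
    rw [ft_eq] at h3 ⊢
    have h4 : ∀ v : ℝ, ee (-(v * w)) * ((-2 * π * I * v) • f v) = (-2 * π * I) * (ee (-(v * w)) * (v * f v)) := by
      intro v; simp only [smul_eq_mul]; ring
    simp_rw [h4] at h3
    rw [integral_const_mul] at h3
    rcases mul_eq_zero.1 h3 with h | h
    · exfalso; simp [Real.pi_ne_zero] at h
    · exact h

lemma BL.constMul {a R : ℝ} {f : ℝ → ℂ} (hf : BL a R f) (c : ℂ) : BL a R (fun u => c * f u) where
  cont := by have := hf.cont; fun_prop
  dec := by
    intro K
    obtain ⟨C, hC, h⟩ := hf.dec K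
    refine ⟨‖c‖ * C, by positivity, fun u => ?_⟩
    rw [norm_mul, mul_assoc]
    exact mul_le_mul_of_nonneg_left (h u) (norm_nonneg _)
  van := by
    intro w hw
    have := hf.van w hw
    rw [ft_eq] at this ⊢
    simp_rw [mul_left_comm _ c]
    rw [integral_const_mul, this, mul_zero]

lemma ee_int {f : ℝ → ℂ} (hf : Integrable f) {g : ℝ → ℝ} (hg : Continuous g) :
    Integrable (fun v => ee (g v) * f v) :=
  hf.bdd_mul (c := 1) (ee_continuous.comp hg).aestronglyMeasurable (Filter.Eventually.of_forall fun v => (ee_norm _).le)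

lemma BL.add {a R : ℝ} {f g : ℝ → ℂ} (hf : BL a R f) (hg : BL a R g) : BL a R (fun u => f u + g u) where
  cont := hf.cont.add hg.cont
  dec := by
    intro K
    obtain ⟨C, hC, h⟩ := hf.dec K
    obtain ⟨D, hD, h'⟩ := hg.dec K
    refine ⟨C + D, by positivity, fun u => ?_⟩
    rw [add_mul]
    exact (norm_add_le _ _).trans (add_le_add (h u) (h' u))
  van := by
    intro w hw
    have h1 := hf.van w hw
    have h2 := hg.van w hw
    rw [ft_eq] at h1 h2 ⊢
    simp_rw [mul_add]
    rw [integral_add (ee_int hf.int (by fun_prop)) (ee_int hg.int (by fun_prop)), h1, h2, add_zero]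

lemma BL.quad {a R : ℝ} {f : ℝ → ℂ} (hf : BL a R f) (x y z : ℝ) :
    BL a R (fun u => ((x + y * u + z * u ^ 2 : ℝ) : ℂ) * f u) := by
  have h1 := ((hf.constMul (x : ℂ)).add (hf.mulX.constMul (y : ℂ))).add (hf.mulX.mulX.constMul (z : ℂ))
  convert h1 using 2 with u
  push_cast; ring

lemma BL.ampl {a R : ℝ} {f : ℝ → ℂ} (hf : BL a R f) (N : ℕ) : BL a R (amp N f) := by
  induction N with
  | zero => convert hf using 1; ext u; simp [amp]
  | succ N ih =>
    have := ih.quad 1 0 1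
    convert this using 2 with u
    simp only [amp]; push_cast; ring

lemma BL.affine {a R : ℝ} {f : ℝ → ℂ} (hf : BL a R f) {r : ℝ} (hr : 0 < r) (q : ℝ) :
    BL (r * a) (r * R) (fun t => f (r * t - q)) where
  cont := by have := hf.cont; fun_prop
  dec := by
    intro K
    obtain ⟨C, hC, h⟩ := hf.dec K
    set c : ℝ := (1 + |q|) * (1 + r⁻¹)
    have hc : 0 < c := by positivity
    refine ⟨C * c ^ K, by positivity, fun t => (h _).trans ?_⟩
    rw [mul_assoc, ← mul_pow]
    have : rho (r * t - q) ≤ c * rho t := by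
      apply rho_le_mul hc
      have h1 : |r * t| ≤ |r * t - q| + |q| := by
        have := abs_add_le (r * t - q) q; rwa [sub_add_cancel] at this
      rw [abs_mul, abs_of_pos hr] at h1
      have h2 : |t| ≤ r⁻¹ * (|r * t - q| + |q|) := by
        rw [← mul_le_mul_iff_right₀ hr]; field_simp; linarith
      set A := |r * t - q|
      set B := |q|
      have hA : 0 ≤ A := abs_nonneg _
      have hB : 0 ≤ B := abs_nonneg _
      have hri : 0 < r⁻¹ := by positivity
      have : r⁻¹ * (A + B) ≤ r⁻¹ * ((1 + B) * (1 + A)) :=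
        mul_le_mul_of_nonneg_left (by nlinarith) hri.le
      have : (1:ℝ) ≤ (1 + B) * (1 + A) := by nlinarith
      show 1 + |t| ≤ (1 + B) * (1 + r⁻¹) * (1 + A)
      nlinarith
    exact mul_le_mul_of_nonneg_left (pow_le_pow_left₀ (rho_nonneg _) this K) hC
  van := by
    intro w hw
    have h0 : R < |w / r - a| := by
      have : w - r * a = r * (w / r - a) := by field_simp
      rw [this, abs_mul, abs_of_pos hr] at hw
      exact lt_of_mul_lt_mul_left hw hr.le
    have h1 := hf.van _ h0
    rw [ft_eq] at h1 ⊢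
    have h2 : ∀ t : ℝ, ee (-(t * w)) * f (r * t - q) =
        (fun v : ℝ => ee (-((v - q) * (w / r))) * f (v - q)) (r * t) * ee (-(q * (w / r))) := by
      intro t
      show _ = ee _ * f _ * ee _
      rw [mul_right_comm, ← ee_add]; congr 2; field_simp; ring
    simp_rw [h2]
    rw [integral_mul_const, Measure.integral_comp_mul_left
      (fun v : ℝ => ee (-((v - q) * (w / r))) * f (v - q)) r,
      integral_sub_right_eq_self (fun v : ℝ => ee (-(v * (w / r))) * f v) q, h1]
    simp

lemma BL.shift {a R : ℝ} {f : ℝ → ℂ} (hf : BL a R f) (q : ℝ) : BL a R (fun t => f (t - q)) := by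
  have := hf.affine one_pos q
  simpa only [one_mul] using this

lemma BL.modul {a R : ℝ} {f : ℝ → ℂ} (hf : BL a R f) (l : ℝ) : BL (a + l) R (fun t => ee (l * t) * f t) where
  cont := (ee_continuous.comp (by fun_prop)).mul hf.cont
  dec := by
    intro K
    obtain ⟨C, hC, h⟩ := hf.dec K
    refine ⟨C, hC, fun u => ?_⟩
    rw [norm_mul, ee_norm, one_mul]; exact h u
  van := by
    intro w hw
    have h1 := hf.van (w - l) (by rwa [sub_sub, add_comm l])
    rw [ft_eq] at h1 ⊢
    rw [← h1]; congr 1; ext v; rw [← mul_assoc, ← ee_add]; congr 2; ring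

lemma BL.ftint {a R : ℝ} {f : ℝ → ℂ} (hf : BL a R f) : Integrable (𝓕 f) := by
  apply (ft_continuous hf.int).integrable_of_hasCompactSupport
  apply HasCompactSupport.of_support_subset_isCompact (isCompact_Icc (a := a - R) (b := a + R))
  intro w hw
  by_contra hn
  apply hw
  apply hf.van
  by_contra h
  apply hn
  have := abs_le.1 (not_lt.1 h)
  constructor <;> linarith

lemma ft_flip {f g : ℝ → ℂ} (hf : Integrable f) (hg : Integrable g) :
    ∫ w, 𝓕 f w * g w = ∫ x, f x * 𝓕 g x := by
  have := VectorFourier.integral_fourierIntegral_smul_eq_flip (μ := volume) (ν := volume)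
    (e := Real.fourierChar) (L := innerₗ ℝ) Real.continuous_fourierChar
    (by simp only [innerₗ_apply_apply]; fun_prop) hf hg
  simp only [flip_innerₗ, smul_eq_mul] at this
  exact this

lemma ft_conj (f : ℝ → ℂ) (w : ℝ) : 𝓕 (fun x => (starRingEnd ℂ) (f x)) w = (starRingEnd ℂ) (𝓕 f (-w)) := by
  rw [ft_eq, ft_eq, ← integral_conj]
  congr 1; ext v; rw [map_mul, ee_conj]; ring_nf

lemma BL.pair {a b R R' : ℝ} {f g : ℝ → ℂ} (hf : BL a R f) (hg : BL b R' g) (h : R + R' < |a - b|) :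
    ∫ t, f t * (starRingEnd ℂ) (g t) = 0 := by
  have h1 : ∀ t, (starRingEnd ℂ) (g t) = 𝓕 (fun w => (starRingEnd ℂ) (𝓕 g w)) t := by
    intro t
    rw [ft_conj]
    congr 1
    rw [← Real.fourierInv_eq_fourier_neg, hg.cont.fourierInv_fourier_eq hg.int hg.ftint]
  simp_rw [h1]
  have h2 : Integrable (fun w => (starRingEnd ℂ) (𝓕 g w)) := by
    have := hg.ftint
    refine this.norm.mono' ?_ (Filter.Eventually.of_forall fun w => by simp)
    exact (Complex.continuous_conj.comp (ft_continuous hg.int)).aestronglyMeasurable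
  rw [← ft_flip hf.int h2]
  apply integral_eq_zero_of_ae
  refine Filter.Eventually.of_forall fun w => ?_
  show _ * _ = (0:ℂ)
  by_cases hw : R < |w - a|
  · rw [hf.van w hw, zero_mul]
  · have : R' < |w - b| := by
      have h3 := abs_sub_abs_le_abs_sub (a - b) (a - w)
      have : a - b - (a - w) = w - b := by ring
      rw [this, abs_sub_comm a w] at h3
      push Not at hw; linarith
    rw [hg.van w this, map_zero, mul_zero]

lemma BL.orth {R : ℝ} {h : ℝ → ℂ} (hh : BL 0 R h) (p p' : Tile) (s0 q0 : ℤ)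
    (hlt : R * (tw p.s + tw p'.s) < |tw p.s * p.l - tw p'.s * p'.l|) :
    ∫ t, (wt s0 q0 t : ℂ) * (pk h p t * (starRingEnd ℂ) (pk h p' t)) = 0 := by
  have h1 := ((hh.affine (tw_pos p.s) p.q).quad (1 + (q0:ℝ)^2) (-2 * tw s0 * q0) (tw s0 ^ 2)).modul (tw p.s * p.l)
  have h2 := (hh.affine (tw_pos p'.s) p'.q).modul (tw p'.s * p'.l)
  have := h1.pair h2 (by rw [mul_zero, mul_zero, zero_add, zero_add]; linarith)
  rw [← this]; congr 1; ext t
  unfold wt pk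
  have : (1 + (tw s0 * t - q0) ^ 2 : ℝ) = 1 + (q0:ℝ)^2 + (-2 * tw s0 * q0) * t + (tw s0 ^ 2) * t ^ 2 := by ring
  rw [this]; ring

/-! ### The packet -/

structure Pack (R : ℝ) (φ : ℝ → ℂ) : Prop where
  bl : BL 0 (2 * R) φ
  diff : Differentiable ℝ φ
  ddec : ∀ K : ℕ, ∃ C : ℝ, 0 ≤ C ∧ ∀ u, ‖deriv φ u‖ ≤ C * rho u ^ K
  one : ∀ w, |w| ≤ R → 𝓕 φ w = 1
  conj : ∀ x, (starRingEnd ℂ) (φ x) = φ (-x)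

open SchwartzMap in
lemma schwartz_dec (g : SchwartzMap ℝ ℂ) (K : ℕ) : ∃ C : ℝ, 0 ≤ C ∧ ∀ u, ‖g u‖ ≤ C * rho u ^ K := by
  refine ⟨2 ^ K * ((Finset.Iic ((K, 0) : ℕ × ℕ)).sup fun m => SchwartzMap.seminorm ℝ m.1 m.2) g,
    by positivity, fun u => ?_⟩
  have := SchwartzMap.one_add_le_sup_seminorm_apply (𝕜 := ℝ) (m := (K, 0)) le_rfl le_rfl g u
  rw [norm_iteratedFDeriv_zero] at this
  unfold rho
  rw [inv_pow, ← div_eq_mul_inv, le_div_iff₀ (by positivity), mul_comm]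
  exact this

lemma exists_pack {R : ℝ} (hR : 0 < R) : ∃ φ, Pack R φ := by
  let b : ContDiffBump (0 : ℝ) := ⟨R, 2 * R, hR, by linarith⟩
  let χ : ℝ → ℂ := fun x => ((b x : ℝ) : ℂ)
  have hχs : HasCompactSupport χ := b.hasCompactSupport.comp_left (g := fun x : ℝ => (x : ℂ)) (by simp)
  have hχd : ContDiff ℝ (⊤ : ℕ∞) χ := Complex.ofRealCLM.contDiff.comp b.contDiff
  let X : SchwartzMap ℝ ℂ := hχs.toSchwartzMap hχd
  have hX : (X : ℝ → ℂ) = χ := by ext; rfl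
  let φ : SchwartzMap ℝ ℂ := 𝓕⁻ X
  have hφ : (φ : ℝ → ℂ) = 𝓕⁻ χ := by rw [← hX]; exact SchwartzMap.fourierInv_coe X
  have hft : 𝓕 (φ : ℝ → ℂ) = χ := by
    rw [← SchwartzMap.fourier_coe, ← hX]
    simp [φ]
  refine ⟨φ, ⟨φ.continuous, fun K => schwartz_dec φ K, ?_⟩, φ.differentiable, ?_, ?_, ?_⟩
  · intro w hw
    rw [hft]
    show ((b w : ℝ) : ℂ) = 0
    rw [b.zero_of_le_dist]; · simp
    rw [Real.dist_eq]; exact hw.le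
  · intro K
    obtain ⟨C, hC, h⟩ := schwartz_dec (SchwartzMap.derivCLM ℝ ℂ φ) K
    exact ⟨C, hC, fun u => by simpa using h u⟩
  · intro w hw
    rw [hft]
    show ((b w : ℝ) : ℂ) = 1
    rw [b.one_of_mem_closedBall]; · simp
    rw [Metric.mem_closedBall, Real.dist_eq, sub_zero]; exact hw
  · intro x
    rw [hφ, Real.fourierInv_eq_fourier_neg, Real.fourierInv_eq_fourier_neg, ← ft_conj]
    have : (fun x => (starRingEnd ℂ) (χ x)) = χ := by ext x; simp [χ]
    rw [this, neg_neg]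

lemma one_add_sq_rho (u : ℝ) : (1 + u ^ 2) * rho u ^ 2 ≤ 1 := by
  have := rho_sq_le u
  calc _ ≤ (1 + u ^ 2) * (1 + u ^ 2)⁻¹ := mul_le_mul_of_nonneg_left this (by positivity)
    _ = 1 := mul_inv_cancel₀ (by positivity)

lemma amp_dec_aux {N K : ℕ} (hK : 2 * N + 8 ≤ K) (c u : ℝ) :
    (1 + u ^ 2) ^ N * (rho c ^ K * rho (u - c) ^ K) ≤ rho u ^ 8 := by
  have h1 : rho c * rho (u - c) ≤ rho u := rho_mul_le (by
    have := abs_add_le c (u - c); rwa [add_sub_cancel] at this)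
  have h2 : rho c ^ K * rho (u - c) ^ K ≤ rho u ^ (2 * N + 8) := by
    rw [← mul_pow]
    exact (pow_le_pow_left₀ (mul_nonneg (rho_nonneg _) (rho_nonneg _)) h1 K).trans (rho_pow_le hK)
  calc _ ≤ (1 + u ^ 2) ^ N * rho u ^ (2 * N + 8) := mul_le_mul_of_nonneg_left h2 (by positivity)
    _ = ((1 + u ^ 2) * rho u ^ 2) ^ N * rho u ^ 8 := by rw [mul_pow, pow_add, pow_mul]; ring
    _ ≤ 1 * rho u ^ 8 := by
      apply mul_le_mul_of_nonneg_right _ (pow_nonneg (rho_nonneg u) 8)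
      exact pow_le_one₀ (mul_nonneg (by positivity) (sq_nonneg _)) (one_add_sq_rho u)
    _ = _ := one_mul _

lemma pack_good {R : ℝ} {φ : ℝ → ℂ} (hp : Pack R φ) (N K : ℕ) (hK : 2 * N + 8 ≤ K) :
    ∃ c1 : ℝ, 0 < c1 ∧ ∀ c : ℝ, 0 < c → c ≤ c1 → ∀ c0 : ℝ,
      Good (2 * R) (amp N (fun v => ((c * rho c0 ^ K : ℝ) : ℂ) * φ (v - c0))) := by
  obtain ⟨C, hC, hCb⟩ := hp.bl.dec K
  obtain ⟨D, hD, hDb⟩ := hp.ddec K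
  set A : ℝ := (N + 1) * C + D + 1
  have hA : 0 < A := by positivity
  refine ⟨(A * 2 ^ 8)⁻¹, by positivity, fun c hc hc1 c0 => ?_⟩
  have hcA : c * A ≤ (2 ^ 8)⁻¹ := by
    calc c * A ≤ (A * 2 ^ 8)⁻¹ * A := mul_le_mul_of_nonneg_right hc1 hA.le
      _ = _ := by field_simp
  have hbl : BL 0 (2 * R) (amp N (fun v => ((c * rho c0 ^ K : ℝ) : ℂ) * φ (v - c0))) :=
    ((hp.bl.shift c0).constMul _).ampl N
  have hr0 := rho_nonneg c0
  have hder : ∀ u, ∃ d, HasDerivAt (amp N (fun v => ((c * rho c0 ^ K : ℝ) : ℂ) * φ (v - c0))) d u ∧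
      ‖d‖ ≤ (2 ^ 8)⁻¹ * rho u ^ 8 := by
    intro u
    have h1 : HasDerivAt (fun u : ℝ => (1 + u ^ 2) ^ N) (N * (1 + u ^ 2) ^ (N - 1) * (2 * u)) u := by
      have := (((hasDerivAt_id u).pow 2).const_add 1).pow N
      exact this.congr_deriv (by simp)
    have h2 : HasDerivAt (fun v => φ (v - c0)) (deriv φ (u - c0)) u :=
      HasDerivAt.comp_sub_const u c0 (hp.diff (u - c0)).hasDerivAt
    have h3 := h1.ofReal_comp.mul (h2.const_mul ((c * rho c0 ^ K : ℝ) : ℂ))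
    refine ⟨_, h3, ?_⟩
    have e1 : |N * (1 + u ^ 2) ^ (N - 1) * (2 * u)| ≤ N * (1 + u ^ 2) ^ N := by
      rcases Nat.eq_zero_or_pos N with rfl | hN
      · simp
      · have : N = N - 1 + 1 := by omega
        have e : (1 + u ^ 2) ^ N = (1 + u ^ 2) ^ (N - 1) * (1 + u ^ 2) := by
          conv_lhs => rw [this]
          exact pow_succ _ _
        rw [e, ← mul_assoc (N:ℝ) _ (1 + u ^ 2), abs_mul (_ * _) (2 * u), abs_of_nonneg (by positivity : 0 ≤ (N:ℝ) * (1 + u ^ 2) ^ (N - 1))]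
        apply mul_le_mul_of_nonneg_left _ (by positivity)
        rw [abs_le]; constructor <;> nlinarith [sq_nonneg (u - 1), sq_nonneg (u + 1)]
    have e2 := hCb (u - c0)
    have e3 := hDb (u - c0)
    have e4 := amp_dec_aux hK c0 u
    have hk : 0 ≤ c * rho c0 ^ K := by positivity
    calc _ ≤ |N * (1 + u ^ 2) ^ (N - 1) * (2 * u)| * (c * rho c0 ^ K * ‖φ (u - c0)‖) +
          (1 + u ^ 2) ^ N * (c * rho c0 ^ K * ‖deriv φ (u - c0)‖) := by
          refine (norm_add_le _ _).trans (le_of_eq ?_)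
          rw [norm_mul, norm_mul, norm_mul, norm_mul, Complex.norm_real, Complex.norm_real, Complex.norm_real,
            Real.norm_eq_abs, Real.norm_of_nonneg hk, Real.norm_of_nonneg (by positivity)]
      _ ≤ (N * (1 + u ^ 2) ^ N) * (c * rho c0 ^ K * (C * rho (u - c0) ^ K)) +
          (1 + u ^ 2) ^ N * (c * rho c0 ^ K * (D * rho (u - c0) ^ K)) := by gcongr
      _ = (c * (N * C + D)) * ((1 + u ^ 2) ^ N * (rho c0 ^ K * rho (u - c0) ^ K)) := by ring
      _ ≤ (c * A) * rho u ^ 8 := by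
          apply mul_le_mul (mul_le_mul_of_nonneg_left _ hc.le) e4
          · have := rho_nonneg (u - c0); positivity
          · positivity
          · show N * C + D ≤ (N + 1) * C + D + 1
            linarith
      _ ≤ _ := mul_le_mul_of_nonneg_right hcA (pow_nonneg (rho_nonneg u) 8)
  refine ⟨hbl.cont, ?_, ?_, hbl.orth⟩
  · intro u
    have e2 := hCb (u - c0)
    have e4 := amp_dec_aux hK c0 u
    have hk : 0 ≤ c * rho c0 ^ K := by positivity
    have hA1 : c * C ≤ 1 := by
      have : C ≤ A := by
        show C ≤ (N + 1) * C + D + 1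
        have : 0 ≤ N * C := by positivity
        linarith
      have := mul_le_mul_of_nonneg_left this hc.le
      norm_num at hcA; linarith
    calc _ = (1 + u ^ 2) ^ N * (c * rho c0 ^ K * ‖φ (u - c0)‖) := by
          unfold amp
          rw [norm_mul, norm_mul, Complex.norm_real, Complex.norm_real, Real.norm_of_nonneg hk,
            Real.norm_of_nonneg (by positivity)]
      _ ≤ (1 + u ^ 2) ^ N * (c * rho c0 ^ K * (C * rho (u - c0) ^ K)) := by gcongr
      _ = (c * C) * ((1 + u ^ 2) ^ N * (rho c0 ^ K * rho (u - c0) ^ K)) := by ring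
      _ ≤ 1 * rho u ^ 8 := by
          apply mul_le_mul hA1 e4 _ zero_le_one
          have := rho_nonneg (u - c0); positivity
      _ = _ := one_mul _
  · intro u w huw
    choose d hd hd2 using hder
    have := Convex.norm_image_sub_le_of_norm_deriv_le (𝕜 := ℝ) (s := segment ℝ u w)
      (f := amp N (fun v => ((c * rho c0 ^ K : ℝ) : ℂ) * φ (v - c0))) (C := rho u ^ 8)
      (fun x _ => (hd x).differentiableAt) (fun x hx => by
        rw [(hd x).deriv]
        refine (hd2 x).trans ?_
        have h1 : rho x ≤ 2 * rho u := by
          apply rho_le_mul two_pos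
          have h2 : |u - x| ≤ 1 := by
            have hx' := hx
            rw [segment_eq_image] at hx'
            obtain ⟨θ, hθ, rfl⟩ := hx'
            simp only [smul_eq_mul]
            have : u - ((1 - θ) * u + θ * w) = θ * (u - w) := by ring
            rw [this, abs_mul, abs_of_nonneg hθ.1]
            exact mul_le_one₀ hθ.2 (abs_nonneg _) huw
          have h3 := abs_add_le (u - x) x
          rw [sub_add_cancel] at h3
          have := abs_nonneg x
          linarith
        have h2 := pow_le_pow_left₀ (rho_nonneg x) h1 8
        rw [mul_pow] at h2
        rw [inv_mul_le_iff₀ (by positivity)]; exact h2)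
      (convex_segment u w) (right_mem_segment ℝ u w) (left_mem_segment ℝ u w)
    rw [mul_comm |u - w|]; exact this

lemma pack_good2 {R : ℝ} {φ : ℝ → ℂ} (hp : Pack R φ) (N K : ℕ) (hK : 2 * N + 8 ≤ K) :
    ∃ c : ℝ, 0 < c ∧ ∀ c0 : ℝ, Good (2 * R) (fun v => ((c * rho c0 ^ K : ℝ) : ℂ) * φ (v - c0)) ∧
      Good (2 * R) (amp N (fun v => ((c * rho c0 ^ K : ℝ) : ℂ) * φ (v - c0))) := by
  obtain ⟨c1, h1, g1⟩ := pack_good hp 0 K (by omega)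
  obtain ⟨c2, h2, g2⟩ := pack_good hp N K hK
  refine ⟨min c1 c2, lt_min h1 h2, fun c0 => ⟨?_, g2 _ (lt_min h1 h2) (min_le_right _ _) c0⟩⟩
  have := g1 _ (lt_min h1 h2) (min_le_left _ _) c0
  convert this using 1
  ext u; simp [amp]

/-! ### Convolutions with packets, multilinear Parseval -/

lemma tw_mul_neg (s : ℤ) : tw s * tw (-s) = 1 := by rw [tw_neg, mul_inv_cancel₀ (tw_ne s)]

def kr (φ : ℝ → ℂ) (s l : ℤ) (c x : ℝ) : ℂ := (tw s : ℂ) * (ee (tw s * l * x) * φ (tw s * x + c))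

lemma kr_bl {R : ℝ} {φ : ℝ → ℂ} (hp : Pack R φ) (s l : ℤ) (c : ℝ) :
    BL (tw s * l) (tw s * (2 * R)) (kr φ s l c) := by
  have := ((hp.bl.affine (tw_pos s) (-c)).modul (tw s * l)).constMul (tw s : ℂ)
  simp only [sub_neg_eq_add, mul_zero, zero_add] at this
  exact this

lemma kr_ft {φ : ℝ → ℂ} (s l : ℤ) (c ξ : ℝ) :
    𝓕 (kr φ s l c) ξ = ee (c * (tw (-s) * ξ - l)) * 𝓕 φ (tw (-s) * ξ - l) := by
  rw [ft_eq, ft_eq]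
  set v := tw (-s) * ξ - l
  have hs := tw_mul_neg s
  have h1 : ∀ x : ℝ, ee (-(x * ξ)) * kr φ s l c x =
      ((tw s : ℂ) * ee (c * v)) * (fun u : ℝ => ee (-((u + c) * v)) * φ (u + c)) (tw s * x) := by
    intro x
    have : ee (-(x * ξ)) * ee (tw s * l * x) = ee (c * v) * ee (-((tw s * x + c) * v)) := by
      rw [← ee_add, ← ee_add]; congr 1
      simp only [v]
      have : tw s * x * (tw (-s) * ξ) = x * ξ := by
        calc _ = (tw s * tw (-s)) * (x * ξ) := by ring
          _ = _ := by rw [hs, one_mul]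
      linear_combination this
    unfold kr
    linear_combination (tw s : ℂ) * φ (tw s * x + c) * this
  simp_rw [h1]
  rw [integral_const_mul, Measure.integral_comp_mul_left
      (fun u : ℝ => ee (-((u + c) * v)) * φ (u + c)) (tw s),
      integral_add_right_eq_self (fun u : ℝ => ee (-(u * v)) * φ u) c, abs_of_pos (inv_pos.2 (tw_pos s)),
      Complex.real_smul]
  have : (tw s : ℂ) ≠ 0 := by exact_mod_cast tw_ne s
  push_cast
  field_simp

def cv (φ : ℝ → ℂ) (s l : ℤ) (c : ℝ) (F : ℝ → ℂ) (x : ℝ) : ℂ := ∫ t, F t * kr φ s l c (x - t)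

lemma cv_inv {R : ℝ} {φ F : ℝ → ℂ} (hp : Pack R φ) (hF : Integrable F) (s l : ℤ) (c x : ℝ) :
    cv φ s l c F x = ∫ ξ, ee (x * ξ) * (𝓕 F ξ * 𝓕 (kr φ s l c) ξ) := by
  have hk := kr_bl hp s l c
  have h1 : ∀ ξ, ee (x * ξ) * (𝓕 F ξ * 𝓕 (kr φ s l c) ξ) = 𝓕 F ξ * (ee (x * ξ) * 𝓕 (kr φ s l c) ξ) :=
    fun ξ => by ring
  simp_rw [h1]
  rw [ft_flip hF (ee_int hk.ftint (by fun_prop))]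
  unfold cv
  congr 1; ext t; congr 1
  rw [← hk.cont.fourierInv_fourier_eq hk.int hk.ftint, Real.fourierInv_eq_fourier_neg, ft_eq, ft_eq]
  rw [hk.cont.fourierInv_fourier_eq hk.int hk.ftint]
  congr 1; ext v; rw [← mul_assoc, ← ee_add]; congr 2; ring

lemma cv_conv (φ : ℝ → ℂ) (s l : ℤ) (c : ℝ) (F : ℝ → ℂ) :
    cv φ s l c F = convolution F (kr φ s l c) (ContinuousLinearMap.mul ℂ ℂ) volume := by
  ext x; rw [convolution_def]; rfl

lemma cv_integrable {R : ℝ} {φ F : ℝ → ℂ} (hp : Pack R φ) (hF : Integrable F) (s l : ℤ) (c : ℝ) :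
    Integrable (cv φ s l c F) := by
  rw [cv_conv]; exact hF.integrable_convolution _ (kr_bl hp s l c).int

lemma cv_ft {R : ℝ} {φ F : ℝ → ℂ} (hp : Pack R φ) (hF : Integrable F) (s l : ℤ) (c ξ : ℝ) :
    𝓕 (cv φ s l c F) ξ = 𝓕 F ξ * 𝓕 (kr φ s l c) ξ := by
  rw [cv_conv]; exact Real.fourier_mul_convolution_eq hF (kr_bl hp s l c).int ξ

lemma ftF_bd (F : ℝ → ℂ) (ξ : ℝ) : ‖𝓕 F ξ‖ ≤ ∫ x, ‖F x‖ := by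
  rw [ft_eq]
  refine (norm_integral_le_integral_norm _).trans (le_of_eq ?_)
  congr 1; ext v; rw [norm_mul, ee_norm, one_mul]

lemma cv_ft_int {R : ℝ} {φ F : ℝ → ℂ} (hp : Pack R φ) (hF : Integrable F) (s l : ℤ) (c : ℝ) :
    Integrable (fun ξ => 𝓕 F ξ * 𝓕 (kr φ s l c) ξ) :=
  (kr_bl hp s l c).ftint.bdd_mul (ft_continuous hF).aestronglyMeasurable
    (Filter.Eventually.of_forall (ftF_bd F))

lemma cv_continuous {R : ℝ} {φ F : ℝ → ℂ} (hp : Pack R φ) (hF : Integrable F) (s l : ℤ) (c : ℝ) :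
    Continuous (cv φ s l c F) := by
  have h1 : cv φ s l c F = fun x => 𝓕 (fun ξ => 𝓕 F ξ * 𝓕 (kr φ s l c) ξ) (-x) := by
    ext x
    rw [cv_inv hp hF, ft_eq]
    congr 1; ext v; congr 2; ring
  rw [h1]
  exact (ft_continuous (cv_ft_int hp hF s l c)).comp continuous_neg

lemma cv_cf {R : ℝ} {φ : ℝ → ℂ} (hp : Pack R φ) (F : ℝ → ℂ) (s l q : ℤ) (c θ : ℝ) :
    ‖cv φ s l c F (tw (-s) * (q + θ))‖ = ‖cf (fun v => φ (v - (θ + c))) F ⟨s, q, l⟩‖ := by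
  have hs := tw_mul_neg s
  set x := tw (-s) * (q + θ)
  have hx : tw s * x = q + θ := by simp only [x]; rw [← mul_assoc, hs, one_mul]
  have h1 : cv φ s l c F x = ee (tw s * l * x) * cf (fun v => φ (v - (θ + c))) F ⟨s, q, l⟩ := by
    unfold cv cf
    simp only
    rw [← mul_assoc, ← integral_const_mul]
    congr 1; ext t
    unfold kr pk
    simp only [map_mul]
    rw [ee_conj, hp.conj]
    have e1 : tw s * (x - t) + c = -(tw s * t - q - (θ + c)) := by rw [mul_sub, hx]; ring
    have e2 : ee (tw s * l * (x - t)) = ee (tw s * l * x) * ee (-(tw s * l * t)) := by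
      rw [← ee_add]; congr 1; ring
    rw [e1, e2]; ring
  rw [h1, norm_mul, ee_norm, one_mul]

lemma prod_split {n : ℕ} (hn : 1 ≤ n) (g : Fin n → ℂ) :
    ∏ i, g i = (∏ i : Fin (n - 1), g ⟨i, by omega⟩) * g ⟨n - 1, by omega⟩ := by
  obtain ⟨d, rfl⟩ : ∃ d, n = d + 1 := ⟨n - 1, by omega⟩
  rw [Fin.prod_univ_castSucc]; rfl

lemma gp_coord (n : ℕ) (η : Fin (n - 1) → ℝ) (i : Fin (n - 1)) :
    gammaParam n η ⟨i, by omega⟩ = η i := by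
  unfold gammaParam; simp

lemma gp_last {n : ℕ} (hn : 1 ≤ n) (η : Fin (n - 1) → ℝ) :
    gammaParam n η ⟨n - 1, by omega⟩ = -∑ i, η i := by
  unfold gammaParam; simp

lemma ee_zero : ee 0 = 1 := by rw [ee_eq]; simp

lemma ee_sum {ι : Type*} (A : Finset ι) (g : ι → ℝ) : ee (∑ i ∈ A, g i) = ∏ i ∈ A, ee (g i) := by
  induction A using Finset.induction_on with
  | empty => simp [ee_zero]
  | insert a A ha ih => rw [Finset.sum_insert ha, Finset.prod_insert ha, ee_add, ih]

lemma multi_parseval {d : ℕ} (G : Fin d → ℝ → ℂ) (hG : ∀ i, Integrable (G i)) {f : ℝ → ℂ} (hf : Integrable f) :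
    ∫ η : Fin d → ℝ, (∏ i, G i (η i)) * 𝓕 f (-∑ i, η i) = ∫ x, (∏ i, ∫ ξ, ee (x * ξ) * G i ξ) * f x := by
  have hGp : Integrable (fun η : Fin d → ℝ => ∏ i, G i (η i)) := Integrable.fintype_prod hG
  have h1 : ∀ η : Fin d → ℝ, (∏ i, G i (η i)) * 𝓕 f (-∑ i, η i) =
      ∫ x, ee (x * ∑ i, η i) * ((∏ i, G i (η i)) * f x) := by
    intro η
    rw [ft_eq, ← integral_const_mul]
    congr 1; ext x; rw [mul_neg, neg_neg]; ring
  simp_rw [h1]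
  rw [integral_integral_swap]
  · congr 1; ext x
    have h2 : ∀ η : Fin d → ℝ, ee (x * ∑ i, η i) * ((∏ i, G i (η i)) * f x) =
        (∏ i, (ee (x * η i) * G i (η i))) * f x := by
      intro η
      rw [Finset.mul_sum, ee_sum, Finset.prod_mul_distrib]; ring
    simp_rw [h2]
    rw [integral_mul_const, integral_fintype_prod_volume_eq_prod (fun i ξ => ee (x * ξ) * G i ξ)]
  · have h3 := hGp.mul_prod hf
    have h4 : Continuous (fun p : (Fin d → ℝ) × ℝ => ee (p.2 * ∑ i, p.1 i)) := ee_continuous.comp (by fun_prop)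
    exact h3.bdd_mul (c := 1) h4.aestronglyMeasurable (Filter.Eventually.of_forall fun p => (ee_norm _).le)

/-- The multilinear Parseval identity for packet pieces. -/
lemma tile_parseval {n : ℕ} (hn : 1 ≤ n) {R : ℝ} {φ : ℝ → ℂ} (hp : Pack R φ) {F : Fin n → ℝ → ℂ}
    (hF : ∀ i, Integrable (F i)) (s : ℤ) (l : Fin n → ℤ) (c : Fin n → ℝ) :
    ∫ η : Fin (n - 1) → ℝ, ∏ i, (𝓕 (F i) (gammaParam n η i) * 𝓕 (kr φ s (l i) (c i)) (gammaParam n η i)) =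
      ∫ x, ∏ i, cv φ s (l i) (c i) (F i) x := by
  have := multi_parseval (d := n - 1)
    (fun i ξ => 𝓕 (F ⟨i, by omega⟩) ξ * 𝓕 (kr φ s (l ⟨i, by omega⟩) (c ⟨i, by omega⟩)) ξ)
    (fun i => cv_ft_int hp (hF ⟨i, by omega⟩) s (l ⟨i, by omega⟩) (c ⟨i, by omega⟩))
    (cv_integrable hp (hF ⟨n - 1, by omega⟩) s (l ⟨n - 1, by omega⟩) (c ⟨n - 1, by omega⟩))
  simp_rw [← cv_inv hp (hF _), cv_ft hp (hF _)] at this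
  simp_rw [prod_split hn, gp_coord, gp_last hn]
  exact this

/-! ### The identity for a single frequency cube -/

def ye (n : ℕ) (y : ES (n - 1)) (i : Fin n) : ℝ := if h : (i : ℕ) < n - 1 then y ⟨i, h⟩ else 0

def uu (n : ℕ) (s : ℤ) (z : Fin (n - 1) → ℤ) (η : Fin (n - 1) → ℝ) : ES (n - 1) :=
  tw (-s) • (WithLp.toLp 2 η : ES (n - 1)) - zz z

lemma uu_continuous (n : ℕ) (s : ℤ) (z : Fin (n - 1) → ℤ) : Continuous (uu n s z) := by
  unfold uu
  have : Continuous (fun η : Fin (n - 1) → ℝ => (WithLp.toLp 2 η : ES (n - 1))) := PiLp.continuous_toLp 2 _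
  fun_prop

lemma sum_split {n : ℕ} (hn : 1 ≤ n) (g : Fin n → ℝ) :
    ∑ i, g i = (∑ i : Fin (n - 1), g ⟨i, by omega⟩) + g ⟨n - 1, by omega⟩ := by
  obtain ⟨d, rfl⟩ : ∃ d, n = d + 1 := ⟨n - 1, by omega⟩
  rw [Fin.sum_univ_castSucc]; rfl

lemma inner_ye {n : ℕ} (hn : 1 ≤ n) (y u : ES (n - 1)) : inner ℝ y u = ∑ i, ye n y i * gL n u i := by
  rw [sum_split hn]
  have h1 : ye n y ⟨n - 1, by omega⟩ = 0 := by unfold ye; simp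
  have h2 : ∀ i : Fin (n - 1), ye n y ⟨i, by omega⟩ = y i := by intro i; unfold ye; simp
  rw [h1, zero_mul, add_zero]
  simp_rw [h2, gL_coord]
  rw [PiLp.inner_apply]
  apply Finset.sum_congr rfl
  intro i _
  simp [mul_comm]

lemma gL_uu (n : ℕ) (s : ℤ) (z : Fin (n - 1) → ℤ) (η : Fin (n - 1) → ℝ) (i : Fin n) :
    gL n (uu n s z η) i = tw (-s) * gammaParam n η i - zt n z i := by
  unfold uu
  rw [map_sub, map_smul, Pi.sub_apply, Pi.smul_apply, zt_cast, smul_eq_mul]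
  rfl

lemma gL_cube {n : ℕ} (hn : 1 ≤ n) {u : ES (n - 1)} (hu : ∀ i, |u i| ≤ 1) (i : Fin n) : |gL n u i| ≤ n := by
  rw [gL_apply]
  unfold gammaParam
  split_ifs with h
  · exact (hu _).trans (Nat.one_le_cast.2 hn)
  · rw [abs_neg]
    refine (Finset.abs_sum_le_sum_abs _ _).trans ((Finset.sum_le_sum fun i _ => hu i).trans ?_)
    simp only [Finset.sum_const, Finset.card_univ, Fintype.card_fin, nsmul_eq_mul, mul_one]
    exact_mod_cast Nat.sub_le n 1

def LamQ (n : ℕ) (g : ES (n - 1) → ℂ) (F : Fin n → ℝ → ℂ) (s : ℤ) (z : Fin (n - 1) → ℤ) : ℂ :=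
  ∫ η : Fin (n - 1) → ℝ, g (uu n s z η) * ∏ i, 𝓕 (F i) (gammaParam n η i)

lemma gp_continuous (n : ℕ) (i : Fin n) : Continuous (fun η : Fin (n - 1) → ℝ => gammaParam n η i) := by
  unfold gammaParam
  split_ifs <;> fun_prop

lemma tile_prod_int {n : ℕ} (hn : 1 ≤ n) {R : ℝ} {φ : ℝ → ℂ} (hp : Pack R φ) {F : Fin n → ℝ → ℂ}
    (hF : ∀ i, Integrable (F i)) (s : ℤ) (l : Fin n → ℤ) (c : Fin n → ℝ) :
    Integrable (fun η : Fin (n - 1) → ℝ =>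
      ∏ i, (𝓕 (F i) (gammaParam n η i) * 𝓕 (kr φ s (l i) (c i)) (gammaParam n η i))) := by
  simp_rw [prod_split hn, gp_coord]
  have h1 : Integrable (fun η : Fin (n - 1) → ℝ => ∏ i : Fin (n - 1),
      (fun (i : Fin (n - 1)) ξ => 𝓕 (F ⟨i, by omega⟩) ξ * 𝓕 (kr φ s (l ⟨i, by omega⟩) (c ⟨i, by omega⟩)) ξ) i (η i)) :=
    Integrable.fintype_prod (ι := Fin (n - 1)) (μ := fun _ => volume)
      (f := fun (i : Fin (n - 1)) ξ => 𝓕 (F ⟨i, by omega⟩) ξ * 𝓕 (kr φ s (l ⟨i, by omega⟩) (c ⟨i, by omega⟩)) ξ)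
      (fun i => cv_ft_int hp (hF ⟨i, by omega⟩) s (l ⟨i, by omega⟩) (c ⟨i, by omega⟩))
  have hk := kr_bl hp s (l ⟨n - 1, by omega⟩) (c ⟨n - 1, by omega⟩)
  refine h1.mul_bdd (c := (∫ x, ‖F ⟨n - 1, by omega⟩ x‖) * ∫ x, ‖kr φ s (l ⟨n - 1, by omega⟩) (c ⟨n - 1, by omega⟩) x‖) ?_ ?_
  · exact (((ft_continuous (hF ⟨n - 1, by omega⟩)).comp (gp_continuous n _)).mul
      ((ft_continuous hk.int).comp (gp_continuous n _))).aestronglyMeasurable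
  · refine Filter.Eventually.of_forall fun η => ?_
    rw [norm_mul]
    exact mul_le_mul (ftF_bd _ _) (ftF_bd _ _) (norm_nonneg _) (integral_nonneg fun _ => norm_nonneg _)

lemma tile_identity {n : ℕ} (hn : 1 ≤ n) {φ : ℝ → ℂ} (hp : Pack n φ) {F : Fin n → ℝ → ℂ}
    (hF : ∀ i, Integrable (F i)) (s : ℤ) (z : Fin (n - 1) → ℤ) (g : ES (n - 1) → ℂ)
    (hg1 : Integrable (𝓕 g)) (hg2 : ∀ u, g u = ∫ y, 𝓕 g y * ee (inner ℝ y u))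
    (hg3 : ∀ u, g u ≠ 0 → ∀ i, |u i| ≤ 1) :
    LamQ n g F s z = ∫ y, 𝓕 g y * ∫ x, ∏ i, cv φ s (zt n z i) (ye n y i) (F i) x := by
  set H : (Fin (n - 1) → ℝ) → ℂ := fun η =>
    ∏ i, (𝓕 (F i) (gammaParam n η i) * 𝓕 φ (tw (-s) * gammaParam n η i - zt n z i)) with hH
  have hHi : Integrable H := by
    have := tile_prod_int hn hp hF s (zt n z) (fun _ => 0)
    simpa only [kr_ft, zero_mul, ee_zero, one_mul] using this
  have h1 : ∀ y (η : Fin (n - 1) → ℝ), ∏ i, (𝓕 (F i) (gammaParam n η i) *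
      𝓕 (kr φ s (zt n z i) (ye n y i)) (gammaParam n η i)) = ee (inner ℝ y (uu n s z η)) * H η := by
    intro y η
    rw [inner_ye hn, ee_sum, hH, ← Finset.prod_mul_distrib]
    apply Finset.prod_congr rfl
    intro i _
    rw [kr_ft, gL_uu]; ring
  simp_rw [← tile_parseval hn hp hF, h1, ← integral_const_mul]
  rw [integral_integral_swap]
  · unfold LamQ
    congr 1; ext η
    simp_rw [← mul_assoc]
    rw [integral_mul_const, ← hg2, hH]
    by_cases h0 : g (uu n s z η) = 0
    · rw [h0, zero_mul, zero_mul]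
    · congr 1
      apply Finset.prod_congr rfl
      intro i _
      rw [← gL_uu, hp.one _ (gL_cube hn (hg3 _ h0) i), mul_one]
  · have h3 := hg1.mul_prod hHi
    have h4 : Continuous (fun p : ES (n - 1) × (Fin (n - 1) → ℝ) => ee (inner ℝ p.1 (uu n s z p.2))) :=
      ee_continuous.comp (Continuous.inner continuous_fst ((uu_continuous n s z).comp continuous_snd))
    have h5 := h3.bdd_mul (c := 1) h4.aestronglyMeasurable (Filter.Eventually.of_forall fun p => (ee_norm _).le)
    refine h5.congr (Filter.Eventually.of_forall fun p => ?_)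
    simp only [Function.uncurry]
    ring

lemma tile_enorm {n : ℕ} (hn : 1 ≤ n) {φ : ℝ → ℂ} (hp : Pack n φ) {F : Fin n → ℝ → ℂ}
    (hF : ∀ i, Integrable (F i)) (s : ℤ) (z : Fin (n - 1) → ℤ) (g : ES (n - 1) → ℂ)
    (hg1 : Integrable (𝓕 g)) (hg2 : ∀ u, g u = ∫ y, 𝓕 g y * ee (inner ℝ y u))
    (hg3 : ∀ u, g u ≠ 0 → ∀ i, |u i| ≤ 1) :
    ‖LamQ n g F s z‖ₑ ≤ ∫⁻ y, ‖𝓕 g y‖ₑ * ∫⁻ x, ∏ i, ‖cv φ s (zt n z i) (ye n y i) (F i) x‖ₑ := by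
  rw [tile_identity hn hp hF s z g hg1 hg2 hg3]
  refine (enorm_integral_le_lintegral_enorm _).trans ?_
  apply lintegral_mono
  intro y
  simp only [enorm_mul]
  apply mul_le_mul_right
  refine (enorm_integral_le_lintegral_enorm _).trans (le_of_eq ?_)
  congr 1; ext x
  simp only [enorm_eq_nnnorm, nnnorm_prod]
  push_cast; rfl

/-! ### Splitting the line -/

lemma lint_split (s : ℤ) {f : ℝ → ℝ≥0∞} (hf : Measurable f) :
    ∫⁻ x, f x = ∫⁻ θ in Set.Ico (0:ℝ) 1, ∑' q : ℤ, ENNReal.ofReal (tw (-s)) * f (tw (-s) * (q + θ)) := by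
  have hs := tw_pos (-s)
  have h0 : ∫⁻ x, f x = ENNReal.ofReal (tw (-s)) * ∫⁻ x, f (tw (-s) * x) := by
    have h1 := Real.map_volume_mul_left hs.ne'
    have h2 : ∫⁻ x, f (tw (-s) * x) = ENNReal.ofReal |(tw (-s))⁻¹| * ∫⁻ x, f x := by
      rw [← lintegral_map hf (measurable_const_mul _), h1, lintegral_smul_measure]; rfl
    rw [h2, ← mul_assoc, ← ENNReal.ofReal_mul hs.le, abs_of_pos (inv_pos.2 hs), mul_inv_cancel₀ hs.ne']
    simp
  have hm : ∀ q : ℤ, Measurable (fun θ : ℝ => f (tw (-s) * (q + θ))) := fun q => hf.comp (by fun_prop)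
  rw [h0, lintegral_tsum (fun q => ((hm q).const_mul _).aemeasurable)]
  simp_rw [lintegral_const_mul _ (hm _)]
  rw [ENNReal.tsum_mul_left]
  congr 1
  rw [← setLIntegral_univ, ← iUnion_Ico_intCast ℝ, lintegral_iUnion (fun _ => measurableSet_Ico)
    (Set.pairwise_disjoint_Ico_intCast ℝ)]
  congr 1; ext q
  have hmp : MeasurePreserving (fun θ : ℝ => (q : ℝ) + θ) volume volume := measurePreserving_add_left volume (q : ℝ)
  have := hmp.setLIntegral_comp_preimage (s := Set.Ico (q:ℝ) (q + 1)) measurableSet_Ico (f := fun x => f (tw (-s) * x))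
    (hf.comp (by fun_prop))
  rw [← this]
  congr 2
  simp

/-! ### Summing over cubes -/

lemma cf_scale (a : ℝ) (h F : ℝ → ℂ) (p : Tile) :
    ‖cf (fun v => (a : ℂ) * h v) F p‖ = |a| * ‖cf h F p‖ := by
  have : cf (fun v => (a : ℂ) * h v) F p = (a : ℂ) * cf h F p := by
    have h1 : ∀ t, F t * (starRingEnd ℂ) (pk (fun v => (a:ℂ) * h v) p t)
        = (a:ℂ) * (F t * (starRingEnd ℂ) (pk h p t)) := by
      intro t
      unfold pk
      simp only [map_mul, Complex.conj_ofReal]; ring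
    unfold cf
    simp_rw [h1]
    rw [integral_const_mul]; ring
  rw [this, norm_mul, Complex.norm_real, Real.norm_eq_abs]

lemma ye_le {n : ℕ} (y : ES (n - 1)) (i : Fin n) : |ye n y i| ≤ ‖y‖ := by
  unfold ye
  split_ifs with h
  · exact PiLp.norm_apply_le y _
  · simp

lemma point_bound {n K : ℕ} {φ : ℝ → ℂ} {N0 c A : ℝ} (hc : 0 < c)
    (hg : ∀ c0 : ℝ, Good N0 (fun v => ((c * rho c0 ^ K : ℝ) : ℂ) * φ (v - c0)) ∧
      Good N0 (amp (n + 1) (fun v => ((c * rho c0 ^ K : ℝ) : ℂ) * φ (v - c0))))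
    {F : Fin n → ℝ → ℂ} (PP : Finset (MT n))
    (hA : ∀ h : Fin n → ℝ → ℂ, (∀ i, Good N0 (h i)) → (∀ i, Good N0 (amp (n + 1) (h i))) →
      ∑ P ∈ PP, tw (-P.s) * ∏ i, ‖cf (h i) (F i) (P.pr i)‖ ≤ A)
    (y : ES (n - 1)) {θ : ℝ} (hθ : θ ∈ Set.Ico (0:ℝ) 1) :
    ∑ P ∈ PP, tw (-P.s) * ∏ i, ‖cf (fun v => φ (v - (θ + ye n y i))) (F i) (P.pr i)‖ ≤
      (c⁻¹ * (2 * (1 + ‖y‖)) ^ K) ^ n * A := by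
  set W := c⁻¹ * (2 * (1 + ‖y‖)) ^ K with hW
  have hW0 : 0 ≤ W := by positivity
  set h : Fin n → ℝ → ℂ := fun i v => ((c * rho (θ + ye n y i) ^ K : ℝ) : ℂ) * φ (v - (θ + ye n y i)) with hh
  have h1 := hA h (fun i => (hg _).1) (fun i => (hg _).2)
  refine le_trans ?_ (mul_le_mul_of_nonneg_left h1 (pow_nonneg hW0 n))
  rw [Finset.mul_sum]
  apply Finset.sum_le_sum
  intro P _
  rw [mul_left_comm]
  apply mul_le_mul_of_nonneg_left _ (tw_pos _).le
  have h2 : W ^ n = ∏ i : Fin n, W := by simp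
  rw [h2, ← Finset.prod_mul_distrib]
  apply Finset.prod_le_prod (fun _ _ => norm_nonneg _)
  intro i _
  rw [hh]
  simp only
  have hr := rho_pos (θ + ye n y i)
  rw [cf_scale (c * rho (θ + ye n y i) ^ K) (fun v => φ (v - (θ + ye n y i))), ← mul_assoc]
  rw [abs_of_pos (by positivity)]
  apply le_mul_of_one_le_left (norm_nonneg _)
  have h3 : 1 ≤ (2 * (1 + ‖y‖)) * rho (θ + ye n y i) := by
    unfold rho
    rw [← div_eq_mul_inv, le_div_iff₀ (by positivity)]
    have := abs_add_le θ (ye n y i)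
    have h4 := ye_le y i
    rw [abs_of_nonneg hθ.1] at this
    have := hθ.2
    linarith [norm_nonneg y]
  calc (1:ℝ) ≤ ((2 * (1 + ‖y‖)) * rho (θ + ye n y i)) ^ K := one_le_pow₀ h3
    _ = W * (c * rho (θ + ye n y i) ^ K) := by
      rw [hW, mul_pow]; field_simp

lemma sum_lint_le {ι α : Type*} [MeasurableSpace α] (μ : Measure α) (A : Finset ι) (f : ι → α → ℝ≥0∞) :
    ∑ i ∈ A, ∫⁻ x, f i x ∂μ ≤ ∫⁻ x, ∑ i ∈ A, f i x ∂μ := by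
  induction A using Finset.induction_on with
  | empty => simp
  | insert a A ha ih =>
    simp_rw [Finset.sum_insert ha]
    exact (add_le_add le_rfl ih).trans (le_lintegral_add _ _)

lemma tsum_bound {n : ℕ} (QQ : Finset (ℤ × (Fin (n - 1) → ℤ))) (G : MT n → ℝ) (hG : ∀ P, 0 ≤ G P) {A : ℝ}
    (h : ∀ PP : Finset (MT n), (∀ P ∈ PP, ∃ Q ∈ QQ, ∃ q, P = ⟨Q.1, q, zt n Q.2⟩) → ∑ P ∈ PP, G P ≤ A) :
    ∑ Q ∈ QQ, ∑' q : ℤ, ENNReal.ofReal (G ⟨Q.1, q, zt n Q.2⟩) ≤ ENNReal.ofReal A := by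
  rw [← Summable.tsum_finsetSum (fun _ _ => ENNReal.summable), ENNReal.tsum_eq_iSup_sum]
  apply iSup_le
  intro B
  rw [← Finset.sum_product']
  have hinj : Function.Injective (fun x : ℤ × (ℤ × (Fin (n - 1) → ℤ)) => (⟨x.2.1, x.1, zt n x.2.2⟩ : MT n)) := by
    rintro ⟨q, s, z⟩ ⟨q', s', z'⟩ hx
    simp only [MT.mk.injEq] at hx
    obtain ⟨rfl, rfl, hz⟩ := hx
    rw [zt_inj n hz]
  rw [← ENNReal.ofReal_sum_of_nonneg (fun _ _ => hG _)]
  apply ENNReal.ofReal_le_ofReal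
  have := h ((B ×ˢ QQ).image (fun x => (⟨x.2.1, x.1, zt n x.2.2⟩ : MT n))) (by
    intro P hP
    obtain ⟨x, hx, rfl⟩ := Finset.mem_image.1 hP
    exact ⟨x.2, (Finset.mem_product.1 hx).2, x.1, rfl⟩)
  rwa [Finset.sum_image (fun a _ b _ hab => hinj hab)] at this

lemma cubes_aux {n K : ℕ} (hn : 1 ≤ n) {φ : ℝ → ℂ} (hp : Pack n φ) {N0 c A Cg : ℝ} (hc : 0 < c) (hA0 : 0 ≤ A)
    (hCg : 0 ≤ Cg)
    (hg : ∀ c0 : ℝ, Good N0 (fun v => ((c * rho c0 ^ K : ℝ) : ℂ) * φ (v - c0)) ∧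
      Good N0 (amp (n + 1) (fun v => ((c * rho c0 ^ K : ℝ) : ℂ) * φ (v - c0))))
    {F : Fin n → ℝ → ℂ} (hF : ∀ i, Integrable (F i)) (QQ : Finset (ℤ × (Fin (n - 1) → ℤ)))
    (hA : ∀ PP : Finset (MT n), (∀ P ∈ PP, ∃ Q ∈ QQ, ∃ q, P = ⟨Q.1, q, zt n Q.2⟩) →
      ∀ h : Fin n → ℝ → ℂ, (∀ i, Good N0 (h i)) → (∀ i, Good N0 (amp (n + 1) (h i))) →
      ∑ P ∈ PP, tw (-P.s) * ∏ i, ‖cf (h i) (F i) (P.pr i)‖ ≤ A)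
    (g : ℤ × (Fin (n - 1) → ℤ) → ES (n - 1) → ℂ)
    (hg1 : ∀ Q ∈ QQ, Integrable (𝓕 (g Q))) (hg2 : ∀ Q ∈ QQ, ∀ u, g Q u = ∫ y, 𝓕 (g Q) y * ee (inner ℝ y u))
    (hg3 : ∀ Q ∈ QQ, ∀ u, g Q u ≠ 0 → ∀ i, |u i| ≤ 1)
    (hg4 : ∀ Q ∈ QQ, ∀ y, ‖𝓕 (g Q) y‖ ≤ Cg * (1 + ‖y‖) ^ (-((n * K + n : ℕ) : ℝ))) :
    ∑ Q ∈ QQ, ‖LamQ n (g Q) F Q.1 Q.2‖ ≤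
      (Cg * (c⁻¹ * 2 ^ K) ^ n * (∫⁻ y : ES (n - 1), ENNReal.ofReal ((1 + ‖y‖) ^ (-(n:ℝ)))).toReal) * A := by
  set J := ∫⁻ y : ES (n - 1), ENNReal.ofReal ((1 + ‖y‖) ^ (-(n:ℝ))) with hJ
  have hJf : J < ⊤ := by
    apply finite_integral_one_add_norm
    rw [finrank_euclideanSpace_fin]
    exact_mod_cast (by omega : n - 1 < n)
  have hcon : 0 ≤ Cg * (c⁻¹ * 2 ^ K) ^ n := by positivity
  have key : ∑ Q ∈ QQ, ‖LamQ n (g Q) F Q.1 Q.2‖ₑ ≤ ENNReal.ofReal (Cg * (c⁻¹ * 2 ^ K) ^ n * A) * J := by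
    calc ∑ Q ∈ QQ, ‖LamQ n (g Q) F Q.1 Q.2‖ₑ
        ≤ ∑ Q ∈ QQ, ∫⁻ y, ENNReal.ofReal (Cg * (1 + ‖y‖) ^ (-((n * K + n : ℕ) : ℝ))) *
          ∫⁻ x, ∏ i, ‖cv φ Q.1 (zt n Q.2 i) (ye n y i) (F i) x‖ₑ := by
          apply Finset.sum_le_sum
          intro Q hQ
          refine (tile_enorm hn hp hF Q.1 Q.2 (g Q) (hg1 Q hQ) (hg2 Q hQ) (hg3 Q hQ)).trans ?_
          apply lintegral_mono
          intro y
          apply mul_le_mul_left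
          rw [← ofReal_norm]
          exact ENNReal.ofReal_le_ofReal (hg4 Q hQ y)
      _ ≤ ∫⁻ y, ∑ Q ∈ QQ, ENNReal.ofReal (Cg * (1 + ‖y‖) ^ (-((n * K + n : ℕ) : ℝ))) *
          ∫⁻ x, ∏ i, ‖cv φ Q.1 (zt n Q.2 i) (ye n y i) (F i) x‖ₑ := sum_lint_le _ _ _
      _ ≤ ∫⁻ y : ES (n - 1), ENNReal.ofReal (Cg * (c⁻¹ * 2 ^ K) ^ n * A) * ENNReal.ofReal ((1 + ‖y‖) ^ (-(n:ℝ))) := by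
          apply lintegral_mono
          intro y
          simp only
          rw [← Finset.mul_sum]
          have h1 : ∑ Q ∈ QQ, ∫⁻ x, ∏ i, ‖cv φ Q.1 (zt n Q.2 i) (ye n y i) (F i) x‖ₑ ≤
              ENNReal.ofReal ((c⁻¹ * (2 * (1 + ‖y‖)) ^ K) ^ n * A) := by
            have hm : ∀ Q : ℤ × (Fin (n - 1) → ℤ), Measurable
                (fun x => ∏ i, ‖cv φ Q.1 (zt n Q.2 i) (ye n y i) (F i) x‖ₑ) := by
              intro Q
              refine Finset.measurable_prod _ (fun i _ => ?_)
              exact (cv_continuous hp (hF i) _ _ _).measurable.enorm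
            calc _ = ∑ Q ∈ QQ, ∫⁻ θ in Set.Ico (0:ℝ) 1, ∑' q : ℤ, ENNReal.ofReal (tw (-Q.1)) *
                  ∏ i, ‖cv φ Q.1 (zt n Q.2 i) (ye n y i) (F i) (tw (-Q.1) * (q + θ))‖ₑ :=
                  Finset.sum_congr rfl fun Q _ => lint_split Q.1 (hm Q)
              _ ≤ ∫⁻ θ in Set.Ico (0:ℝ) 1, ∑ Q ∈ QQ, ∑' q : ℤ, ENNReal.ofReal (tw (-Q.1)) *
                  ∏ i, ‖cv φ Q.1 (zt n Q.2 i) (ye n y i) (F i) (tw (-Q.1) * (q + θ))‖ₑ := sum_lint_le _ _ _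
              _ ≤ ∫⁻ θ in Set.Ico (0:ℝ) 1, ENNReal.ofReal ((c⁻¹ * (2 * (1 + ‖y‖)) ^ K) ^ n * A) := by
                  apply setLIntegral_mono measurable_const
                  intro θ hθ
                  have h2 : ∀ (Q : ℤ × (Fin (n - 1) → ℤ)) (q : ℤ), ENNReal.ofReal (tw (-Q.1)) *
                      ∏ i, ‖cv φ Q.1 (zt n Q.2 i) (ye n y i) (F i) (tw (-Q.1) * (q + θ))‖ₑ =
                      ENNReal.ofReal ((fun P : MT n => tw (-P.s) * ∏ i,
                        ‖cf (fun v => φ (v - (θ + ye n y i))) (F i) (P.pr i)‖) ⟨Q.1, q, zt n Q.2⟩) := by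
                    intro Q q
                    simp only [MT.pr]
                    rw [ENNReal.ofReal_mul (tw_pos _).le, ENNReal.ofReal_prod_of_nonneg (fun _ _ => norm_nonneg _)]
                    congr 1
                    apply Finset.prod_congr rfl
                    intro i _
                    rw [← cv_cf hp, ofReal_norm]
                  simp_rw [h2]
                  apply tsum_bound QQ (fun P : MT n => tw (-P.s) * ∏ i,
                        ‖cf (fun v => φ (v - (θ + ye n y i))) (F i) (P.pr i)‖) (fun P => mul_nonneg (tw_pos _).le (Finset.prod_nonneg fun _ _ => norm_nonneg _))
                  intro PP hPP
                  exact point_bound hc hg PP (hA PP hPP) y hθ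
              _ = _ := by simp
          refine (mul_le_mul_right h1 _).trans (le_of_eq ?_)
          rw [← ENNReal.ofReal_mul (by positivity), ← ENNReal.ofReal_mul (by positivity)]
          congr 1
          have hy : 0 < 1 + ‖y‖ := by positivity
          have e1 : (1 + ‖y‖) ^ (-((n * K + n : ℕ) : ℝ)) = ((1 + ‖y‖) ^ (n * K))⁻¹ * (1 + ‖y‖) ^ (-(n:ℝ)) := by
            rw [← Real.rpow_natCast, ← Real.rpow_neg hy.le, ← Real.rpow_add hy]
            congr 1; push_cast; ring
          rw [e1, mul_pow 2, ← mul_assoc c⁻¹, mul_pow _ ((1 + ‖y‖) ^ K), ← pow_mul, mul_comm K n]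
          field_simp
      _ = _ := by rw [lintegral_const_mul']; exact ENNReal.ofReal_ne_top
  have h2 : ENNReal.ofReal (∑ Q ∈ QQ, ‖LamQ n (g Q) F Q.1 Q.2‖) ≤
      ENNReal.ofReal ((Cg * (c⁻¹ * 2 ^ K) ^ n * J.toReal) * A) := by
    rw [ENNReal.ofReal_sum_of_nonneg (fun _ _ => norm_nonneg _)]
    simp_rw [ofReal_norm]
    refine key.trans (le_of_eq ?_)
    have e : Cg * (c⁻¹ * 2 ^ K) ^ n * J.toReal * A = Cg * (c⁻¹ * 2 ^ K) ^ n * A * J.toReal := by ring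
    rw [e, ENNReal.ofReal_mul (mul_nonneg hcon hA0), ENNReal.ofReal_toReal hJf.ne]
  exact (ENNReal.ofReal_le_ofReal_iff (by positivity)).1 h2

/-! ### The bound for finite collections of cubes -/

def Kn (n : ℕ) : ℕ := 2 * (n + 1) + 8

def LLw (n : ℕ) : ℝ := n * (8 * (2 * n))

def rr (n : ℕ) : ℝ := n * LLw n + n

lemma rr_pos {n : ℕ} (hn : 1 ≤ n) : 0 < rr n := by
  have hn' : (0 : ℝ) < n := by exact_mod_cast hn
  unfold rr LLw; positivity

theorem cubes_bound {n k : ℕ} (hn : 1 ≤ n) (hk : 1 ≤ k) {Γ' : Submodule ℝ (Fin n → ℝ)}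
    (hΓ : (Γ' : Set (Fin n → ℝ)) ⊆ GammaSet n) (hnd : NonDegenerate n k Γ')
    {T : ES (n - 1) →L[ℝ] ES (n - 1)} (hT : Proj Γ' T)
    (a : Fin n → ℝ) (ha : ∑ i, a i = 1) (ha1 : ∀ i, a i < 1) (j : Fin n) (hj : ∀ i, i ≠ j → 1 / 2 < a i)
    (hj1 : (k : ℝ) - n + 3 / 2 < a j) (hj2 : a j < (k : ℝ) - n + 2) (B : ℝ) :
    ∃ C, 0 ≤ C ∧ ∀ E : Fin n → Set ℝ, (∀ i, MeasurableSet (E i)) → (∀ i, volume (E i) < ⊤) →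
      (∀ i, 0 < (volume (E i)).toReal) → ∃ Ω, MeasurableSet Ω ∧ 2 * volume Ω ≤ volume (E j) ∧
      ∀ m, SymbolEst n Γ' (n * Kn n + n) B m →
      ∀ F : Fin n → ℝ → ℂ, (∀ i, Measurable (F i)) → (∀ i x, ‖F i x‖ ≤ 1) → (∀ i x, x ∉ E i → F i x = 0) →
        (∀ x ∈ Ω, F j x = 0) → ∀ QQ : Finset (ℤ × (Fin (n - 1) → ℤ)),
        ∑ Q ∈ QQ, ‖LamQ n (gQ n T (rr n) m Q.1 Q.2) F Q.1 Q.2‖ ≤ C * ∏ i, (volume (E i)).toReal ^ a i := by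
  have hn' : (0 : ℝ) < n := by exact_mod_cast hn
  have hL0 : 0 < LLw n := by unfold LLw; positivity
  have hr0 := rr_pos hn
  obtain ⟨C3, hC3, hND⟩ := nd_of hk hΓ hnd
  obtain ⟨φ, hφ⟩ := exists_pack hn'
  obtain ⟨c, hc, hg⟩ := pack_good2 hφ (n + 1) (Kn n) le_rfl
  have hpar : Par n k Γ' C3 (LLw n) (‖gL n‖ * (4 * rr n + n)) (2 * n) :=
    ⟨hk, hn, hND, hC3, by positivity, by positivity, le_rfl⟩
  obtain ⟨C0, hC0, hmod⟩ := model_bound hpar a ha ha1 j hj hj1 hj2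
  obtain ⟨Cg, hCg, hgf⟩ := gQ_fourier hn hT hΓ hr0 (n * Kn n) B
  set J := (∫⁻ y : ES (n - 1), ENNReal.ofReal ((1 + ‖y‖) ^ (-(n:ℝ)))).toReal with hJ
  have hJ0 : 0 ≤ J := ENNReal.toReal_nonneg
  refine ⟨(Cg * (c⁻¹ * 2 ^ Kn n) ^ n * J) * C0, by positivity, fun E hE hEf hEp => ?_⟩
  obtain ⟨Ω, hΩ, hΩ2, hb⟩ := hmod E hE hEf hEp
  refine ⟨Ω, hΩ, hΩ2, fun m hm F hFm hF1 hFs hFΩ QQ => ?_⟩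
  have hintg : ∀ i, Integrable (F i) := fun i => (fok_of (hFm i) (hF1 i) (hFs i) (hE i) (hEf i)).int
  set QQ' := QQ.filter (fun Q => ∃ u, gQ n T (rr n) m Q.1 Q.2 u ≠ 0) with hQQ'
  have hsum : ∑ Q ∈ QQ, ‖LamQ n (gQ n T (rr n) m Q.1 Q.2) F Q.1 Q.2‖
      = ∑ Q ∈ QQ', ‖LamQ n (gQ n T (rr n) m Q.1 Q.2) F Q.1 Q.2‖ := by
    symm
    apply Finset.sum_subset (Finset.filter_subset _ _)
    intro Q hQ hQ'
    have h0 : ∀ u, gQ n T (rr n) m Q.1 Q.2 u = 0 := by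
      intro u; by_contra hc
      exact hQ' (Finset.mem_filter.2 ⟨hQ, u, hc⟩)
    simp [LamQ, h0]
  rw [hsum, mul_assoc]
  have hP0 : 0 ≤ C0 * ∏ i, (volume (E i)).toReal ^ a i :=
    mul_nonneg hC0 (Finset.prod_nonneg fun i _ => Real.rpow_nonneg (hEp i).le _)
  refine cubes_aux hn hφ hc hP0 hCg hg hintg QQ' ?_ (fun Q => gQ n T (rr n) m Q.1 Q.2)
    (fun Q _ => (hgf m hm Q.1 Q.2).2.2.1) (fun Q _ => (hgf m hm Q.1 Q.2).2.2.2.2)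
    (fun Q _ u hu => (gQ_supp hr0 hu).1) (fun Q _ => (hgf m hm Q.1 Q.2).2.2.2.1)
  intro PP hPP h hh hh'
  refine hb F h hFm hF1 hFs hFΩ hh hh' PP ?_
  intro P hP
  obtain ⟨Q, hQ, q, rfl⟩ := hPP P hP
  obtain ⟨u, hu⟩ := (Finset.mem_filter.1 hQ).2
  obtain ⟨h1, h2, h3⟩ := gQ_supp hr0 hu
  exact whit_of hn hT hΓ hL0 le_rfl _ _ _ u h1 h2 h3

/-! ### Limits and conclusion -/

lemma lim_bound {d : ℕ} {I : (Fin d → ℝ) → ℂ} (hI : Integrable I) (w : ℕ → (Fin d → ℝ) → ℝ) (w0 : (Fin d → ℝ) → ℝ)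
    (hw : ∀ N, Continuous (w N)) {c A : ℝ} (hb : ∀ N η, |w N η| ≤ c)
    (hl : ∀ᵐ η, Filter.Tendsto (fun N => w N η) Filter.atTop (nhds (w0 η)))
    (h : ∀ N, ‖∫ η, I η * (w N η : ℂ)‖ ≤ A) : ‖∫ η, I η * (w0 η : ℂ)‖ ≤ A := by
  have ht : Filter.Tendsto (fun N => ∫ η, I η * (w N η : ℂ)) Filter.atTop (nhds (∫ η, I η * (w0 η : ℂ))) := by
    refine tendsto_integral_of_dominated_convergence (fun η => ‖I η‖ * c) ?_ (hI.norm.mul_const c) ?_ ?_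
    · intro N
      exact hI.aestronglyMeasurable.mul (Complex.continuous_ofReal.comp (hw N)).aestronglyMeasurable
    · intro N
      refine Filter.Eventually.of_forall fun η => ?_
      rw [norm_mul, Complex.norm_real, Real.norm_eq_abs]
      exact mul_le_mul_of_nonneg_left (hb N η) (norm_nonneg _)
    · filter_upwards [hl] with η hη
      exact Filter.Tendsto.const_mul _ ((Complex.continuous_ofReal.tendsto _).comp hη)
  exact le_of_tendsto ht.norm (Filter.Eventually.of_forall h)

lemma gQ_uu {n : ℕ} (T : ES (n - 1) →L[ℝ] ES (n - 1)) (r : ℝ) (m : (Fin n → ℝ) → ℂ) (s : ℤ) (z : Fin (n - 1) → ℤ)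
    (η : Fin (n - 1) → ℝ) : gQ n T r m s z (uu n s z η) = m (gammaParam n η) *
      ((psi (tw (-s) • (WithLp.toLp 2 η : ES (n - 1)) - zz z) *
        Wf r (tw (-s) • T (WithLp.toLp 2 η : ES (n - 1))) : ℝ) : ℂ) := by
  unfold gQ kap uu
  have e : tw s • (tw (-s) • (WithLp.toLp 2 η : ES (n - 1)) - zz z + zz z) = WithLp.toLp 2 η := by
    rw [sub_add_cancel, smul_smul, ← tw_add, add_neg_cancel, tw_zero, one_smul]
  rw [e, sub_add_cancel, map_smul]
  rfl

lemma toLp_cont (d : ℕ) : Continuous (fun η : Fin d → ℝ => (WithLp.toLp 2 η : ES d)) :=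
  PiLp.continuous_toLp 2 _

lemma wS_cont {d : ℕ} (T : ES d →L[ℝ] ES d) (r : ℝ) (S : ℤ) :
    Continuous (fun η : Fin d → ℝ => bmp d r (tw S • T (WithLp.toLp 2 η : ES d))) :=
  (bmp d r).continuous.comp ((T.continuous.comp (toLp_cont d)).const_smul (tw S))

lemma Wf_cont {d : ℕ} (T : ES d →L[ℝ] ES d) (r : ℝ) (s : ℤ) :
    Continuous (fun η : Fin d → ℝ => Wf r (tw s • T (WithLp.toLp 2 η : ES d))) :=
  (Wf_contDiff r).continuous.comp ((T.continuous.comp (toLp_cont d)).const_smul (tw s))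

lemma psi_cont {d : ℕ} (s : ℤ) (z : Fin d → ℤ) :
    Continuous (fun η : Fin d → ℝ => psi (tw s • (WithLp.toLp 2 η : ES d) - zz z)) :=
  psi_contDiff.continuous.comp (((toLp_cont d).const_smul (tw s)).sub continuous_const)

lemma psi_abs {d : ℕ} (u : ES d) : |psi u| ≤ 1 := by
  have := psi_sum_abs u 0
  have e : zbox d 0 = {0} := by
    ext z; simp [zbox, funext_iff]
  rw [e] at this
  have e2 : (zz (0 : Fin d → ℤ) : ES d) = 0 := by ext i; simp [zz]
  simpa [e2] using this

lemma fixedS {n : ℕ} (T : ES (n - 1) →L[ℝ] ES (n - 1)) (r : ℝ) (m : (Fin n → ℝ) → ℂ) (F : Fin n → ℝ → ℂ) {A : ℝ}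
    (hI : Integrable (fun η : Fin (n - 1) → ℝ => m (gammaParam n η) * ∏ i, 𝓕 (F i) (gammaParam n η i)))
    (h : ∀ QQ : Finset (ℤ × (Fin (n - 1) → ℤ)), ∑ Q ∈ QQ, ‖LamQ n (gQ n T r m Q.1 Q.2) F Q.1 Q.2‖ ≤ A) (S : ℕ) :
    ‖∫ η : Fin (n - 1) → ℝ, (m (gammaParam n η) * ∏ i, 𝓕 (F i) (gammaParam n η i)) *
      ((bmp (n - 1) r (tw (-S) • T (WithLp.toLp 2 η : ES (n - 1))) - bmp (n - 1) r (tw S • T (WithLp.toLp 2 η : ES (n - 1))) : ℝ) : ℂ)‖ ≤ A := by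
  let W : ℤ → (Fin (n - 1) → ℝ) → ℝ := fun s η => Wf r (tw (-s) • T (WithLp.toLp 2 η : ES (n - 1)))
  let p : ℤ → (Fin (n - 1) → ℤ) → (Fin (n - 1) → ℝ) → ℝ := fun s z η => psi (tw (-s) • (WithLp.toLp 2 η : ES (n - 1)) - zz z)
  refine lim_bound hI (fun Z η => ∑ s ∈ Finset.Ico (-(S : ℤ)) S, (∑ z ∈ zbox (n - 1) Z, p s z η) * W s η) _ ?_
    (c := ∑ s ∈ Finset.Ico (-(S : ℤ)) S, 1) ?_ ?_ ?_
  · intro Z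
    exact continuous_finsetSum _ fun s _ => (continuous_finsetSum _ fun z _ => psi_cont _ _).mul (Wf_cont _ _ _)
  · intro Z η
    refine (Finset.abs_sum_le_sum_abs _ _).trans (Finset.sum_le_sum fun s _ => ?_)
    rw [abs_mul]
    exact mul_le_one₀ (psi_sum_abs _ _) (abs_nonneg _) (Wf_abs _ _)
  · refine Filter.Eventually.of_forall fun η => ?_
    rw [← Wf_sum]
    refine tendsto_finsetSum _ fun s _ => ?_
    obtain ⟨Z0, hZ0⟩ := exists_nat_ge ‖tw (-s) • (WithLp.toLp 2 η : ES (n - 1))‖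
    apply tendsto_nhds_of_eventually_eq
    filter_upwards [Filter.eventually_ge_atTop Z0] with Z hZ
    have : ∑ z ∈ zbox (n - 1) Z, p s z η = 1 := by
      apply psi_sum_one
      intro i
      refine (PiLp.norm_apply_le (tw (-s) • (WithLp.toLp 2 η : ES (n - 1))) i).trans (hZ0.trans ?_)
      exact_mod_cast hZ
    rw [this, one_mul]
  · intro Z
    have hintg : ∀ s z, Integrable (fun η : Fin (n - 1) → ℝ =>
        (m (gammaParam n η) * ∏ i, 𝓕 (F i) (gammaParam n η i)) * ((p s z η * W s η : ℝ) : ℂ)) := by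
      intro s z
      refine hI.mul_bdd (c := 1) ?_ ?_
      · exact (Complex.continuous_ofReal.comp ((psi_cont _ _).mul (Wf_cont _ _ _))).aestronglyMeasurable
      · refine Filter.Eventually.of_forall fun η => ?_
        rw [Complex.norm_real, Real.norm_eq_abs, abs_mul]
        exact mul_le_one₀ (psi_abs _) (abs_nonneg _) (Wf_abs _ _)
    have e : ∫ η : Fin (n - 1) → ℝ, (m (gammaParam n η) * ∏ i, 𝓕 (F i) (gammaParam n η i)) *
        ((∑ s ∈ Finset.Ico (-(S : ℤ)) S, (∑ z ∈ zbox (n - 1) Z, p s z η) * W s η : ℝ) : ℂ)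
        = ∑ Q ∈ Finset.Ico (-(S : ℤ)) S ×ˢ zbox (n - 1) Z, LamQ n (gQ n T r m Q.1 Q.2) F Q.1 Q.2 := by
      rw [Finset.sum_product]
      have : ∀ s z, LamQ n (gQ n T r m s z) F s z = ∫ η : Fin (n - 1) → ℝ,
          (m (gammaParam n η) * ∏ i, 𝓕 (F i) (gammaParam n η i)) * ((p s z η * W s η : ℝ) : ℂ) := by
        intro s z
        unfold LamQ
        congr 1
        ext η
        rw [gQ_uu]
        ring
      simp_rw [this]
      simp_rw [← integral_finset_sum _ (fun z _ => hintg _ z)]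
      rw [← integral_finset_sum _ (fun s _ => integrable_finset_sum _ fun z _ => hintg s z)]
      congr 1
      ext η
      simp_rw [← Finset.mul_sum]
      push_cast
      simp_rw [Finset.sum_mul]
    rw [e]
    exact (norm_sum_le _ _).trans (h _)

lemma tw_tendsto_zero : Filter.Tendsto (fun S : ℕ => tw (-(S : ℤ))) Filter.atTop (nhds 0) := by
  have : (fun S : ℕ => tw (-(S : ℤ))) = fun S : ℕ => (1 / 2 : ℝ) ^ S := by
    ext S
    rw [tw_neg, tw_natCast]; simp
  rw [this]
  exact tendsto_pow_atTop_nhds_zero_of_lt_one (by norm_num) (by norm_num)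

lemma ae_T {n k : ℕ} {Γ' : Submodule ℝ (Fin n → ℝ)} {T : ES (n - 1) →L[ℝ] ES (n - 1)} (hT : Proj Γ' T)
    (hfr : Module.finrank ℝ Γ' = k) (hkn : k < n - 1) :
    ∀ᵐ η : Fin (n - 1) → ℝ, T (WithLp.toLp 2 η : ES (n - 1)) ≠ 0 := by
  let L : (Fin (n - 1) → ℝ) →ₗ[ℝ] (Fin n → ℝ) :=
    (gL n : ES (n - 1) →ₗ[ℝ] (Fin n → ℝ)) ∘ₗ ((WithLp.linearEquiv 2 ℝ (Fin (n - 1) → ℝ)).symm : (Fin (n - 1) → ℝ) →ₗ[ℝ] ES (n - 1))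
  have hLi : Function.Injective L := by
    intro x y hxy
    ext i
    have h1 := gL_coord n (WithLp.toLp 2 x) i
    have h2 := gL_coord n (WithLp.toLp 2 y) i
    have h3 : gL n (WithLp.toLp 2 x) = gL n (WithLp.toLp 2 y) := hxy
    rw [h3, h2] at h1
    exact h1.symm
  have hne : Γ'.comap L ≠ ⊤ := by
    intro h
    have hle : LinearMap.range L ≤ Γ' := by
      rintro _ ⟨x, rfl⟩
      have : x ∈ Γ'.comap L := by rw [h]; trivial
      exact this
    have h1 := Submodule.finrank_mono hle
    rw [LinearMap.finrank_range_of_inj hLi, hfr] at h1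
    simp at h1
    omega
  have h0 := Measure.addHaar_submodule (volume : Measure (Fin (n - 1) → ℝ)) _ hne
  rw [MeasureTheory.ae_iff]
  refine measure_mono_null ?_ h0
  intro η hη
  simp only [ne_eq, not_not, Set.mem_setOf_eq] at hη
  exact (hT.ker _).1 hη

lemma lam_bound {n k : ℕ} {Γ' : Submodule ℝ (Fin n → ℝ)} {T : ES (n - 1) →L[ℝ] ES (n - 1)} (hT : Proj Γ' T)
    (hfr : Module.finrank ℝ Γ' = k) (hkn : k < n - 1) {r : ℝ} (hr : 0 < r) (m : (Fin n → ℝ) → ℂ) (F : Fin n → ℝ → ℂ) {A : ℝ}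
    (h : ∀ QQ : Finset (ℤ × (Fin (n - 1) → ℤ)), ∑ Q ∈ QQ, ‖LamQ n (gQ n T r m Q.1 Q.2) F Q.1 Q.2‖ ≤ A) :
    ‖Lam n m F‖ ≤ A := by
  have hA : 0 ≤ A := by simpa using h ∅
  by_cases hI : Integrable (fun η : Fin (n - 1) → ℝ => m (gammaParam n η) * ∏ i, 𝓕 (F i) (gammaParam n η i))
  swap
  · unfold Lam; rw [integral_undef hI, norm_zero]; exact hA
  have := lim_bound hI (fun S η => bmp (n - 1) r (tw (-S) • T (WithLp.toLp 2 η : ES (n - 1)))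
    - bmp (n - 1) r (tw S • T (WithLp.toLp 2 η : ES (n - 1)))) (fun _ => 1) (c := 1) (A := A) ?_ ?_ ?_ ?_
  · simpa [Lam] using this
  · intro S; exact (wS_cont T r _).sub (wS_cont T r _)
  · intro S η
    rw [abs_le]
    have h1 := (bmp (n - 1) r).nonneg' (tw (-S) • T (WithLp.toLp 2 η : ES (n - 1)))
    have h2 := (bmp (n - 1) r).nonneg' (tw S • T (WithLp.toLp 2 η : ES (n - 1)))
    have h3 := (bmp (n - 1) r).le_one (x := tw (-S) • T (WithLp.toLp 2 η : ES (n - 1)))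
    have h4 := (bmp (n - 1) r).le_one (x := tw S • T (WithLp.toLp 2 η : ES (n - 1)))
    constructor <;> linarith
  · filter_upwards [ae_T hT hfr hkn] with η hη
    set x := T (WithLp.toLp 2 η : ES (n - 1)) with hx
    have hx0 : 0 < ‖x‖ := norm_pos_iff.2 hη
    apply tendsto_nhds_of_eventually_eq
    have e1 : ∀ᶠ S : ℕ in Filter.atTop, tw (-(S : ℤ)) < min (r / ‖x‖) (‖x‖ / (2 * r)) :=
      tw_tendsto_zero.eventually_lt_const (by positivity)
    filter_upwards [e1] with S hS
    obtain ⟨hS1, hS2⟩ := lt_min_iff.1 hS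
    rw [bmp_one hr, bmp_zero hr, sub_zero]
    · rw [norm_smul, Real.norm_of_nonneg (tw_pos _).le]
      rw [lt_div_iff₀ (by positivity), tw_neg] at hS2
      have hp := tw_pos (S : ℤ)
      have : 2 * r = tw S * ((tw S)⁻¹ * (2 * r)) := by field_simp
      rw [this]
      exact mul_le_mul_of_nonneg_left hS2.le hp.le
    · rw [norm_smul, Real.norm_of_nonneg (tw_pos _).le]
      rw [lt_div_iff₀ hx0] at hS1
      exact hS1.le
  · intro S
    exact fixedS T r m F hI h S

/-- Theorem 2.3 (`rwt-bound`): `Λ_m` is of restricted type `α` for all bad tuples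
with `1/2 < αᵢ < 1` at good indices and `k-n+3/2 < αⱼ < k-n+2` at the bad index. -/
theorem statement2 (n k : ℕ) (hn : 2 ≤ n) (hk : 1 ≤ k) (hkn : 2 * k < n) :
    ∃ M : ℕ, ∀ (Γ' : Submodule ℝ (Fin n → ℝ)),
      (Γ' : Set (Fin n → ℝ)) ⊆ GammaSet n →
      Module.finrank ℝ Γ' = k →
      NonDegenerate n k Γ' →
      ∀ a : Fin n → ℝ, Admissible n a →
      ∀ j : Fin n, a j < 0 →
        (∀ i, i ≠ j → 1 / 2 < a i) →
        (k : ℝ) - n + 3 / 2 < a j → a j < (k : ℝ) - n + 2 →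
        ∀ B : ℝ, ∃ C : ℝ, ∀ m : (Fin n → ℝ) → ℂ,
          SymbolEst n Γ' M B m →
          RestrictedType n (Lam n m) a C := by
  refine ⟨n * Kn n + n, fun Γ' hΓ hfr hnd a hadm j haj hj hj1 hj2 B => ?_⟩
  have hn1 : 1 ≤ n := by omega
  obtain ⟨T, hT⟩ := exists_proj Γ'
  obtain ⟨C, hC, hb⟩ := cubes_bound hn1 hk hΓ hnd hT a hadm.2.1 hadm.1 j hj hj1 hj2 B
  refine ⟨C, fun m hm E hE hEf => ?_⟩
  by_cases hpos : ∀ i, 0 < (volume (E i)).toReal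
  · obtain ⟨Ω, hΩ, hΩ2, hQ⟩ := hb E hE hEf hpos
    refine ⟨fun i => if i = j then E i \ Ω else E i, ?_, ?_, ?_, ?_, ?_⟩
    · intro i
      dsimp only
      split_ifs
      · exact (hE i).diff hΩ
      · exact hE i
    · intro i
      dsimp only
      split_ifs
      · exact Set.diff_subset
      · exact le_rfl
    · intro i hi
      have : i ≠ j := by rintro rfl; linarith
      simp [this]
    · intro i
      by_cases hij : i = j
      · subst hij
        simp only [if_true]
        have h1 : volume (E i) ≤ volume (E i \ Ω) + volume Ω := by
          refine (measure_mono ?_).trans (measure_union_le _ _)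
          intro x hx
          by_cases hxΩ : x ∈ Ω
          · exact Or.inr hxΩ
          · exact Or.inl ⟨hx, hxΩ⟩
        have h2 : volume (E i) + volume (E i) ≤ 2 * volume (E i \ Ω) + volume (E i) := by
          calc volume (E i) + volume (E i) = 2 * volume (E i) := (two_mul _).symm
            _ ≤ 2 * (volume (E i \ Ω) + volume Ω) := by gcongr
            _ = 2 * volume (E i \ Ω) + 2 * volume Ω := mul_add _ _ _
            _ ≤ _ := by gcongr
        exact (ENNReal.add_le_add_iff_right (hEf i).ne).1 h2
      · simp only [hij, if_false]
        rw [two_mul]; exact le_self_add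
    · intro F hFm hF1 hFs
      refine lam_bound hT hfr (by omega) (rr_pos hn1) m F (hQ m hm F hFm hF1 ?_ ?_)
      · intro i x hx
        apply hFs
        dsimp only
        split_ifs
        · exact fun h => hx h.1
        · exact hx
      · intro x hx
        apply hFs
        simp [hx]
  · push Not at hpos
    obtain ⟨i, hi⟩ := hpos
    refine ⟨E, hE, fun _ => le_rfl, fun _ _ => rfl, fun i => by rw [two_mul]; exact le_self_add, ?_⟩
    intro F hFm hF1 hFs
    have h0 : volume (E i) = 0 := by
      have : (volume (E i)).toReal = 0 := le_antisymm hi ENNReal.toReal_nonneg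
      rcases (ENNReal.toReal_eq_zero_iff _).1 this with h | h
      · exact h
      · exact absurd h (hEf i).ne
    have hF0 : ∀ ξ, 𝓕 (F i) ξ = 0 := by
      intro ξ
      have h1 := ftF_bd (F i) ξ
      have h2 : ∫ x, ‖F i x‖ = 0 := by
        apply integral_eq_zero_of_ae
        rw [Filter.EventuallyEq, ae_iff]
        refine measure_mono_null ?_ h0
        intro x hx
        by_contra hc
        exact hx (by simp [hFs i x hc])
      rw [h2] at h1
      exact norm_le_zero_iff.1 h1
    have hL : Lam n m F = 0 := by
      unfold Lam
      have : ∀ η, ∏ l, 𝓕 (F l) (gammaParam n η l) = 0 := fun η =>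
        Finset.prod_eq_zero (Finset.mem_univ i) (hF0 _)
      simp [this]
    rw [hL, norm_zero]
    exact mul_nonneg hC (Finset.prod_nonneg fun l _ => Real.rpow_nonneg ENNReal.toReal_nonneg _)
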